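/- Let Ω_0, Ω_1 ⊆ ℝ^d be bounded open sets with equal positive Lebesgue measure. Let ψ : ℝ^d → ℝ be convex and T : ℝ^d → ℝ^d a Borel map such that ψ is differentiable at Lebesgue-a.e. x with gradient ∇ψ(x) = T(x), and such that T pushes the measure 1_{Ω_0} dx forward to 1_{Ω_1} dx (T is the Brenier optimal transport map). For t ∈ [0,1] let μ_t = ((1−t)·id + t·T)_# (1_{Ω_0} dx) be the Wasserstein geodesic (displacement interpolant). Then the infimum of the action ∫_0^1 ∫_{ℝ^d} ρ |v|² dx dt over admissible pairs (ρ, v) — measurable with ρ(x,t) ∈ {0,1} a.e., ρ integrable on ℝ^d × [0,1], ∫_0^1 ∫ ρ|v|² < ∞, and satisfying the weak continuity equation with endpoints 1_{Ω_0}, 1_{Ω_1}: for all smooth compactly supported q on ℝ^d × [0,1], ∫_0^1 ∫ ρ(∂_t q + v·∇q) dx dt = ∫_{Ω_1} q(·,1) − ∫_{Ω_0} q(·,0) — is attained by some admissible pair if and only if for every t ∈ [0,1] there is a measurable set Ω_t ⊆ ℝ^d such that μ_t equals the measure 1_{Ω_t} dx. -/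

import Mathlib

open Set MeasureTheory
open scoped ENNReal RealInnerProductSpace

/-- The space-time measure: Lebesgue measure on `ℝ^d` times Lebesgue measure
restricted to `[0,1]`. -/
noncomputable def spaceTime (d : ℕ) : Measure (EuclideanSpace ℝ (Fin d) × ℝ) :=
  (volume : Measure (EuclideanSpace ℝ (Fin d))).prod (volume.restrict (Icc (0:ℝ) 1))

/-- Admissibility of a pair `(ρ, v)` for the shape-distance problem between `Ω₀` and
`Ω₁`: `ρ` and `v` are measurable, `ρ(x,t) ∈ {0,1}` a.e., `ρ` is integrable on
`ℝ^d × [0,1]`, the action is finite, and the continuity equation holds weakly with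
endpoint data `1_{Ω₀}` at `t = 0` and `1_{Ω₁}` at `t = 1`. -/
def ShapeAdmissible {d : ℕ} (Ω₀ Ω₁ : Set (EuclideanSpace ℝ (Fin d)))
    (ρ : EuclideanSpace ℝ (Fin d) → ℝ → ℝ)
    (v : EuclideanSpace ℝ (Fin d) → ℝ → EuclideanSpace ℝ (Fin d)) : Prop :=
  Measurable (fun q : EuclideanSpace ℝ (Fin d) × ℝ => ρ q.1 q.2) ∧
  Measurable (fun q : EuclideanSpace ℝ (Fin d) × ℝ => v q.1 q.2) ∧
  (∀ᵐ q ∂(spaceTime d), ρ q.1 q.2 = 0 ∨ ρ q.1 q.2 = 1) ∧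
  Integrable (fun q : EuclideanSpace ℝ (Fin d) × ℝ => ρ q.1 q.2) (spaceTime d) ∧
  (∫⁻ q, ENNReal.ofReal (ρ q.1 q.2 * ‖v q.1 q.2‖ ^ 2) ∂(spaceTime d)) < ⊤ ∧
  ∀ q : EuclideanSpace ℝ (Fin d) → ℝ → ℝ,
    ContDiff ℝ (⊤ : ℕ∞) (fun z : EuclideanSpace ℝ (Fin d) × ℝ => q z.1 z.2) →
    HasCompactSupport (fun z : EuclideanSpace ℝ (Fin d) × ℝ => q z.1 z.2) →
    (∫ t in Icc (0:ℝ) 1, ∫ x, ρ x t *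
        (deriv (fun s => q x s) t + ⟪v x t, gradient (fun y => q y t) x⟫)) =
      (∫ x in Ω₁, q x 1) - (∫ x in Ω₀, q x 0)

/-- The set of values of the action `𝒜(ρ,v) = ∫₀¹∫ ρ|v|² dx dt` over admissible pairs. -/
noncomputable def shapeActionSet {d : ℕ} (Ω₀ Ω₁ : Set (EuclideanSpace ℝ (Fin d))) :
    Set ℝ≥0∞ :=
  { A | ∃ ρ v, ShapeAdmissible Ω₀ Ω₁ ρ v ∧
      A = ∫⁻ q, ENNReal.ofReal (ρ q.1 q.2 * ‖v q.1 q.2‖ ^ 2) ∂(spaceTime d) }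


abbrev Eu (d : ℕ) := EuclideanSpace ℝ (Fin d)

/-- Set-based admissible paths. -/
def SPath {d : ℕ} (A B : Set (Eu d)) (S : Set (Eu d × ℝ)) (v : Eu d × ℝ → Eu d) : Prop :=
  MeasurableSet S ∧ spaceTime d S < ⊤ ∧ Measurable v ∧
  (∫⁻ z in S, ‖v z‖ₑ ^ 2 ∂(spaceTime d)) < ⊤ ∧
  ∀ q : Eu d × ℝ → ℝ, ContDiff ℝ (⊤ : ℕ∞) q → HasCompactSupport q →
    ∫ z in S, fderiv ℝ q z (v z, 1) ∂(spaceTime d) =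
      (∫ x in B, q (x, 1)) - (∫ x in A, q (x, 0))

def Conn {d : ℕ} (A B : Set (Eu d)) (c : ℝ≥0∞) : Prop :=
  ∃ S v, SPath A B S v ∧ (∫⁻ z in S, ‖v z‖ₑ ^ 2 ∂(spaceTime d)) ≤ c

instance spaceTime_sf (d : ℕ) : SFinite (spaceTime d) := by unfold spaceTime; infer_instance
instance spaceTime_sigmaf (d : ℕ) : SigmaFinite (spaceTime d) := by
  unfold spaceTime; infer_instance

lemma fderiv_split {d : ℕ} {q : Eu d → ℝ → ℝ}
    (hq : ContDiff ℝ (⊤ : ℕ∞) (fun z : Eu d × ℝ => q z.1 z.2)) (x : Eu d) (t : ℝ) (w : Eu d) :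
    fderiv ℝ (fun z : Eu d × ℝ => q z.1 z.2) (x, t) (w, 1) =
      deriv (fun s => q x s) t + ⟪w, gradient (fun y => q y t) x⟫ := by
  have hd : DifferentiableAt ℝ (fun z : Eu d × ℝ => q z.1 z.2) (x, t) :=
    (hq.differentiable (by simp)) _
  have h1 : HasDerivAt (fun s => q x s)
      (fderiv ℝ (fun z : Eu d × ℝ => q z.1 z.2) (x, t) (0, 1)) t := by
    have : HasDerivAt (fun s : ℝ => ((x, s) : Eu d × ℝ)) (0, 1) t :=
      (hasDerivAt_const t x).prodMk (hasDerivAt_id t)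
    exact hd.hasFDerivAt.comp_hasDerivAt t this
  have h2 : HasFDerivAt (fun y => q y t)
      ((fderiv ℝ (fun z : Eu d × ℝ => q z.1 z.2) (x, t)).comp
        (ContinuousLinearMap.inl ℝ (Eu d) ℝ)) x := by
    have : HasFDerivAt (fun y : Eu d => ((y, t) : Eu d × ℝ))
        (ContinuousLinearMap.inl ℝ (Eu d) ℝ) x := by
      exact hasFDerivAt_prodMk_left x t
    exact HasFDerivAt.comp x (g := fun z : Eu d × ℝ => q z.1 z.2) hd.hasFDerivAt this
  have h3 : ⟪w, gradient (fun y => q y t) x⟫ =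
      fderiv ℝ (fun z : Eu d × ℝ => q z.1 z.2) (x, t) (w, 0) := by
    rw [real_inner_comm, ← InnerProductSpace.toDual_apply_apply (𝕜 := ℝ), toDual_gradient,
      h2.fderiv]
    simp
  rw [h1.deriv, h3, ← map_add]; simp

lemma sq_enorm_integrable {d : ℕ} {S : Set (Eu d × ℝ)} {v : Eu d × ℝ → Eu d}
    (hS : spaceTime d S < ⊤) (hv : Measurable v)
    (h2 : (∫⁻ z in S, ‖v z‖ₑ ^ 2 ∂(spaceTime d)) < ⊤) :
    Integrable v ((spaceTime d).restrict S) := by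
  have : IsFiniteMeasure ((spaceTime d).restrict S) := ⟨by simpa using hS⟩
  have : MemLp v 2 ((spaceTime d).restrict S) := by
    refine ⟨hv.aestronglyMeasurable, ?_⟩
    rw [eLpNorm_lt_top_iff_lintegral_rpow_enorm_lt_top (by simp) (by simp)]
    simpa using h2
  exact this.integrable (by norm_num)

lemma test_integrable {d : ℕ} {μ : Measure (Eu d × ℝ)} [IsFiniteMeasure μ] {v : Eu d × ℝ → Eu d}
    (hv : Integrable v μ) {q : Eu d × ℝ → ℝ} (hq : ContDiff ℝ (⊤ : ℕ∞) q)
    (C : ℝ) (hC : ∀ᵐ z ∂μ, ‖fderiv ℝ q z‖ ≤ C) :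
    Integrable (fun z => fderiv ℝ q z (v z, 1)) μ := by
  have hi : Integrable (fun z => ((v z, (1:ℝ)) : Eu d × ℝ)) μ :=
    hv.prodMk (integrable_const _)
  refine (hi.norm.const_mul C).mono' ?_ ?_
  · have := (hq.continuous_fderiv (by simp)).aestronglyMeasurable (μ := μ)
    exact (ContinuousLinearMap.apply ℝ ℝ : _ →L[ℝ] _).aestronglyMeasurable_comp₂ hi.1 this
  · filter_upwards [hC] with z hz
    refine (ContinuousLinearMap.le_opNorm _ _).trans ?_
    gcongr

lemma fderiv_bound {d : ℕ} {q : Eu d × ℝ → ℝ} (hq : ContDiff ℝ (⊤ : ℕ∞) q)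
    (hc : HasCompactSupport q) : ∃ C, ∀ z, ‖fderiv ℝ q z‖ ≤ C := by
  exact (hc.fderiv ℝ).exists_bound_of_continuous (hq.continuous_fderiv (by simp))

lemma SPath.adm {d : ℕ} {A B : Set (Eu d)} {S v} (h : SPath A B S v) :
    ∃ ρ w, ShapeAdmissible A B ρ w ∧
      (∫⁻ q, ENNReal.ofReal (ρ q.1 q.2 * ‖w q.1 q.2‖ ^ 2) ∂(spaceTime d)) =
      ∫⁻ z in S, ‖v z‖ₑ ^ 2 ∂(spaceTime d) := by
  classical
  obtain ⟨hS, hfin, hv, h2, hw⟩ := h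
  have key : (∫⁻ q : Eu d × ℝ, ENNReal.ofReal (S.indicator (fun _ => (1:ℝ)) (q.1, q.2) * ‖v (q.1, q.2)‖ ^ 2)
      ∂(spaceTime d)) = ∫⁻ z in S, ‖v z‖ₑ ^ 2 ∂(spaceTime d) := by
    rw [← lintegral_indicator hS]
    congr 1; ext z
    by_cases hz : z ∈ S
    · simp only [Prod.mk.eta, indicator_of_mem hz, one_mul]
      rw [ENNReal.ofReal_pow (norm_nonneg _), ofReal_norm]
    · simp [indicator_of_notMem hz]
  refine ⟨fun x t => S.indicator (fun _ => (1:ℝ)) (x, t), fun x t => v (x, t),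
    ⟨?_, ?_, ?_, ?_, ?_, ?_⟩, key⟩
  · exact measurable_const.indicator hS
  · exact hv
  · refine Filter.Eventually.of_forall fun z => ?_
    by_cases hz : z ∈ S <;> simp [hz]
  · exact (integrable_indicator_iff hS).2 (integrableOn_const hfin.ne)
  · rw [key]; exact h2
  · intro q hq hc
    have := hw _ hq hc
    rw [← this, ← integral_indicator hS]
    have : IsFiniteMeasure ((spaceTime d).restrict S) := ⟨by simpa using hfin⟩
    have hintg : Integrable (S.indicator fun z => fderiv ℝ (fun z : Eu d × ℝ => q z.1 z.2) z (v z, 1))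
        (spaceTime d) := by
      obtain ⟨C, hC⟩ := fderiv_bound hq hc
      rw [integrable_indicator_iff hS]
      exact test_integrable (sq_enorm_integrable hfin hv h2) hq C (Filter.Eventually.of_forall hC)
    unfold spaceTime at hintg ⊢
    rw [integral_prod_symm _ hintg]
    refine integral_congr_ae (Filter.Eventually.of_forall fun t => ?_)
    refine integral_congr_ae (Filter.Eventually.of_forall fun x => ?_)
    simp only
    rw [← fderiv_split hq]
    by_cases hz : (x, t) ∈ S <;> simp [hz]

lemma adm_path {d : ℕ} {A B : Set (Eu d)} {ρ w} (h : ShapeAdmissible A B ρ w) :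
    ∃ S v, SPath A B S v ∧
      (∫⁻ q, ENNReal.ofReal (ρ q.1 q.2 * ‖w q.1 q.2‖ ^ 2) ∂(spaceTime d)) =
      ∫⁻ z in S, ‖v z‖ₑ ^ 2 ∂(spaceTime d) := by
  classical
  obtain ⟨hρ, hv, h01, hintg, hact, hw⟩ := h
  set S : Set (Eu d × ℝ) := {z | ρ z.1 z.2 = 1} with hSdef
  have hS : MeasurableSet S := hρ (measurableSet_singleton 1)
  have hind : ∀ᵐ z ∂(spaceTime d), ρ z.1 z.2 = S.indicator (fun _ => (1:ℝ)) z := by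
    filter_upwards [h01] with z hz
    rcases hz with hz | hz
    · rw [indicator_of_notMem, hz]; simp [hSdef, hz]
    · rw [indicator_of_mem, hz]; simp [hSdef, hz]
  have hfin : spaceTime d S < ⊤ := by
    have : Integrable (S.indicator fun _ => (1:ℝ)) (spaceTime d) := hintg.congr hind
    rw [integrable_indicator_iff hS, integrableOn_const_iff] at this
    simpa using this
  have key : (∫⁻ q, ENNReal.ofReal (ρ q.1 q.2 * ‖w q.1 q.2‖ ^ 2) ∂(spaceTime d)) =
      ∫⁻ z in S, ‖w z.1 z.2‖ₑ ^ 2 ∂(spaceTime d) := by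
    rw [← lintegral_indicator hS]
    refine lintegral_congr_ae ?_
    filter_upwards [hind] with z hz
    rw [hz]
    by_cases hz : z ∈ S
    · simp only [indicator_of_mem hz, one_mul]
      rw [ENNReal.ofReal_pow (norm_nonneg _), ofReal_norm]
    · simp [indicator_of_notMem hz]
  refine ⟨S, fun z => w z.1 z.2, ⟨hS, hfin, hv, key ▸ hact, ?_⟩, key⟩
  intro q hq hc
  have := hw (fun x t => q (x, t)) hq hc
  rw [← this, ← integral_indicator hS]
  have : IsFiniteMeasure ((spaceTime d).restrict S) := ⟨by simpa using hfin⟩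
  have hintg : Integrable (S.indicator fun z => fderiv ℝ q z (w z.1 z.2, 1))
      (spaceTime d) := by
    obtain ⟨C, hC⟩ := fderiv_bound hq hc
    rw [integrable_indicator_iff hS]
    exact test_integrable (sq_enorm_integrable hfin hv (key ▸ hact)) hq C
      (Filter.Eventually.of_forall hC)
  have hae : (S.indicator fun z => fderiv ℝ q z (w z.1 z.2, 1)) =ᵐ[spaceTime d]
      fun z => ρ z.1 z.2 * (deriv (fun s => q (z.1, s)) z.2 +
        ⟪w z.1 z.2, gradient (fun y => q (y, z.2)) z.1⟫) := by
    filter_upwards [hind] with z hz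
    rw [hz, ← fderiv_split (q := fun x t => q (x, t)) hq]
    by_cases hz : z ∈ S <;> simp [hz]
  rw [integral_congr_ae hae]
  replace hintg := hintg.congr hae
  unfold spaceTime at hintg ⊢
  rw [integral_prod_symm _ hintg]

open Set MeasureTheory
open scoped ENNReal RealInnerProductSpace

lemma spaceTime_ae_Ioo (d : ℕ) : ∀ᵐ z ∂(spaceTime d), z.2 ∈ Ioo (0:ℝ) 1 := by
  have h : ∀ᵐ t ∂(volume.restrict (Icc (0:ℝ) 1)), t ∈ Ioo (0:ℝ) 1 := by
    rw [← restrict_Ioo_eq_restrict_Icc]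
    exact ae_restrict_mem measurableSet_Ioo
  exact Measure.quasiMeasurePreserving_snd.ae h

/-- affine time change -/
def tch (d : ℕ) (β α : ℝ) (z : Eu d × ℝ) : Eu d × ℝ := (z.1, β + α * z.2)

lemma tch_cont (d : ℕ) (β α : ℝ) : Continuous (tch d β α) := by unfold tch; fun_prop

lemma tch_smooth (d : ℕ) (β α : ℝ) {q : Eu d × ℝ → ℝ} (hq : ContDiff ℝ (⊤ : ℕ∞) q) :
    ContDiff ℝ (⊤ : ℕ∞) (fun z => q (tch d β α z)) := by
  unfold tch; fun_prop

lemma tch_embed (d : ℕ) (β : ℝ) {α : ℝ} (hα : α ≠ 0) : MeasurableEmbedding (tch d β α) := by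
  refine (tch_cont d β α).measurableEmbedding ?_
  rintro ⟨x, s⟩ ⟨y, t⟩ h
  simp only [tch, Prod.mk.injEq, add_right_inj, mul_eq_mul_left_iff] at h
  simp [h.1, h.2.resolve_right hα]

lemma tch_comp_inv (d : ℕ) (β : ℝ) {α : ℝ} (hα : α ≠ 0) (z) :
    tch d β α (tch d (-β / α) (1 / α) z) = z := by
  simp only [tch]; ext <;> simp; field_simp; ring

lemma tch_inv_comp (d : ℕ) (β : ℝ) {α : ℝ} (hα : α ≠ 0) (z) :
     (tch d (-β / α) (1 / α) (tch d β α z)) = z := by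
  simp only [tch]; ext <;> simp; field_simp; ring

lemma tch_supp (d : ℕ) (β : ℝ) {α : ℝ} (hα : α ≠ 0) {q : Eu d × ℝ → ℝ}
    (hq : HasCompactSupport q) : HasCompactSupport (fun z => q (tch d β α z)) := by
  let e : (Eu d × ℝ) ≃ₜ (Eu d × ℝ) :=
    { toFun := tch d β α
      invFun := tch d (-β / α) (1 / α)
      left_inv := tch_inv_comp d β hα
      right_inv := tch_comp_inv d β hα
      continuous_toFun := tch_cont _ _ _
      continuous_invFun := tch_cont _ _ _ }
  exact hq.comp_homeomorph e

lemma tch_fderiv (d : ℕ) (β α : ℝ) {q : Eu d × ℝ → ℝ} (hq : ContDiff ℝ (⊤ : ℕ∞) q)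
    (z : Eu d × ℝ) (w : Eu d) :
    fderiv ℝ (fun z => q (tch d β α z)) z (w, 1) = fderiv ℝ q (tch d β α z) (w, α) := by
  have h1 : HasFDerivAt (tch d β α)
      ((ContinuousLinearMap.fst ℝ (Eu d) ℝ).prod (α • ContinuousLinearMap.snd ℝ (Eu d) ℝ)) z := by
    have := (hasFDerivAt_snd (𝕜 := ℝ) (p := z)).const_mul α |>.const_add β
    exact (hasFDerivAt_fst (𝕜 := ℝ) (p := z)).prodMk this
  have h2 := ((hq.differentiable (by simp)) (tch d β α z)).hasFDerivAt.comp z h1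
  have : (fun z => q (tch d β α z)) = q ∘ tch d β α := rfl
  rw [this, h2.fderiv]
  simp

lemma tch_map (d : ℕ) (β : ℝ) {α : ℝ} (hα : α ≠ 0) :
    ENNReal.ofReal |α| • (spaceTime d).map (tch d β α) =
      (volume : Measure (Eu d)).prod (volume.restrict ((fun t => β + α * t) '' Icc (0:ℝ) 1)) := by
  have hm : MeasurableEmbedding (fun t : ℝ => β + α * t) :=
    (measurableEmbedding_addLeft β).comp (measurableEmbedding_mulLeft₀ hα)
  have h1 : (spaceTime d).map (tch d β α) = (volume : Measure (Eu d)).prod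
      ((volume.restrict (Icc (0:ℝ) 1)).map (fun t => β + α * t)) := by
    have : tch d β α = Prod.map id (fun t => β + α * t) := rfl
    rw [this, spaceTime, ← Measure.map_prod_map _ _ measurable_id hm.measurable, Measure.map_id]
  rw [h1, ← Measure.prod_smul_right]
  congr 1
  rw [← hm.injective.preimage_image (Icc (0:ℝ) 1), ← hm.restrict_map, hm.injective.preimage_image]
  rw [← Measure.restrict_smul]
  congr 1
  have h2 : (fun t : ℝ => β + α * t) = (fun t => β + t) ∘ (fun t => α * t) := rfl
  rw [h2, ← Measure.map_map (by fun_prop) (by fun_prop), ← Measure.map_smul,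
    Real.smul_map_volume_mul_left hα, map_add_left_eq_self]

lemma Conn.symm {d : ℕ} {A B : Set (Eu d)} {c} (h : Conn A B c) : Conn B A c := by
  obtain ⟨S, v, ⟨hS, hfin, hv, h2, hw⟩, hc⟩ := h
  have hmap : (spaceTime d).map (tch d 1 (-1)) = spaceTime d := by
    have := tch_map d 1 (α := -1) (by norm_num)
    have him : (fun t : ℝ => 1 + -1 * t) '' Icc 0 1 = Icc 0 1 := by
      have : (fun t : ℝ => 1 + -1 * t) = fun t => 1 - t := by ext; ring
      rw [this, image_const_sub_Icc]; norm_num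
    rw [him] at this
    simpa [spaceTime] using this
  have hem := tch_embed d 1 (α := -1) (by norm_num)
  have hinv : ∀ z, tch d 1 (-1) (tch d 1 (-1) z) = z := by
    intro z; simp [tch]
  set f := tch d 1 (-1) with hf
  have hres : (spaceTime d).restrict (f ⁻¹' S) = ((spaceTime d).restrict S).map f := by
    have : S = f ⁻¹' (f ⁻¹' S) := by ext z; simp [hinv]
    conv_rhs => rw [this]
    rw [← hem.restrict_map, hmap]
  have hact : (∫⁻ z in f ⁻¹' S, ‖-v (f z)‖ₑ ^ 2 ∂(spaceTime d)) =
      ∫⁻ z in S, ‖v z‖ₑ ^ 2 ∂(spaceTime d) := by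
    rw [hres, hem.lintegral_map]; simp [hinv]
  refine ⟨f ⁻¹' S, fun z => - v (f z), ⟨hem.measurable hS, ?_, ?_, ?_, ?_⟩, ?_⟩
  · rw [← Measure.restrict_apply_univ, hres, Measure.map_apply hem.measurable MeasurableSet.univ]
    simpa using hfin
  · exact (hv.comp hem.measurable).neg
  · rw [hact]; exact h2
  · intro q hq hcs
    have := hw _ (tch_smooth d 1 (-1) hq) (tch_supp d 1 (α := -1) (by norm_num) hcs)
    rw [hres, hem.integral_map]
    have h3 : ∀ z, fderiv ℝ q (f z) (-v (f (f z)), 1) =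
        - fderiv ℝ (fun z => q (tch d 1 (-1) z)) z (v z, 1) := by
      intro z
      rw [tch_fderiv _ _ _ hq, ← map_neg, hinv]; simp [hf]
    simp_rw [h3, integral_neg, this]
    simp [tch]
  · rw [hact]; exact hc

lemma spaceTime_split (d : ℕ) {τ : ℝ} (h0 : 0 < τ) (h1 : τ < 1) :
    spaceTime d = ENNReal.ofReal τ • (spaceTime d).map (tch d 0 τ) +
      ENNReal.ofReal (1 - τ) • (spaceTime d).map (tch d τ (1 - τ)) := by
  have e1 := tch_map d 0 (α := τ) h0.ne'
  have e2 := tch_map d τ (α := 1 - τ) (by linarith)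
  rw [abs_of_pos h0] at e1
  rw [abs_of_pos (by linarith)] at e2
  rw [e1, e2, ← Measure.prod_add]
  unfold spaceTime
  congr 1
  have i1 : (fun t : ℝ => 0 + τ * t) '' Icc 0 1 = Icc 0 τ := by
    simp only [zero_add]
    rw [image_mul_left_Icc h0.le (by norm_num)]; simp
  have i2 : (fun t : ℝ => τ + (1 - τ) * t) '' Icc 0 1 = Icc τ 1 := by
    have : (fun t : ℝ => τ + (1 - τ) * t) = (fun t => τ + t) ∘ (fun t => (1 - τ) * t) := rfl
    rw [this, image_comp, image_mul_left_Icc (by linarith) (by norm_num), image_const_add_Icc]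
    simp
  rw [i1, i2, ← restrict_Ico_eq_restrict_Icc (b := τ), ← Measure.restrict_union ?_ measurableSet_Icc,
    Ico_union_Icc_eq_Icc h0.le h1.le]
  exact disjoint_left.2 fun x hx hx' => not_lt.2 hx'.1 hx.2

lemma Conn.concat {d : ℕ} {A B C : Set (Eu d)} {a b : ℝ≥0∞} (h : Conn A B a) (h' : Conn B C b)
    {τ : ℝ} (h0 : 0 < τ) (h1 : τ < 1) :
    Conn A C (ENNReal.ofReal τ⁻¹ * a + ENNReal.ofReal (1 - τ)⁻¹ * b) := by
  classical
  obtain ⟨S, v, ⟨hS, hfin, hv, h2, hw⟩, hc⟩ := h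
  obtain ⟨S', v', ⟨hS', hfin', hv', h2', hw'⟩, hc'⟩ := h'
  have h1' : 0 < 1 - τ := by linarith
  have hsplit := spaceTime_split d h0 h1
  have hem1 := tch_embed d 0 h0.ne'
  have hem2 := tch_embed d τ h1'.ne'
  set f1 := tch d 0 τ with hf1
  set f2 := tch d τ (1 - τ) with hf2
  set g1 := tch d (-0 / τ) (1 / τ) with hg1
  set g2 := tch d (-τ / (1 - τ)) (1 / (1 - τ)) with hg2
  have gf1 : ∀ z, g1 (f1 z) = z := tch_inv_comp d 0 h0.ne'
  have gf2 : ∀ z, g2 (f2 z) = z := tch_inv_comp d τ h1'.ne'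
  have hg1m : Measurable g1 := (tch_cont _ _ _).measurable
  have hg2m : Measurable g2 := (tch_cont _ _ _).measurable
  have hlt : MeasurableSet {z : Eu d × ℝ | z.2 < τ} := measurableSet_lt measurable_snd measurable_const
  set R : Set (Eu d × ℝ) := {z | z.2 < τ} ∩ g1 ⁻¹' S ∪ {z | z.2 < τ}ᶜ ∩ g2 ⁻¹' S' with hR
  have hRm : MeasurableSet R := (hlt.inter (hg1m hS)).union (hlt.compl.inter (hg2m hS'))
  set w : Eu d × ℝ → Eu d := fun z => if z.2 < τ then τ⁻¹ • v (g1 z) else (1 - τ)⁻¹ • v' (g2 z)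
    with hwdef
  have hwm : Measurable w := by
    refine Measurable.ite hlt ?_ ?_
    · exact (hv.comp hg1m).const_smul τ⁻¹
    · exact (hv'.comp hg2m).const_smul (1 - τ)⁻¹
  have m1 : ∀ᵐ z ∂(spaceTime d), (f1 z).2 < τ := by
    filter_upwards [spaceTime_ae_Ioo d] with z hz
    simp only [hf1, tch]; nlinarith [hz.2]
  have m2 : ∀ᵐ z ∂(spaceTime d), ¬ (f2 z).2 < τ := by
    filter_upwards [spaceTime_ae_Ioo d] with z hz
    simp only [hf2, tch]; nlinarith [hz.1]
  have hres : (spaceTime d).restrict R =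
      ENNReal.ofReal τ • ((spaceTime d).restrict S).map f1 +
      ENNReal.ofReal (1 - τ) • ((spaceTime d).restrict S').map f2 := by
    conv_lhs => rw [hsplit]
    rw [Measure.restrict_add, Measure.restrict_smul, Measure.restrict_smul, hem1.restrict_map,
      hem2.restrict_map]
    congr 2
    · refine congrArg (Measure.map _) (Measure.restrict_congr_set ?_)
      filter_upwards [m1] with z hz
      apply propext
      change f1 z ∈ R ↔ z ∈ S
      simp [hR, hz, gf1]
    · refine congrArg (Measure.map _) (Measure.restrict_congr_set ?_)
      filter_upwards [m2] with z hz
      apply propext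
      change f2 z ∈ R ↔ z ∈ S'
      have : τ ≤ (f2 z).2 := not_lt.1 hz
      simp [hR, gf2, this]
  have w1 : ∀ᵐ z ∂((spaceTime d).restrict S), w (f1 z) = τ⁻¹ • v z := by
    filter_upwards [ae_restrict_of_ae m1] with z hz
    simp only [hwdef, hz, if_true, gf1]
  have w2 : ∀ᵐ z ∂((spaceTime d).restrict S'), w (f2 z) = (1 - τ)⁻¹ • v' z := by
    filter_upwards [ae_restrict_of_ae m2] with z hz
    simp only [hwdef, hz, if_false, gf2]
  have scale : ∀ (r : ℝ), 0 < r → ∀ (u : Eu d × ℝ → Eu d) (P : Set (Eu d × ℝ)), Measurable u →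
      ENNReal.ofReal r * ∫⁻ z in P, ‖r⁻¹ • u z‖ₑ ^ 2 ∂(spaceTime d) =
      ENNReal.ofReal r⁻¹ * ∫⁻ z in P, ‖u z‖ₑ ^ 2 ∂(spaceTime d) := by
    intro r hr u P hu
    simp_rw [enorm_smul, mul_pow]
    rw [lintegral_const_mul _ (hu.enorm.pow_const 2), ← mul_assoc]
    congr 1
    rw [Real.enorm_eq_ofReal (inv_nonneg.2 hr.le), ← ENNReal.ofReal_pow (inv_nonneg.2 hr.le),
      ← ENNReal.ofReal_mul hr.le]
    congr 1; field_simp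
  have hact : (∫⁻ z in R, ‖w z‖ₑ ^ 2 ∂(spaceTime d)) =
      ENNReal.ofReal τ⁻¹ * (∫⁻ z in S, ‖v z‖ₑ ^ 2 ∂(spaceTime d)) +
      ENNReal.ofReal (1 - τ)⁻¹ * ∫⁻ z in S', ‖v' z‖ₑ ^ 2 ∂(spaceTime d) := by
    rw [hres, lintegral_add_measure, lintegral_smul_measure, lintegral_smul_measure,
      hem1.lintegral_map, hem2.lintegral_map, ← scale τ h0 v S hv, ← scale (1 - τ) h1' v' S' hv']
    simp only [smul_eq_mul]
    congr 2
    · exact lintegral_congr_ae (w1.mono fun z hz => by simp only [hz])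
    · exact lintegral_congr_ae (w2.mono fun z hz => by simp only [hz])
  have hRfin : spaceTime d R < ⊤ := by
    rw [← Measure.restrict_apply_univ, hres]
    simp only [Measure.coe_add, Measure.coe_smul, Pi.add_apply, Pi.smul_apply, smul_eq_mul]
    rw [Measure.map_apply hem1.measurable MeasurableSet.univ,
      Measure.map_apply hem2.measurable MeasurableSet.univ]
    simp only [preimage_univ, Measure.restrict_apply_univ]
    exact ENNReal.add_lt_top.2 ⟨ENNReal.mul_lt_top (by simp) hfin, ENNReal.mul_lt_top (by simp) hfin'⟩
  have hRact : (∫⁻ z in R, ‖w z‖ₑ ^ 2 ∂(spaceTime d)) < ⊤ := by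
    rw [hact]
    exact ENNReal.add_lt_top.2 ⟨ENNReal.mul_lt_top (by simp) h2, ENNReal.mul_lt_top (by simp) h2'⟩
  refine ⟨R, w, ⟨hRm, hRfin, hwm, hRact, ?_⟩, ?_⟩
  · intro q hq hcs
    have e1 := hw _ (tch_smooth d 0 τ hq) (tch_supp d 0 h0.ne' hcs)
    have e2 := hw' _ (tch_smooth d τ (1 - τ) hq) (tch_supp d τ h1'.ne' hcs)
    have : IsFiniteMeasure ((spaceTime d).restrict R) := ⟨by simpa using hRfin⟩
    obtain ⟨K, hK⟩ := fderiv_bound hq hcs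
    have hintg := test_integrable (sq_enorm_integrable hRfin hwm hRact) hq K
      (Filter.Eventually.of_forall hK)
    rw [hres] at hintg ⊢
    rw [integrable_add_measure] at hintg
    rw [integral_add_measure hintg.1 hintg.2, integral_smul_measure, integral_smul_measure,
      hem1.integral_map, hem2.integral_map]
    have k1 : τ • ∫ z in S, fderiv ℝ q (f1 z) (w (f1 z), 1) ∂(spaceTime d) =
        ∫ z in S, fderiv ℝ (fun z => q (tch d 0 τ z)) z (v z, 1) ∂(spaceTime d) := by
      rw [← integral_smul]
      refine integral_congr_ae ?_
      filter_upwards [w1] with z hz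
      rw [tch_fderiv _ _ _ hq, hz, ← map_smul]
      simp [hf1, smul_smul, mul_inv_cancel₀ h0.ne']
    have k2 : (1 - τ) • ∫ z in S', fderiv ℝ q (f2 z) (w (f2 z), 1) ∂(spaceTime d) =
        ∫ z in S', fderiv ℝ (fun z => q (tch d τ (1 - τ) z)) z (v' z, 1) ∂(spaceTime d) := by
      rw [← integral_smul]
      refine integral_congr_ae ?_
      filter_upwards [w2] with z hz
      rw [tch_fderiv _ _ _ hq, hz, ← map_smul]
      simp [hf2, smul_smul, mul_inv_cancel₀ h1'.ne']
    rw [ENNReal.toReal_ofReal h0.le, ENNReal.toReal_ofReal h1'.le, k1, k2, e1, e2]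
    simp [tch]
  · rw [hact]; gcongr

/-- `A` and `B` can be joined with action at most `ℓ²`. -/
def Len {d : ℕ} (A B : Set (Eu d)) (l : ℝ) : Prop := 0 < l ∧ Conn A B (ENNReal.ofReal (l ^ 2))

lemma Conn.mono {d : ℕ} {A B : Set (Eu d)} {a b : ℝ≥0∞} (h : Conn A B a) (hab : a ≤ b) :
    Conn A B b := by
  obtain ⟨S, v, h, hc⟩ := h
  exact ⟨S, v, h, hc.trans hab⟩

lemma Len.mono {d : ℕ} {A B : Set (Eu d)} {a b : ℝ} (h : Len A B a) (hab : a ≤ b) :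
    Len A B b := by
  refine ⟨h.1.trans_le hab, h.2.mono (ENNReal.ofReal_le_ofReal ?_)⟩
  have := h.1
  gcongr

lemma Len.symm {d : ℕ} {A B : Set (Eu d)} {a : ℝ} (h : Len A B a) : Len B A a := ⟨h.1, h.2.symm⟩

lemma Len.trans {d : ℕ} {A B C : Set (Eu d)} {a b : ℝ} (h : Len A B a) (h' : Len B C b) :
    Len A C (a + b) := by
  have ha := h.1
  have hb := h'.1
  refine ⟨by linarith, ?_⟩
  have := h.2.concat h'.2 (τ := a / (a + b)) (by positivity)
    ((div_lt_one (by linarith)).2 (by linarith))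
  refine this.mono (le_of_eq ?_)
  have e : 1 - a / (a + b) = b / (a + b) := by field_simp; ring
  rw [e, ← ENNReal.ofReal_mul (by positivity), ← ENNReal.ofReal_mul (by positivity),
    ← ENNReal.ofReal_add (by positivity) (by positivity)]
  congr 1
  field_simp

open Set MeasureTheory ProbabilityTheory
open scoped ENNReal RealInnerProductSpace

lemma fiber_char {Y Z : Type*} [MeasurableSpace Y] [MeasurableSpace Z]
    [MeasurableSpace.CountablyGenerated Z] (m : Measure Z) [SFinite m]
    (κ : Kernel Y Z) [IsFiniteKernel κ]
    (h : ∀ y, ∃ A, MeasurableSet A ∧ κ y = m.restrict A) :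
    ∃ A : Set (Y × Z), MeasurableSet A ∧ ∀ y, κ y = m.restrict (Prod.mk y ⁻¹' A) := by
  let η : Kernel Y Z := Kernel.const Y m.toFinite
  refine ⟨{p | 0 < κ.rnDeriv η p.1 p.2}, measurableSet_lt measurable_const (by fun_prop), fun y => ?_⟩
  obtain ⟨A, hA, hκ⟩ := h y
  have hac : κ y ≪ η y := by
    rw [hκ]
    exact Measure.absolutelyContinuous_of_le Measure.restrict_le_self |>.trans
      (absolutelyContinuous_toFinite m)
  have hd : κ y = (η y).withDensity (κ.rnDeriv η y) := by
    have := Kernel.withDensity_rnDeriv_eq hac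
    rw [← this, Kernel.withDensity_apply _ (by fun_prop)]
  have hrm : Measurable (κ.rnDeriv η y) := by fun_prop
  set r := κ.rnDeriv η y
  have hP : MeasurableSet {z | 0 < r z} := measurableSet_lt measurable_const hrm
  have hpre : (Prod.mk y ⁻¹' {p : Y × Z | 0 < κ.rnDeriv η p.1 p.2}) = {z | 0 < r z} := rfl
  rw [hpre, hκ]
  refine Measure.restrict_congr_set ?_
  rw [ae_eq_set]
  constructor
  · have h0 : κ y {z | 0 < r z}ᶜ = 0 := by
      rw [hd, withDensity_apply _ hP.compl]
      rw [lintegral_eq_zero_iff hrm]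
      filter_upwards [ae_restrict_mem hP.compl] with z hz
      simpa using hz
    rw [hκ, Measure.restrict_apply hP.compl] at h0
    rwa [sdiff_eq, inter_comm]
  · have h0 : κ y ({z | 0 < r z} \ A) = 0 := by
      rw [hκ, Measure.restrict_apply (hP.diff hA)]; simp
    rw [hd, withDensity_apply _ (hP.diff hA), lintegral_eq_zero_iff hrm] at h0
    have h1 : η y ({z | 0 < r z} \ A) = 0 := by
      have := (ae_restrict_iff' (hP.diff hA)).1 h0
      rw [ae_iff] at this
      refine measure_mono_null ?_ this
      intro z hz
      simp only [mem_ofPred_eq, Classical.not_imp]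
      refine ⟨hz, ?_⟩
      have : 0 < r z := hz.1
      simpa using this.ne'
    exact absolutelyContinuous_toFinite m h1

lemma fam_char {X Y Z : Type*} [MeasurableSpace X] [MeasurableSpace Y] [MeasurableSpace Z]
    [MeasurableSpace.CountablyGenerated Z] (m : Measure Z) [SFinite m]
    (μ : Measure Y) [SFinite μ] (M : Kernel Y X) [IsFiniteKernel M] (g : Y × X → Z)
    (hg : Measurable g)
    (h : ∀ y, ∃ A, MeasurableSet A ∧ (M y).map (fun x => g (y, x)) = m.restrict A) :
    ∃ A : Set (Y × Z), MeasurableSet A ∧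
      (μ ⊗ₘ M).map (fun p => (p.1, g p)) = (μ.prod m).restrict A := by
  let κ : Kernel Y Z := (Kernel.id ×ₖ M).map g
  have hκ : ∀ y, κ y = (M y).map (fun x => g (y, x)) := by
    intro y
    ext s hs
    rw [Kernel.map_apply' _ hg _ hs, Kernel.prod_apply' _ _ _ (hg hs),
      Measure.map_apply (by fun_prop) hs]
    simp only [Kernel.id_apply]
    rw [lintegral_dirac' _ ?_]
    · rfl
    · exact measurable_measure_prodMk_left (hg hs)
  obtain ⟨A, hA, hAκ⟩ := fiber_char m κ (fun y => by rw [hκ]; exact h y)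
  refine ⟨A, hA, ?_⟩
  ext s hs
  rw [Measure.map_apply (by fun_prop) hs, Measure.compProd_apply (by measurability),
    Measure.restrict_apply hs, Measure.prod_apply (hs.inter hA)]
  refine lintegral_congr fun y => ?_
  have h2 := hAκ y
  rw [hκ] at h2
  have h3 := congrArg (fun ν => ν (Prod.mk y ⁻¹' s)) h2
  rw [Measure.map_apply (by fun_prop) (measurable_prodMk_left hs),
    Measure.restrict_apply (measurable_prodMk_left hs)] at h3
  exact h3

/-- Straight line Lagrangian motion gives an Eulerian path. -/
lemma lagr {d : ℕ} {X : Type*} [MeasurableSpace X] [StandardBorelSpace X] (m : Measure X)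
    [IsFiniteMeasure m] (a b : X → Eu d) (ha : Measurable a) (hb : Measurable b)
    (h2 : (∫⁻ x, ‖b x - a x‖ₑ ^ 2 ∂m) < ⊤) (X' : Set X) (hX' : MeasurableSet X')
    (hX0 : m X'ᶜ = 0)
    (hinj : ∀ t ∈ Ioo (0:ℝ) 1, InjOn (fun x => (1 - t) • a x + t • b x) X')
    (hch : ∀ t ∈ Ioo (0:ℝ) 1, ∃ A, MeasurableSet A ∧
      m.map (fun x => (1 - t) • a x + t • b x) = volume.restrict A)
    {A B : Set (Eu d)} (hA : MeasurableSet A) (hB : MeasurableSet B)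
    (hmA : m.map a = volume.restrict A)
    (hmB : m.map b = volume.restrict B) :
    Conn A B (∫⁻ x, ‖b x - a x‖ₑ ^ 2 ∂m) := by
  classical
  let c : ℝ → ℝ := fun t => max 0 (min t 1)
  have hc : Measurable c := by fun_prop
  have hcI : ∀ t ∈ Icc (0:ℝ) 1, c t = t := by
    intro t ht; simp [c, ht.1, ht.2]
  let γ : ℝ × X → Eu d := fun p => (1 - c p.1) • a p.2 + c p.1 • b p.2
  have hγ : Measurable γ := by fun_prop
  let I : Measure ℝ := volume.restrict (Icc (0:ℝ) 1)
  let M : Kernel ℝ X := Kernel.const ℝ m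
  have hall : ∀ t : ℝ, ∃ A, MeasurableSet A ∧ (M t).map (fun x => γ (t, x)) = volume.restrict A := by
    intro t
    simp only [γ, M, Kernel.const_apply]
    rcases le_or_gt t 0 with h0 | h0
    · have : c t = 0 := by simp [c, h0]
      refine ⟨A, hA, ?_⟩
      simpa [this] using hmA
    rcases le_or_gt 1 t with h1 | h1
    · have : c t = 1 := by simp [c, h1]
      refine ⟨B, hB, ?_⟩
      simpa [this] using hmB
    · rw [hcI t ⟨h0.le, h1.le⟩]; exact hch t ⟨h0, h1⟩
  obtain ⟨S₀, hS₀, hmap⟩ := fam_char (volume : Measure (Eu d)) I M γ hγ hall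
  have hcp : I ⊗ₘ M = I.prod m := Measure.compProd_const
  rw [hcp] at hmap
  let S : Set (Eu d × ℝ) := Prod.swap ⁻¹' S₀
  have hS : MeasurableSet S := measurable_swap hS₀
  let Φ : ℝ × X → Eu d × ℝ := fun p => (γ p, p.1)
  have hΦ : Measurable Φ := by fun_prop
  have hN : (I.prod m).map Φ = (spaceTime d).restrict S := by
    have e1 : Φ = Prod.swap ∘ (fun p => (p.1, γ p)) := rfl
    rw [e1, ← Measure.map_map measurable_swap (by fun_prop), hmap]
    have : S₀ = Prod.swap ⁻¹' S := by ext; simp [S]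
    rw [this, ← Measure.restrict_map measurable_swap hS, Measure.prod_swap]
    rfl
  -- velocity
  let D : Set (ℝ × X) := Ioo (0:ℝ) 1 ×ˢ X'
  have hD : MeasurableSet D := measurableSet_Ioo.prod hX'
  have hDae : ∀ᵐ p ∂(I.prod m), p ∈ D := by
    have h1 : ∀ᵐ t ∂I, t ∈ Ioo (0:ℝ) 1 := by
      simp only [I]
      rw [← restrict_Ioo_eq_restrict_Icc]
      exact ae_restrict_mem measurableSet_Ioo
    have h2 : ∀ᵐ x ∂m, x ∈ X' := by rw [ae_iff]; exact hX0
    filter_upwards [Measure.quasiMeasurePreserving_fst.ae h1,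
      Measure.quasiMeasurePreserving_snd.ae h2] with p hp1 hp2 using ⟨hp1, hp2⟩
  have hemb : MeasurableEmbedding (fun p : D => Φ p) := by
    have : StandardBorelSpace D := hD.standardBorel
    refine (hΦ.comp measurable_subtype_coe).measurableEmbedding ?_
    rintro ⟨⟨t, x⟩, ht, hx⟩ ⟨⟨s, y⟩, hs, hy⟩ h
    simp only [Φ, γ, Prod.mk.injEq, Function.comp] at h
    obtain ⟨h1, rfl⟩ := h
    simp only at ht hx hy
    rw [hcI t ⟨ht.1.le, ht.2.le⟩] at h1
    have := hinj t ht hx hy h1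
    simp [this]
  obtain ⟨v, hv, hvΦ⟩ := hemb.exists_measurable_extend
    (g := fun p : D => b p.1.2 - a p.1.2) (by fun_prop) (fun _ => ⟨0⟩)
  have hvae : ∀ᵐ p ∂(I.prod m), v (Φ p) = b p.2 - a p.2 := by
    filter_upwards [hDae] with p hp
    exact congrFun hvΦ ⟨p, hp⟩
  have hact : (∫⁻ z in S, ‖v z‖ₑ ^ 2 ∂(spaceTime d)) = ∫⁻ x, ‖b x - a x‖ₑ ^ 2 ∂m := by
    rw [← hN, lintegral_map (by fun_prop) hΦ]
    have : (∫⁻ p, ‖v (Φ p)‖ₑ ^ 2 ∂(I.prod m)) = ∫⁻ p, ‖b p.2 - a p.2‖ₑ ^ 2 ∂(I.prod m) :=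
      lintegral_congr_ae (hvae.mono fun p hp => by simp only [hp])
    rw [this, lintegral_prod _ (by fun_prop)]
    simp [I]
  have hfin : spaceTime d S < ⊤ := by
    rw [← Measure.restrict_apply_univ, ← hN]
    exact measure_lt_top _ _
  have hact2 : (∫⁻ z in S, ‖v z‖ₑ ^ 2 ∂(spaceTime d)) < ⊤ := by rw [hact]; exact h2
  refine ⟨S, v, ⟨hS, hfin, hv, hact2, ?_⟩, hact.le⟩
  intro q hq hcs
  have hfm : IsFiniteMeasure ((spaceTime d).restrict S) := ⟨by simpa using hfin⟩
  obtain ⟨K, hK⟩ := fderiv_bound hq hcs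
  have hintg := test_integrable (sq_enorm_integrable hfin hv hact2) hq K
      (Filter.Eventually.of_forall hK)
  rw [← hN] at hintg ⊢
  have hint0 := hintg
  rw [integrable_map_measure hintg.1 hΦ.aemeasurable] at hintg
  rw [integral_map hΦ.aemeasurable hint0.1]
  have hae : (fun p : ℝ × X => fderiv ℝ q (Φ p) (v (Φ p), 1)) =ᵐ[I.prod m]
      fun p => fderiv ℝ q (((1 - p.1) • a p.2 + p.1 • b p.2), p.1) (b p.2 - a p.2, 1) := by
    filter_upwards [hvae, hDae] with p hp hpD
    rw [hp]
    simp only [Φ, γ]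
    rw [hcI p.1 ⟨hpD.1.1.le, hpD.1.2.le⟩]
  rw [integral_congr_ae hae]
  have hint2 := hintg.congr hae
  rw [integral_prod_symm _ hint2]
  have hqc := hq.continuous
  have hqb : ∃ C, ∀ z, ‖q z‖ ≤ C := hcs.exists_bound_of_continuous hqc
  obtain ⟨C, hC⟩ := hqb
  have hftc : ∀ x, (∫ t, fderiv ℝ q (((1 - t) • a x + t • b x), t) (b x - a x, 1) ∂I) =
      q (b x, 1) - q (a x, 0) := by
    intro x
    have hcont : Continuous (fun t : ℝ =>
        fderiv ℝ q (((1 - t) • a x + t • b x), t) (b x - a x, 1)) := by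
      have := hq.continuous_fderiv (by simp)
      fun_prop
    simp only [I]
    rw [integral_Icc_eq_integral_Ioc, ← intervalIntegral.integral_of_le zero_le_one]
    have hder : ∀ t ∈ uIcc (0:ℝ) 1, HasDerivAt (fun t : ℝ => q (((1 - t) • a x + t • b x), t))
        (fderiv ℝ q (((1 - t) • a x + t • b x), t) (b x - a x, 1)) t := by
      intro t _
      have h1 : HasDerivAt (fun t : ℝ => ((((1 - t) • a x + t • b x), t) : Eu d × ℝ))
          (b x - a x, 1) t := by
        refine HasDerivAt.prodMk ?_ (hasDerivAt_id t)
        have h3 := ((hasDerivAt_id t).const_sub 1).smul_const (a x)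
        have h4 := (hasDerivAt_id t).smul_const (b x)
        have := h3.add h4
        have e : b x - a x = -(1:ℝ) • a x + (1:ℝ) • b x := by
          rw [neg_one_smul, one_smul]; abel
        rw [e]
        exact this
      exact ((hq.differentiable (by simp)) _).hasFDerivAt.comp_hasDerivAt t h1
    rw [intervalIntegral.integral_eq_sub_of_hasDerivAt hder (hcont.intervalIntegrable _ _)]
    simp
  have : (∫ x, ∫ t, fderiv ℝ q (((1 - t) • a x + t • b x), t) (b x - a x, 1) ∂I ∂m) =
      ∫ x, (q (b x, 1) - q (a x, 0)) ∂m := by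
    congr 1; ext x; exact hftc x
  rw [this, integral_sub]
  · congr 1
    · rw [← hmB, integral_map hb.aemeasurable (by fun_prop)]
    · rw [← hmA, integral_map ha.aemeasurable (by fun_prop)]
  · exact Integrable.of_bound (by
      have : Measurable (fun x => q (b x, 1)) := by fun_prop
      exact this.aestronglyMeasurable) C (Filter.Eventually.of_forall fun x => hC _)
  · exact Integrable.of_bound (by
      have : Measurable (fun x => q (a x, 0)) := by fun_prop
      exact this.aestronglyMeasurable) C (Filter.Eventually.of_forall fun x => hC _)

open Set MeasureTheory ProbabilityTheory
open scoped ENNReal RealInnerProductSpace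

/-- distribution function of a set -/
noncomputable def Gd (E : Set ℝ) (r : ℝ) : ℝ := volume.real (E ∩ Iic r)

open Classical in
/-- quantile function of a set -/
noncomputable def Xq (E : Set ℝ) (u : ℝ) : ℝ :=
  if 0 < u ∧ u < volume.real E then sInf {r | u ≤ Gd E r} else 0

lemma Gd_fin {R : ℝ} {E : Set ℝ} (hE : E ⊆ Icc (-R) R) : volume E < ⊤ :=
  (measure_mono hE).trans_lt (by simp)

lemma Gd_mono {R : ℝ} {E : Set ℝ} (hE : E ⊆ Icc (-R) R) : Monotone (Gd E) := by
  intro r s hrs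
  refine measureReal_mono (inter_subset_inter_right _ (Iic_subset_Iic.2 hrs)) ?_
  exact ((measure_mono inter_subset_left).trans_lt (Gd_fin hE)).ne

lemma Gd_lip {R : ℝ} {E : Set ℝ} (hE : E ⊆ Icc (-R) R) {r s : ℝ} (hrs : r ≤ s) :
    Gd E s - Gd E r ≤ s - r := by
  have h1 : E ∩ Iic s ⊆ (E ∩ Iic r) ∪ Ioc r s := by
    rintro x ⟨hx, hs⟩
    rcases le_or_gt x r with h | h
    · exact Or.inl ⟨hx, h⟩
    · exact Or.inr ⟨h, hs⟩
  have h2 : volume.real (E ∩ Iic s) ≤ volume.real ((E ∩ Iic r) ∪ Ioc r s) := by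
    refine measureReal_mono h1 ?_
    have := measure_union_le (μ := volume) (E ∩ Iic r) (Ioc r s)
    refine (this.trans_lt (ENNReal.add_lt_top.2 ⟨?_, by simp⟩)).ne
    exact (measure_mono inter_subset_left).trans_lt (Gd_fin hE)
  have h3 := measureReal_union_le (μ := volume) (E ∩ Iic r) (Ioc r s)
  have h4 : volume.real (Ioc r s) = s - r := by
    simp [measureReal_def, ENNReal.toReal_ofReal (sub_nonneg.2 hrs)]
  unfold Gd; linarith

lemma Gd_cont {R : ℝ} {E : Set ℝ} (hE : E ⊆ Icc (-R) R) : Continuous (Gd E) := by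
  have : LipschitzWith 1 (Gd E) := by
    refine LipschitzWith.of_le_add fun x y => ?_
    rcases le_total x y with h | h
    · have := Gd_mono hE h
      have := dist_nonneg (x := x) (y := y); linarith
    · have := Gd_lip hE h
      rw [Real.dist_eq, abs_of_nonneg (by linarith)]; linarith
  exact this.continuous

lemma Gd_low {R : ℝ} {E : Set ℝ} (hE : E ⊆ Icc (-R) R) {r : ℝ} (hr : r ≤ -R) : Gd E r = 0 := by
  have : volume (E ∩ Iic r) = 0 := by
    refine measure_mono_null (t := {-R}) ?_ (by simp)
    rintro x ⟨hx, hxr⟩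
    have := (hE hx).1
    exact le_antisymm (le_trans hxr hr) this
  simp [Gd, measureReal_def, this]

lemma Gd_high {R : ℝ} {E : Set ℝ} (hE : E ⊆ Icc (-R) R) {r : ℝ} (hr : R ≤ r) :
    Gd E r = volume.real E := by
  unfold Gd
  rw [inter_eq_left.2]
  exact fun x hx => (hE hx).2.trans hr

lemma Xq_le {R : ℝ} {E : Set ℝ} (hE : E ⊆ Icc (-R) R) {u : ℝ} (h0 : 0 < u)
    (h1 : u < volume.real E) (r : ℝ) : Xq E u ≤ r ↔ u ≤ Gd E r := by
  have hX : Xq E u = sInf {r | u ≤ Gd E r} := by simp [Xq, h0, h1]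
  have hbb : BddBelow {r | u ≤ Gd E r} := by
    refine ⟨-R, fun r hr => ?_⟩
    by_contra hlt
    push Not at hlt
    have h3 : u ≤ Gd E r := hr
    rw [Gd_low hE hlt.le] at h3
    linarith
  have hne : {r | u ≤ Gd E r}.Nonempty := ⟨R, by
    change u ≤ Gd E R
    rw [Gd_high hE le_rfl]; exact h1.le⟩
  have hcl : IsClosed {r | u ≤ Gd E r} := isClosed_le continuous_const (Gd_cont hE)
  have hmem : u ≤ Gd E (sInf {r | u ≤ Gd E r}) := hcl.csInf_mem hne hbb
  rw [hX]
  exact ⟨fun h => hmem.trans (Gd_mono hE h), fun h => csInf_le hbb h⟩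

lemma Gd_Xq {R : ℝ} {E : Set ℝ} (hE : E ⊆ Icc (-R) R) {u : ℝ} (h0 : 0 < u)
    (h1 : u < volume.real E) : Gd E (Xq E u) = u := by
  refine le_antisymm ?_ ((Xq_le hE h0 h1 _).1 le_rfl)
  have hc := (Gd_cont hE).continuousAt (x := Xq E u)
  have : ∀ r ∈ Iio (Xq E u), Gd E r ≤ u := fun r hr => by
    by_contra h
    push Not at h
    exact absurd ((Xq_le hE h0 h1 r).2 h.le) (not_le.2 hr)
  have hcw : Filter.Tendsto (Gd E) (nhdsWithin (Xq E u) (Iio (Xq E u))) (nhds (Gd E (Xq E u))) :=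
    hc.continuousWithinAt
  exact le_of_tendsto hcw (Filter.eventually_of_mem self_mem_nhdsWithin this)

lemma Xq_exp {R : ℝ} {E : Set ℝ} (hE : E ⊆ Icc (-R) R) {u w : ℝ}
    (hu : u ∈ Ioo 0 (volume.real E)) (hw : w ∈ Ioo 0 (volume.real E)) (h : u ≤ w) :
    w - u ≤ Xq E w - Xq E u := by
  have h1 : Xq E u ≤ Xq E w := by
    rw [Xq_le hE hu.1 hu.2, Gd_Xq hE hw.1 hw.2]; exact h
  have := Gd_lip hE h1
  rwa [Gd_Xq hE hu.1 hu.2, Gd_Xq hE hw.1 hw.2] at this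

lemma Xq_mem {R : ℝ} {E : Set ℝ} (hE : E ⊆ Icc (-R) R) {u : ℝ}
    (hu : u ∈ Ioo 0 (volume.real E)) : Xq E u ∈ Icc (-R) R := by
  constructor
  · by_contra h
    push Not at h
    have := Gd_Xq hE hu.1 hu.2
    rw [Gd_low hE h.le] at this
    exact absurd hu.1 (by linarith)
  · rw [Xq_le hE hu.1 hu.2, Gd_high hE le_rfl]; exact hu.2.le

lemma Xq_meas {Y : Type*} [MeasurableSpace Y] {R : ℝ} {E : Set (Y × ℝ)} (hEm : MeasurableSet E)
    (hE : ∀ y, Prod.mk y ⁻¹' E ⊆ Icc (-R) R) :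
    Measurable (fun p : Y × ℝ => Xq (Prod.mk p.1 ⁻¹' E) p.2) := by
  classical
  refine measurable_of_Iic fun r => ?_
  have hG : ∀ r, Measurable (fun y => Gd (Prod.mk y ⁻¹' E) r) := by
    intro r
    have : (fun y => Gd (Prod.mk y ⁻¹' E) r) =
        fun y => (volume (Prod.mk y ⁻¹' (E ∩ (univ ×ˢ Iic r)))).toReal := by
      ext y; unfold Gd; rw [measureReal_def]; congr 2; ext x; simp
    rw [this]
    exact (measurable_measure_prodMk_left (hEm.inter (MeasurableSet.univ.prod measurableSet_Iic))).ennreal_toReal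
  have hm : Measurable (fun y => volume.real (Prod.mk y ⁻¹' E)) := by
    exact (measurable_measure_prodMk_left hEm).ennreal_toReal
  have hL : MeasurableSet {p : Y × ℝ | 0 < p.2 ∧ p.2 < volume.real (Prod.mk p.1 ⁻¹' E)} :=
    (measurableSet_lt measurable_const measurable_snd).inter
      (measurableSet_lt measurable_snd (hm.comp measurable_fst))
  have : (fun p : Y × ℝ => Xq (Prod.mk p.1 ⁻¹' E) p.2) ⁻¹' Iic r =
      ({p : Y × ℝ | 0 < p.2 ∧ p.2 < volume.real (Prod.mk p.1 ⁻¹' E)} ∩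
        {p | p.2 ≤ Gd (Prod.mk p.1 ⁻¹' E) r}) ∪
      ({p : Y × ℝ | 0 < p.2 ∧ p.2 < volume.real (Prod.mk p.1 ⁻¹' E)}ᶜ ∩ {p | 0 ≤ r}) := by
    ext ⟨y, u⟩
    by_cases h : 0 < u ∧ u < volume.real (Prod.mk y ⁻¹' E)
    · simp only [mem_preimage, mem_Iic, mem_union, mem_inter_iff, mem_ofPred_eq, mem_compl_iff]
      rw [Xq_le (hE y) h.1 h.2]
      tauto
    · simp only [mem_preimage, mem_Iic, mem_union, mem_inter_iff, mem_ofPred_eq, mem_compl_iff]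
      rw [Xq, if_neg h]
      tauto
  rw [this]
  exact (hL.inter (measurableSet_le measurable_snd ((hG r).comp measurable_fst))).union
    (hL.compl.inter (by measurability))

lemma Xq_meas1 {R : ℝ} {E : Set ℝ} (hEm : MeasurableSet E) (hE : E ⊆ Icc (-R) R) :
    Measurable (Xq E) := by
  have := Xq_meas (Y := Unit) (E := Prod.snd ⁻¹' E) (measurable_snd hEm) (fun y => hE)
  exact this.comp (measurable_prodMk_left (x := ()))

lemma Xq_map {R : ℝ} {E : Set ℝ} (hEm : MeasurableSet E) (hE : E ⊆ Icc (-R) R) :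
    (volume.restrict (Ioo 0 (volume.real E))).map (Xq E) = volume.restrict E := by
  have hf : IsFiniteMeasure (volume.restrict (Ioo 0 (volume.real E))) := ⟨by simp⟩
  refine Measure.ext_of_Iic _ _ fun r => ?_
  have hG0 : 0 ≤ Gd E r := measureReal_nonneg
  have hG1 : Gd E r ≤ volume.real E := measureReal_mono inter_subset_left (Gd_fin hE).ne
  rw [Measure.map_apply (Xq_meas1 hEm hE) measurableSet_Iic,
    Measure.restrict_apply (Xq_meas1 hEm hE measurableSet_Iic),
    Measure.restrict_apply measurableSet_Iic]
  have : Xq E ⁻¹' Iic r ∩ Ioo 0 (volume.real E) = Ioo 0 (volume.real E) ∩ Iic (Gd E r) := by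
    ext u
    constructor
    · rintro ⟨h1, h2⟩; exact ⟨h2, (Xq_le hE h2.1 h2.2 r).1 h1⟩
    · rintro ⟨h1, h2⟩; exact ⟨(Xq_le hE h1.1 h1.2 r).2 h2, h1⟩
  rw [this]
  have e2 : volume (Iic r ∩ E) = ENNReal.ofReal (Gd E r) := by
    rw [inter_comm, Gd, ofReal_measureReal (((measure_mono inter_subset_left).trans_lt (Gd_fin hE)).ne)]
  rw [e2]
  apply le_antisymm
  · calc volume (Ioo 0 (volume.real E) ∩ Iic (Gd E r)) ≤ volume (Ioc 0 (Gd E r)) :=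
        measure_mono fun x hx => ⟨hx.1.1, hx.2⟩
      _ = _ := by simp
  · calc ENNReal.ofReal (Gd E r) = volume (Ioo 0 (Gd E r)) := by simp
      _ ≤ volume (Ioo 0 (volume.real E) ∩ Iic (Gd E r)) :=
        measure_mono fun x hx => ⟨⟨hx.1, hx.2.trans_le hG1⟩, hx.2.le⟩

/-- derivative one -/
lemma char1 {f : ℝ → ℝ} {S : Set ℝ} (hS : MeasurableSet S) (hf : Measurable f) (hi : InjOn f S)
    (hd : ∀ x ∈ S, HasDerivAt f 1 x) :
    MeasurableSet (f '' S) ∧ (volume.restrict S).map f = volume.restrict (f '' S) := by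
  refine ⟨hS.image_of_measurable_injOn hf hi, ?_⟩
  have := map_withDensity_abs_det_fderiv_eq_addHaar volume hS.nullMeasurableSet
    (fun x hx => (hd x hx).hasDerivWithinAt.hasFDerivWithinAt) hi
  simpa using this

lemma Xq_deriv {R : ℝ} {E : Set ℝ} (hEm : MeasurableSet E) (hE : E ⊆ Icc (-R) R) :
    ∀ᵐ u ∂(volume.restrict (Ioo 0 (volume.real E))), HasDerivAt (Xq E) 1 u := by
  set m := volume.real E
  have hmono : MonotoneOn (Xq E) (Ioo 0 m) := fun u hu w hw h => by
    have := Xq_exp hE hu hw h; linarith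
  have hX := Xq_meas1 hEm hE
  have h1 : ∀ᵐ u ∂(volume.restrict (Ioo 0 m)), DifferentiableAt ℝ (Xq E) u := by
    filter_upwards [hmono.ae_differentiableWithinAt measurableSet_Ioo,
      ae_restrict_mem measurableSet_Ioo] with u hu hm
    exact hu.differentiableAt (isOpen_Ioo.mem_nhds hm)
  let S : Set ℝ := Ioo 0 m ∩ {u | DifferentiableAt ℝ (Xq E) u} ∩ Xq E ⁻¹' E
  have hSm : MeasurableSet S :=
    (measurableSet_Ioo.inter (measurableSet_of_differentiableAt ℝ (Xq E))).inter (hX hEm)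
  have h2 : ∀ᵐ u ∂(volume.restrict (Ioo 0 m)), u ∈ S := by
    have h3 : ∀ᵐ u ∂(volume.restrict (Ioo 0 m)), Xq E u ∈ E := by
      refine ae_of_ae_map (p := fun x => x ∈ E) hX.aemeasurable ?_
      rw [Xq_map hEm hE]
      exact ae_restrict_mem hEm
    filter_upwards [h1, h3, ae_restrict_mem measurableSet_Ioo] with u a b c using ⟨⟨c, a⟩, b⟩
  have hge : ∀ u ∈ S, 1 ≤ deriv (Xq E) u := by
    intro u hu
    have hd := hu.1.2.hasDerivAt
    have ht := hd.tendsto_slope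
    have ht' := ht.mono_left (nhdsWithin_mono u (t := {u}ᶜ) (s := Ioi u) (fun x hx => ne_of_gt hx))
    refine ge_of_tendsto ht' ?_
    have : Ioo u m ∈ nhdsWithin u (Ioi u) := Ioo_mem_nhdsGT hu.1.1.2
    filter_upwards [this] with w hw
    have := Xq_exp hE hu.1.1 ⟨hu.1.1.1.trans hw.1, hw.2⟩ hw.1.le
    rw [slope_def_field, le_div_iff₀ (by linarith [hw.1])]
    linarith
  have hvol : volume S = ENNReal.ofReal m := by
    have : volume.restrict (Ioo 0 m) Sᶜ = 0 := h2
    have h4 : volume.restrict (Ioo 0 m) S = volume.restrict (Ioo 0 m) univ := by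
      rw [← measure_add_measure_compl hSm, this, add_zero]
    rw [Measure.restrict_apply hSm, Measure.restrict_apply_univ] at h4
    rw [inter_eq_left.2 (fun u hu => hu.1.1)] at h4
    simpa using h4
  have hle : ∫⁻ u in S, ENNReal.ofReal (deriv (Xq E) u) ≤ ∫⁻ u in S, 1 := by
    rw [lintegral_deriv_eq_volume_image_of_monotoneOn hSm
      (fun x hx => hx.1.2.hasDerivAt.hasDerivWithinAt)
      (hmono.mono fun u hu => hu.1.1)]
    simp only [lintegral_one, Measure.restrict_apply_univ, hvol]
    calc volume (Xq E '' S) ≤ volume E := measure_mono (by rintro _ ⟨u, hu, rfl⟩; exact hu.2)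
      _ = ENNReal.ofReal m := (ofReal_measureReal (Gd_fin hE).ne).symm
  have hle' : (1 : ℝ → ℝ≥0∞) ≤ᵐ[volume.restrict S] fun u => ENNReal.ofReal (deriv (Xq E) u) := by
    filter_upwards [ae_restrict_mem hSm] with u hu
    simpa using hge u hu
  have heq := ae_eq_of_ae_le_of_lintegral_le hle' (by
      simp [hvol]) (by fun_prop) hle
  have h5 := (ae_restrict_iff' hSm).1 heq
  filter_upwards [h2, ae_restrict_of_ae h5] with u hu h6
  have h7 := h6 hu
  have h8 : deriv (Xq E) u = 1 := by
    have : (1:ℝ≥0∞) = ENNReal.ofReal (deriv (Xq E) u) := h7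
    rw [eq_comm, ENNReal.ofReal_eq_one] at this
    exact this
  rw [← h8]; exact hu.1.2.hasDerivAt

lemma Xq_interp {R : ℝ} {E F : Set ℝ} (hEm : MeasurableSet E) (hE : E ⊆ Icc (-R) R)
    (hFm : MeasurableSet F) (hF : F ⊆ Icc (-R) R) (h : volume.real E = volume.real F)
    {t : ℝ} (ht : t ∈ Icc (0:ℝ) 1) :
    InjOn (fun u => (1 - t) * Xq E u + t * Xq F u) (Ioo 0 (volume.real E)) ∧
    ∃ A, MeasurableSet A ∧ (volume.restrict (Ioo 0 (volume.real E))).map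
      (fun u => (1 - t) * Xq E u + t * Xq F u) = volume.restrict A := by
  have ht0 := ht.1
  have ht1 := ht.2
  have hinj : InjOn (fun u => (1 - t) * Xq E u + t * Xq F u) (Ioo 0 (volume.real E)) := by
    have key : ∀ u ∈ Ioo 0 (volume.real E), ∀ w ∈ Ioo 0 (volume.real E), u < w →
        (1 - t) * Xq E u + t * Xq F u < (1 - t) * Xq E w + t * Xq F w := by
      intro u hu w hw huw
      have h1 := Xq_exp hE hu hw huw.le
      have h2 := Xq_exp hF (h ▸ hu) (h ▸ hw) huw.le
      nlinarith
    intro u hu w hw he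
    rcases lt_trichotomy u w with h1 | h1 | h1
    · exact absurd he (key u hu w hw h1).ne
    · exact h1
    · exact absurd he (key w hw u hu h1).ne'
  refine ⟨hinj, ?_⟩
  have hX := Xq_meas1 hEm hE
  have hX' := Xq_meas1 hFm hF
  have hd : ∀ᵐ u ∂(volume.restrict (Ioo 0 (volume.real E))),
      HasDerivAt (fun u => (1 - t) * Xq E u + t * Xq F u) 1 u := by
    have h2 := Xq_deriv hFm hF
    rw [← h] at h2
    filter_upwards [Xq_deriv hEm hE, h2] with u h3 h4
    have := (h3.const_mul (1 - t)).add (h4.const_mul t)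
    have e : (1 - t) * 1 + t * 1 = (1:ℝ) := by ring
    rw [e] at this
    exact this
  obtain ⟨S₀, hS₀, hS₀m, hS₀0⟩ := exists_measurable_superset_of_null hd
  let S := Ioo 0 (volume.real E) \ S₀
  have hS : MeasurableSet S := measurableSet_Ioo.diff hS₀m
  have hres : volume.restrict (Ioo 0 (volume.real E)) = volume.restrict S := by
    refine Measure.restrict_congr_set ?_
    rw [Measure.restrict_apply hS₀m] at hS₀0
    rw [ae_eq_set]
    constructor
    · refine measure_mono_null ?_ hS₀0
      intro x hx
      simp only [S, mem_sdiff, not_and, not_not] at hx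
      exact ⟨hx.2 hx.1, hx.1⟩
    · simp [S]
  obtain ⟨hA, hmap⟩ := char1 (f := fun u => (1 - t) * Xq E u + t * Xq F u) hS (by fun_prop)
    (hinj.mono sdiff_subset) (fun x hx => by
      by_contra hne; exact hx.2 (hS₀ hne))
  exact ⟨_, hA, by rw [hres]; exact hmap⟩

lemma Xq_cost {R : ℝ} {E F : Set ℝ} (hEm : MeasurableSet E) (hE : E ⊆ Icc (-R) R)
    (hFm : MeasurableSet F) (hF : F ⊆ Icc (-R) R) (h : volume.real E = volume.real F) :
    ∫⁻ u in Ioo 0 (volume.real E), ‖Xq F u - Xq E u‖ₑ ^ 2 ≤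
      ENNReal.ofReal (4 * R ^ 2) * volume (symmDiff E F) := by
  have hX := Xq_meas1 hEm hE
  have hX' := Xq_meas1 hFm hF
  rcases lt_or_ge R 0 with hR | hR
  · have : E = ∅ := by
      rw [Set.eq_empty_iff_forall_notMem]; intro x hx
      have := hE hx; linarith [this.1, this.2]
    simp [this]
  set m := volume.real E
  let B : Set (ℝ × ℝ) := {p | p.1 ∈ Ioo 0 m ∧ p.2 ∈ Icc (-R) R ∧ ¬ (Xq E p.1 ≤ p.2 ↔ Xq F p.1 ≤ p.2)}
  have hBm : MeasurableSet B := by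
    have e1 : MeasurableSet {p : ℝ × ℝ | Xq E p.1 ≤ p.2} := measurableSet_le (by fun_prop) (by fun_prop)
    have e2 : MeasurableSet {p : ℝ × ℝ | Xq F p.1 ≤ p.2} := measurableSet_le (by fun_prop) (by fun_prop)
    have : B = (Ioo 0 m ×ˢ Icc (-R) R) ∩ symmDiff {p : ℝ × ℝ | Xq E p.1 ≤ p.2} {p : ℝ × ℝ | Xq F p.1 ≤ p.2} := by
      ext p; simp only [B, mem_inter_iff, mem_prod, mem_symmDiff, mem_ofPred_eq]; tauto
    rw [this]
    exact (measurableSet_Ioo.prod measurableSet_Icc).inter (e1.symmDiff e2)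
  have h1 : ∀ u ∈ Ioo 0 m, ‖Xq F u - Xq E u‖ₑ ^ 2 ≤ ENNReal.ofReal (2 * R) * volume (Prod.mk u ⁻¹' B) := by
    intro u hu
    have hE1 := Xq_mem hE hu
    have hF1 := Xq_mem hF (h ▸ hu)
    have hsub : ENNReal.ofReal |Xq F u - Xq E u| ≤ volume (Prod.mk u ⁻¹' B) := by
      rcases le_total (Xq E u) (Xq F u) with hle | hle
      · rw [abs_of_nonneg (by linarith), ← Real.volume_Ico]
        refine measure_mono fun r hr => ⟨hu, ⟨hE1.1.trans hr.1, hr.2.le.trans hF1.2⟩, ?_⟩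
        intro hc; exact absurd (hc.1 hr.1) (not_le.2 hr.2)
      · rw [abs_of_nonpos (by linarith), neg_sub, ← Real.volume_Ico]
        refine measure_mono fun r hr => ⟨hu, ⟨hF1.1.trans hr.1, hr.2.le.trans hE1.2⟩, ?_⟩
        intro hc; exact absurd (hc.2 hr.1) (not_le.2 hr.2)
    have hab : |Xq F u - Xq E u| ≤ 2 * R := by
      rw [abs_le]; constructor <;> linarith [hE1.1, hE1.2, hF1.1, hF1.2]
    rw [← ofReal_norm, Real.norm_eq_abs, sq]
    exact mul_le_mul' (ENNReal.ofReal_le_ofReal hab) hsub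
  have h2 : ∫⁻ u in Ioo 0 m, volume (Prod.mk u ⁻¹' B) ≤ ENNReal.ofReal (2 * R) * volume (symmDiff E F) := by
    calc ∫⁻ u in Ioo 0 m, volume (Prod.mk u ⁻¹' B) ≤ ∫⁻ u, volume (Prod.mk u ⁻¹' B) :=
          setLIntegral_le_lintegral _ _
      _ = (volume.prod volume) B := (Measure.prod_apply hBm).symm
      _ = ∫⁻ r, volume ((fun u => (u, r)) ⁻¹' B) := Measure.prod_apply_symm hBm
      _ ≤ ∫⁻ r, (Icc (-R) R).indicator (fun _ => volume (symmDiff E F)) r := by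
          refine lintegral_mono fun r => ?_
          by_cases hr : r ∈ Icc (-R) R
          · rw [indicator_of_mem hr]
            have hs : (fun u => (u, r)) ⁻¹' B ⊆ uIoc (Gd E r) (Gd F r) := by
              rintro u ⟨hu, -, hne⟩
              rw [Xq_le hE hu.1 hu.2, Xq_le hF hu.1 (h ▸ hu.2)] at hne
              rw [mem_uIoc]
              by_contra hcon
              push Not at hcon
              apply hne
              constructor
              · intro h3; by_contra h4; push Not at h4; exact absurd (hcon.2 h4) (not_lt.2 h3)
              · intro h3; by_contra h4; push Not at h4; exact absurd (hcon.1 h4) (not_lt.2 h3)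
            refine (measure_mono hs).trans ?_
            rw [Real.volume_uIoc]
            have hfs : volume (symmDiff E F) ≠ ⊤ := by
              refine ((measure_mono (t := E ∪ F) ?_).trans_lt ((measure_union_le _ _).trans_lt
                (ENNReal.add_lt_top.2 ⟨Gd_fin hE, Gd_fin hF⟩))).ne
              exact symmDiff_subset_union
            have key : ∀ E F : Set ℝ, E ⊆ Icc (-R) R → F ⊆ Icc (-R) R → volume (symmDiff E F) ≠ ⊤ →
                Gd F r - Gd E r ≤ volume.real (symmDiff E F) := by
              intro E F hE hF hfs
              have h5 : F ∩ Iic r ⊆ (E ∩ Iic r) ∪ symmDiff E F := by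
                rintro x ⟨hx, hxr⟩
                by_cases hxE : x ∈ E
                · exact Or.inl ⟨hxE, hxr⟩
                · exact Or.inr (Or.inr ⟨hx, hxE⟩)
              have h6 := measureReal_mono (μ := volume) h5 (((measure_union_le _ _).trans_lt
                (ENNReal.add_lt_top.2 ⟨(measure_mono inter_subset_left).trans_lt (Gd_fin hE),
                  lt_top_iff_ne_top.2 hfs⟩)).ne)
              have h7 := measureReal_union_le (μ := volume) (E ∩ Iic r) (symmDiff E F)
              unfold Gd; linarith
            have k1 := key E F hE hF hfs
            have k2 := key F E hF hE (by rwa [symmDiff_comm])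
            rw [symmDiff_comm] at k2
            calc ENNReal.ofReal |Gd F r - Gd E r| ≤ ENNReal.ofReal (volume.real (symmDiff E F)) :=
                  ENNReal.ofReal_le_ofReal (abs_le.2 ⟨by linarith, k1⟩)
              _ = _ := ofReal_measureReal hfs
          · rw [indicator_of_notMem hr]
            have : (fun u => (u, r)) ⁻¹' B = ∅ := by
              ext u; simp only [B, mem_preimage, mem_ofPred_eq, mem_empty_iff_false, iff_false]
              tauto
            simp [this]
      _ = _ := by
          rw [lintegral_indicator measurableSet_Icc]
          simp only [lintegral_const, Measure.restrict_apply_univ, Real.volume_Icc]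
          rw [mul_comm]; congr 2; ring
  calc ∫⁻ u in Ioo 0 m, ‖Xq F u - Xq E u‖ₑ ^ 2 ≤
      ∫⁻ u in Ioo 0 m, ENNReal.ofReal (2 * R) * volume (Prod.mk u ⁻¹' B) :=
        setLIntegral_mono' measurableSet_Ioo h1
    _ = ENNReal.ofReal (2 * R) * ∫⁻ u in Ioo 0 m, volume (Prod.mk u ⁻¹' B) :=
        lintegral_const_mul _ (measurable_measure_prodMk_left hBm)
    _ ≤ ENNReal.ofReal (2 * R) * (ENNReal.ofReal (2 * R) * volume (symmDiff E F)) := by gcongr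
    _ = _ := by
        rw [← mul_assoc, ← ENNReal.ofReal_mul (by linarith)]; congr 2; ring

open Set MeasureTheory ProbabilityTheory
open scoped ENNReal RealInnerProductSpace

/-- Lagrangian path with general curves -/
lemma lagrC {d : ℕ} {X : Type*} [MeasurableSpace X] [StandardBorelSpace X] (m : Measure X)
    [IsFiniteMeasure m] (g g' : ℝ × X → Eu d) (hg : Measurable g) (hg' : Measurable g')
    (hgd : ∀ x, ∀ t ∈ Icc (0:ℝ) 1, HasDerivAt (fun s => g (s, x)) (g' (t, x)) t)
    (hgc : ∀ x, ContinuousOn (fun t => g' (t, x)) (Icc (0:ℝ) 1))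
    (h2 : (∫⁻ p, ‖g' p‖ₑ ^ 2 ∂((volume.restrict (Icc (0:ℝ) 1)).prod m)) < ⊤)
    (X' : Set X) (hX' : MeasurableSet X') (hX0 : m X'ᶜ = 0)
    (hinj : ∀ t ∈ Ioo (0:ℝ) 1, InjOn (fun x => g (t, x)) X')
    (hch : ∀ t ∈ Ioo (0:ℝ) 1, ∃ A, MeasurableSet A ∧
      m.map (fun x => g (t, x)) = volume.restrict A)
    {A B : Set (Eu d)} (hA : MeasurableSet A) (hB : MeasurableSet B)
    (hmA : m.map (fun x => g (0, x)) = volume.restrict A)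
    (hmB : m.map (fun x => g (1, x)) = volume.restrict B) :
    Conn A B (∫⁻ p, ‖g' p‖ₑ ^ 2 ∂((volume.restrict (Icc (0:ℝ) 1)).prod m)) := by
  classical
  let c : ℝ → ℝ := fun t => max 0 (min t 1)
  have hc : Measurable c := by fun_prop
  have hcI : ∀ t ∈ Icc (0:ℝ) 1, c t = t := by
    intro t ht; simp [c, ht.1, ht.2]
  let γ : ℝ × X → Eu d := fun p => g (c p.1, p.2)
  have hγ : Measurable γ := by fun_prop
  let I : Measure ℝ := volume.restrict (Icc (0:ℝ) 1)
  let M : Kernel ℝ X := Kernel.const ℝ m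
  have hall : ∀ t : ℝ, ∃ A, MeasurableSet A ∧ (M t).map (fun x => γ (t, x)) = volume.restrict A := by
    intro t
    simp only [γ, M, Kernel.const_apply]
    rcases le_or_gt t 0 with h0 | h0
    · have : c t = 0 := by simp [c, h0]
      refine ⟨A, hA, ?_⟩
      simpa [this] using hmA
    rcases le_or_gt 1 t with h1 | h1
    · have : c t = 1 := by simp [c, h1]
      refine ⟨B, hB, ?_⟩
      simpa [this] using hmB
    · rw [hcI t ⟨h0.le, h1.le⟩]; exact hch t ⟨h0, h1⟩
  obtain ⟨S₀, hS₀, hmap⟩ := fam_char (volume : Measure (Eu d)) I M γ hγ hall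
  have hcp : I ⊗ₘ M = I.prod m := Measure.compProd_const
  rw [hcp] at hmap
  let S : Set (Eu d × ℝ) := Prod.swap ⁻¹' S₀
  have hS : MeasurableSet S := measurable_swap hS₀
  let Φ : ℝ × X → Eu d × ℝ := fun p => (γ p, p.1)
  have hΦ : Measurable Φ := by fun_prop
  have hN : (I.prod m).map Φ = (spaceTime d).restrict S := by
    have e1 : Φ = Prod.swap ∘ (fun p => (p.1, γ p)) := rfl
    rw [e1, ← Measure.map_map measurable_swap (by fun_prop), hmap]
    have : S₀ = Prod.swap ⁻¹' S := by ext; simp [S]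
    rw [this, ← Measure.restrict_map measurable_swap hS, Measure.prod_swap]
    rfl
  -- velocity
  let D : Set (ℝ × X) := Ioo (0:ℝ) 1 ×ˢ X'
  have hD : MeasurableSet D := measurableSet_Ioo.prod hX'
  have hDae : ∀ᵐ p ∂(I.prod m), p ∈ D := by
    have h1 : ∀ᵐ t ∂I, t ∈ Ioo (0:ℝ) 1 := by
      simp only [I]
      rw [← restrict_Ioo_eq_restrict_Icc]
      exact ae_restrict_mem measurableSet_Ioo
    have h2 : ∀ᵐ x ∂m, x ∈ X' := by rw [ae_iff]; exact hX0
    filter_upwards [Measure.quasiMeasurePreserving_fst.ae h1,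
      Measure.quasiMeasurePreserving_snd.ae h2] with p hp1 hp2 using ⟨hp1, hp2⟩
  have hemb : MeasurableEmbedding (fun p : D => Φ p) := by
    have : StandardBorelSpace D := hD.standardBorel
    refine (hΦ.comp measurable_subtype_coe).measurableEmbedding ?_
    rintro ⟨⟨t, x⟩, ht, hx⟩ ⟨⟨s, y⟩, hs, hy⟩ h
    simp only [Φ, γ, Prod.mk.injEq, Function.comp] at h
    obtain ⟨h1, rfl⟩ := h
    simp only at ht hx hy
    rw [hcI t ⟨ht.1.le, ht.2.le⟩] at h1
    have := hinj t ht hx hy h1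
    simp [this]
  obtain ⟨v, hv, hvΦ⟩ := hemb.exists_measurable_extend
    (g := fun p : D => g' p.1) (by fun_prop) (fun _ => ⟨0⟩)
  have hvae : ∀ᵐ p ∂(I.prod m), v (Φ p) = g' p := by
    filter_upwards [hDae] with p hp
    exact congrFun hvΦ ⟨p, hp⟩
  have hact : (∫⁻ z in S, ‖v z‖ₑ ^ 2 ∂(spaceTime d)) = ∫⁻ p, ‖g' p‖ₑ ^ 2 ∂(I.prod m) := by
    rw [← hN, lintegral_map (by fun_prop) hΦ]
    have : (∫⁻ p, ‖v (Φ p)‖ₑ ^ 2 ∂(I.prod m)) = ∫⁻ p, ‖g' p‖ₑ ^ 2 ∂(I.prod m) :=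
      lintegral_congr_ae (hvae.mono fun p hp => by simp only [hp])
    rw [this]
  have hfin : spaceTime d S < ⊤ := by
    rw [← Measure.restrict_apply_univ, ← hN]
    exact measure_lt_top _ _
  have hact2 : (∫⁻ z in S, ‖v z‖ₑ ^ 2 ∂(spaceTime d)) < ⊤ := by rw [hact]; exact h2
  refine ⟨S, v, ⟨hS, hfin, hv, hact2, ?_⟩, hact.le⟩
  intro q hq hcs
  have hfm : IsFiniteMeasure ((spaceTime d).restrict S) := ⟨by simpa using hfin⟩
  obtain ⟨K, hK⟩ := fderiv_bound hq hcs
  have hintg := test_integrable (sq_enorm_integrable hfin hv hact2) hq K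
      (Filter.Eventually.of_forall hK)
  rw [← hN] at hintg ⊢
  have hint0 := hintg
  rw [integrable_map_measure hintg.1 hΦ.aemeasurable] at hintg
  rw [integral_map hΦ.aemeasurable hint0.1]
  have hae : (fun p : ℝ × X => fderiv ℝ q (Φ p) (v (Φ p), 1)) =ᵐ[I.prod m]
      fun p => fderiv ℝ q (g p, p.1) (g' p, 1) := by
    filter_upwards [hvae, hDae] with p hp hpD
    rw [hp]
    simp only [Φ, γ]
    rw [hcI p.1 ⟨hpD.1.1.le, hpD.1.2.le⟩]
  rw [integral_congr_ae hae]
  have hint2 := hintg.congr hae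
  rw [integral_prod_symm _ hint2]
  have hqc := hq.continuous
  have hqb : ∃ C, ∀ z, ‖q z‖ ≤ C := hcs.exists_bound_of_continuous hqc
  obtain ⟨C, hC⟩ := hqb
  have hftc : ∀ x, (∫ t, fderiv ℝ q (g (t, x), t) (g' (t, x), 1) ∂I) =
      q (g (1, x), 1) - q (g (0, x), 0) := by
    intro x
    have hgct : ContinuousOn (fun t => g (t, x)) (Icc (0:ℝ) 1) := fun t ht =>
      (hgd x t ht).continuousAt.continuousWithinAt
    have hcont : ContinuousOn (fun t : ℝ =>
        fderiv ℝ q (g (t, x), t) (g' (t, x), 1)) (Icc (0:ℝ) 1) := by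
      have h5 := hq.continuous_fderiv (by simp)
      exact (h5.comp_continuousOn (hgct.prodMk continuousOn_id)).clm_apply
        ((hgc x).prodMk continuousOn_const)
    simp only [I]
    rw [integral_Icc_eq_integral_Ioc, ← intervalIntegral.integral_of_le zero_le_one]
    have hder : ∀ t ∈ uIcc (0:ℝ) 1, HasDerivAt (fun t : ℝ => q (g (t, x), t))
        (fderiv ℝ q (g (t, x), t) (g' (t, x), 1)) t := by
      intro t ht
      rw [uIcc_of_le zero_le_one] at ht
      have h1 : HasDerivAt (fun t : ℝ => ((g (t, x), t) : Eu d × ℝ))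
          (g' (t, x), 1) t := (hgd x t ht).prodMk (hasDerivAt_id t)
      exact ((hq.differentiable (by simp)) _).hasFDerivAt.comp_hasDerivAt t h1
    rw [intervalIntegral.integral_eq_sub_of_hasDerivAt hder
      (ContinuousOn.intervalIntegrable (by rwa [uIcc_of_le zero_le_one]))]
  have : (∫ x, ∫ t, fderiv ℝ q (g (t, x), t) (g' (t, x), 1) ∂I ∂m) =
      ∫ x, (q (g (1, x), 1) - q (g (0, x), 0)) ∂m := by
    congr 1; ext x; exact hftc x
  rw [this, integral_sub]
  · congr 1
    · rw [← hmB, integral_map (by fun_prop) (by fun_prop)]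
    · rw [← hmA, integral_map (by fun_prop) (by fun_prop)]
  · exact Integrable.of_bound (by
      have : Measurable (fun x => q (g (1, x), 1)) := by fun_prop
      exact this.aestronglyMeasurable) C (Filter.Eventually.of_forall fun x => hC _)
  · exact Integrable.of_bound (by
      have : Measurable (fun x => q (g (0, x), 0)) := by fun_prop
      exact this.aestronglyMeasurable) C (Filter.Eventually.of_forall fun x => hC _)

open Set MeasureTheory ProbabilityTheory
open scoped ENNReal RealInnerProductSpace

lemma map_equiv_restrict {α β : Type*} [MeasurableSpace α] [MeasurableSpace β] {μ : Measure α}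
    {ν : Measure β} (e : α ≃ᵐ β) (he : MeasurePreserving e μ ν) (A : Set α) :
    (μ.restrict A).map e = ν.restrict (e '' A) := by
  have := he.restrict_image_emb e.measurableEmbedding A
  exact this.map_eq

/-- fibrewise monotone rearrangement -/
lemma move_abs {d : ℕ} {Y : Type*} [MeasurableSpace Y] [StandardBorelSpace Y] (μ : Measure Y)
    [SFinite μ] (e : Y × ℝ ≃ᵐ Eu d) (he : MeasurePreserving e (μ.prod volume) volume)
    (hlin : ∀ y r s (t : ℝ), (1 - t) • e (y, r) + t • e (y, s) = e (y, (1 - t) * r + t * s))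
    (hnorm : ∀ y r s, ‖e (y, s) - e (y, r)‖ₑ = ‖s - r‖ₑ) {R : ℝ} (E F : Set (Y × ℝ))
    (hEm : MeasurableSet E) (hFm : MeasurableSet F)
    (hE : ∀ y, Prod.mk y ⁻¹' E ⊆ Icc (-R) R) (hF : ∀ y, Prod.mk y ⁻¹' F ⊆ Icc (-R) R)
    (hEF : ∀ y, volume.real (Prod.mk y ⁻¹' E) = volume.real (Prod.mk y ⁻¹' F))
    (hfin : (μ.prod volume) E < ⊤) (hfinF : (μ.prod volume) F < ⊤) :
    Conn (e '' E) (e '' F) (ENNReal.ofReal (4 * R ^ 2) * (μ.prod volume) (symmDiff E F)) := by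
  classical
  have hEy : ∀ y, MeasurableSet (Prod.mk y ⁻¹' E) := fun y => measurable_prodMk_left hEm
  have hFy : ∀ y, MeasurableSet (Prod.mk y ⁻¹' F) := fun y => measurable_prodMk_left hFm
  have hmm : Measurable (fun y => volume.real (Prod.mk y ⁻¹' E)) :=
    (measurable_measure_prodMk_left hEm).ennreal_toReal
  let L : Set (Y × ℝ) := {p | p.2 ∈ Ioo 0 (volume.real (Prod.mk p.1 ⁻¹' E))}
  have hL : MeasurableSet L := by
    have h1 : MeasurableSet {p : Y × ℝ | 0 < p.2} := measurableSet_lt (by fun_prop) (by fun_prop)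
    have h2 : MeasurableSet {p : Y × ℝ | p.2 < volume.real (Prod.mk p.1 ⁻¹' E)} :=
      measurableSet_lt (by fun_prop) (hmm.comp measurable_fst)
    exact h1.inter h2
  let f : Y → ℝ → ℝ≥0∞ := fun y u => L.indicator 1 (y, u)
  have hf : Measurable (Function.uncurry f) := by
    have : Function.uncurry f = L.indicator 1 := by ext ⟨y, u⟩; rfl
    rw [this]; exact measurable_one.indicator hL
  let K : Kernel Y ℝ := Kernel.const Y (volume.restrict (Ioo 0 (2 * R)))
  have : IsFiniteMeasure (volume.restrict (Ioo 0 (2 * R))) := ⟨by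
    rw [Measure.restrict_apply_univ]; exact measure_Ioo_lt_top⟩
  let M : Kernel Y ℝ := K.withDensity f
  have hMf : IsFiniteKernel M := Kernel.isFiniteKernel_withDensity_of_bounded K
    (B := 1) (by simp) (fun a b => by
      simp only [f]; exact indicator_le_self' (by simp) _)
  have hle : ∀ y, volume.real (Prod.mk y ⁻¹' E) ≤ max (2 * R) 0 := by
    intro y
    have h1 : volume.real (Prod.mk y ⁻¹' E) ≤ volume.real (Icc (-R) R) :=
      measureReal_mono (hE y) (by simp)
    refine h1.trans ?_
    rw [Real.volume_real_Icc]; exact max_le_max (by linarith) le_rfl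
  have hM : ∀ y, M y = volume.restrict (Ioo 0 (volume.real (Prod.mk y ⁻¹' E))) := by
    intro y
    simp only [M]
    rw [Kernel.withDensity_apply _ hf]
    have e1 : f y = (Ioo 0 (volume.real (Prod.mk y ⁻¹' E))).indicator 1 := by
      ext u; simp only [f, indicator, L]; rfl
    rw [e1, withDensity_indicator_one measurableSet_Ioo]
    simp only [K, Kernel.const_apply]
    rw [Measure.restrict_restrict measurableSet_Ioo]
    congr 1
    refine inter_eq_left.2 fun u hu => ⟨hu.1, ?_⟩
    have := hu.2.trans_le (hle y)
    rcases lt_max_iff.1 this with h | h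
    · exact h
    · exact absurd hu.1 (by linarith)
  have hcomp : ∀ (G : Set (Y × ℝ)), MeasurableSet G → (∀ y, Prod.mk y ⁻¹' G ⊆ Icc (-R) R) →
      (∀ y, volume.real (Prod.mk y ⁻¹' E) = volume.real (Prod.mk y ⁻¹' G)) →
      (μ ⊗ₘ M).map (fun p => (p.1, Xq (Prod.mk p.1 ⁻¹' G) p.2)) = (μ.prod volume).restrict G := by
    intro G hGm hG hEG
    have hXm := Xq_meas hGm hG
    ext s hs
    rw [Measure.map_apply (by fun_prop) hs, Measure.compProd_apply (by
      exact (measurable_fst.prodMk hXm) hs), Measure.restrict_apply hs,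
      Measure.prod_apply (hs.inter hGm)]
    refine lintegral_congr fun y => ?_
    have h3 := Xq_map (measurable_prodMk_left hGm : MeasurableSet (Prod.mk y ⁻¹' G)) (hG y)
    have h4 : volume (Prod.mk y ⁻¹' (s ∩ G)) = (volume.restrict (Prod.mk y ⁻¹' G)) (Prod.mk y ⁻¹' s) := by
      rw [Measure.restrict_apply (measurable_prodMk_left hs)]; rfl
    rw [h4, ← h3, Measure.map_apply (Xq_meas1 (measurable_prodMk_left hGm) (hG y))
      (measurable_prodMk_left hs), hM, hEG]
    rfl
  have hXE := Xq_meas hEm hE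
  have hXF := Xq_meas hFm hF
  let a : Y × ℝ → Eu d := fun p => e (p.1, Xq (Prod.mk p.1 ⁻¹' E) p.2)
  let b : Y × ℝ → Eu d := fun p => e (p.1, Xq (Prod.mk p.1 ⁻¹' F) p.2)
  have ha : Measurable a := e.measurable.comp (measurable_fst.prodMk hXE)
  have hb : Measurable b := e.measurable.comp (measurable_fst.prodMk hXF)
  have hma : (μ ⊗ₘ M).map a = volume.restrict (e '' E) := by
    rw [← map_equiv_restrict e he, ← hcomp E hEm hE (fun _ => rfl), Measure.map_map e.measurable
      (measurable_fst.prodMk hXE)]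
    rfl
  have hmb : (μ ⊗ₘ M).map b = volume.restrict (e '' F) := by
    rw [← map_equiv_restrict e he, ← hcomp F hFm hF hEF, Measure.map_map e.measurable
      (measurable_fst.prodMk hXF)]
    rfl
  have hvE : volume (e '' E) = (μ.prod volume) E := by
    rw [← he.measure_preimage_equiv (e '' E), e.injective.preimage_image]
  have hfm : IsFiniteMeasure (μ ⊗ₘ M) := ⟨by
    rw [← preimage_univ (f := a), ← Measure.map_apply ha MeasurableSet.univ, hma]
    simp only [Measure.restrict_apply_univ, hvE]
    exact hfin⟩
  have hcost : (∫⁻ p, ‖b p - a p‖ₑ ^ 2 ∂(μ ⊗ₘ M)) ≤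
      ENNReal.ofReal (4 * R ^ 2) * (μ.prod volume) (symmDiff E F) := by
    rw [Measure.lintegral_compProd (by fun_prop), Measure.prod_apply (hEm.symmDiff hFm),
      ← lintegral_const_mul _ (measurable_measure_prodMk_left (hEm.symmDiff hFm))]
    refine lintegral_mono fun y => ?_
    simp only [a, b, hnorm, hM]
    exact Xq_cost (hEy y) (hE y) (hFy y) (hF y) (hEF y)
  have hsd : (μ.prod volume) (symmDiff E F) < ⊤ :=
    (measure_mono (symmDiff_subset_union)).trans_lt (measure_union_lt_top hfin hfinF)
  refine Conn.mono (lagr (μ ⊗ₘ M) a b ha hb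
    (hcost.trans_lt (ENNReal.mul_lt_top ENNReal.ofReal_lt_top hsd)) L hL ?_ ?_ ?_
    (e.measurableEmbedding.measurableSet_image.2 hEm) (e.measurableEmbedding.measurableSet_image.2 hFm)
    hma hmb) hcost
  · rw [Measure.compProd_apply hL.compl]
    refine (lintegral_congr fun y => ?_).trans lintegral_zero
    rw [hM, Measure.restrict_apply (measurable_prodMk_left hL.compl)]
    convert measure_empty (μ := volume)
    ext u; simp [L]
  · intro t ht p hp p' hp' h
    simp only [a, b, hlin] at h
    have h5 := e.injective h
    simp only [Prod.mk.injEq] at h5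
    obtain ⟨y, u⟩ := p
    obtain ⟨y', u'⟩ := p'
    obtain ⟨h6, h7⟩ := h5
    simp only at h6 h7
    subst h6
    have := (Xq_interp (hEy y) (hE y) (hFy y) (hF y) (hEF y) ⟨ht.1.le, ht.2.le⟩).1 hp hp' h7
    exact Prod.ext rfl this
  · intro t ht
    obtain ⟨A, hA, hmap⟩ := fam_char volume μ M
      (fun p => (1 - t) * Xq (Prod.mk p.1 ⁻¹' E) p.2 + t * Xq (Prod.mk p.1 ⁻¹' F) p.2)
      (by fun_prop) (fun y => by
        rw [hM]
        exact (Xq_interp (hEy y) (hE y) (hFy y) (hF y) (hEF y) ⟨ht.1.le, ht.2.le⟩).2)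
    refine ⟨e '' A, e.measurableEmbedding.measurableSet_image.2 hA, ?_⟩
    rw [← map_equiv_restrict e he, ← hmap, Measure.map_map e.measurable (by fun_prop)]
    congr 1
    ext1 p
    simp only [a, b, hlin]
    rfl

/-- coordinates singling out direction `i` -/
noncomputable def cEq {n : ℕ} (i : Fin (n + 1)) : (Fin n → ℝ) × ℝ ≃ᵐ Eu (n + 1) :=
  (MeasurableEquiv.prodComm.trans (MeasurableEquiv.piFinSuccAbove (fun _ => ℝ) i).symm).trans
    (MeasurableEquiv.toLp 2 (Fin (n + 1) → ℝ))

lemma cEq_mp {n : ℕ} (i : Fin (n + 1)) : MeasurePreserving (cEq i)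
    ((volume : Measure (Fin n → ℝ)).prod volume) volume := by
  have h1 := (EuclideanSpace.volume_preserving_symm_measurableEquiv_toLp (Fin (n + 1))).symm
  have h2 := (volume_preserving_piFinSuccAbove (fun _ : Fin (n + 1) => ℝ) i).symm
  have h3 : MeasurePreserving Prod.swap ((volume : Measure (Fin n → ℝ)).prod (volume : Measure ℝ))
    ((volume : Measure ℝ).prod (volume : Measure (Fin n → ℝ))) := Measure.measurePreserving_swap
  exact h1.comp (h2.comp h3)

lemma cEq_apply {n : ℕ} (i : Fin (n + 1)) (y : Fin n → ℝ) (r : ℝ) (j : Fin (n + 1)) :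
    cEq i (y, r) j = (i.insertNth r y : Fin (n + 1) → ℝ) j := rfl

lemma cEq_self {n : ℕ} (i : Fin (n + 1)) (y : Fin n → ℝ) (r : ℝ) : cEq i (y, r) i = r := by
  rw [cEq_apply, Fin.insertNth_apply_same]

lemma cEq_above {n : ℕ} (i : Fin (n + 1)) (y : Fin n → ℝ) (r : ℝ) (j : Fin n) :
    cEq i (y, r) (i.succAbove j) = y j := by
  rw [cEq_apply, Fin.insertNth_apply_succAbove]

lemma cEq_ne {n : ℕ} (i : Fin (n + 1)) (y : Fin n → ℝ) (r s : ℝ) {j : Fin (n + 1)} (h : j ≠ i) :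
    cEq i (y, r) j = cEq i (y, s) j := by
  obtain ⟨k, rfl⟩ := Fin.exists_succAbove_eq h
  rw [cEq_above, cEq_above]

lemma cEq_surj {n : ℕ} (i : Fin (n + 1)) (x : Eu (n + 1)) : ∃ y, x = cEq i (y, x i) := by
  obtain ⟨⟨y, r⟩, rfl⟩ := (cEq i).surjective x
  exact ⟨y, by rw [cEq_self]⟩

/-- one dimensional move -/
lemma move1 {n : ℕ} (i : Fin (n + 1)) {R : ℝ} (E F : Set (Eu (n + 1)))
    (hEm : MeasurableSet E) (hFm : MeasurableSet F)
    (hE : ∀ x ∈ E, x i ∈ Icc (-R) R) (hF : ∀ x ∈ F, x i ∈ Icc (-R) R)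
    (hEF : ∀ y, volume.real {r | cEq i (y, r) ∈ E} = volume.real {r | cEq i (y, r) ∈ F})
    (hfin : volume E < ⊤) (hfinF : volume F < ⊤) :
    Conn E F (ENNReal.ofReal (4 * R ^ 2) * volume (symmDiff E F)) := by
  have h := move_abs (volume : Measure (Fin n → ℝ)) (cEq i) (cEq_mp i) ?_ ?_ (R := R)
    (cEq i ⁻¹' E) (cEq i ⁻¹' F) ((cEq i).measurable hEm) ((cEq i).measurable hFm)
    ?_ ?_ hEF ?_ ?_
  · rw [← preimage_symmDiff, (cEq_mp i).measure_preimage_equiv,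
      image_preimage_eq _ (cEq i).surjective, image_preimage_eq _ (cEq i).surjective] at h
    exact h
  · intro y r s t
    ext j
    by_cases hj : j = i
    · subst hj; simp [cEq_self]
    · have h1 := cEq_ne i y r ((1 - t) * r + t * s) hj
      have h2 := cEq_ne i y s ((1 - t) * r + t * s) hj
      simp only [PiLp.add_apply, PiLp.smul_apply, smul_eq_mul, h1, h2]
      ring
  · intro y r s
    have : cEq i (y, s) - cEq i (y, r) = EuclideanSpace.single i (s - r) := by
      ext j
      by_cases hj : j = i
      · subst hj; simp [cEq_self]
      · simp [hj, cEq_ne i y s r hj]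
    rw [this, ← ofReal_norm, EuclideanSpace.norm_single, ofReal_norm]
  · intro y r hr; have := hE _ hr; rwa [cEq_self] at this
  · intro y r hr; have := hF _ hr; rwa [cEq_self] at this
  · rw [(cEq_mp i).measure_preimage_equiv]; exact hfin
  · rw [(cEq_mp i).measure_preimage_equiv]; exact hfinF

open Set MeasureTheory ProbabilityTheory
open scoped ENNReal RealInnerProductSpace

/-- reduction to the torus `[-L,L)` -/
noncomputable def tor (L s : ℝ) : ℝ := -L + Int.fract ((s + L) / (2 * L)) * (2 * L)

lemma tor_meas (L : ℝ) : Measurable (tor L) := by unfold tor; fun_prop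

lemma tor_mem {L : ℝ} (hL : 0 < L) (s : ℝ) : tor L s ∈ Ico (-L) L := by
  have h1 := Int.fract_nonneg ((s + L) / (2 * L))
  have h2 := Int.fract_lt_one ((s + L) / (2 * L))
  unfold tor
  constructor
  · nlinarith
  · nlinarith

lemma tor_eq {L : ℝ} (hL : 0 < L) {s : ℝ} (hs : s ∈ Ico (-L) L) : tor L s = s := by
  have : Int.fract ((s + L) / (2 * L)) = (s + L) / (2 * L) := by
    rw [Int.fract_eq_self]
    constructor
    · exact div_nonneg (by linarith [hs.1]) (by linarith)
    · rw [div_lt_one (by linarith)]; linarith [hs.2]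
  unfold tor; rw [this]; field_simp; ring

lemma tor_per {L : ℝ} (hL : 0 < L) : Function.Periodic (tor L) (2 * L) := by
  intro s
  unfold tor
  have : (s + 2 * L + L) / (2 * L) = (s + L) / (2 * L) + 1 := by field_simp; ring
  rw [this, Int.fract_add_one]

lemma tor_mp {L : ℝ} (hL : 0 < L) (s : ℝ) : MeasurePreserving (fun r => tor L (r + s))
    (volume.restrict (Ico (-L) L)) (volume.restrict (Ico (-L) L)) := by
  have hm : Measurable (fun r => tor L (r + s)) := (tor_meas L).comp (by fun_prop)
  refine ⟨hm, ?_⟩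
  have hfin : IsFiniteMeasure (volume.restrict (Ico (-L) L)) := ⟨by
    rw [Measure.restrict_apply_univ]; exact measure_Ico_lt_top⟩
  ext G hG
  rw [← measureReal_eq_measureReal_iff]
  let f : ℝ → ℝ := (tor L ⁻¹' G).indicator 1
  have hGm : MeasurableSet (tor L ⁻¹' G) := tor_meas L hG
  have hper : Function.Periodic f (2 * L) := by
    intro r
    have e : (r + 2 * L ∈ tor L ⁻¹' G) ↔ r ∈ tor L ⁻¹' G := by
      rw [mem_preimage, mem_preimage, tor_per hL r]
    by_cases h : r ∈ tor L ⁻¹' G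
    · simp only [f]; rw [indicator_of_mem h, indicator_of_mem (e.2 h)]; rfl
    · simp only [f]; rw [indicator_of_notMem h, indicator_of_notMem (fun h' => h (e.1 h'))]
  have h1 := hper.intervalIntegral_add_eq (-L + s) (-L)
  have h2 : ∫ x in (-L + s)..(-L + s + 2 * L), f x = ∫ x in (-L)..(L), f (x + s) := by
    rw [intervalIntegral.integral_comp_add_right]; congr 1; ring
  have e3 : -L + 2 * L = L := by ring
  rw [h2, e3, intervalIntegral.integral_of_le (by linarith), intervalIntegral.integral_of_le
    (by linarith), ← integral_Ico_eq_integral_Ioc, ← integral_Ico_eq_integral_Ioc] at h1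
  have h4 : ∀ H : Set ℝ, MeasurableSet H → ∫ x in Ico (-L) L, H.indicator (1 : ℝ → ℝ) x =
      (volume.restrict (Ico (-L) L)).real H := by
    intro H hH; rw [integral_indicator_one hH]
  have h5 : (fun x => f (x + s)) = ((fun r => tor L (r + s)) ⁻¹' G).indicator (1 : ℝ → ℝ) := by
    rfl
  rw [h5, h4 _ (hm hG), h4 _ hGm] at h1
  rw [map_measureReal_apply hm hG, h1]
  refine measureReal_congr ?_
  filter_upwards [ae_restrict_mem measurableSet_Ico] with r hr
  have := tor_eq hL hr
  refine propext ?_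
  change tor L r ∈ G ↔ r ∈ G
  rw [this]

/-- representation of laws on an interval -/
lemma exists_law {Y : Type*} [MeasurableSpace Y] [StandardBorelSpace Y] [Nonempty Y] (ν : Measure Y)
    [IsProbabilityMeasure ν] {L : ℝ} (hL : 0 < L) :
    ∃ g : ℝ → Y, Measurable g ∧
      (volume.restrict (Ico L (3 * L))).map g = ENNReal.ofReal (2 * L) • ν := by
  obtain ⟨f, hf, hfm⟩ := Measure.exists_measurable_map_eq ν
  let h : ℝ → ℝ := fun r => (2 * L)⁻¹ * (r + (-L))
  let p : ℝ → unitInterval := fun r => projIcc 0 1 zero_le_one (h r)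
  have hp : Measurable p := by
    have : Continuous p := continuous_projIcc.comp (by fun_prop)
    exact this.measurable
  refine ⟨f ∘ p, hf.comp hp, ?_⟩
  have key : (volume.restrict (Ico L (3 * L))).map p =
      ENNReal.ofReal (2 * L) • (volume : Measure unitInterval) := by
    ext s hs
    rw [Measure.map_apply hp hs, Measure.smul_apply, unitInterval.volume_apply]
    have h1 : volume (h ⁻¹' (Subtype.val '' s)) = ENNReal.ofReal (2 * L) * volume (Subtype.val '' s) := by
      have : h ⁻¹' (Subtype.val '' s) = (fun r => r + (-L)) ⁻¹' ((fun x => (2 * L)⁻¹ * x) ⁻¹'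
        (Subtype.val '' s)) := rfl
      rw [this, measure_preimage_add_right, Real.volume_preimage_mul_left (by positivity), inv_inv,
        abs_of_pos (by linarith)]
    rw [smul_eq_mul, ← h1, Measure.restrict_apply (hp hs)]
    have hne : ∀ᵐ r : ℝ, r ≠ 3 * L := by
      rw [ae_iff]; simp
    refine measure_congr ?_
    filter_upwards [hne] with r hr
    refine propext ?_
    change (p r ∈ s ∧ r ∈ Ico L (3 * L)) ↔ (h r) ∈ Subtype.val '' s
    constructor
    · rintro ⟨h2, h3⟩
      refine ⟨p r, h2, ?_⟩
      simp only [p]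
      have : h r ∈ Icc (0:ℝ) 1 := by
        simp only [h]
        constructor
        · exact mul_nonneg (by positivity) (by linarith [h3.1])
        · rw [inv_mul_le_iff₀ (by linarith)]; linarith [h3.2]
      rw [projIcc_of_mem _ this]
    · rintro ⟨u, hu, hur⟩
      have e : p r = u := by
        simp only [p]; rw [← hur]; exact projIcc_val _ u
      refine ⟨by rw [e]; exact hu, ?_⟩
      have h2 := u.2
      have e2 : r = L + 2 * L * u := by rw [hur]; simp only [h]; field_simp; ring
      constructor
      · rw [e2]; nlinarith [h2.1]
      · refine lt_of_le_of_ne ?_ hr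
        rw [e2]; nlinarith [h2.2]
  rw [← Measure.map_map hf hp, key, Measure.map_smul, hfm]

open Set MeasureTheory ProbabilityTheory
open scoped ENNReal RealInnerProductSpace

lemma fiber_vol {n : ℕ} (i : Fin (n + 1)) {S : Set (Eu (n + 1))} (hS : MeasurableSet S) :
    volume S = ∫⁻ y, volume {r | cEq i (y, r) ∈ S} := by
  rw [← (cEq_mp i).measure_preimage_equiv, Measure.prod_apply ((cEq i).measurable hS)]
  rfl

lemma fiber_meas {n : ℕ} (i : Fin (n + 1)) {S : Set (Eu (n + 1))} (hS : MeasurableSet S) (y) :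
    MeasurableSet {r | cEq i (y, r) ∈ S} :=
  ((cEq i).measurable.comp measurable_prodMk_left) hS

/-- moving a small set in the presence of a static one -/
lemma step1 {n : ℕ} (i : Fin (n + 1)) {R : ℝ} (C S S' : Set (Eu (n + 1)))
    (hCm : MeasurableSet C) (hSm : MeasurableSet S) (hSm' : MeasurableSet S')
    (hC : ∀ x ∈ C, x i ∈ Icc (-R) R) (hS : ∀ x ∈ S, x i ∈ Icc (-R) R)
    (hS' : ∀ x ∈ S', x i ∈ Icc (-R) R) (hd : Disjoint C S) (hd' : Disjoint C S')
    (hf : ∀ y, volume {r | cEq i (y, r) ∈ S} = volume {r | cEq i (y, r) ∈ S'})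
    (hCf : volume C < ⊤) (hSf : volume S < ⊤) {l : ℝ} (hl : 0 < l)
    (hle : ENNReal.ofReal (4 * R ^ 2) * (2 * volume S) ≤ ENNReal.ofReal (l ^ 2)) :
    volume S' = volume S ∧ Len (C ∪ S) (C ∪ S') l := by
  have hv : volume S' = volume S := by
    rw [fiber_vol i hSm, fiber_vol i hSm']
    exact lintegral_congr fun y => (hf y).symm
  refine ⟨hv, hl, ?_⟩
  refine Conn.mono (move1 (R := R) i (C ∪ S) (C ∪ S') (hCm.union hSm) (hCm.union hSm') ?_ ?_ ?_
    (measure_union_lt_top hCf hSf) (measure_union_lt_top hCf (hv ▸ hSf))) (le_trans ?_ hle)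
  · rintro x (h | h); exacts [hC x h, hS x h]
  · rintro x (h | h); exacts [hC x h, hS' x h]
  · intro y
    have h1 : ∀ T : Set (Eu (n + 1)), MeasurableSet T → Disjoint C T →
        volume {r | cEq i (y, r) ∈ C ∪ T} = volume {r | cEq i (y, r) ∈ C} +
          volume {r | cEq i (y, r) ∈ T} := by
      intro T hT hdT
      rw [← measure_union _ (fiber_meas i hT y)]
      · rfl
      · rw [Set.disjoint_left]; intro r h2 h3
        exact Set.disjoint_left.1 hdT h2 h3
    simp only [measureReal_def, h1 S hSm hd, h1 S' hSm' hd', hf]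
  · gcongr
    calc volume (symmDiff (C ∪ S) (C ∪ S')) ≤ volume (S ∪ S') := by
          refine measure_mono ?_
          rintro x (⟨h1 | h1, h2⟩ | ⟨h1 | h1, h2⟩)
          · exact absurd (Or.inl h1) h2
          · exact Or.inl h1
          · exact absurd (Or.inl h1) h2
          · exact Or.inr h1
      _ ≤ volume S + volume S' := measure_union_le _ _
      _ = 2 * volume S := by rw [hv, two_mul]

/-- intermediate sets in the parking cell -/
def Sk (n : ℕ) (L : ℝ) (g : ℝ → (Fin n → ℝ) × ℝ) (B : Set (Eu (n + 1))) (k : ℕ) :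
    Set (Eu (n + 1)) :=
  {x | x 0 ∈ Ico L (3 * L) ∧ (∀ i : Fin n, x i.succ ∈ Ico (-L) L) ∧
    cEq 0 (fun i : Fin n => if (i : ℕ) < k then tor L (x i.succ + (g (x 0)).1 i) else x i.succ,
      (g (x 0)).2) ∈ B}

lemma coord_meas {n : ℕ} (j : Fin n) : Measurable (fun x : Eu n => x j) := by fun_prop

lemma Sk_meas {n : ℕ} {L : ℝ} {g : ℝ → (Fin n → ℝ) × ℝ} (hg : Measurable g)
    {B : Set (Eu (n + 1))} (hB : MeasurableSet B) (k : ℕ) : MeasurableSet (Sk n L g B k) := by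
  refine MeasurableSet.inter ((coord_meas 0) measurableSet_Ico) (MeasurableSet.inter ?_ ?_)
  · have : MeasurableSet (⋂ i : Fin n, {x : Eu (n + 1) | x i.succ ∈ Ico (-L) L}) :=
      MeasurableSet.iInter fun i => (coord_meas i.succ) measurableSet_Ico
    have e : {x : Eu (n + 1) | ∀ i : Fin n, x i.succ ∈ Ico (-L) L} =
        ⋂ i : Fin n, {x : Eu (n + 1) | x i.succ ∈ Ico (-L) L} := by ext x; simp
    rw [← e] at this
    exact this
  · refine ((cEq 0).measurable.comp ?_) hB
    refine Measurable.prodMk (measurable_pi_lambda _ fun i => ?_) ?_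
    · by_cases h : (i : ℕ) < k
      · simp only [h, if_true]
        refine (tor_meas L).comp ((coord_meas _).add ?_)
        exact (measurable_pi_apply i).comp (measurable_fst.comp (hg.comp (coord_meas 0)))
      · simp only [h, if_false]; exact coord_meas _
    · exact measurable_snd.comp (hg.comp (coord_meas 0))

lemma cEq0_zero {n : ℕ} (y : Fin n → ℝ) (r : ℝ) : cEq (0 : Fin (n + 1)) (y, r) 0 = r := cEq_self 0 y r
lemma cEq0_succ {n : ℕ} (y : Fin n → ℝ) (r : ℝ) (i : Fin n) :
    cEq (0 : Fin (n + 1)) (y, r) i.succ = y i := by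
  have := cEq_above (0 : Fin (n + 1)) y r i
  rwa [Fin.succAbove_zero] at this

/-- normalised measure on `[-L,L)` -/
noncomputable def p1 (L : ℝ) : Measure ℝ := (ENNReal.ofReal (2 * L))⁻¹ • volume.restrict (Ico (-L) L)

lemma p1_prob {L : ℝ} (hL : 0 < L) : IsProbabilityMeasure (p1 L) := ⟨by
  simp only [p1, Measure.smul_apply, Measure.restrict_apply_univ, Real.volume_Ico, smul_eq_mul]
  rw [show L - -L = 2 * L by ring]
  exact ENNReal.inv_mul_cancel (by simp [hL]) ENNReal.ofReal_ne_top⟩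

lemma p1_smul {L : ℝ} (hL : 0 < L) : ENNReal.ofReal (2 * L) • p1 L = volume.restrict (Ico (-L) L) := by
  rw [p1, smul_smul, ENNReal.mul_inv_cancel (by simp [hL]) ENNReal.ofReal_ne_top, one_smul]

lemma exists_g (n : ℕ) {L : ℝ} (hL : 0 < L) : ∃ g : ℝ → (Fin n → ℝ) × ℝ, Measurable g ∧
    (volume.restrict (Ico L (3 * L))).map g =
      ENNReal.ofReal (2 * L) • ((Measure.pi fun _ : Fin n => p1 L).prod (p1 L)) := by
  have := p1_prob hL
  exact exists_law _ hL

lemma Sk_fib0 {n : ℕ} {L : ℝ} (hL : 0 < L) {g : ℝ → (Fin n → ℝ) × ℝ} (hg : Measurable g)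
    (hgl : (volume.restrict (Ico L (3 * L))).map g =
      ENNReal.ofReal (2 * L) • ((Measure.pi fun _ : Fin n => p1 L).prod (p1 L)))
    {B : Set (Eu (n + 1))} (hB : MeasurableSet B) (hBc : ∀ x ∈ B, ∀ j, x j ∈ Ico (-L) L) (y) :
    volume {r | cEq 0 (y, r) ∈ B} = volume {r | cEq 0 (y, r) ∈ Sk n L g B 0} := by
  have := p1_prob hL
  simp only [Sk, mem_ofPred_eq, cEq0_zero, cEq0_succ, Nat.not_lt_zero, if_false]
  by_cases hy : ∀ i, y i ∈ Ico (-L) L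
  · have h1 : (volume.restrict (Ico L (3 * L))).map (fun r => (g r).2) =
        volume.restrict (Ico (-L) L) := by
      rw [← p1_smul hL]
      have : (fun r => (g r).2) = Prod.snd ∘ g := rfl
      rw [this, ← Measure.map_map measurable_snd hg, hgl, Measure.map_smul, Measure.map_snd_prod,
        measure_univ, one_smul]
    have hm := fiber_meas 0 hB y
    have h2 : {r | cEq 0 (y, r) ∈ B} = {r | cEq 0 (y, r) ∈ B} ∩ Ico (-L) L := by
      refine (inter_eq_left.2 fun r hr => ?_).symm
      have := hBc _ hr 0
      rwa [cEq0_zero] at this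
    have hm2 : MeasurableSet ((fun r => (g r).2) ⁻¹' {r | cEq 0 (y, r) ∈ B}) :=
      (measurable_snd.comp hg) hm
    rw [h2, ← Measure.restrict_apply hm, ← h1, Measure.map_apply (by fun_prop) hm,
      Measure.restrict_apply hm2]
    congr 1
    ext r
    simp only [mem_inter_iff, mem_preimage, mem_ofPred_eq]
    tauto
  · have h1 : {r | cEq 0 (y, r) ∈ B} = ∅ := by
      rw [eq_empty_iff_forall_notMem]
      intro r hr
      refine hy fun i => ?_
      have := hBc _ hr i.succ
      rwa [cEq0_succ] at this
    have h2 : {r | r ∈ Ico L (3 * L) ∧ (∀ i : Fin n, y i ∈ Ico (-L) L) ∧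
        cEq 0 (fun i : Fin n => y i, (g r).2) ∈ B} = ∅ := by
      rw [eq_empty_iff_forall_notMem]
      intro r hr
      exact hy hr.2.1
    rw [h1]; exact (congrArg volume h2).symm

lemma Sk_fibk {n : ℕ} {L : ℝ} (hL : 0 < L) {g : ℝ → (Fin n → ℝ) × ℝ}
    {B : Set (Eu (n + 1))} (hB : MeasurableSet B) (k : Fin n) (y) :
    volume {r | cEq k.succ (y, r) ∈ Sk n L g B k} =
      volume {r | cEq k.succ (y, r) ∈ Sk n L g B (k + 1)} := by
  classical
  let x := cEq k.succ (y, 0)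
  have h0 : ∀ r, cEq k.succ (y, r) 0 = x 0 := fun r => cEq_ne _ _ _ _ (Fin.succ_ne_zero k).symm
  have hi : ∀ r (i : Fin n), i ≠ k → cEq k.succ (y, r) i.succ = x i.succ := fun r i hik =>
    cEq_ne _ _ _ _ (fun h => hik (Fin.succ_injective _ h))
  have hk : ∀ r, cEq k.succ (y, r) k.succ = r := fun r => cEq_self _ _ _
  by_cases hc : x 0 ∈ Ico L (3 * L) ∧ ∀ i : Fin n, i ≠ k → x i.succ ∈ Ico (-L) L
  · let w : ℝ → (Fin n → ℝ) := fun r i => if i = k then r else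
      if (i : ℕ) < k then tor L (x i.succ + (g (x 0)).1 i) else x i.succ
    let G : Set ℝ := {r | cEq 0 (w r, (g (x 0)).2) ∈ B}
    have hG : MeasurableSet G := by
      refine ((cEq 0).measurable.comp ?_) hB
      refine Measurable.prodMk (measurable_pi_lambda _ fun i => ?_) measurable_const
      by_cases h : i = k
      · simp only [w, h, if_true]; exact measurable_id
      · simp only [w, h, if_false]; exact measurable_const
    have hall : ∀ r, (∀ i : Fin n, cEq k.succ (y, r) i.succ ∈ Ico (-L) L) ↔ r ∈ Ico (-L) L := by
      intro r
      constructor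
      · intro h; have := h k; rwa [hk] at this
      · intro h i
        by_cases hik : i = k
        · subst hik; rwa [hk]
        · rw [hi r i hik]; exact hc.2 i hik
    have e1 : {r | cEq k.succ (y, r) ∈ Sk n L g B k} = G ∩ Ico (-L) L := by
      ext r
      simp only [Sk, mem_ofPred_eq, hall, h0, G, mem_inter_iff]
      have : (fun i : Fin n => if (i : ℕ) < k then tor L (cEq k.succ (y, r) i.succ + (g (x 0)).1 i)
          else cEq k.succ (y, r) i.succ) = w r := by
        ext i
        by_cases hik : i = k
        · subst hik; simp [w, hk]
        · simp only [w, hik, if_false, hi r i hik]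
      rw [this]
      have := hc.1
      tauto
    have e2 : {r | cEq k.succ (y, r) ∈ Sk n L g B (k + 1)} =
        (fun r => tor L (r + (g (x 0)).1 k)) ⁻¹' G ∩ Ico (-L) L := by
      ext r
      simp only [Sk, mem_ofPred_eq, hall, h0, G, mem_inter_iff, mem_preimage]
      have : (fun i : Fin n => if (i : ℕ) < k + 1 then
          tor L (cEq k.succ (y, r) i.succ + (g (x 0)).1 i)
          else cEq k.succ (y, r) i.succ) = w (tor L (r + (g (x 0)).1 k)) := by
        ext i
        by_cases hik : i = k
        · subst hik; simp [w, hk]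
        · have h3 : ((i : ℕ) < k + 1) ↔ (i : ℕ) < k := by
            have : (i : ℕ) ≠ k := fun h => hik (Fin.ext h)
            omega
          simp only [w, hik, if_false, hi r i hik, h3]
      rw [this]
      have := hc.1
      tauto
    have hmp := tor_mp hL ((g (x 0)).1 k)
    rw [e1, e2, ← Measure.restrict_apply hG, ← Measure.restrict_apply (hmp.measurable hG),
      hmp.measure_preimage hG.nullMeasurableSet]
  · have : ∀ m, {r | cEq k.succ (y, r) ∈ Sk n L g B m} = ∅ := by
      intro m
      rw [eq_empty_iff_forall_notMem]
      intro r hr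
      refine hc ⟨?_, fun i hik => ?_⟩
      · have := hr.1; rwa [h0] at this
      · have := hr.2.1 i; rwa [hi r i hik] at this
    rw [this, this]

lemma Sk_fibn {n : ℕ} {L : ℝ} (hL : 0 < L) {g : ℝ → (Fin n → ℝ) × ℝ} (hg : Measurable g)
    (hgl : (volume.restrict (Ico L (3 * L))).map g =
      ENNReal.ofReal (2 * L) • ((Measure.pi fun _ : Fin n => p1 L).prod (p1 L)))
    {B : Set (Eu (n + 1))} (hB : MeasurableSet B) (y : Fin n → ℝ) (hy : ∀ i, y i ∈ Ico (-L) L) :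
    volume {r | cEq 0 (y, r) ∈ Sk n L g B n} =
      ENNReal.ofReal (2 * L) * ((Measure.pi fun _ : Fin n => p1 L).prod (p1 L)) (cEq 0 ⁻¹' B) := by
  have := p1_prob hL
  simp only [Sk, mem_ofPred_eq, cEq0_zero, cEq0_succ, Fin.is_lt, if_true]
  let τ : (Fin n → ℝ) × ℝ → (Fin n → ℝ) × ℝ := Prod.map (fun b i => tor L (b i + y i)) id
  have hτ : MeasurePreserving τ ((Measure.pi fun _ : Fin n => p1 L).prod (p1 L))
      ((Measure.pi fun _ : Fin n => p1 L).prod (p1 L)) := by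
    refine MeasurePreserving.prod ?_ (MeasurePreserving.id _)
    exact measurePreserving_pi _ _ (f := fun i r => tor L (r + y i)) fun i =>
      (tor_mp hL (y i)).smul_measure _
  have hcB : MeasurableSet (cEq 0 ⁻¹' B) := (cEq 0).measurable hB
  have e : ∀ s, ENNReal.ofReal (2 * L) * ((Measure.pi fun _ : Fin n => p1 L).prod (p1 L)) s =
    (ENNReal.ofReal (2 * L) • ((Measure.pi fun _ : Fin n => p1 L).prod (p1 L))) s := fun s => rfl
  rw [← hτ.measure_preimage hcB.nullMeasurableSet, e, ← hgl,
    Measure.map_apply hg (hτ.measurable hcB), Measure.restrict_apply (hg (hτ.measurable hcB))]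
  congr 1
  ext r
  simp only [mem_ofPred_eq, mem_inter_iff, mem_preimage, τ, Prod.map, id]
  have : (fun i => tor L (y i + (g r).1 i)) = fun i => tor L ((g r).1 i + y i) := by
    ext i; rw [add_comm]
  rw [this]
  tauto

open Set MeasureTheory ProbabilityTheory
open scoped ENNReal RealInnerProductSpace

/-- the final parking slab -/
def KK (n : ℕ) (L h : ℝ) : Set (Eu (n + 1)) :=
  {x | x 0 ∈ Ico L (L + h) ∧ ∀ i : Fin n, x i.succ ∈ Ico (-L) L}

lemma KK_meas (n : ℕ) (L h : ℝ) : MeasurableSet (KK n L h) := by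
  refine MeasurableSet.inter ((coord_meas 0) measurableSet_Ico) ?_
  have : MeasurableSet (⋂ i : Fin n, {x : Eu (n + 1) | x i.succ ∈ Ico (-L) L}) :=
    MeasurableSet.iInter fun i => (coord_meas i.succ) measurableSet_Ico
  have e : {x : Eu (n + 1) | ∀ i : Fin n, x i.succ ∈ Ico (-L) L} =
      ⋂ i : Fin n, {x : Eu (n + 1) | x i.succ ∈ Ico (-L) L} := by ext x; simp
  rw [← e] at this
  exact this

lemma KK_fib (n : ℕ) (L h : ℝ) (y : Fin n → ℝ) : volume {r | cEq 0 (y, r) ∈ KK n L h} =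
    (pi univ fun _ : Fin n => Ico (-L) L).indicator (fun _ => ENNReal.ofReal h) y := by
  classical
  simp only [KK, mem_ofPred_eq, cEq0_zero, cEq0_succ]
  by_cases hy : ∀ i, y i ∈ Ico (-L) L
  · rw [indicator_of_mem (by simpa [mem_pi] using hy)]
    have : {r | r ∈ Ico L (L + h) ∧ ∀ i, y i ∈ Ico (-L) L} = Ico L (L + h) := by
      ext r; exact ⟨fun h => h.1, fun h => ⟨h, hy⟩⟩
    rw [this, Real.volume_Ico]; congr 1; ring
  · rw [indicator_of_notMem (by simpa [mem_pi] using hy)]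
    have : {r | r ∈ Ico L (L + h) ∧ ∀ i, y i ∈ Ico (-L) L} = ∅ := by
      rw [eq_empty_iff_forall_notMem]; intro r hr; exact hy hr.2
    rw [this, measure_empty]

lemma KK_vol (n : ℕ) (L h : ℝ) : volume (KK n L h) =
    ENNReal.ofReal h * volume (pi univ fun _ : Fin n => Ico (-L) L) := by
  rw [fiber_vol 0 (KK_meas n L h)]
  simp_rw [KK_fib]
  rw [lintegral_indicator_const (MeasurableSet.univ_pi fun i => measurableSet_Ico)]

lemma KK_inj {n : ℕ} {L h h' : ℝ} (hL : 0 < L) (hh : 0 ≤ h) (hh' : 0 ≤ h')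
    (e : volume (KK n L h) = volume (KK n L h')) : h = h' := by
  rw [KK_vol, KK_vol, Real.volume_pi_Ico] at e
  have h0 : (∏ i : Fin n, ENNReal.ofReal (L - -L)) ≠ 0 := by
    rw [Finset.prod_ne_zero_iff]; intro i _; simp; linarith
  have h1 : (∏ i : Fin n, ENNReal.ofReal (L - -L)) ≠ ⊤ := by
    refine ENNReal.prod_ne_top fun i _ => ENNReal.ofReal_ne_top
  rw [ENNReal.mul_left_inj h0 h1] at e
  rwa [ENNReal.ofReal_eq_ofReal_iff hh hh'] at e

lemma sym_half {n : ℕ} {L l : ℝ} (hL : 0 < L) (hl : 0 < l) {C B : Set (Eu (n + 1))}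
    (hC : MeasurableSet C) (hB : MeasurableSet B) (hCc : ∀ x ∈ C, ∀ j, x j ∈ Ico (-L) L)
    (hBc : ∀ x ∈ B, ∀ j, x j ∈ Ico (-L) L) (hd : Disjoint C B) (hCf : volume C < ⊤)
    (hBf : volume B < ⊤)
    (hle : ENNReal.ofReal (4 * (3 * L) ^ 2) * (2 * volume B) ≤ ENNReal.ofReal (l ^ 2)) :
    ∃ h, 0 ≤ h ∧ volume (KK n L h) = volume B ∧ Len (C ∪ B) (C ∪ KK n L h) ((n + 2) * l) := by
  obtain ⟨g, hg, hgl⟩ := exists_g n hL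
  have := p1_prob hL
  have hr1 : ∀ {r : ℝ}, r ∈ Ico (-L) L → r ∈ Icc (-(3 * L)) (3 * L) := fun {r} h =>
    ⟨by linarith [h.1], by linarith [h.2]⟩
  have hr2 : ∀ {r : ℝ}, r ∈ Ico L (3 * L) → r ∈ Icc (-(3 * L)) (3 * L) := fun {r} h =>
    ⟨by linarith [h.1], by linarith [h.2]⟩
  have hSi : ∀ k, ∀ x ∈ Sk n L g B k, ∀ j, x j ∈ Icc (-(3 * L)) (3 * L) := by
    intro k x hx j
    rcases Fin.eq_zero_or_eq_succ j with rfl | ⟨i, rfl⟩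
    · exact hr2 hx.1
    · exact hr1 (hx.2.1 i)
  have hdS : ∀ k, Disjoint C (Sk n L g B k) := by
    intro k
    rw [Set.disjoint_left]; intro x h1 h2
    have := hCc x h1 0; have := h2.1; have h3 := ‹x 0 ∈ Ico (-L) L›.2
    linarith [this.1]
  have main : ∀ k, k ≤ n → volume (Sk n L g B k) = volume B ∧
      Len (C ∪ B) (C ∪ Sk n L g B k) ((k + 1) * l) := by
    intro k
    induction k with
    | zero =>
      intro _
      have := step1 (R := 3 * L) 0 C B (Sk n L g B 0) hC hB (Sk_meas hg hB 0)
        (fun x hx => hr1 (hCc x hx _)) (fun x hx => hr1 (hBc x hx _)) (fun x hx => hSi 0 x hx _)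
        hd (hdS 0) (fun y => Sk_fib0 hL hg hgl hB hBc y) hCf hBf hl hle
      refine ⟨this.1, ?_⟩
      simpa using this.2
    | succ k ih =>
      intro hk
      obtain ⟨v, p⟩ := ih (by omega)
      have := step1 (R := 3 * L) (Fin.succ ⟨k, by omega⟩) C (Sk n L g B k) (Sk n L g B (k + 1)) hC
        (Sk_meas hg hB k) (Sk_meas hg hB (k + 1))
        (fun x hx => hr1 (hCc x hx _)) (fun x hx => hSi k x hx _)
        (fun x hx => hSi (k + 1) x hx _)
        (hdS k) (hdS _) (fun y => Sk_fibk hL hB ⟨k, by omega⟩ y) hCf (v ▸ hBf) hl (v ▸ hle)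
      refine ⟨this.1.trans v, ?_⟩
      have := p.trans this.2
      convert this using 1
      push_cast; ring
  obtain ⟨v, p⟩ := main n le_rfl
  set c := ENNReal.ofReal (2 * L) * ((Measure.pi fun _ : Fin n => p1 L).prod (p1 L)) (cEq 0 ⁻¹' B)
    with hc
  have hcle : c ≤ ENNReal.ofReal (2 * L) := by
    rw [hc]; exact (mul_le_mul_right prob_le_one _).trans (mul_one _).le
  have hct : c ≠ ⊤ := ne_top_of_le_ne_top ENNReal.ofReal_ne_top hcle
  have hc2 : c.toReal ≤ 2 * L := by
    have := ENNReal.toReal_mono ENNReal.ofReal_ne_top hcle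
    rwa [ENNReal.toReal_ofReal (by linarith)] at this
  have hfib : ∀ y, volume {r | cEq 0 (y, r) ∈ Sk n L g B n} =
      volume {r | cEq 0 (y, r) ∈ KK n L c.toReal} := by
    intro y
    rw [KK_fib]
    by_cases hy : ∀ i, y i ∈ Ico (-L) L
    · rw [indicator_of_mem (by simpa [mem_pi] using hy), ENNReal.ofReal_toReal hct,
        Sk_fibn hL hg hgl hB y hy]
    · rw [indicator_of_notMem (by simpa [mem_pi] using hy)]
      have : {r | cEq 0 (y, r) ∈ Sk n L g B n} = ∅ := by
        rw [eq_empty_iff_forall_notMem]; intro r hr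
        refine hy fun i => ?_
        have := hr.2.1 i; rwa [cEq0_succ] at this
      rw [this, measure_empty]
  have := step1 (R := 3 * L) 0 C (Sk n L g B n) (KK n L c.toReal) hC
    (Sk_meas hg hB n) (KK_meas _ _ _)
    (fun x hx => hr1 (hCc x hx _)) (fun x hx => hSi n x hx _)
    (fun x hx => hr2 ⟨hx.1.1, by linarith [hx.1.2]⟩)
    (hdS n) (by
      rw [Set.disjoint_left]; intro x h1 h2
      have := hCc x h1 0; have := h2.1; have h3 := ‹x 0 ∈ Ico (-L) L›.2
      linarith [this.1]) hfib hCf (v ▸ hBf) hl (v ▸ hle)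
  refine ⟨c.toReal, ENNReal.toReal_nonneg, this.1.trans v, ?_⟩
  have := p.trans this.2
  convert this using 1
  ring

/-- Sets with small symmetric difference are at small distance. -/
lemma sym_small (n : ℕ) {L ε : ℝ} (hL : 0 < L) (hε : 0 < ε) : ∃ δ : ℝ, 0 < δ ∧
    ∀ E F : Set (Eu (n + 1)), MeasurableSet E → MeasurableSet F →
    (∀ x ∈ E, ∀ j, x j ∈ Ico (-L) L) → (∀ x ∈ F, ∀ j, x j ∈ Ico (-L) L) →
    volume E < ⊤ → volume E = volume F → volume (E \ F) ≤ ENNReal.ofReal δ → Len E F ε := by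
  set l := ε / (2 * (n + 2)) with hl
  have hlp : 0 < l := by positivity
  refine ⟨l ^ 2 / (8 * (3 * L) ^ 2), by positivity, ?_⟩
  intro E F hE hF hEc hFc hEf hEF hd
  have hd' : volume (F \ E) = volume (E \ F) := by
    have h1 := measure_inter_add_sdiff E hF (μ := volume)
    have h2 := measure_inter_add_sdiff F hE (μ := volume)
    rw [inter_comm, ← hEF, ← h1] at h2
    exact (ENNReal.add_right_inj (ne_top_of_le_ne_top hEf.ne (measure_mono inter_subset_left))).1 h2
  have key : ∀ b : ℝ≥0∞, b ≤ ENNReal.ofReal (l ^ 2 / (8 * (3 * L) ^ 2)) →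
      ENNReal.ofReal (4 * (3 * L) ^ 2) * (2 * b) ≤ ENNReal.ofReal (l ^ 2) := by
    intro b hb
    calc _ ≤ ENNReal.ofReal (4 * (3 * L) ^ 2) * (2 * ENNReal.ofReal (l ^ 2 / (8 * (3 * L) ^ 2))) := by
          gcongr
      _ = ENNReal.ofReal (l ^ 2) := by
          rw [show (2 : ℝ≥0∞) = ENNReal.ofReal 2 by simp, ← ENNReal.ofReal_mul (by norm_num),
            ← ENNReal.ofReal_mul (by positivity)]
          congr 1
          field_simp; ring
  have dj : ∀ E F : Set (Eu (n + 1)), Disjoint (E ∩ F) (E \ F) := fun E F =>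
    disjoint_sdiff_self_right.mono_left inter_subset_right
  have hCf : volume (E ∩ F) < ⊤ := (measure_mono inter_subset_left).trans_lt hEf
  obtain ⟨h1, p1, v1, q1⟩ := sym_half hL hlp (hE.inter hF) (hE.diff hF) (fun x hx => hEc x hx.1)
    (fun x hx => hEc x hx.1) (dj E F) hCf ((measure_mono sdiff_subset).trans_lt hEf) (key _ hd)
  obtain ⟨h2, p2, v2, q2⟩ := sym_half hL hlp (hE.inter hF) (hF.diff hE) (fun x hx => hEc x hx.1)
    (fun x hx => hFc x hx.1) (by rw [inter_comm]; exact dj F E) hCf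
    ((measure_mono sdiff_subset).trans_lt (hEF ▸ hEf)) (key _ (hd' ▸ hd))
  have : h1 = h2 := KK_inj hL p1 p2 (by rw [v1, v2, hd'])
  subst this
  rw [inter_union_sdiff] at q1
  rw [inter_comm E F, inter_union_sdiff] at q2
  rw [inter_comm] at q1
  have := q1.trans q2.symm
  convert this using 1
  rw [hl]; field_simp; ring

open Set MeasureTheory ProbabilityTheory
open scoped ENNReal RealInnerProductSpace

lemma det_diag {n : ℕ} (b : OrthonormalBasis (Fin n) ℝ (Eu n)) (A : Eu n →L[ℝ] Eu n) (a : Fin n → ℝ)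
    (h : ∀ i, A (b i) = a i • b i) : A.det = ∏ i, a i := by
  classical
  rw [ContinuousLinearMap.det, ← LinearMap.det_toMatrix b.toBasis]
  have : LinearMap.toMatrix b.toBasis b.toBasis (A : Eu n →ₗ[ℝ] Eu n) = Matrix.diagonal a := by
    ext i j
    rw [LinearMap.toMatrix_apply]
    simp only [OrthonormalBasis.coe_toBasis, ContinuousLinearMap.coe_coe, h, map_smul,
      Finsupp.smul_apply, OrthonormalBasis.coe_toBasis_repr_apply, smul_eq_mul, Matrix.diagonal_apply]
    rw [OrthonormalBasis.repr_self]
    by_cases hij : i = j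
    · subst hij; simp
    · simp [hij]
  rw [this, Matrix.det_diagonal]

lemma lam_exists {n : ℕ} (P : Eu n →L[ℝ] Eu n) (hs : (P : Eu n →ₗ[ℝ] Eu n).IsSymmetric) {κ : ℝ}
    (hκ : 0 < κ) (h1 : ∀ w, κ * ‖w‖ ^ 2 ≤ ⟪P w, w⟫) (h2 : ∀ w, ⟪P w, w⟫ ≤ (1 - κ) * ‖w‖ ^ 2) :
    ∃ l l' : ℝ → ℝ, Measurable l ∧ Measurable l' ∧ ContinuousOn l' (Icc 0 1) ∧
      ∀ t ∈ Icc (0 : ℝ) 1, HasDerivAt l (l' t) t ∧ 0 < l t ∧ l t ≤ 1 ∧ |l' t| ≤ n / κ ∧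
        l t * ((1 - t) • P + t • (ContinuousLinearMap.id ℝ _ - P)).det =
          min P.det (ContinuousLinearMap.id ℝ _ - P).det := by
  classical
  have hn : Module.finrank ℝ (Eu n) = n := by simp
  let b := hs.eigenvectorBasis hn
  let p := hs.eigenvalues hn
  have hb : ∀ i, P (b i) = p i • b i := fun i => hs.apply_eigenvectorBasis hn i
  have hbn : ∀ i, ‖b i‖ = 1 := fun i => b.orthonormal.1 i
  have hip : ∀ i, ⟪P (b i), b i⟫ = p i := by
    intro i; rw [hb, real_inner_smul_left, real_inner_self_eq_norm_sq, hbn]; simp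
  have hp1 : ∀ i, κ ≤ p i := fun i => by have := h1 (b i); rw [hip, hbn] at this; simpa using this
  have hp2 : ∀ i, p i ≤ 1 - κ := fun i => by
    have := h2 (b i); rw [hip, hbn] at this; simpa using this
  let a : Fin n → ℝ → ℝ := fun i t => (1 - t) * p i + t * (1 - p i)
  have ha : ∀ i, ∀ t ∈ Icc (0 : ℝ) 1, κ ≤ a i t := by
    intro i t ht
    have e1 := mul_le_mul_of_nonneg_left (hp1 i) (sub_nonneg.2 ht.2)
    have e2 : t * κ ≤ t * (1 - p i) := mul_le_mul_of_nonneg_left (by linarith [hp2 i]) ht.1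
    simp only [a]; linarith
  have had : ∀ t : ℝ, ((1 - t) • P + t • (ContinuousLinearMap.id ℝ _ - P)).det = ∏ i, a i t := by
    intro t
    refine det_diag b _ _ fun i => ?_
    simp only [add_apply, smul_apply,
      sub_apply, ContinuousLinearMap.id_apply, hb, a]
    module
  have hP : P.det = ∏ i, p i := det_diag b _ _ hb
  have hQ : (ContinuousLinearMap.id ℝ _ - P).det = ∏ i, (1 - p i) := by
    refine det_diag b _ _ fun i => ?_
    simp only [sub_apply, ContinuousLinearMap.id_apply, hb]
    module
  have hPp : 0 < ∏ i, p i := Finset.prod_pos fun i _ => hκ.trans_le (hp1 i)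
  have hQp : 0 < ∏ i, (1 - p i) := Finset.prod_pos fun i _ => by linarith [hp2 i]
  set σ := min (∏ i, p i) (∏ i, (1 - p i)) with hσ
  have hσp : 0 < σ := lt_min hPp hQp
  let l : ℝ → ℝ := fun t => σ * Real.exp (- ∑ i, Real.log (a i t))
  let l' : ℝ → ℝ := fun t => l t * (- ∑ i, (1 - 2 * p i) / a i t)
  have ham : ∀ i, Continuous (a i) := fun i => by fun_prop
  have hl : Measurable l := by
    refine measurable_const.mul (Real.measurable_exp.comp (Measurable.neg ?_))
    exact Finset.measurable_sum _ fun i _ => Real.measurable_log.comp (ham i).measurable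
  have hexp : ∀ t ∈ Icc (0 : ℝ) 1, Real.exp (- ∑ i, Real.log (a i t)) = (∏ i, a i t)⁻¹ := by
    intro t ht
    rw [Real.exp_neg, Real.exp_sum]
    congr 1
    exact Finset.prod_congr rfl fun i _ => Real.exp_log (hκ.trans_le (ha i t ht))
  have hd : ∀ t ∈ Icc (0 : ℝ) 1, HasDerivAt l (l' t) t := by
    intro t ht
    have : HasDerivAt (fun t => - ∑ i, Real.log (a i t)) (- ∑ i, (1 - 2 * p i) / a i t) t := by
      refine (HasDerivAt.fun_sum fun i _ => ?_).neg
      refine HasDerivAt.log ?_ (hκ.trans_le (ha i t ht)).ne'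
      have := (((hasDerivAt_id t).const_sub 1).mul_const (p i)).add
        ((hasDerivAt_id t).mul_const (1 - p i))
      refine this.congr_deriv ?_
      ring
    refine (this.exp.const_mul σ).congr_deriv ?_
    simp only [l', l]; ring
  have hl1 : ∀ t ∈ Icc (0 : ℝ) 1, l t ≤ 1 := by
    intro t ht
    have hlog : Real.log σ ≤ ∑ i, Real.log (a i t) := by
      have e1 : ∀ i, (1 - t) * Real.log (p i) + t * Real.log (1 - p i) ≤ Real.log (a i t) := by
        intro i
        exact strictConcaveOn_log_Ioi.concaveOn.2 (hκ.trans_le (hp1 i))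
          (show 1 - p i ∈ Ioi (0 : ℝ) by simp only [mem_Ioi]; linarith [hp2 i])
          (sub_nonneg.2 ht.2) ht.1 (by ring)
      have e2 := Finset.sum_le_sum fun i (_ : i ∈ Finset.univ) => e1 i
      rw [Finset.sum_add_distrib, ← Finset.mul_sum, ← Finset.mul_sum,
        ← Real.log_prod (fun i _ => (hκ.trans_le (hp1 i)).ne'),
        ← Real.log_prod (fun i _ => by linarith [hp2 i])] at e2
      have e3 : Real.log σ ≤ Real.log (∏ i, p i) := Real.log_le_log hσp (min_le_left _ _)
      have e4 : Real.log σ ≤ Real.log (∏ i, (1 - p i)) := Real.log_le_log hσp (min_le_right _ _)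
      nlinarith [mul_le_mul_of_nonneg_left e3 (sub_nonneg.2 ht.2), mul_le_mul_of_nonneg_left e4 ht.1]
    simp only [l]
    conv_lhs => rw [← Real.exp_log hσp]
    rw [← Real.exp_add]
    exact Real.exp_le_one_iff.2 (by linarith)
  have hl0 : ∀ t, 0 < l t := fun t => mul_pos hσp (Real.exp_pos _)
  refine ⟨l, l', hl, ?_, ?_, fun t ht => ⟨hd t ht, hl0 t, hl1 t ht, ?_, ?_⟩⟩
  · refine hl.mul (Measurable.neg ?_)
    exact Finset.measurable_sum _ fun i _ => measurable_const.div (ham i).measurable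
  · refine ContinuousOn.mul (fun t ht => (hd t ht).continuousAt.continuousWithinAt) ?_
    refine (continuousOn_finsetSum _ fun i _ => ?_).neg
    exact continuousOn_const.div (ham i).continuousOn fun t ht => (hκ.trans_le (ha i t ht)).ne'
  · simp only [l']
    rw [abs_mul, abs_neg, abs_of_pos (hl0 t)]
    have : |∑ i, (1 - 2 * p i) / a i t| ≤ n / κ := by
      refine (Finset.abs_sum_le_sum_abs _ _).trans ?_
      calc ∑ i, |(1 - 2 * p i) / a i t| ≤ ∑ i : Fin n, 1 / κ := by
            refine Finset.sum_le_sum fun i _ => ?_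
            rw [abs_div, abs_of_pos (hκ.trans_le (ha i t ht))]
            refine div_le_div₀ zero_le_one ?_ hκ (ha i t ht)
            rw [abs_le]; constructor <;> linarith [hp1 i, hp2 i]
        _ = n / κ := by simp; ring
    calc _ ≤ 1 * (n / κ) := mul_le_mul (hl1 t ht) this (abs_nonneg _) zero_le_one
      _ = _ := one_mul _
  · rw [had, hP, hQ]
    simp only [l]
    rw [hexp t ht, mul_assoc, inv_mul_cancel₀, mul_one]
    exact (Finset.prod_pos fun i _ => hκ.trans_le (ha i t ht)).ne'

open Set MeasureTheory ProbabilityTheory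
open scoped ENNReal RealInnerProductSpace

lemma sum_borel {X Y : Type} [TopologicalSpace X] [TopologicalSpace Y] [mX : MeasurableSpace X]
    [mY : MeasurableSpace Y] [BorelSpace X] [BorelSpace Y] : BorelSpace (X ⊕ Y) := by
  refine ⟨le_antisymm ?_ ?_⟩
  · intro s hs
    have e : s = Sum.inl '' (Sum.inl ⁻¹' s) ∪ Sum.inr '' (Sum.inr ⁻¹' s) := by
      ext (x | x) <;> simp
    have h1 : MeasurableSet (Sum.inl ⁻¹' s) := measurable_inl hs
    have h2 : MeasurableSet (Sum.inr ⁻¹' s) := measurable_inr hs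
    rw [e]
    have a1 : MeasurableSet[borel (X ⊕ Y)] (Sum.inl '' (Sum.inl ⁻¹' s)) := by
      let _ : MeasurableSpace (X ⊕ Y) := borel _
      have : BorelSpace (X ⊕ Y) := ⟨rfl⟩
      exact (Topology.IsOpenEmbedding.inl).measurableEmbedding.measurableSet_image.2 h1
    have a2 : MeasurableSet[borel (X ⊕ Y)] (Sum.inr '' (Sum.inr ⁻¹' s)) := by
      let _ : MeasurableSpace (X ⊕ Y) := borel _
      have : BorelSpace (X ⊕ Y) := ⟨rfl⟩
      exact (Topology.IsOpenEmbedding.inr).measurableEmbedding.measurableSet_image.2 h2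
    exact MeasurableSet.union a1 a2
  · refine MeasurableSpace.generateFrom_le fun s hs => ?_
    have hs' := isOpen_sum_iff.1 hs
    have e : s = Sum.inl '' (Sum.inl ⁻¹' s) ∪ Sum.inr '' (Sum.inr ⁻¹' s) := by
      ext (x | x) <;> simp
    rw [e]
    exact (measurableSet_inl_image.2 hs'.1.measurableSet).union
      (measurableSet_inr_image.2 hs'.2.measurableSet)

/-- Lagrangian construction in the presence of a static (parked) set. -/
lemma lagrP {d : ℕ} {X : Type} [MeasurableSpace X] [StandardBorelSpace X] (m : Measure X)
    [IsFiniteMeasure m] (g g' : ℝ × X → Eu d) (hg : Measurable g) (hg' : Measurable g')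
    (hgd : ∀ x, ∀ t ∈ Icc (0:ℝ) 1, HasDerivAt (fun s => g (s, x)) (g' (t, x)) t)
    (hgc : ∀ x, ContinuousOn (fun t => g' (t, x)) (Icc (0:ℝ) 1))
    (h2 : (∫⁻ p, ‖g' p‖ₑ ^ 2 ∂((volume.restrict (Icc (0:ℝ) 1)).prod m)) < ⊤)
    (X' : Set X) (hX' : MeasurableSet X') (hX0 : m X'ᶜ = 0)
    (hinj : ∀ t ∈ Icc (0:ℝ) 1, InjOn (fun x => g (t, x)) X')
    (hch : ∀ t ∈ Icc (0:ℝ) 1,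
      m.map (fun x => g (t, x)) = volume.restrict ((fun x => g (t, x)) '' X'))
    (Pk : Set (Eu d)) (hPk : MeasurableSet Pk) (hPf : volume Pk < ⊤)
    (hdis : ∀ t ∈ Icc (0:ℝ) 1, ∀ x ∈ X', g (t, x) ∉ Pk) :
    Conn (((fun x => g (0, x)) '' X') ∪ Pk) (((fun x => g (1, x)) '' X') ∪ Pk)
      (∫⁻ p, ‖g' p‖ₑ ^ 2 ∂((volume.restrict (Icc (0:ℝ) 1)).prod m)) := by
  have hgt : ∀ t, Measurable fun x => g (t, x) := fun t => hg.comp measurable_prodMk_left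
  have him : ∀ t ∈ Icc (0:ℝ) 1, MeasurableSet ((fun x => g (t, x)) '' X') := fun t ht =>
    hX'.image_of_measurable_injOn (hgt t) (hinj t ht)
  have hPfin : IsFiniteMeasure (volume.restrict Pk) := ⟨by simpa using hPf⟩
  let M : Measure (X ⊕ Eu d) := m.map Sum.inl + (volume.restrict Pk).map Sum.inr
  let G : ℝ × (X ⊕ Eu d) → Eu d := fun p => Sum.elim (fun x => g (p.1, x)) id p.2
  let G' : ℝ × (X ⊕ Eu d) → Eu d := fun p => Sum.elim (fun x => g' (p.1, x)) (fun _ => 0) p.2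
  have hGm : Measurable G := by
    have : G = (Sum.elim g Prod.snd) ∘ MeasurableEquiv.prodSumDistrib ℝ X (Eu d) := by
      ext ⟨t, x | x⟩ <;> rfl
    rw [this]; exact (hg.sumElim measurable_snd).comp (MeasurableEquiv.measurable _)
  have hGm' : Measurable G' := by
    have : G' = (Sum.elim g' (fun _ => 0)) ∘ MeasurableEquiv.prodSumDistrib ℝ X (Eu d) := by
      ext ⟨t, x | x⟩ <;> rfl
    rw [this]; exact (hg'.sumElim measurable_const).comp (MeasurableEquiv.measurable _)
  have hcost : (∫⁻ p, ‖G' p‖ₑ ^ 2 ∂((volume.restrict (Icc (0:ℝ) 1)).prod M)) =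
      ∫⁻ p, ‖g' p‖ₑ ^ 2 ∂((volume.restrict (Icc (0:ℝ) 1)).prod m) := by
    have hm : Measurable fun p => ‖G' p‖ₑ ^ 2 := by fun_prop
    rw [Measure.prod_add, lintegral_add_measure]
    have e1 : (volume.restrict (Icc (0:ℝ) 1)).prod (m.map (Sum.inl : X → X ⊕ Eu d)) =
        ((volume.restrict (Icc (0:ℝ) 1)).prod m).map (Prod.map id Sum.inl) := by
      rw [← Measure.map_prod_map _ _ measurable_id measurable_inl, Measure.map_id]
    have e2 : (volume.restrict (Icc (0:ℝ) 1)).prod ((volume.restrict Pk).map (Sum.inr : Eu d → X ⊕ Eu d)) =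
        ((volume.restrict (Icc (0:ℝ) 1)).prod (volume.restrict Pk)).map (Prod.map id Sum.inr) := by
      rw [← Measure.map_prod_map _ _ measurable_id measurable_inr, Measure.map_id]
    rw [e1, e2, lintegral_map hm (by fun_prop), lintegral_map hm (by fun_prop)]
    simp [G', Prod.map]
  have hmap : ∀ t ∈ Icc (0:ℝ) 1, M.map (fun x => G (t, x)) =
      volume.restrict (((fun x => g (t, x)) '' X') ∪ Pk) := by
    intro t ht
    have hm : Measurable fun x => G (t, x) := hGm.comp measurable_prodMk_left
    rw [Measure.map_add _ _ hm, Measure.map_map hm measurable_inl, Measure.map_map hm measurable_inr,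
      Measure.restrict_union _ hPk, ← hch t ht]
    · congr 1
      have : (fun x => G (t, x)) ∘ Sum.inr = id := rfl
      rw [this, Measure.map_id]
    · rw [Set.disjoint_left]; rintro _ ⟨x, hx, rfl⟩; exact hdis t ht x hx
  have hsb : StandardBorelSpace (X ⊕ Eu d) := by
    let _ := upgradeStandardBorel X
    have : BorelSpace (X ⊕ Eu d) := sum_borel
    infer_instance
  rw [← hcost]
  refine lagrC M G G' hGm hGm' ?_ ?_ (hcost ▸ h2) (Sum.inl '' X' ∪ Sum.inr '' Pk)
    ((measurableSet_inl_image.2 hX').union (measurableSet_inr_image.2 hPk)) ?_ ?_ ?_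
    ((him 0 (by simp)).union hPk) ((him 1 (by simp)).union hPk)
    (hmap 0 (by simp)) (hmap 1 (by simp))
  · rintro (x | x) t ht
    · exact hgd x t ht
    · exact hasDerivAt_const _ _
  · rintro (x | x)
    · exact hgc x
    · exact continuousOn_const
  · have hms : MeasurableSet ((Sum.inl '' X' ∪ Sum.inr '' Pk : Set (X ⊕ Eu d))ᶜ) :=
      ((measurableSet_inl_image.2 hX').union (measurableSet_inr_image.2 hPk)).compl
    rw [Measure.add_apply, Measure.map_apply measurable_inl hms, Measure.map_apply measurable_inr hms]
    have a1 : (Sum.inl ⁻¹' ((Sum.inl '' X' ∪ Sum.inr '' Pk : Set (X ⊕ Eu d))ᶜ)) = X'ᶜ := by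
      ext x; simp
    have a2 : (Sum.inr ⁻¹' ((Sum.inl '' X' ∪ Sum.inr '' Pk : Set (X ⊕ Eu d))ᶜ)) = Pkᶜ := by
      ext x; simp
    rw [a1, a2, hX0, Measure.restrict_apply hPk.compl]
    simp
  · intro t ht
    have ht' := Ioo_subset_Icc_self ht
    rintro _ (⟨x, hx, rfl⟩ | ⟨x, hx, rfl⟩) _ (⟨y, hy, rfl⟩ | ⟨y, hy, rfl⟩) h
    · exact congrArg _ (hinj t ht' hx hy h)
    · exact absurd (show g (t, x) ∈ Pk from (show g (t, x) = y from h) ▸ hy) (hdis t ht' x hx)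
    · exact absurd (show g (t, y) ∈ Pk from (show x = g (t, y) from h) ▸ hx) (hdis t ht' y hy)
    · exact congrArg _ (show x = y from h)
  · intro t ht
    exact ⟨_, (him t (Ioo_subset_Icc_self ht)).union hPk, hmap t (Ioo_subset_Icc_self ht)⟩

open Set MeasureTheory ProbabilityTheory
open scoped ENNReal RealInnerProductSpace

lemma eu_coord_le {d : ℕ} (y : Eu d) (i : Fin d) : |y i| ≤ ‖y‖ := by
  simpa using PiLp.norm_apply_le y i

lemma eu_norm_le {d : ℕ} (y : Eu d) {b : ℝ} (hb : 0 ≤ b) (h : ∀ i, |y i| ≤ b) : ‖y‖ ≤ d * b := by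
  have h1 : ‖y‖ ^ 2 ≤ d * b ^ 2 := by
    rw [EuclideanSpace.norm_sq_eq]
    calc ∑ i, ‖y i‖ ^ 2 ≤ ∑ i : Fin d, b ^ 2 := by
          refine Finset.sum_le_sum fun i _ => ?_
          rw [Real.norm_eq_abs]
          exact pow_le_pow_left₀ (abs_nonneg _) (h i) 2
      _ = d * b ^ 2 := by simp
  rcases Nat.eq_zero_or_pos d with rfl | hd
  · have : ‖y‖ ^ 2 ≤ 0 := by simpa using h1
    have : ‖y‖ = 0 := by nlinarith [norm_nonneg y]
    simp [this]
  have hd' : (1 : ℝ) ≤ d := by exact_mod_cast hd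
  refine le_of_sq_le_sq ?_ (by positivity)
  rw [mul_pow]
  nlinarith [mul_nonneg (sub_nonneg.2 hd') (sq_nonneg b), sq_nonneg b]

/-- index of the grid cell -/
noncomputable def kk {d : ℕ} (h : ℝ) (y : Eu d) : Fin d → ℤ := fun i => ⌊y i / h⌋
/-- centre of the grid cell -/
noncomputable def cc {d : ℕ} (h : ℝ) (k : Fin d → ℤ) : Eu d := WithLp.toLp 2 fun i => h * (k i + 1 / 2)
/-- shrunk open cube -/
def cub {d : ℕ} (h θ : ℝ) (k : Fin d → ℤ) : Set (Eu d) :=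
  {y | ∀ i, |y i - h * (k i + 1 / 2)| < (1 - θ) * h / 2}

lemma cc_apply {d : ℕ} (h : ℝ) (k : Fin d → ℤ) (i) : cc h k i = h * (k i + 1 / 2) := rfl

lemma kk_meas {d : ℕ} (h : ℝ) : Measurable (kk h : Eu d → Fin d → ℤ) :=
  measurable_pi_lambda _ fun i => Int.measurable_floor.comp ((coord_meas i).div_const h)

lemma kk_iff {d : ℕ} {h : ℝ} (hh : 0 < h) (y : Eu d) (k : Fin d → ℤ) :
    kk h y = k ↔ ∀ i, y i ∈ Ico (h * k i) (h * (k i + 1)) := by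
  rw [funext_iff]
  refine forall_congr' fun i => ?_
  simp only [kk, Int.floor_eq_iff, mem_Ico, le_div_iff₀ hh, div_lt_iff₀ hh]
  rw [mul_comm h, mul_comm h]

lemma kk_dist {d : ℕ} {h : ℝ} (hh : 0 < h) (y : Eu d) : ‖y - cc h (kk h y)‖ ≤ d * h := by
  refine eu_norm_le _ hh.le fun i => ?_
  have := (kk_iff hh y (kk h y)).1 rfl i
  simp only [PiLp.sub_apply, cc_apply]
  rw [abs_le]; constructor <;> nlinarith [this.1, this.2]

lemma cub_kk {d : ℕ} {h θ : ℝ} (hh : 0 < h) (hθ : 0 ≤ θ) {k : Fin d → ℤ} {y : Eu d}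
    (hy : y ∈ cub h θ k) : kk h y = k := by
  rw [kk_iff hh]
  intro i
  have := abs_lt.1 (hy i)
  constructor <;> nlinarith [this.1, this.2, mul_nonneg hθ hh.le]

lemma cub_open {d : ℕ} (h θ : ℝ) (k : Fin d → ℤ) : IsOpen (cub h θ k) := by
  have : cub h θ k = ⋂ i, {y : Eu d | |y i - h * (k i + 1 / 2)| < (1 - θ) * h / 2} := by
    ext y; simp [cub]
  rw [this]
  refine isOpen_iInter_of_finite fun i => isOpen_lt ?_ continuous_const
  fun_prop

lemma cub_sep {d : ℕ} {h θ : ℝ} (hh : 0 < h) {k k' : Fin d → ℤ} (hk : k ≠ k')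
    {p p' : Eu d} (hp : p ∈ cub h θ k) (hp' : p' ∈ cub h θ k') : θ * h ≤ ‖p - p'‖ := by
  obtain ⟨i, hi⟩ := Function.ne_iff.1 hk
  refine le_trans ?_ (eu_coord_le (p - p') i)
  have a := abs_lt.1 (hp i)
  have b := abs_lt.1 (hp' i)
  rw [PiLp.sub_apply]
  rcases lt_or_gt_of_ne hi with h1 | h1
  · have : (k i : ℝ) + 1 ≤ k' i := by exact_mod_cast h1
    rw [abs_sub_comm]
    refine le_trans ?_ (le_abs_self _)
    nlinarith [mul_le_mul_of_nonneg_left this hh.le]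
  · have : (k' i : ℝ) + 1 ≤ k i := by exact_mod_cast h1
    refine le_trans ?_ (le_abs_self _)
    nlinarith [mul_le_mul_of_nonneg_left this hh.le]

lemma eu_box_Ico {d : ℕ} (a b : Fin d → ℝ) : volume {y : Eu d | ∀ i, y i ∈ Ico (a i) (b i)} =
    ∏ i, ENNReal.ofReal (b i - a i) := by
  rw [← Real.volume_pi_Ico, ← (EuclideanSpace.volume_preserving_symm_measurableEquiv_toLp (Fin d)).symm.measure_preimage_equiv]
  congr 1; ext y; simp [mem_pi]

lemma eu_box_Ioo {d : ℕ} (a b : Fin d → ℝ) : volume {y : Eu d | ∀ i, y i ∈ Ioo (a i) (b i)} =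
    ∏ i, ENNReal.ofReal (b i - a i) := by
  rw [← Real.volume_pi_Ioo, ← (EuclideanSpace.volume_preserving_symm_measurableEquiv_toLp (Fin d)).symm.measure_preimage_equiv]
  congr 1; ext y; simp [mem_pi]

lemma cell_vol {d : ℕ} {h : ℝ} (hh : 0 < h) (k : Fin d → ℤ) :
    volume {y : Eu d | kk h y = k} = ENNReal.ofReal (h ^ d) := by
  simp_rw [kk_iff hh]
  rw [eu_box_Ico]
  have : ∀ i : Fin d, h * ((k i : ℝ) + 1) - h * k i = h := fun i => by ring
  simp [this, ENNReal.ofReal_pow hh.le]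

lemma cub_vol {d : ℕ} {h θ : ℝ} (hh : 0 < h) (hθ : θ ≤ 1) (k : Fin d → ℤ) :
    volume (cub h θ k : Set (Eu d)) = ENNReal.ofReal (((1 - θ) * h) ^ d) := by
  have : (cub h θ k : Set (Eu d)) = {y : Eu d | ∀ i, y i ∈
      Ioo (h * (k i + 1 / 2) - (1 - θ) * h / 2) (h * (k i + 1 / 2) + (1 - θ) * h / 2)} := by
    ext y
    refine forall_congr' fun i => ?_
    rw [abs_lt, mem_Ioo]
    constructor <;> rintro ⟨a, b⟩ <;> constructor <;> linarith
  rw [this, eu_box_Ioo]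
  have : ∀ i : Fin d, (h * ((k i : ℝ) + 1 / 2) + (1 - θ) * h / 2) -
      (h * (k i + 1 / 2) - (1 - θ) * h / 2) = (1 - θ) * h := fun i => by ring
  simp only [this, Finset.prod_const, Finset.card_univ, Fintype.card_fin]
  rw [ENNReal.ofReal_pow (mul_nonneg (by linarith) hh.le)]

lemma bad_vol {d : ℕ} {h θ : ℝ} (hh : 0 < h) (hθ0 : 0 ≤ θ) (hθ : θ ≤ 1) (J : Set (Fin d → ℤ)) :
    volume {y : Eu d | kk h y ∈ J ∧ y ∉ cub h θ (kk h y)} ≤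
      ENNReal.ofReal (d * θ) * volume {y : Eu d | kk h y ∈ J} := by
  have hcell : ∀ k : Fin d → ℤ, MeasurableSet {y : Eu d | kk h y = k} := fun k =>
    kk_meas h (measurableSet_singleton k)
  have e1 : {y : Eu d | kk h y ∈ J ∧ y ∉ cub h θ (kk h y)} =
      ⋃ k ∈ J, ({y : Eu d | kk h y = k} \ cub h θ k) := by
    ext y; simp
  have e2 : {y : Eu d | kk h y ∈ J} = ⋃ k ∈ J, {y : Eu d | kk h y = k} := by
    ext y; simp
  rw [e1, e2]
  rw [measure_biUnion (to_countable J) _ fun k _ => hcell k]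
  · refine (measure_biUnion_le _ (to_countable J) _).trans ?_
    rw [← ENNReal.tsum_mul_left]
    refine ENNReal.tsum_le_tsum fun k => ?_
    have hsub : (cub h θ (k : Fin d → ℤ) : Set (Eu d)) ⊆ {y : Eu d | kk h y = k} :=
      fun y hy => cub_kk hh hθ0 hy
    rw [measure_sdiff hsub (cub_open h θ _).measurableSet.nullMeasurableSet
      (by rw [cub_vol hh hθ]; exact ENNReal.ofReal_ne_top), cell_vol hh, cub_vol hh hθ,
      ← ENNReal.ofReal_sub _ (by have : 0 ≤ 1 - θ := by linarith
                                 positivity), ← ENNReal.ofReal_mul (by positivity)]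
    refine ENNReal.ofReal_le_ofReal ?_
    rw [mul_pow]
    have := one_add_mul_le_pow (a := -θ) (by linarith) d
    have h2 : (1 + (d : ℝ) * -θ) * h ^ d ≤ (1 + -θ) ^ d * h ^ d :=
      mul_le_mul_of_nonneg_right this (by positivity)
    have h3 : (1 + -θ) = 1 - θ := by ring
    rw [h3] at h2
    linarith
  · intro k _ k' _ hkk
    rw [Function.onFun, Set.disjoint_left]
    intro y h1 h2
    exact hkk (h1.symm.trans h2)

/-- scale the 0-th coordinate -/
noncomputable def S0 {n : ℕ} (l : ℝ) : Eu (n + 1) →L[ℝ] Eu (n + 1) :=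
  ContinuousLinearMap.id ℝ _ + (l - 1) •
    (EuclideanSpace.proj (0 : Fin (n + 1)) : Eu (n + 1) →L[ℝ] ℝ).smulRight
      (EuclideanSpace.single (0 : Fin (n + 1)) (1 : ℝ))

lemma S0_apply {n : ℕ} (l : ℝ) (y : Eu (n + 1)) :
    S0 l y = y + ((l - 1) * y 0) • EuclideanSpace.single (0 : Fin (n + 1)) (1 : ℝ) := by
  simp [S0, mul_smul]

lemma S0_coord {n : ℕ} (l : ℝ) (y : Eu (n + 1)) (i : Fin (n + 1)) :
    S0 l y i = if i = 0 then l * y i else y i := by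
  rw [S0_apply]
  by_cases hi : i = 0
  · subst hi; simp; ring
  · simp [hi]

lemma S0_det {n : ℕ} (l : ℝ) : (S0 l : Eu (n + 1) →L[ℝ] Eu (n + 1)).det = l := by
  rw [det_diag (EuclideanSpace.basisFun (Fin (n + 1)) ℝ) (S0 l) (fun i => if i = 0 then l else 1)]
  · rw [Finset.prod_ite_eq' Finset.univ 0 fun _ => l]; simp
  · intro i
    ext j
    rw [S0_coord]
    by_cases hj : j = 0
    · subst hj
      by_cases hi : i = 0
      · subst hi; simp
      · simp [hi, Ne.symm hi]
    · by_cases hi : i = 0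
      · subst hi; simp [hj]
      · simp [hi, hj]

lemma S0_norm {n : ℕ} {l : ℝ} (h0 : 0 ≤ l) (h1 : l ≤ 1) (y : Eu (n + 1)) (i) : |S0 l y i| ≤ |y i| := by
  rw [S0_coord]
  split_ifs
  · rw [abs_mul, abs_of_nonneg h0]; nlinarith [abs_nonneg (y i)]
  · exact le_rfl

open Set MeasureTheory ProbabilityTheory
open scoped ENNReal RealInnerProductSpace

lemma det_bd {n : ℕ} (P : Eu n →L[ℝ] Eu n) (hs : (P : Eu n →ₗ[ℝ] Eu n).IsSymmetric)
    (h1 : ∀ w, 0 ≤ ⟪P w, w⟫) (h2 : ∀ w, ⟪P w, w⟫ ≤ ‖w‖ ^ 2) : 0 ≤ P.det ∧ P.det ≤ 1 := by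
  classical
  have hn : Module.finrank ℝ (Eu n) = n := by simp
  let b := hs.eigenvectorBasis hn
  let p := hs.eigenvalues hn
  have hb : ∀ i, P (b i) = p i • b i := fun i => hs.apply_eigenvectorBasis hn i
  have hbn : ∀ i, ‖b i‖ = 1 := fun i => b.orthonormal.1 i
  have hip : ∀ i, ⟪P (b i), b i⟫ = p i := by
    intro i; rw [hb, real_inner_smul_left, real_inner_self_eq_norm_sq, hbn]; simp
  have hp1 : ∀ i, 0 ≤ p i := fun i => by have := h1 (b i); rwa [hip] at this
  have hp2 : ∀ i, p i ≤ 1 := fun i => by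
    have := h2 (b i); rw [hip, hbn] at this; simpa using this
  rw [det_diag b P p hb]
  exact ⟨Finset.prod_nonneg fun i _ => hp1 i, Finset.prod_le_one (fun i _ => hp1 i) fun i _ => hp2 i⟩

/-- straight-line interpolation `Z_t` is expanding -/
lemma Z_expand {d : ℕ} {Rm : Eu d → Eu d} {κ : ℝ}
    (hm1 : ∀ z z', κ * ‖z - z'‖ ^ 2 ≤ ⟪Rm z - Rm z', z - z'⟫)
    (hm2 : ∀ z z', ⟪Rm z - Rm z', z - z'⟫ ≤ (1 - κ) * ‖z - z'‖ ^ 2) {t : ℝ} (ht : t ∈ Icc (0 : ℝ) 1)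
    (z z' : Eu d) :
    κ * ‖z - z'‖ ≤ ‖((1 - t) • Rm z + t • (z - Rm z)) - ((1 - t) • Rm z' + t • (z' - Rm z'))‖ := by
  set v := ((1 - t) • Rm z + t • (z - Rm z)) - ((1 - t) • Rm z' + t • (z' - Rm z')) with hv
  have e : v = (1 - t) • (Rm z - Rm z') + t • ((z - z') - (Rm z - Rm z')) := by rw [hv]; module
  have h1 : κ * ‖z - z'‖ ^ 2 ≤ ⟪v, z - z'⟫ := by
    rw [e, inner_add_left, real_inner_smul_left, real_inner_smul_left,
      inner_sub_left (z - z'), real_inner_self_eq_norm_sq]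
    nlinarith [mul_le_mul_of_nonneg_left (hm1 z z') (sub_nonneg.2 ht.2),
      mul_le_mul_of_nonneg_left (hm2 z z') ht.1]
  have h2 := h1.trans (real_inner_le_norm v (z - z'))
  rcases (norm_nonneg (z - z')).eq_or_lt with h0 | h0
  · rw [← h0]; simp
  · refine le_of_mul_le_mul_right ?_ h0
    nlinarith

/-- velocity field along the cells -/
lemma cell_deriv {d : ℕ} (P : Eu d →L[ℝ] Eu d) (r c v e : Eu d) (l l' : ℝ → ℝ) (a : ℝ) {t : ℝ}
    (hl : HasDerivAt l (l' t) t) :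
    HasDerivAt (fun s : ℝ => (1 - s) • (r + P (v + ((l s - 1) * a) • e)) +
      s • ((c - r) + ((v + ((l s - 1) * a) • e) - P (v + ((l s - 1) * a) • e))))
      ((c - (2 : ℝ) • r) + ((v + ((l t - 1) * a) • e) - (2 : ℝ) • P (v + ((l t - 1) * a) • e)) +
        (l' t * a) • ((1 - t) • P e + t • (e - P e))) t := by
  have hu : HasDerivAt (fun s => v + ((l s - 1) * a) • e) ((l' t * a) • e) t :=
    (((hl.sub_const 1).mul_const a).smul_const e).const_add v
  have hPu : HasDerivAt (fun s => P (v + ((l s - 1) * a) • e)) (P ((l' t * a) • e)) t :=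
    P.hasFDerivAt.comp_hasDerivAt t hu
  have h1 : HasDerivAt (fun s : ℝ => 1 - s) (-1) t := by
    simpa using (hasDerivAt_id t).const_sub 1
  have h2 := (h1.smul (hPu.const_add r)).add ((hasDerivAt_id t).smul ((hu.sub hPu).const_add (c - r)))
  refine h2.congr_deriv ?_
  simp only [map_smul, id, Pi.sub_apply]
  module

set_option maxHeartbeats 1000000 in
lemma grid_core {n : ℕ} (Rm : Eu (n + 1) → Eu (n + 1)) (P : Eu (n + 1) → Eu (n + 1) →L[ℝ] Eu (n + 1))
    (hP : ∀ z, HasFDerivAt Rm (P z) z)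
    (hs : ∀ z, (P z : Eu (n + 1) →ₗ[ℝ] Eu (n + 1)).IsSymmetric) {κ : ℝ} (hκ : 0 < κ)
    (hm1 : ∀ z z', κ * ‖z - z'‖ ^ 2 ≤ ⟪Rm z - Rm z', z - z'⟫)
    (hm2 : ∀ z z', ⟪Rm z - Rm z', z - z'⟫ ≤ (1 - κ) * ‖z - z'‖ ^ 2)
    (h1 : ∀ z w, κ * ‖w‖ ^ 2 ≤ ⟪P z w, w⟫) (h2 : ∀ z w, ⟪P z w, w⟫ ≤ (1 - κ) * ‖w‖ ^ 2)
    (hPn : ∀ z, ‖P z‖ ≤ 1) {h θ ω : ℝ} (hh : 0 < h) (hθ : 0 < θ)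
    (hω : 2 * ω * (n + 1) < κ * θ) (J : Set (Fin (n + 1) → ℤ))
    (hJ : ∀ k ∈ J, ∀ z ∈ Metric.closedBall (cc h k) ((n + 1) * h), ‖P z - P (cc h k)‖ ≤ ω)
    {X' : Set (Eu (n + 1))} (hX' : X' = {y | kk h y ∈ J ∧ y ∈ cub h θ (kk h y)})
    (hX'f : volume X' < ⊤) {m : Measure (Eu (n + 1))}
    (hm : m = (volume.restrict X').withDensity fun y => ENNReal.ofReal
      (min (P (cc h (kk h y))).det (ContinuousLinearMap.id ℝ (Eu (n + 1)) - P (cc h (kk h y))).det)) :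
    MeasurableSet X' ∧ IsFiniteMeasure m ∧ ∃ g g' : ℝ × Eu (n + 1) → Eu (n + 1), Measurable g ∧
      Measurable g' ∧
      (∀ x, ∀ t ∈ Icc (0:ℝ) 1, HasDerivAt (fun s => g (s, x)) (g' (t, x)) t) ∧
      (∀ x, ContinuousOn (fun t => g' (t, x)) (Icc (0:ℝ) 1)) ∧
      (∀ t ∈ Icc (0:ℝ) 1, InjOn (fun x => g (t, x)) X') ∧
      (∀ t ∈ Icc (0:ℝ) 1, m.map (fun x => g (t, x)) = volume.restrict ((fun x => g (t, x)) '' X')) ∧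
      (∀ x, ∃ c, c = cc h (kk h x) ∧ ∀ t ∈ Icc (0:ℝ) 1, (∃ w, ‖w‖ ≤ (n + 1) * h ∧ g (t, x) =
        (1 - t) • (Rm c + P c w) + t • ((c - Rm c) + (w - P c w))) ∧
        ‖g' (t, x)‖ ≤ ‖c - (2 : ℝ) • Rm c‖ + 3 * (n + 1) * (1 + (n + 1) / κ) * h) := by
  classical
  choose l l' hlm hlm' hlc hl using fun k : Fin (n + 1) → ℤ =>
    lam_exists (P (cc h k)) (hs _) hκ (h1 _) (h2 _)
  let e : Eu (n + 1) := EuclideanSpace.single (0 : Fin (n + 1)) (1 : ℝ)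
  have hen : ‖e‖ = 1 := by simp [e]
  let u : (Fin (n + 1) → ℤ) → ℝ → Eu (n + 1) → Eu (n + 1) := fun k t y =>
    (y - cc h k) + ((l k t - 1) * (y - cc h k) 0) • e
  have hu : ∀ k t y, u k t y = S0 (l k t) (y - cc h k) := fun k t y => (S0_apply _ _).symm
  let G : (Fin (n + 1) → ℤ) → ℝ × Eu (n + 1) → Eu (n + 1) := fun k p =>
    (1 - p.1) • (Rm (cc h k) + P (cc h k) (u k p.1 p.2)) +
      p.1 • ((cc h k - Rm (cc h k)) + (u k p.1 p.2 - P (cc h k) (u k p.1 p.2)))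
  let G' : (Fin (n + 1) → ℤ) → ℝ × Eu (n + 1) → Eu (n + 1) := fun k p =>
    (cc h k - (2 : ℝ) • Rm (cc h k)) + (u k p.1 p.2 - (2 : ℝ) • P (cc h k) (u k p.1 p.2)) +
      (l' k p.1 * (p.2 - cc h k) 0) • ((1 - p.1) • P (cc h k) e + p.1 • (e - P (cc h k) e))
  have hum : ∀ k, Measurable fun p : ℝ × Eu (n + 1) => u k p.1 p.2 := by
    intro k
    have : Measurable fun p : ℝ × Eu (n + 1) => l k p.1 := (hlm k).comp measurable_fst
    refine Measurable.add (by fun_prop) (Measurable.smul_const (Measurable.mul (this.sub_const 1) ?_) e)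
    exact (coord_meas 0).comp (by fun_prop)
  have hPum : ∀ k, Measurable fun p : ℝ × Eu (n + 1) => P (cc h k) (u k p.1 p.2) := fun k =>
    (P (cc h k)).continuous.measurable.comp (hum k)
  have hGm : ∀ k, Measurable (G k) := by
    intro k
    have a := hum k
    have b := hPum k
    exact ((measurable_const.sub measurable_fst).smul (b.const_add _)).add
      (measurable_fst.smul ((a.sub b).const_add _))
  have hGm' : ∀ k, Measurable (G' k) := by
    intro k
    have a := hum k
    have b := hPum k
    have c : Measurable fun p : ℝ × Eu (n + 1) => l' k p.1 := (hlm' k).comp measurable_fst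
    refine Measurable.add (Measurable.const_add (a.sub (b.const_smul (2 : ℝ))) _) ?_
    refine Measurable.smul (c.mul ?_) (by fun_prop)
    exact (coord_meas 0).comp (by fun_prop)
  have hcomb : ∀ F : (Fin (n + 1) → ℤ) → ℝ × Eu (n + 1) → Eu (n + 1), (∀ k, Measurable (F k)) →
      Measurable fun p : ℝ × Eu (n + 1) => F (kk h p.2) p := by
    intro F hF
    have : Measurable fun q : (Fin (n + 1) → ℤ) × (ℝ × Eu (n + 1)) => F q.1 q.2 :=
      measurable_from_prod_countable_right fun k => hF k
    exact this.comp (((kk_meas h).comp measurable_snd).prodMk measurable_id)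
  have hwb : ∀ y, ‖y - cc h (kk h y)‖ ≤ (n + 1) * h := fun y => by
    have := kk_dist (d := n + 1) hh y; push_cast at this; exact this
  have hub : ∀ t ∈ Icc (0 : ℝ) 1, ∀ y, ‖u (kk h y) t y‖ ≤ (n + 1) * h := by
    intro t ht y
    have := eu_norm_le (u (kk h y) t y) hh.le fun i => by
      rw [hu]
      refine (S0_norm (hl _ t ht).2.1.le (hl _ t ht).2.2.1 _ i).trans ?_
      have := (kk_iff hh y (kk h y)).1 rfl i
      simp only [PiLp.sub_apply, cc_apply]
      rw [abs_le]; constructor <;> nlinarith [this.1, this.2]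
    push_cast at this; exact this
  have hXm : MeasurableSet X' := by
    have : X' = ⋃ k ∈ J, cub h θ k := by
      rw [hX']; ext y
      simp only [mem_ofPred_eq, mem_iUnion, exists_prop]
      constructor
      · rintro ⟨a, b⟩; exact ⟨_, a, b⟩
      · rintro ⟨k, a, b⟩
        have := cub_kk hh hθ.le b
        rw [this]; exact ⟨a, b⟩
    rw [this]
    exact (isOpen_biUnion fun k _ => cub_open h θ k).measurableSet
  have hdb : ∀ z, 0 < min (P z).det (ContinuousLinearMap.id ℝ (Eu (n + 1)) - P z).det ∧
      min (P z).det (ContinuousLinearMap.id ℝ (Eu (n + 1)) - P z).det ≤ 1 := by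
    intro z
    obtain ⟨L, L', -, -, -, hL⟩ := lam_exists (P z) (hs z) hκ (h1 z) (h2 z)
    have hκ1 : κ ≤ 1 := by
      have a := h1 z e
      have b := h2 z e
      rw [hen] at a b; norm_num at a b; linarith
    have hb := det_bd (P z) (hs z) (fun w => le_trans (by positivity) (h1 z w))
      (fun w => (h2 z w).trans (by nlinarith [sq_nonneg ‖w‖]))
    refine ⟨?_, (min_le_left _ _).trans hb.2⟩
    have a0 := hL 0 (by simp)
    have a1 := hL 1 (by simp)
    have hσ : min (P z).det (ContinuousLinearMap.id ℝ (Eu (n + 1)) - P z).det ≠ 0 := by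
      intro h0
      have inj : ∀ A : Eu (n + 1) →L[ℝ] Eu (n + 1), (∀ w, κ * ‖w‖ ^ 2 ≤ ⟪A w, w⟫) → A.det ≠ 0 := by
        intro A hA h0
        have : ¬ Function.Injective (A : Eu (n + 1) →ₗ[ℝ] Eu (n + 1)) := by
          intro hi
          have := LinearMap.isUnit_det _ ((LinearMap.isUnit_iff_ker_eq_bot _).2 (LinearMap.ker_eq_bot.2 hi))
          exact this.ne_zero h0
        refine this ((injective_iff_map_eq_zero _).2 fun w hw => ?_)
        have h3 := hA w
        rw [show A w = 0 from hw, inner_zero_left] at h3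
        have : ‖w‖ ^ 2 ≤ 0 := by nlinarith
        have : ‖w‖ = 0 := by nlinarith [norm_nonneg w]
        simpa using this
      rcases min_choice (P z).det (ContinuousLinearMap.id ℝ (Eu (n + 1)) - P z).det with h3 | h3
      · exact inj _ (h1 z) (h3 ▸ h0)
      · refine inj _ (fun w => ?_) (h3 ▸ h0)
        have := h2 z w
        rw [sub_apply, inner_sub_left, ContinuousLinearMap.id_apply,
          real_inner_self_eq_norm_sq]
        linarith
    have hb2 := det_bd (ContinuousLinearMap.id ℝ (Eu (n + 1)) - P z)
      (fun x y => by
        have := hs z x y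
        simp only [ContinuousLinearMap.coe_coe] at this
        simp only [ContinuousLinearMap.coe_coe, sub_apply, ContinuousLinearMap.id_apply,
          inner_sub_left, inner_sub_right, this])
      (fun w => by
        rw [sub_apply, inner_sub_left, ContinuousLinearMap.id_apply,
          real_inner_self_eq_norm_sq]
        nlinarith [h2 z w, sq_nonneg ‖w‖])
      (fun w => by
        rw [sub_apply, inner_sub_left, ContinuousLinearMap.id_apply,
          real_inner_self_eq_norm_sq]
        nlinarith [h1 z w, sq_nonneg ‖w‖])
    exact lt_of_le_of_ne (le_min hb.1 hb2.1) (Ne.symm hσ)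
  have hinj : ∀ t ∈ Icc (0:ℝ) 1, InjOn (fun x => G (kk h x) (t, x)) X' := by
    intro t ht y1 hy1 y2 hy2 heq
    rw [hX'] at hy1 hy2
    simp only at heq
    by_cases hk : kk h y1 = kk h y2
    · rw [← hk] at heq
      set k := kk h y1
      have e1 : ((1 - t) • P (cc h k) + t • (ContinuousLinearMap.id ℝ (Eu (n + 1)) - P (cc h k)))
          (S0 (l k t) (y1 - y2)) = 0 := by
        have : S0 (l k t) (y1 - y2) = u k t y1 - u k t y2 := by
          rw [hu, hu, ← map_sub]; congr 1; abel
        rw [this]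
        have h3 := sub_eq_zero.2 heq
        rw [← h3]
        simp only [add_apply, smul_apply, sub_apply, ContinuousLinearMap.id_apply, map_sub, G]
        module
      have e2 : S0 (l k t) (y1 - y2) = 0 := by
        set w := S0 (l k t) (y1 - y2)
        have h3 : κ * ‖w‖ ^ 2 ≤ ⟪((1 - t) • P (cc h k) + t • (ContinuousLinearMap.id ℝ (Eu (n + 1)) - P (cc h k))) w, w⟫ := by
          simp only [add_apply, smul_apply, sub_apply, ContinuousLinearMap.id_apply]
          rw [inner_add_left, real_inner_smul_left, real_inner_smul_left, inner_sub_left,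
            real_inner_self_eq_norm_sq]
          nlinarith [mul_le_mul_of_nonneg_left (h1 (cc h k) w) (sub_nonneg.2 ht.2),
            mul_le_mul_of_nonneg_left (h2 (cc h k) w) ht.1]
        rw [e1, inner_zero_left] at h3
        have : ‖w‖ ^ 2 ≤ 0 := by nlinarith
        have : ‖w‖ = 0 := by nlinarith [norm_nonneg w]
        simpa using this
      have e3 : y1 - y2 = 0 := by
        ext i
        have h3 := congrArg (fun v : Eu (n + 1) => v i) e2
        simp only [S0_coord] at h3
        split_ifs at h3 with hi
        · have h4 : l k t * (y1 - y2) i = 0 := h3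
          exact (mul_eq_zero.1 h4).resolve_left (hl k t ht).2.1.ne'
        · exact h3
      exact sub_eq_zero.1 e3
    · exfalso
      have key : ∀ y, kk h y ∈ J → y ∈ cub h θ (kk h y) →
          cc h (kk h y) + u (kk h y) t y ∈ cub h θ (kk h y) ∧
          ‖G (kk h y) (t, y) - ((1 - t) • Rm (cc h (kk h y) + u (kk h y) t y) +
            t • ((cc h (kk h y) + u (kk h y) t y) - Rm (cc h (kk h y) + u (kk h y) t y)))‖ ≤
            ω * ((n + 1) * h) := by
        intro y hyJ hy
        set k := kk h y with hkd
        constructor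
        · intro i
          have h3 := S0_norm (hl k t ht).2.1.le (hl k t ht).2.2.1 (y - cc h k) i
          rw [← hu] at h3
          have h4 := hy i
          simp only [PiLp.sub_apply, cc_apply] at h3
          simp only [PiLp.add_apply, cc_apply, add_sub_cancel_left]
          exact h3.trans_lt h4
        · have hb := hub t ht y
          rw [← hkd] at hb
          have h3 := Convex.norm_image_sub_le_of_norm_hasFDerivWithin_le' (f := Rm) (f' := P)
            (φ := P (cc h k)) (C := ω) (s := Metric.closedBall (cc h k) ((n + 1) * h))
            (x := cc h k) (y := cc h k + u k t y) (fun x _ => (hP x).hasFDerivWithinAt)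
            (fun x hx => hJ k hyJ x hx) (convex_closedBall _ _)
            (Metric.mem_closedBall_self (by positivity))
            (by rw [Metric.mem_closedBall, dist_eq_norm]; simpa using hb)
          rw [add_sub_cancel_left] at h3
          have hω0 : 0 ≤ ω := (norm_nonneg _).trans (hJ k hyJ _ (Metric.mem_closedBall_self (by positivity)))
          have h4 : G k (t, y) - ((1 - t) • Rm (cc h k + u k t y) +
            t • ((cc h k + u k t y) - Rm (cc h k + u k t y))) =
              (2 * t - 1) • (Rm (cc h k + u k t y) - Rm (cc h k) - P (cc h k) (u k t y)) := by
            simp only [G]; module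
          rw [h4, norm_smul]
          have h5 : ‖2 * t - 1‖ ≤ 1 := by
            rw [Real.norm_eq_abs, abs_le]; constructor <;> linarith [ht.1, ht.2]
          calc _ ≤ 1 * (ω * ‖u k t y‖) := mul_le_mul h5 h3 (norm_nonneg _) zero_le_one
            _ ≤ ω * ((n + 1) * h) := by
              rw [one_mul]; exact mul_le_mul_of_nonneg_left hb hω0
      obtain ⟨a1, b1⟩ := key y1 hy1.1 hy1.2
      obtain ⟨a2, b2⟩ := key y2 hy2.1 hy2.2
      have h3 := cub_sep hh hk a1 a2
      have h4 := Z_expand hm1 hm2 ht (cc h (kk h y1) + u (kk h y1) t y1) (cc h (kk h y2) + u (kk h y2) t y2)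
      rw [heq] at b1
      rw [norm_sub_rev] at b1
      have h5 := (norm_sub_le_norm_sub_add_norm_sub _ (G (kk h y2) (t, y2)) _).trans (add_le_add b1 b2)
      have h6 := h4.trans h5
      have h7 := (mul_le_mul_of_nonneg_left h3 hκ.le).trans h6
      nlinarith
  have hGcm := hcomb G hGm
  have hσm : Measurable fun y => ENNReal.ofReal
      (min (P (cc h (kk h y))).det (ContinuousLinearMap.id ℝ (Eu (n + 1)) - P (cc h (kk h y))).det) := by
    have : Measurable fun k : Fin (n + 1) → ℤ => ENNReal.ofReal
      (min (P (cc h k)).det (ContinuousLinearMap.id ℝ (Eu (n + 1)) - P (cc h k)).det) := measurable_of_countable _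
    exact this.comp (kk_meas h)
  refine ⟨hXm, ?_, fun p => G (kk h p.2) p, fun p => G' (kk h p.2) p, hGcm,
    hcomb G' hGm', ?_, ?_, hinj, ?_, ?_⟩
  · rw [hm]
    refine isFiniteMeasure_withDensity ?_
    refine (lt_of_le_of_lt (lintegral_mono fun y => ?_) (?_ : ∫⁻ _ in X', 1 < ⊤)).ne
    · exact ENNReal.ofReal_le_one.2 (hdb _).2
    · simpa using hX'f
  · intro x t ht
    exact cell_deriv (P (cc h (kk h x))) (Rm (cc h (kk h x))) (cc h (kk h x)) (x - cc h (kk h x)) e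
      (l (kk h x)) (l' (kk h x)) ((x - cc h (kk h x)) 0) (hl _ t ht).1
  · intro x
    have hlc' : ContinuousOn (l (kk h x)) (Icc 0 1) := fun t ht =>
      (hl _ t ht).1.continuousAt.continuousWithinAt
    have a := hlc (kk h x)
    have b : ContinuousOn (fun t => u (kk h x) t x) (Icc 0 1) := by
      simp only [u]; fun_prop
    have c : ContinuousOn (fun t => P (cc h (kk h x)) (u (kk h x) t x)) (Icc 0 1) :=
      (P (cc h (kk h x))).continuous.comp_continuousOn b
    have d1 : ContinuousOn (fun t => (cc h (kk h x) - (2 : ℝ) • Rm (cc h (kk h x))) +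
        (u (kk h x) t x - (2 : ℝ) • P (cc h (kk h x)) (u (kk h x) t x))) (Icc 0 1) :=
      continuousOn_const.add (b.sub (c.const_smul (2 : ℝ)))
    have d2 : ContinuousOn (fun t => (l' (kk h x) t * (x - cc h (kk h x)) 0) •
        ((1 - t) • P (cc h (kk h x)) e + t • (e - P (cc h (kk h x)) e))) (Icc 0 1) :=
      ContinuousOn.smul (a.mul continuousOn_const) (by fun_prop)
    exact d1.add d2
  · intro t ht
    have := map_withDensity_abs_det_fderiv_eq_addHaar (s := X') (f := fun x => G (kk h x) (t, x))
      (f' := fun y => ((1 - t) • P (cc h (kk h y)) +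
        t • (ContinuousLinearMap.id ℝ (Eu (n + 1)) - P (cc h (kk h y)))).comp (S0 (l (kk h y) t)))
      volume hXm.nullMeasurableSet ?_ (hinj t ht)
    · rw [← this, hm]
      congr 2
      ext y
      congr 1
      have h3 := (hl (kk h y) t ht).2.2.2.2
      have hdet : (((1 - t) • P (cc h (kk h y)) +
        t • (ContinuousLinearMap.id ℝ (Eu (n + 1)) - P (cc h (kk h y)))).comp (S0 (l (kk h y) t))).det =
        ((1 - t) • P (cc h (kk h y)) +
        t • (ContinuousLinearMap.id ℝ (Eu (n + 1)) - P (cc h (kk h y)))).det * (S0 (l (kk h y) t)).det :=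
        LinearMap.det_comp _ _
      rw [hdet]
      rw [S0_det, mul_comm, h3, abs_of_pos (hdb _).1]
    · intro y hy
      have hy' := hy
      rw [hX'] at hy'
      have h3 : HasFDerivAt (fun x => G (kk h y) (t, x)) (((1 - t) • P (cc h (kk h y)) +
          t • (ContinuousLinearMap.id ℝ (Eu (n + 1)) - P (cc h (kk h y)))).comp (S0 (l (kk h y) t))) y := by
        set k := kk h y
        have h4 : HasFDerivAt (fun x => ((1 - t) • P (cc h k) +
          t • (ContinuousLinearMap.id ℝ (Eu (n + 1)) - P (cc h k))).comp (S0 (l k t)) (x - cc h k) +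
          ((1 - t) • Rm (cc h k) + t • (cc h k - Rm (cc h k)))) (((1 - t) • P (cc h k) +
          t • (ContinuousLinearMap.id ℝ (Eu (n + 1)) - P (cc h k))).comp (S0 (l k t))) y := by
          refine HasFDerivAt.add_const _ ?_
          have := (((1 - t) • P (cc h k) +
            t • (ContinuousLinearMap.id ℝ (Eu (n + 1)) - P (cc h k))).comp (S0 (l k t))).hasFDerivAt.comp y
            ((hasFDerivAt_id y).sub_const (cc h k))
          exact this
        refine h4.congr_of_eventuallyEq (Filter.Eventually.of_forall fun x => ?_)
        simp only [G, hu, ContinuousLinearMap.comp_apply, add_apply, smul_apply, sub_apply,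
          ContinuousLinearMap.id_apply]
        module
      refine (h3.congr_of_eventuallyEq ?_).hasFDerivWithinAt
      filter_upwards [(cub_open h θ (kk h y)).mem_nhds hy'.2] with x hx
      rw [cub_kk hh hθ.le hx]
  · intro x
    refine ⟨_, rfl, fun t ht => ⟨⟨u (kk h x) t x, hub t ht x, rfl⟩, ?_⟩⟩
    set k := kk h x
    have n1 : ‖u k t x - (2 : ℝ) • P (cc h k) (u k t x)‖ ≤ 3 * ((n + 1) * h) := by
      have a := (P (cc h k)).le_of_opNorm_le (hPn _) (u k t x)
      have b := norm_sub_le (u k t x) ((2 : ℝ) • P (cc h k) (u k t x))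
      rw [norm_smul, Real.norm_two] at b
      have c := hub t ht x
      linarith
    have n2 : ‖(1 - t) • P (cc h k) e + t • (e - P (cc h k) e)‖ ≤ 3 := by
      have a := (P (cc h k)).le_of_opNorm_le (hPn _) e
      have b := norm_add_le ((1 - t) • P (cc h k) e) (t • (e - P (cc h k) e))
      have c := norm_sub_le e (P (cc h k) e)
      rw [norm_smul, norm_smul, Real.norm_of_nonneg (sub_nonneg.2 ht.2), Real.norm_of_nonneg ht.1] at b
      rw [hen] at a c
      nlinarith [ht.1, ht.2, norm_nonneg (P (cc h k) e), norm_nonneg (e - P (cc h k) e)]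
    have n3 : ‖l' k t * (x - cc h k) 0‖ ≤ (n + 1) / κ * ((n + 1) * h) := by
      rw [norm_mul]
      have a := (hl k t ht).2.2.2.1
      push_cast at a
      exact mul_le_mul a ((eu_coord_le _ _).trans (hwb x)) (norm_nonneg _) (by positivity)
    have n4 : ‖(l' k t * (x - cc h k) 0) • ((1 - t) • P (cc h k) e + t • (e - P (cc h k) e))‖ ≤
        (n + 1) / κ * ((n + 1) * h) * 3 := by
      rw [norm_smul]
      exact mul_le_mul n3 n2 (norm_nonneg _) (by positivity)
    calc _ ≤ ‖cc h k - (2 : ℝ) • Rm (cc h k)‖ + ‖u k t x - (2 : ℝ) • P (cc h k) (u k t x)‖ +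
          ‖(l' k t * (x - cc h k) 0) • ((1 - t) • P (cc h k) e + t • (e - P (cc h k) e))‖ :=
          norm_add₃_le
      _ ≤ ‖cc h k - (2 : ℝ) • Rm (cc h k)‖ + 3 * ((n + 1) * h) + (n + 1) / κ * ((n + 1) * h) * 3 := by
          linarith
      _ = _ := by ring

open Set MeasureTheory ProbabilityTheory
open scoped ENNReal RealInnerProductSpace

/-- the density available at a point -/
noncomputable def sg {d : ℕ} (P : Eu d →L[ℝ] Eu d) : ℝ :=
  min P.det (ContinuousLinearMap.id ℝ (Eu d) - P).det

lemma sg_cont {d : ℕ} : Continuous (sg : (Eu d →L[ℝ] Eu d) → ℝ) :=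
  ContinuousLinearMap.continuous_det.min
    (ContinuousLinearMap.continuous_det.comp (continuous_const.sub continuous_id))

lemma sg_bd {n : ℕ} (P : Eu n →L[ℝ] Eu n) (hs : (P : Eu n →ₗ[ℝ] Eu n).IsSymmetric)
    (h1 : ∀ w, 0 ≤ ⟪P w, w⟫) (h2 : ∀ w, ⟪P w, w⟫ ≤ ‖w‖ ^ 2) : 0 ≤ sg P ∧ sg P ≤ 1 := by
  have hb := det_bd P hs h1 h2
  have hb2 := det_bd (ContinuousLinearMap.id ℝ (Eu n) - P) (fun x y => by
        have := hs x y
        simp only [ContinuousLinearMap.coe_coe] at this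
        simp only [ContinuousLinearMap.coe_coe, sub_apply, ContinuousLinearMap.id_apply,
          inner_sub_left, inner_sub_right, this])
      (fun w => by
        rw [sub_apply, inner_sub_left, ContinuousLinearMap.id_apply,
          real_inner_self_eq_norm_sq]
        nlinarith [h2 w])
      (fun w => by
        rw [sub_apply, inner_sub_left, ContinuousLinearMap.id_apply,
          real_inner_self_eq_norm_sq]
        nlinarith [h1 w])
  exact ⟨le_min hb.1 hb2.1, (min_le_left _ _).trans hb.2⟩

lemma uc_ev {X Y : Type*} [PseudoMetricSpace X] [PseudoMetricSpace Y] {K : Set X} (hK : IsCompact K)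
    {f : X → Y} (hf : Continuous f) (A : ℝ) {η : ℝ} (hη : 0 < η) :
    ∀ᶠ h in nhdsWithin (0:ℝ) (Ioi 0), ∀ z ∈ K, ∀ z' ∈ K, dist z z' ≤ A * h → dist (f z) (f z') ≤ η := by
  obtain ⟨δ, hδ, H⟩ := Metric.uniformContinuousOn_iff_le.1
    (hK.uniformContinuousOn_of_continuous hf.continuousOn) η hη
  have : ∀ᶠ h in nhdsWithin (0:ℝ) (Ioi 0), A * h < δ := by
    have : Continuous fun h : ℝ => A * h := by fun_prop
    have := (this.tendsto 0).mono_left (nhdsWithin_le_nhds (s := Ioi 0))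
    rw [mul_zero] at this
    exact this.eventually_lt_const hδ
  filter_upwards [this] with h hh z hz z' hz' hzz
  exact H z hz z' hz' (hzz.trans hh.le)

set_option maxHeartbeats 1000000 in
lemma grid_lem {n : ℕ} (Rm : Eu (n + 1) → Eu (n + 1)) (P : Eu (n + 1) → Eu (n + 1) →L[ℝ] Eu (n + 1))
    (hP : ∀ z, HasFDerivAt Rm (P z) z) (hPc : Continuous P)
    (hs : ∀ z, (P z : Eu (n + 1) →ₗ[ℝ] Eu (n + 1)).IsSymmetric) {κ : ℝ} (hκ : 0 < κ)
    (hm1 : ∀ z z', κ * ‖z - z'‖ ^ 2 ≤ ⟪Rm z - Rm z', z - z'⟫)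
    (hm2 : ∀ z z', ⟪Rm z - Rm z', z - z'⟫ ≤ (1 - κ) * ‖z - z'‖ ^ 2)
    (h1 : ∀ z w, κ * ‖w‖ ^ 2 ≤ ⟪P z w, w⟫) (h2 : ∀ z w, ⟪P z w, w⟫ ≤ (1 - κ) * ‖w‖ ^ 2)
    (hPn : ∀ z, ‖P z‖ ≤ 1) {K Ω0 Ω1 : Set (Eu (n + 1))} (hK : IsCompact K) (hΩ0 : IsOpen Ω0)
    (hΩ1 : IsOpen Ω1) (hK0 : ∀ z ∈ K, Rm z ∈ Ω0) (hK1 : ∀ z ∈ K, z - Rm z ∈ Ω1) {ε : ℝ} (hε : 0 < ε) :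
    ∃ E0 E1 : Set (Eu (n + 1)), E0 ⊆ Ω0 ∧ E1 ⊆ Ω1 ∧ MeasurableSet E0 ∧ MeasurableSet E1 ∧
      volume E0 = volume E1 ∧ volume E0 < ⊤ ∧
      (∫⁻ z in K, ENNReal.ofReal (sg (P z)) ≤ volume E0 + ENNReal.ofReal ε) ∧
      ∀ Pk : Set (Eu (n + 1)), MeasurableSet Pk → volume Pk < ⊤ →
        Disjoint (convexHull ℝ (Ω0 ∪ Ω1)) Pk →
        Conn (E0 ∪ Pk) (E1 ∪ Pk)
          ((∫⁻ z in K, ENNReal.ofReal (sg (P z) * ‖z - (2 : ℝ) • Rm z‖ ^ 2)) + ENNReal.ofReal ε) := by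
  have hRd : Differentiable ℝ Rm := fun z => (hP z).differentiableAt
  have hRc : Continuous Rm := hRd.continuous
  have hRl : ∀ z z', ‖Rm z - Rm z'‖ ≤ ‖z - z'‖ := by
    intro z z'
    have := convex_univ.norm_image_sub_le_of_norm_hasFDerivWithin_le (f := Rm) (f' := P) (C := 1)
      (x := z') (y := z) (fun x _ => (hP x).hasFDerivWithinAt) (fun x _ => hPn x) (mem_univ _) (mem_univ _)
    simpa using this
  have hκ1 : κ ≤ 1 - κ := by
    have a := (h1 0 (EuclideanSpace.single 0 1)).trans (h2 0 _)
    simpa using a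
  have hsgb : ∀ z, 0 ≤ sg (P z) ∧ sg (P z) ≤ 1 := fun z => sg_bd _ (hs z)
    (fun w => le_trans (by positivity) (h1 z w))
    (fun w => (h2 z w).trans (by nlinarith [sq_nonneg ‖w‖]))
  set C : ℝ := 3 * (n + 1) * (1 + (n + 1) / κ) with hC
  have hC0 : 0 < C := by positivity
  set K' := Metric.cthickening 1 K with hK'
  have hK'c : IsCompact K' := hK.cthickening
  have hKK' : K ⊆ K' := Metric.self_subset_cthickening _
  have hK'm : MeasurableSet K' := hK'c.isClosed.measurableSet
  set V : ℝ := volume.real K' with hV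
  have hV0 : 0 ≤ V := measureReal_nonneg
  have hVe : volume K' = ENNReal.ofReal V := (ofReal_measureReal hK'c.measure_lt_top.ne).symm
  let H : Eu (n + 1) × ℝ → ℝ := fun p => sg (P p.1) * (‖p.1 - (2 : ℝ) • Rm p.1‖ + p.2) ^ 2
  have hSc : Continuous fun z => sg (P z) := sg_cont.comp hPc
  have hHc : Continuous H := (hSc.comp continuous_fst).mul (by fun_prop)
  let F : Eu (n + 1) → ℝ := fun z => H (z, 0)
  have hFc : Continuous F := hHc.comp (by fun_prop)
  have hF0 : ∀ z, 0 ≤ F z := fun z => mul_nonneg (hsgb z).1 (sq_nonneg _)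
  obtain ⟨M0, hM0⟩ := hK'c.bddAbove_image hFc.continuousOn
  set M := max M0 0 with hM
  have hMF : ∀ z ∈ K', F z ≤ M := fun z hz => (hM0 (mem_image_of_mem F hz)).trans (le_max_left _ _)
  have hM00 : 0 ≤ M := le_max_right _ _
  set η : ℝ := ε / (2 * (V + 1)) with hη
  have hη0 : 0 < η := by positivity
  have hηV : η * V ≤ ε / 2 := by
    rw [hη, div_mul_eq_mul_div, div_le_iff₀ (by positivity)]; nlinarith
  set θ : ℝ := min 1 (ε / (2 * (n + 1) * (V + 1))) with hθ
  have hθ0 : 0 < θ := lt_min one_pos (by positivity)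
  have hθV : (n + 1) * θ * V ≤ ε / 2 := by
    have : θ ≤ ε / (2 * (n + 1) * (V + 1)) := min_le_right _ _
    rw [le_div_iff₀ (by positivity)] at this
    nlinarith [mul_nonneg (mul_nonneg (by positivity : (0:ℝ) ≤ n + 1) hθ0.le) hV0]
  set ω : ℝ := κ * θ / (4 * (n + 1)) with hω
  have hω0 : 0 < ω := by positivity
  have hωlt : 2 * ω * (n + 1) < κ * θ := by
    have : 2 * ω * (n + 1) = κ * θ / 2 := by rw [hω]; field_simp; norm_num
    rw [this]; exact half_lt_self (by positivity)
  set e1 : ℝ := ε / (2 * (M + 1)) with he1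
  have he10 : 0 < e1 := by positivity
  have hMe : M * e1 ≤ ε / 2 := by
    rw [he1, mul_div_assoc', div_le_iff₀ (by positivity)]; nlinarith
  obtain ⟨δ0, hδ0, hd0⟩ := (hK.image hRc).exists_thickening_subset_open hΩ0 (by
    rintro _ ⟨z, hz, rfl⟩; exact hK0 z hz)
  obtain ⟨δ1, hδ1, hd1⟩ := (hK.image (continuous_id.sub hRc)).exists_thickening_subset_open hΩ1 (by
    rintro _ ⟨z, hz, rfl⟩; exact hK1 z hz)
  have ht0 : ∀ A : ℝ, Filter.Tendsto (fun h : ℝ => A * h) (nhdsWithin (0:ℝ) (Ioi 0)) (nhds 0) := by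
    intro A
    have : Continuous fun h : ℝ => A * h := by fun_prop
    have := (this.tendsto 0).mono_left (nhdsWithin_le_nhds (s := Ioi 0))
    simpa using this
  have evol : ∀ᶠ h in nhdsWithin (0:ℝ) (Ioi 0),
      volume (Metric.cthickening (2 * (n + 1) * h) K) < volume K + ENNReal.ofReal e1 := by
    have := (tendsto_measure_cthickening_of_isCompact (μ := volume) hK).comp (ht0 (2 * (n + 1)))
    refine this.eventually_lt_const ?_
    exact ENNReal.lt_add_right hK.measure_lt_top.ne (by simpa using he10)
  obtain ⟨h, hh, eP, eS, eH, ev, q1, q2, q3, q4⟩ := (eventually_mem_nhdsWithin.and <|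
    (uc_ev hK'c hPc (n + 1) hω0).and <| (uc_ev hK'c hSc (n + 1) hη0).and <|
    (uc_ev (hK'c.prod (isCompact_Icc (a := (0:ℝ)) (b := 1))) hHc (n + 1 + C) hη0).and <| evol.and <|
    ((ht0 (2 * (n + 1))).eventually_lt_const one_pos).and <|
    ((ht0 (2 * (n + 1))).eventually_lt_const hδ0).and <|
    ((ht0 (4 * (n + 1))).eventually_lt_const hδ1).and <|
    ((ht0 C).eventually_lt_const one_pos)).exists
  have hh : 0 < h := hh
  set J : Set (Fin (n + 1) → ℤ) := {k | ∃ z ∈ K, kk h z = k} with hJ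
  set X' : Set (Eu (n + 1)) := {y | kk h y ∈ J ∧ y ∈ cub h θ (kk h y)} with hX'
  have hnh : 0 < (n + 1) * h := by positivity
  have hkd : ∀ y : Eu (n + 1), ‖y - cc h (kk h y)‖ ≤ (n + 1) * h := fun y => by
    simpa using kk_dist hh y
  have memK' : ∀ z ∈ K, ∀ y, ‖y - z‖ ≤ 2 * (n + 1) * h → y ∈ K' := by
    intro z hz y hy
    exact Metric.mem_cthickening_of_dist_le y z 1 K hz (by rw [dist_eq_norm]; linarith)
  have hcJ : ∀ k ∈ J, ∃ z ∈ K, ‖z - cc h k‖ ≤ (n + 1) * h := by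
    rintro k ⟨z, hz, rfl⟩; exact ⟨z, hz, hkd z⟩
  have hcK' : ∀ k ∈ J, cc h k ∈ K' := by
    intro k hk
    obtain ⟨z, hz, hz'⟩ := hcJ k hk
    refine memK' z hz _ ?_
    rw [norm_sub_rev]; linarith
  have hJsub : {y | kk h y ∈ J} ⊆ Metric.cthickening (2 * (n + 1) * h) K := by
    intro y hy
    obtain ⟨z, hz, hz'⟩ := hcJ _ hy
    refine Metric.mem_cthickening_of_dist_le y z _ K hz ?_
    have := norm_sub_le_norm_sub_add_norm_sub y (cc h (kk h y)) z
    rw [dist_eq_norm]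
    rw [norm_sub_rev] at hz'
    linarith [hkd y]
  have hcth : Metric.cthickening (2 * (n + 1) * h) K ⊆ K' := Metric.cthickening_mono q1.le K
  have hX'sub : X' ⊆ Metric.cthickening (2 * (n + 1) * h) K := fun y hy => hJsub hy.1
  have hX'f : volume X' < ⊤ := (measure_mono (hX'sub.trans hcth)).trans_lt hK'c.measure_lt_top
  have hJm : MeasurableSet {y : Eu (n + 1) | kk h y ∈ J} := kk_meas h (J.to_countable.measurableSet)
  obtain ⟨hXm, hmf, g, g', hg, hg', hgd, hgc, hinj, hch, hgb⟩ := grid_core Rm P hP hs hκ hm1 hm2 h1 h2 hPn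
    hh hθ0 hωlt J (fun k hk z hz => by
      rw [← dist_eq_norm]
      obtain ⟨z0, hz0, hz0'⟩ := hcJ k hk
      rw [Metric.mem_closedBall] at hz
      refine eP z (memK' z0 hz0 z ?_) _ (hcK' k hk) hz
      have := norm_sub_le_norm_sub_add_norm_sub z (cc h k) z0
      rw [dist_eq_norm] at hz
      rw [norm_sub_rev] at hz0'
      linarith) hX' hX'f rfl
  set m := (volume.restrict X').withDensity fun y => ENNReal.ofReal
      (min (P (cc h (kk h y))).det (ContinuousLinearMap.id ℝ (Eu (n + 1)) - P (cc h (kk h y))).det) with hm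
  have hσm : Measurable fun y => ENNReal.ofReal (sg (P (cc h (kk h y)))) := by
    have : Measurable fun k : Fin (n + 1) → ℤ => ENNReal.ofReal (sg (P (cc h k))) :=
      measurable_of_countable _
    exact this.comp (kk_meas h)
  have hgt : ∀ t, Measurable fun x => g (t, x) := fun t => hg.comp measurable_prodMk_left
  have i0 : (0:ℝ) ∈ Icc (0:ℝ) 1 := by simp
  have i1 : (1:ℝ) ∈ Icc (0:ℝ) 1 := by simp
  have himv : ∀ t ∈ Icc (0:ℝ) 1, volume ((fun x => g (t, x)) '' X') = m univ := by
    intro t ht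
    have := congrArg (fun μ => μ univ) (hch t ht)
    simp only [Measure.restrict_apply_univ] at this
    rw [← this, Measure.map_apply (hgt t) MeasurableSet.univ, preimage_univ]
  have him : ∀ t ∈ Icc (0:ℝ) 1, MeasurableSet ((fun x => g (t, x)) '' X') := fun t ht =>
    hXm.image_of_measurable_injOn (hgt t) (hinj t ht)
  have hc0 : ∀ k ∈ J, ∀ w : Eu (n + 1), ‖w‖ ≤ (n + 1) * h → Rm (cc h k) + P (cc h k) w ∈ Ω0 := by
    intro k hk w hw
    obtain ⟨z, hz, hz'⟩ := hcJ k hk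
    refine hd0 (Metric.mem_thickening_iff.2 ⟨Rm z, mem_image_of_mem _ hz, ?_⟩)
    rw [dist_eq_norm]
    have a := (P (cc h k)).le_of_opNorm_le (hPn _) w
    have b := hRl (cc h k) z
    have c := norm_add_le (Rm (cc h k) - Rm z) (P (cc h k) w)
    rw [show Rm (cc h k) + P (cc h k) w - Rm z = Rm (cc h k) - Rm z + P (cc h k) w by abel]
    rw [norm_sub_rev] at hz'
    linarith
  have hc1 : ∀ k ∈ J, ∀ w : Eu (n + 1), ‖w‖ ≤ (n + 1) * h →
      (cc h k - Rm (cc h k)) + (w - P (cc h k) w) ∈ Ω1 := by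
    intro k hk w hw
    obtain ⟨z, hz, hz'⟩ := hcJ k hk
    refine hd1 (Metric.mem_thickening_iff.2 ⟨z - Rm z, mem_image_of_mem _ hz, ?_⟩)
    rw [dist_eq_norm]
    have a := (P (cc h k)).le_of_opNorm_le (hPn _) w
    have b := hRl (cc h k) z
    have c := norm_add_le ((cc h k - z) - (Rm (cc h k) - Rm z)) (w - P (cc h k) w)
    have c2 := norm_sub_le (cc h k - z) (Rm (cc h k) - Rm z)
    have c3 := norm_sub_le w (P (cc h k) w)
    rw [show cc h k - Rm (cc h k) + (w - P (cc h k) w) - (z - Rm z) =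
      (cc h k - z) - (Rm (cc h k) - Rm z) + (w - P (cc h k) w) by abel]
    rw [norm_sub_rev] at hz'
    linarith
  have hpt : ∀ x ∈ X', ∀ t ∈ Icc (0:ℝ) 1, ∃ a ∈ Ω0, ∃ b ∈ Ω1, g (t, x) = (1 - t) • a + t • b := by
    intro x hx t ht
    obtain ⟨c, rfl, hc⟩ := hgb x
    obtain ⟨⟨w, hw, e⟩, -⟩ := hc t ht
    exact ⟨_, hc0 _ hx.1 w hw, _, hc1 _ hx.1 w hw, e⟩
  have hKX : volume (K \ X') ≤ ENNReal.ofReal (ε / 2) := by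
    have a : K \ X' ⊆ {y | kk h y ∈ J ∧ y ∉ cub h θ (kk h y)} := by
      rintro y ⟨hy, hy'⟩
      exact ⟨⟨y, hy, rfl⟩, fun h3 => hy' ⟨⟨y, hy, rfl⟩, h3⟩⟩
    refine (measure_mono a).trans ((bad_vol hh hθ0.le (min_le_left _ _) J).trans ?_)
    refine (mul_le_mul_right (measure_mono (hJsub.trans hcth)) _).trans ?_
    rw [hVe, ← ENNReal.ofReal_mul (by positivity)]
    refine ENNReal.ofReal_le_ofReal ?_
    push_cast; exact hθV
  refine ⟨_, _, ?_, ?_, him 0 i0, him 1 i1, (himv 0 i0).trans (himv 1 i1).symm, ?_, ?_, ?_⟩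
  · rintro _ ⟨x, hx, rfl⟩
    obtain ⟨a, ha, b, hb, e⟩ := hpt x hx 0 i0
    simp only [e]; simpa using ha
  · rintro _ ⟨x, hx, rfl⟩
    obtain ⟨a, ha, b, hb, e⟩ := hpt x hx 1 i1
    simp only [e]; simpa using hb
  · rw [himv 0 i0]; exact measure_lt_top _ _
  · rw [himv 0 i0]
    have hmu : m univ = ∫⁻ y in X', ENNReal.ofReal (sg (P (cc h (kk h y)))) := by
      rw [hm, withDensity_apply _ MeasurableSet.univ, Measure.restrict_univ]; rfl
    rw [hmu]
    have hKm : MeasurableSet K := hK.isClosed.measurableSet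
    calc ∫⁻ z in K, ENNReal.ofReal (sg (P z))
        ≤ ∫⁻ z in (K ∩ X') ∪ (K \ X'), ENNReal.ofReal (sg (P z)) := by rw [inter_union_sdiff]
      _ ≤ (∫⁻ z in K ∩ X', ENNReal.ofReal (sg (P z))) + ∫⁻ z in K \ X', ENNReal.ofReal (sg (P z)) :=
          lintegral_union_le _ _ _
      _ ≤ (∫⁻ z in K ∩ X', (ENNReal.ofReal (sg (P (cc h (kk h z)))) + ENNReal.ofReal η)) +
            ∫⁻ z in K \ X', 1 := by
          refine add_le_add (setLIntegral_mono (hσm.add_const _) fun z hz => ?_)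
            (lintegral_mono fun z => ENNReal.ofReal_le_one.2 (hsgb z).2)
          rw [← ENNReal.ofReal_add (hsgb _).1 hη0.le]
          refine ENNReal.ofReal_le_ofReal ?_
          have := eS z (hKK' hz.1) (cc h (kk h z)) (hcK' _ hz.2.1) (by rw [dist_eq_norm]; exact hkd z)
          rw [Real.dist_eq] at this
          linarith [(abs_le.1 this).2]
      _ ≤ (∫⁻ y in X', ENNReal.ofReal (sg (P (cc h (kk h y))))) + ENNReal.ofReal (ε / 2) +
            ENNReal.ofReal (ε / 2) := by
          rw [lintegral_add_right _ measurable_const]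
          refine add_le_add (add_le_add (lintegral_mono_set inter_subset_right) ?_) ?_
          · rw [setLIntegral_const]
            refine (mul_le_mul_right (measure_mono (inter_subset_left.trans hKK')) _).trans ?_
            rw [hVe, ← ENNReal.ofReal_mul hη0.le]
            exact ENNReal.ofReal_le_ofReal hηV
          · simpa using hKX
      _ = _ := by
          rw [add_assoc, ← ENNReal.ofReal_add (by positivity) (by positivity), add_halves]
  · intro Pk hPk hPf hdis
    set cost := ∫⁻ p, ‖g' p‖ₑ ^ 2 ∂((volume.restrict (Icc (0:ℝ) 1)).prod m) with hcost
    have hcb : cost ≤ (∫⁻ z in K, ENNReal.ofReal (sg (P z) * ‖z - (2 : ℝ) • Rm z‖ ^ 2)) +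
        ENNReal.ofReal ε := by
      have hKm : MeasurableSet K := hK.isClosed.measurableSet
      set Kh := Metric.cthickening (2 * (n + 1) * h) K with hKh
      have hKhm : MeasurableSet Kh := Metric.isClosed_cthickening.measurableSet
      have a1 : cost ≤ ∫⁻ y in X', ENNReal.ofReal (F y + η) := by
        rw [hcost, lintegral_prod _ (by fun_prop)]
        have : ∀ t ∈ Icc (0:ℝ) 1, ∫⁻ y, ‖g' (t, y)‖ₑ ^ 2 ∂m ≤ ∫⁻ y in X', ENNReal.ofReal (F y + η) := by
          intro t ht
          have hgm : Measurable fun y => ‖g' (t, y)‖ₑ ^ 2 := by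
            have : Measurable fun y => g' (t, y) := hg'.comp measurable_prodMk_left
            fun_prop
          have hm' : m = (volume.restrict X').withDensity fun y =>
            ENNReal.ofReal (sg (P (cc h (kk h y)))) := hm
          rw [hm', lintegral_withDensity_eq_lintegral_mul _ hσm hgm]
          refine setLIntegral_mono (by fun_prop) fun y hy => ?_
          obtain ⟨c, rfl, hc⟩ := hgb y
          have hb := (hc t ht).2
          set c := cc h (kk h y)
          have : ‖g' (t, y)‖ₑ ^ 2 ≤ ENNReal.ofReal ((‖c - (2:ℝ) • Rm c‖ + C * h) ^ 2) := by
            rw [← ofReal_norm, ← ENNReal.ofReal_pow (norm_nonneg _)]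
            exact ENNReal.ofReal_le_ofReal (pow_le_pow_left₀ (norm_nonneg _) hb 2)
          refine (mul_le_mul_right this _).trans ?_
          change ENNReal.ofReal (sg (P c)) * _ ≤ _
          rw [← ENNReal.ofReal_mul (hsgb c).1]
          refine ENNReal.ofReal_le_ofReal ?_
          have hd := eH (c, C * h) ⟨hcK' _ hy.1, ⟨by positivity, q4.le⟩⟩ (y, 0)
            ⟨hcth (hX'sub hy), by simp⟩ (by
              rw [Prod.dist_eq]
              refine max_le ?_ ?_
              · rw [dist_comm, dist_eq_norm]
                refine (hkd y).trans ?_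
                nlinarith
              · simp only [dist_zero_right, Real.norm_eq_abs]
                rw [abs_of_pos (by positivity)]
                nlinarith)
          rw [Real.dist_eq] at hd
          have := (abs_le.1 hd).2
          simp only [F]
          linarith
        calc _ ≤ ∫⁻ t in Icc (0:ℝ) 1, ∫⁻ y in X', ENNReal.ofReal (F y + η) :=
              setLIntegral_mono measurable_const this
          _ = _ := by simp
      refine a1.trans ?_
      calc ∫⁻ y in X', ENNReal.ofReal (F y + η) ≤ ∫⁻ y in Kh, ENNReal.ofReal (F y + η) :=
            lintegral_mono_set hX'sub
        _ = (∫⁻ y in Kh, ENNReal.ofReal (F y)) + ENNReal.ofReal η * volume Kh := by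
            rw [← setLIntegral_const, ← lintegral_add_right _ measurable_const]
            refine lintegral_congr fun y => ?_
            rw [ENNReal.ofReal_add (hF0 y) hη0.le]
        _ ≤ ((∫⁻ y in K, ENNReal.ofReal (F y)) + ENNReal.ofReal (ε / 2)) + ENNReal.ofReal (ε / 2) := by
            refine add_le_add ?_ ?_
            · have hs : Kh = K ∪ (Kh \ K) := by
                rw [union_sdiff_self, union_eq_self_of_subset_left (Metric.self_subset_cthickening _)]
              calc ∫⁻ y in Kh, ENNReal.ofReal (F y)
                  = ∫⁻ y in K ∪ (Kh \ K), ENNReal.ofReal (F y) := by rw [← hs]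
                _ ≤ (∫⁻ y in K, ENNReal.ofReal (F y)) + ∫⁻ y in Kh \ K, ENNReal.ofReal (F y) :=
                  lintegral_union_le _ _ _
                _ ≤ _ := by
                  refine add_le_add le_rfl ?_
                  calc _ ≤ ∫⁻ y in Kh \ K, ENNReal.ofReal M :=
                        setLIntegral_mono measurable_const fun y hy =>
                          ENNReal.ofReal_le_ofReal (hMF y (hcth hy.1))
                    _ = ENNReal.ofReal M * volume (Kh \ K) := setLIntegral_const _ _
                    _ ≤ ENNReal.ofReal M * ENNReal.ofReal e1 := by
                        refine mul_le_mul_right ?_ _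
                        rw [measure_sdiff (Metric.self_subset_cthickening _) hKm.nullMeasurableSet
                          hK.measure_lt_top.ne]
                        rw [tsub_le_iff_left]
                        exact ev.le
                    _ ≤ _ := by
                        rw [← ENNReal.ofReal_mul hM00]
                        exact ENNReal.ofReal_le_ofReal hMe
            · refine (mul_le_mul_right (measure_mono hcth) _).trans ?_
              rw [hVe, ← ENNReal.ofReal_mul hη0.le]
              exact ENNReal.ofReal_le_ofReal hηV
        _ = _ := by
            rw [add_assoc, ← ENNReal.ofReal_add (by positivity) (by positivity), add_halves]
            simp [F, H]
    refine Conn.mono ?_ hcb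
    refine lagrP m g g' hg hg' hgd hgc ?_ X' hXm ?_ hinj hch Pk hPk hPf ?_
    · refine hcb.trans_lt (ENNReal.add_lt_top.2 ⟨?_, ENNReal.ofReal_lt_top⟩)
      have : ContinuousOn F K := hFc.continuousOn
      have := (this.integrableOn_compact hK (μ := volume)).lintegral_lt_top
      simpa [F, H] using this
    · rw [hm, withDensity_apply _ hXm.compl, Measure.restrict_restrict hXm.compl]; simp
    · intro t ht x hx hxP
      obtain ⟨a, ha, b, hb, e⟩ := hpt x hx t ht
      refine disjoint_left.1 hdis ?_ hxP
      rw [e]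
      have ha' : a ∈ convexHull ℝ (Ω0 ∪ Ω1) := subset_convexHull ℝ _ (Or.inl ha)
      have hb' : b ∈ convexHull ℝ (Ω0 ∪ Ω1) := subset_convexHull ℝ _ (Or.inr hb)
      exact (convex_convexHull ℝ (Ω0 ∪ Ω1)) ha' hb'
        (sub_nonneg.2 ht.2) ht.1 (by ring)

open Set MeasureTheory ProbabilityTheory
open scoped ENNReal RealInnerProductSpace

lemma mono_deriv {d : ℕ} {Rm : Eu d → Eu d} {A : Eu d →L[ℝ] Eu d} {z : Eu d} (hA : HasFDerivAt Rm A z)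
    {a b : ℝ} (h1 : ∀ z z', a * ‖z - z'‖ ^ 2 ≤ ⟪Rm z - Rm z', z - z'⟫)
    (h2 : ∀ z z', ⟪Rm z - Rm z', z - z'⟫ ≤ b * ‖z - z'‖ ^ 2) (w : Eu d) :
    a * ‖w‖ ^ 2 ≤ ⟪A w, w⟫ ∧ ⟪A w, w⟫ ≤ b * ‖w‖ ^ 2 := by
  have h3 : HasDerivAt (fun s : ℝ => Rm (z + s • w)) (A w) 0 := hA.hasLineDerivAt w
  have h4 := h3.tendsto_slope_zero
  have h5 : Filter.Tendsto (fun s : ℝ => ⟪s⁻¹ • (Rm (z + (0 + s) • w) - Rm (z + (0:ℝ) • w)), w⟫)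
      (nhdsWithin 0 {0}ᶜ) (nhds ⟪A w, w⟫) := h4.inner tendsto_const_nhds
  have key : ∀ s : ℝ, s ≠ 0 → a * ‖w‖ ^ 2 ≤ ⟪s⁻¹ • (Rm (z + (0 + s) • w) - Rm (z + (0:ℝ) • w)), w⟫ ∧
      ⟪s⁻¹ • (Rm (z + (0 + s) • w) - Rm (z + (0:ℝ) • w)), w⟫ ≤ b * ‖w‖ ^ 2 := by
    intro s hs
    have i1 := h1 (z + (0 + s) • w) (z + (0:ℝ) • w)
    have i2 := h2 (z + (0 + s) • w) (z + (0:ℝ) • w)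
    set D := Rm (z + (0 + s) • w) - Rm (z + (0:ℝ) • w)
    have e : z + (0 + s) • w - (z + (0:ℝ) • w) = s • w := by module
    rw [e, norm_smul, mul_pow, real_inner_smul_right, Real.norm_eq_abs, sq_abs] at i1 i2
    rw [real_inner_smul_left]
    have hs2 : 0 < s ^ 2 := by positivity
    have e2 : s * ⟪D, w⟫ = s ^ 2 * (s⁻¹ * ⟪D, w⟫) := by field_simp
    rw [e2] at i1 i2
    constructor
    · refine le_of_mul_le_mul_left ?_ hs2; linarith
    · refine le_of_mul_le_mul_left ?_ hs2; linarith
  constructor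
  · refine ge_of_tendsto h5 ?_
    filter_upwards [self_mem_nhdsWithin] with s hs using (key s hs).1
  · refine le_of_tendsto h5 ?_
    filter_upwards [self_mem_nhdsWithin] with s hs using (key s hs).2

/-- the real inner product as a bilinear continuous map -/
noncomputable def ipB (d : ℕ) : Eu d →L[ℝ] Eu d →L[ℝ] ℝ :=
  (isBoundedBilinearMap_inner (𝕜 := ℝ) (E := Eu d)).toContinuousLinearMap

lemma ipB_apply {d : ℕ} (x y : Eu d) : ipB d x y = ⟪x, y⟫ := rfl

lemma grad_symm {d : ℕ} {Rm : Eu d → Eu d} {φ : Eu d → ℝ} (hφ : ∀ z, HasGradientAt φ (Rm z) z)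
    {A : Eu d →L[ℝ] Eu d} {z : Eu d} (hA : HasFDerivAt Rm A z) :
    (A : Eu d →ₗ[ℝ] Eu d).IsSymmetric := by
  have h1 : HasFDerivAt (fun z => ipB d (Rm z)) ((ipB d).comp A) z := (ipB d).hasFDerivAt.comp z hA
  have h2 : ∀ y, HasFDerivAt φ (ipB d (Rm y)) y := fun y => by
    have := (hφ y).hasFDerivAt
    have e : ipB d (Rm y) = (InnerProductSpace.toDual ℝ (Eu d)) (Rm y) := by
      ext v; simp [ipB_apply]
    rw [e]; exact this
  intro x y
  have := second_derivative_symmetric_of_eventually (Filter.Eventually.of_forall h2) h1 x y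
  simp only [ContinuousLinearMap.comp_apply, ipB_apply] at this
  simp only [ContinuousLinearMap.coe_coe]
  rw [this, real_inner_comm]

lemma moll_one {d : ℕ} {Rm : Eu d → Eu d} {φ : Eu d → ℝ} (hφ : ∀ z, HasGradientAt φ (Rm z) z)
    (hl : LipschitzWith 1 Rm) (hmn : ∀ z z', 0 ≤ ⟪Rm z - Rm z', z - z'⟫)
    (η : ContDiffBump (0 : Eu d)) :
    ∃ (Re : Eu d → Eu d) (Pe : Eu d → Eu d →L[ℝ] Eu d), (∀ z, HasFDerivAt Re (Pe z) z) ∧ Continuous Pe ∧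
      (∀ z, (Pe z : Eu d →ₗ[ℝ] Eu d).IsSymmetric) ∧
      (∀ z z', 0 ≤ ⟪Re z - Re z', z - z'⟫) ∧ (∀ z z', ⟪Re z - Re z', z - z'⟫ ≤ ‖z - z'‖ ^ 2) ∧
      (∀ z, ‖Pe z‖ ≤ 1) ∧ (∀ z, ‖Re z - Rm z‖ ≤ η.rOut) ∧
      Pe = convolution (η.normed volume) (fderiv ℝ Rm) (ContinuousLinearMap.lsmul ℝ ℝ) volume := by
  set N := η.normed (volume : Measure (Eu d)) with hN
  have hNc : Continuous N := η.continuous_normed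
  have hNs : HasCompactSupport N := η.hasCompactSupport_normed
  have hNi : Integrable N := η.integrable_normed
  have hN0 : ∀ w, 0 ≤ N w := η.nonneg_normed
  have hN1 : ∫ w, N w = 1 := η.integral_normed
  have hRc : Continuous Rm := hl.continuous
  have hPm : Measurable (fderiv ℝ Rm) := measurable_fderiv ℝ Rm
  have hPb : ∀ z, ‖fderiv ℝ Rm z‖ ≤ 1 := fun z => by
    simpa using norm_fderiv_le_of_lipschitz ℝ hl
  have hPli : LocallyIntegrable (fderiv ℝ Rm) volume :=
    (memLp_top_of_bound hPm.aestronglyMeasurable 1 (Filter.Eventually.of_forall hPb)).locallyIntegrable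
      (by simp)
  set Pe := convolution N (fderiv ℝ Rm) (ContinuousLinearMap.lsmul ℝ ℝ) volume with hPe
  set Re := convolution N Rm (ContinuousLinearMap.lsmul ℝ ℝ) volume with hRe
  have hRe' : ∀ z, Re z = ∫ w, N w • Rm (z - w) := fun z => rfl
  have hPe' : ∀ z, Pe z = ∫ w, N w • fderiv ℝ Rm (z - w) := fun z => rfl
  have hRint : ∀ z, Integrable fun w => N w • Rm (z - w) := by
    intro z
    have c : Continuous fun w => N w • Rm (z - w) := by fun_prop
    exact c.integrable_of_hasCompactSupport hNs.smul_right
  have hPint : ∀ z, Integrable fun w => N w • fderiv ℝ Rm (z - w) := by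
    intro z
    refine hNi.norm.mono' (Measurable.aestronglyMeasurable ?_) (Filter.Eventually.of_forall fun w => ?_)
    · exact hNc.measurable.smul (hPm.comp (by fun_prop))
    · rw [norm_smul]
      exact mul_le_of_le_one_right (norm_nonneg _) (hPb _)
  have hder : ∀ z, HasFDerivAt Re (Pe z) z := by
    intro z
    refine (hasFDerivAt_integral_of_dominated_loc_of_lip (μ := volume) (F := fun z w => N w • Rm (z - w))
      (F' := fun w => N w • fderiv ℝ Rm (z - w)) (bound := N) (s := univ) (x₀ := z) Filter.univ_mem
      (Filter.Eventually.of_forall fun z => (hRint z).aestronglyMeasurable) (hRint z)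
      (hPint z).aestronglyMeasurable (Filter.Eventually.of_forall fun w => ?_) hNi ?_).2
    · refine LipschitzOnWith.of_dist_le_mul fun x _ y _ => ?_
      rw [dist_eq_norm, ← smul_sub, norm_smul, Real.coe_nnabs, Real.norm_eq_abs]
      refine mul_le_mul_of_nonneg_left ?_ (abs_nonneg _)
      have := hl.dist_le_mul (x - w) (y - w)
      simpa [dist_eq_norm] using this
    · have hd := hl.ae_differentiableAt (μ := (volume : Measure (Eu d)))
      have hq := (Measure.measurePreserving_sub_left (volume : Measure (Eu d)) z).quasiMeasurePreserving.ae hd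
      filter_upwards [hq] with w hw
      have := (hw.hasFDerivAt.comp z ((hasFDerivAt_id z).sub_const w)).const_smul (N w)
      rw [ContinuousLinearMap.comp_id] at this
      exact this
  have hinn : ∀ z z', ⟪Re z - Re z', z - z'⟫ = ∫ w, N w * ⟪Rm (z - w) - Rm (z' - w), z - z'⟫ := by
    intro z z'
    rw [hRe', hRe', ← integral_sub (hRint z) (hRint z'), real_inner_comm, ← integral_inner]
    · refine integral_congr_ae (Filter.Eventually.of_forall fun w => ?_)
      simp only
      rw [← smul_sub, real_inner_smul_right, real_inner_comm]
    · exact (hRint z).sub (hRint z')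
  have hlip : LipschitzWith 1 Re := by
    refine LipschitzWith.of_dist_le_mul fun z z' => ?_
    rw [dist_eq_norm, hRe', hRe', ← integral_sub (hRint z) (hRint z')]
    refine (norm_integral_le_of_norm_le (hNi.mul_const ‖z - z'‖) (Filter.Eventually.of_forall fun w => ?_)).trans ?_
    · rw [← smul_sub, norm_smul, Real.norm_of_nonneg (hN0 w)]
      refine mul_le_mul_of_nonneg_left ?_ (hN0 w)
      have := hl.dist_le_mul (z - w) (z' - w)
      simpa [dist_eq_norm] using this
    · rw [integral_mul_const, hN1]; simp [dist_eq_norm]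
  refine ⟨Re, Pe, hder, hNs.continuous_convolution_left _ hNc hPli, ?_, ?_, ?_, ?_, ?_, rfl⟩
  · intro z x y
    let L : (Eu d →L[ℝ] Eu d) →L[ℝ] ℝ :=
      ((ipB d).flip y).comp (ContinuousLinearMap.apply ℝ (Eu d) x) -
        ((ipB d) x).comp (ContinuousLinearMap.apply ℝ (Eu d) y)
    have hL : ∀ A, L A = ⟪A x, y⟫ - ⟪x, A y⟫ := fun A => rfl
    have h1 : L (Pe z) = 0 := by
      rw [hPe', ← L.integral_comp_comm (hPint z)]
      refine integral_eq_zero_of_ae (Filter.Eventually.of_forall fun w => ?_)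
      have hs : ∀ u, L (fderiv ℝ Rm u) = 0 := by
        intro u
        by_cases hu : DifferentiableAt ℝ Rm u
        · have := grad_symm hφ hu.hasFDerivAt x y
          rw [hL]
          simp only [ContinuousLinearMap.coe_coe] at this
          rw [this, sub_self]
        · rw [fderiv_zero_of_not_differentiableAt hu, map_zero]
      simp [hs]
    rw [hL] at h1
    exact sub_eq_zero.1 h1
  · intro z z'
    rw [hinn]
    refine integral_nonneg fun w => mul_nonneg (hN0 w) ?_
    have := hmn (z - w) (z' - w)
    rwa [sub_sub_sub_cancel_right] at this
  · intro z z'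
    refine (real_inner_le_norm _ _).trans ?_
    have := hlip.dist_le_mul z z'
    simp only [dist_eq_norm, NNReal.coe_one, one_mul] at this
    nlinarith [norm_nonneg (z - z')]
  · intro z
    simpa using (hder z).le_of_lipschitz hlip
  · intro z
    rw [← dist_eq_norm]
    refine ContDiffBump.dist_normed_convolution_le hRc.aestronglyMeasurable fun x hx => ?_
    have := hl.dist_le_mul x z
    rw [Metric.mem_ball] at hx
    simp only [NNReal.coe_one, one_mul] at this
    linarith

lemma moll_seq {d : ℕ} {Rm : Eu d → Eu d} {φ : Eu d → ℝ} (hφ : ∀ z, HasGradientAt φ (Rm z) z)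
    (hl : LipschitzWith 1 Rm) (hmn : ∀ z z', 0 ≤ ⟪Rm z - Rm z', z - z'⟫) :
    ∃ (Re : ℕ → Eu d → Eu d) (Pe : ℕ → Eu d → Eu d →L[ℝ] Eu d) (κ : ℕ → ℝ),
      (∀ j, 0 < κ j ∧ (∀ z, HasFDerivAt (Re j) (Pe j z) z) ∧ Continuous (Pe j) ∧
      (∀ z, (Pe j z : Eu d →ₗ[ℝ] Eu d).IsSymmetric) ∧
      (∀ z z', κ j * ‖z - z'‖ ^ 2 ≤ ⟪Re j z - Re j z', z - z'⟫) ∧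
      (∀ z z', ⟪Re j z - Re j z', z - z'⟫ ≤ (1 - κ j) * ‖z - z'‖ ^ 2) ∧
      (∀ z, ‖Pe j z‖ ≤ 1) ∧ (∀ z, ‖Re j z - Rm z‖ ≤ (1 + ‖z‖ + 2 * ‖Rm z‖) * (1 / ((j : ℝ) + 1)))) ∧
      ∀ᵐ z, Filter.Tendsto (fun j => Pe j z) Filter.atTop (nhds (fderiv ℝ Rm z)) := by
  let η : ℕ → ContDiffBump (0 : Eu d) := fun j =>
    ⟨1 / (2 * ((j : ℝ) + 1)), 1 / ((j : ℝ) + 1), by positivity, by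
      refine one_div_lt_one_div_of_lt (by positivity) ?_
      have : (0:ℝ) ≤ j := by positivity
      linarith⟩
  choose Re Pe h1 h2 h3 h4 h5 h6 h7 h8 using fun j => moll_one hφ hl hmn (η j)
  let κ : ℕ → ℝ := fun j => 1 / ((j : ℝ) + 3)
  have hκ0 : ∀ j, 0 < κ j := fun j => by positivity
  have hκ2 : ∀ j, κ j ≤ 1 / 3 := fun j => by
    refine one_div_le_one_div_of_le (by norm_num) ?_
    have : (0:ℝ) ≤ j := by positivity
    linarith
  have hκ3 : ∀ j, κ j ≤ 1 / ((j:ℝ) + 1) := fun j => by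
    refine one_div_le_one_div_of_le (by positivity) (by linarith)
  have hlim1 : Filter.Tendsto (fun j : ℕ => 1 / ((j:ℝ) + 1)) Filter.atTop (nhds 0) :=
    tendsto_one_div_add_atTop_nhds_zero_nat
  have hκl : Filter.Tendsto κ Filter.atTop (nhds 0) :=
    squeeze_zero (fun j => (hκ0 j).le) hκ3 hlim1
  refine ⟨fun j z => (1 - 2 * κ j) • Re j z + κ j • z,
    fun j z => (1 - 2 * κ j) • Pe j z + κ j • ContinuousLinearMap.id ℝ (Eu d), κ, fun j => ?_, ?_⟩
  · have hc : 0 ≤ 1 - 2 * κ j := by linarith [hκ2 j]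
    refine ⟨hκ0 j, fun z => by
        have := ((h1 j z).const_smul (1 - 2 * κ j)).add ((hasFDerivAt_id z).const_smul (κ j))
        exact this,
      by have := h2 j; fun_prop, ?_, ?_, ?_, ?_, ?_⟩
    · intro z x y
      have := h3 j z x y
      simp only [ContinuousLinearMap.coe_coe] at this
      simp only [ContinuousLinearMap.coe_coe, add_apply, smul_apply, ContinuousLinearMap.id_apply,
        inner_add_left, inner_add_right, real_inner_smul_left, real_inner_smul_right, this]
    · intro z z'
      have e : (1 - 2 * κ j) • Re j z + κ j • z - ((1 - 2 * κ j) • Re j z' + κ j • z') =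
        (1 - 2 * κ j) • (Re j z - Re j z') + κ j • (z - z') := by module
      rw [e, inner_add_left, real_inner_smul_left, real_inner_smul_left, real_inner_self_eq_norm_sq]
      nlinarith [mul_nonneg hc (h4 j z z')]
    · intro z z'
      have e : (1 - 2 * κ j) • Re j z + κ j • z - ((1 - 2 * κ j) • Re j z' + κ j • z') =
        (1 - 2 * κ j) • (Re j z - Re j z') + κ j • (z - z') := by module
      rw [e, inner_add_left, real_inner_smul_left, real_inner_smul_left, real_inner_self_eq_norm_sq]
      nlinarith [mul_le_mul_of_nonneg_left (h5 j z z') hc]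
    · intro z
      refine (norm_add_le _ _).trans ?_
      rw [norm_smul, norm_smul, Real.norm_of_nonneg hc, Real.norm_of_nonneg (hκ0 j).le]
      have a := ContinuousLinearMap.norm_id_le (𝕜 := ℝ) (E := Eu d)
      nlinarith [h6 j z, hκ0 j]
    · intro z
      have e : (1 - 2 * κ j) • Re j z + κ j • z - Rm z =
        (1 - 2 * κ j) • (Re j z - Rm z) + κ j • (z - (2:ℝ) • Rm z) := by module
      rw [e]
      refine (norm_add_le _ _).trans ?_
      rw [norm_smul, norm_smul, Real.norm_of_nonneg hc, Real.norm_of_nonneg (hκ0 j).le]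
      have a : ‖Re j z - Rm z‖ ≤ 1 / ((j:ℝ) + 1) := h7 j z
      have b : ‖z - (2:ℝ) • Rm z‖ ≤ ‖z‖ + 2 * ‖Rm z‖ := by
        refine (norm_sub_le _ _).trans ?_
        rw [norm_smul, Real.norm_two]
      have c : κ j * ‖z - (2:ℝ) • Rm z‖ ≤ 1 / ((j:ℝ) + 1) * (‖z‖ + 2 * ‖Rm z‖) :=
        mul_le_mul (hκ3 j) b (norm_nonneg _) (by positivity)
      have c2 : (1 - 2 * κ j) * ‖Re j z - Rm z‖ ≤ 1 * (1 / ((j:ℝ) + 1)) :=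
        mul_le_mul (by linarith [hκ0 j]) a (norm_nonneg _) zero_le_one
      linarith
  · have hPm : Measurable (fderiv ℝ Rm) := measurable_fderiv ℝ Rm
    have hPb : ∀ z, ‖fderiv ℝ Rm z‖ ≤ 1 := fun z => by
      simpa using norm_fderiv_le_of_lipschitz ℝ hl
    have hPli : LocallyIntegrable (fderiv ℝ Rm) volume :=
      (memLp_top_of_bound hPm.aestronglyMeasurable 1 (Filter.Eventually.of_forall hPb)).locallyIntegrable
        (by simp)
    have := ContDiffBump.ae_convolution_tendsto_right_of_locallyIntegrable (φ := η) (K := 2)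
      (μ := (volume : Measure (Eu d))) (l := Filter.atTop) hlim1
      (Filter.Eventually.of_forall fun j => by
        change 1 / ((j:ℝ) + 1) ≤ 2 * (1 / (2 * ((j:ℝ) + 1)))
        apply le_of_eq; field_simp) hPli
    filter_upwards [this] with z hz
    have hz' : Filter.Tendsto (fun j => Pe j z) Filter.atTop (nhds (fderiv ℝ Rm z)) := by
      simpa only [h8] using hz
    have a : Filter.Tendsto (fun j => 1 - 2 * κ j) Filter.atTop (nhds (1 - 2 * 0)) :=
      tendsto_const_nhds.sub (hκl.const_mul 2)
    have := (a.smul hz').add (hκl.smul_const (ContinuousLinearMap.id ℝ (Eu d)))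
    have e : (1 - 2 * 0 : ℝ) • fderiv ℝ Rm z + (0:ℝ) • ContinuousLinearMap.id ℝ (Eu d) =
        fderiv ℝ Rm z := by
      ext1 v; simp
    rw [e] at this
    exact this

open Set MeasureTheory ProbabilityTheory
open scoped ENNReal RealInnerProductSpace

lemma lip_vol {d : ℕ} {f : Eu d → Eu d} {s : Set (Eu d)} {L : NNReal} (h : LipschitzOnWith L f s) :
    volume (f '' s) ≤ (L : ℝ≥0∞) ^ d * volume s := by
  have hfr : Module.finrank ℝ (Eu d) = d := by simp
  have hH := isAddHaarMeasure_hausdorffMeasure (E := Eu d)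
  rw [hfr] at hH
  have e := Measure.isAddLeftInvariant_eq_smul (volume : Measure (Eu d)) (Measure.hausdorffMeasure (d : ℝ))
  have h2 := h.hausdorffMeasure_image_le (d := d) (by positivity)
  rw [ENNReal.rpow_natCast] at h2
  rw [e]
  simp only [Measure.smul_apply, ENNReal.smul_def, smul_eq_mul]
  rw [mul_left_comm]
  exact mul_le_mul_right h2 _

lemma sub_grad {d : ℕ} {ψ : Eu d → ℝ} (hψ : ConvexOn ℝ univ ψ) {x g : Eu d} (hg : HasGradientAt ψ g x)
    (y : Eu d) : ψ x + ⟪g, y - x⟫ ≤ ψ y := by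
  have h3 : HasDerivAt (fun s : ℝ => ψ (x + s • (y - x))) ⟪g, y - x⟫ 0 := by
    have := hg.hasFDerivAt.hasLineDerivAt (y - x)
    simp only [InnerProductSpace.toDual_apply_apply] at this
    exact this
  have h4 := h3.tendsto_slope_zero_right
  have h5 : ⟪g, y - x⟫ ≤ ψ y - ψ x := by
    refine le_of_tendsto h4 ?_
    filter_upwards [Ioc_mem_nhdsGT (zero_lt_one' ℝ)] with s hs
    have := hψ.2 (mem_univ x) (mem_univ y) (sub_nonneg.2 hs.2) hs.1.le (by ring)
    have e : (1 - s) • x + s • y = x + (0 + s) • (y - x) := by module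
    rw [e] at this
    simp only [smul_eq_mul] at this ⊢
    rw [zero_smul, add_zero, inv_mul_le_iff₀ hs.1]
    linarith
  linarith

/-- good set of points for the Brenier map -/
def BD {d : ℕ} (Ω0 Ω1 : Set (Eu d)) (ψ : Eu d → ℝ) (T : Eu d → Eu d) (D : Set (Eu d)) : Prop :=
  MeasurableSet D ∧ D ⊆ Ω0 ∧ volume (Ω0 \ D) = 0 ∧
    ∀ x ∈ D, HasGradientAt ψ (T x) x ∧ T x ∈ Ω1 ∧ ∀ y, ψ x + ⟪T x, y - x⟫ ≤ ψ y

lemma exists_BD {d : ℕ} {Ω0 Ω1 : Set (Eu d)} (h0 : IsOpen Ω0) (h1 : IsOpen Ω1) {ψ : Eu d → ℝ}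
    (hψ : ConvexOn ℝ univ ψ) {T : Eu d → Eu d} (hT : Measurable T)
    (hgrad : ∀ᵐ x, HasGradientAt ψ (T x) x)
    (hpush : (volume.restrict Ω0).map T = volume.restrict Ω1) : ∃ D, BD Ω0 Ω1 ψ T D := by
  have a : ∀ᵐ x ∂(volume.restrict Ω0), T x ∈ Ω1 := by
    have : ∀ᵐ y ∂((volume.restrict Ω0).map T), y ∈ Ω1 := by
      rw [hpush]; exact ae_restrict_mem h1.measurableSet
    exact ae_of_ae_map hT.aemeasurable this
  have b : ∀ᵐ x ∂(volume.restrict Ω0), HasGradientAt ψ (T x) x ∧ T x ∈ Ω1 :=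
    (ae_restrict_of_ae hgrad).and a
  obtain ⟨N, hN, hNm, hN0⟩ := exists_measurable_superset_of_null (ae_iff.1 b)
  refine ⟨Ω0 \ N, h0.measurableSet.diff hNm, sdiff_subset, ?_, fun x hx => ?_⟩
  · rw [Measure.restrict_apply hNm] at hN0
    refine measure_mono_null (fun x hx => ?_) hN0
    refine ⟨?_, hx.1⟩
    by_contra h
    exact hx.2 ⟨hx.1, h⟩
  · have : HasGradientAt ψ (T x) x ∧ T x ∈ Ω1 := by
      by_contra h
      exact hx.2 (hN h)
    exact ⟨this.1, this.2, sub_grad hψ this.1⟩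

lemma resolv {d : ℕ} {ψ : Eu d → ℝ} (hψ : ConvexOn ℝ univ ψ) {r : ℝ} (hr : 0 ≤ r) :
    ∃ (Rm : Eu d → Eu d) (φ : Eu d → ℝ), (∀ z, HasGradientAt φ (Rm z) z) ∧ LipschitzWith 1 Rm ∧
      (∀ z z', 0 ≤ ⟪Rm z - Rm z', z - z'⟫) ∧
      ∀ x p, ‖x‖ ≤ r → (∀ y, ψ x + ⟪p, y - x⟫ ≤ ψ y) → Rm (x + p) = x := by
  have hc : Continuous ψ := by
    have := hψ.continuousOn isOpen_univ
    rwa [continuousOn_univ] at this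
  let f : Eu d → Eu d → ℝ := fun z x => ψ x + ‖x‖ ^ 2 / 2 - ⟪z, x⟫
  have hfc : ∀ z, Continuous (f z) := fun z => by simp only [f]; fun_prop
  have hB : IsCompact (Metric.closedBall (0 : Eu d) r) := isCompact_closedBall _ _
  choose Rm hRm hmin using fun z => hB.exists_isMinOn ⟨0, by simpa using hr⟩ (hfc z).continuousOn
  have hst : ∀ z, ∀ x ∈ Metric.closedBall (0 : Eu d) r, f z (Rm z) + ‖x - Rm z‖ ^ 2 / 2 ≤ f z x := by
    intro z x hx
    have key : ∀ s ∈ Ioc (0:ℝ) 1, (1 - s) / 2 * ‖x - Rm z‖ ^ 2 ≤ f z x - f z (Rm z) := by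
      intro s hs
      have m1 : (1 - s) • Rm z + s • x ∈ Metric.closedBall (0 : Eu d) r :=
        (convex_closedBall (0 : Eu d) r) (hRm z) hx (sub_nonneg.2 hs.2) hs.1.le (by ring)
      have m2 : f z (Rm z) ≤ f z ((1 - s) • Rm z + s • x) := hmin z m1
      have m3 := hψ.2 (mem_univ (Rm z)) (mem_univ x) (sub_nonneg.2 hs.2) hs.1.le (by ring)
      have m4 : ‖(1 - s) • Rm z + s • x‖ ^ 2 = (1 - s) * ‖Rm z‖ ^ 2 + s * ‖x‖ ^ 2 -
          s * (1 - s) * ‖x - Rm z‖ ^ 2 := by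
        rw [norm_add_sq_real, norm_sub_sq_real, norm_smul, norm_smul, real_inner_smul_left,
          real_inner_smul_right, real_inner_comm x, mul_pow, mul_pow, Real.norm_eq_abs,
          Real.norm_eq_abs, sq_abs, sq_abs]
        ring
      simp only [f, smul_eq_mul] at m2 m3 ⊢
      rw [m4, inner_add_right, real_inner_smul_right, real_inner_smul_right] at m2
      have : s * ((1 - s) / 2 * ‖x - Rm z‖ ^ 2) ≤ s * (ψ x + ‖x‖ ^ 2 / 2 - ⟪z, x⟫ -
        (ψ (Rm z) + ‖Rm z‖ ^ 2 / 2 - ⟪z, Rm z⟫)) := by linarith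
      exact le_of_mul_le_mul_left this hs.1
    have hlim : Filter.Tendsto (fun s : ℝ => (1 - s) / 2 * ‖x - Rm z‖ ^ 2) (nhdsWithin 0 (Ioi 0))
        (nhds ((1 - 0) / 2 * ‖x - Rm z‖ ^ 2)) := by
      have : Continuous fun s : ℝ => (1 - s) / 2 * ‖x - Rm z‖ ^ 2 := by fun_prop
      exact (this.tendsto 0).mono_left nhdsWithin_le_nhds
    have := le_of_tendsto hlim (by filter_upwards [Ioc_mem_nhdsGT (zero_lt_one' ℝ)] with s hs using key s hs)
    linarith
  have hfirm : ∀ z z', ‖Rm z - Rm z'‖ ^ 2 ≤ ⟪Rm z - Rm z', z - z'⟫ := by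
    intro z z'
    have a := hst z _ (hRm z')
    have b := hst z' _ (hRm z)
    rw [norm_sub_rev] at a
    simp only [f] at a b
    have e : ⟪Rm z - Rm z', z - z'⟫ = ⟪z, Rm z⟫ - ⟪z', Rm z⟫ - ⟪z, Rm z'⟫ + ⟪z', Rm z'⟫ := by
      rw [inner_sub_left, inner_sub_right, inner_sub_right, real_inner_comm z, real_inner_comm z',
        real_inner_comm z, real_inner_comm z']
      ring
    rw [e]; linarith
  have hlip : ∀ z z', ‖Rm z - Rm z'‖ ≤ ‖z - z'‖ := by
    intro z z'
    have := (hfirm z z').trans (real_inner_le_norm _ _)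
    rcases (norm_nonneg (Rm z - Rm z')).eq_or_lt with h | h
    · rw [← h]; positivity
    · refine le_of_mul_le_mul_left ?_ h
      nlinarith
  refine ⟨Rm, fun z => - f z (Rm z), fun z => ?_, LipschitzWith.of_dist_le_mul fun z z' => ?_,
    fun z z' => (sq_nonneg _).trans (hfirm z z'), ?_⟩
  · rw [hasGradientAt_iff_isLittleO]
    have hO : (fun z' => -f z' (Rm z') - -f z (Rm z) - ⟪Rm z, z' - z⟫) =O[nhds z]
        fun z' => ‖z' - z‖ ^ 2 := by
      refine Asymptotics.IsBigO.of_bound 1 (Filter.Eventually.of_forall fun z' => ?_)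
      have a := hst z _ (hRm z')
      have b := hst z' _ (hRm z)
      have c : ⟪Rm z', z' - z⟫ - ⟪Rm z, z' - z⟫ ≤ ‖z' - z‖ ^ 2 := by
        rw [← inner_sub_left]
        refine (real_inner_le_norm _ _).trans ?_
        nlinarith [hlip z' z, norm_nonneg (z' - z)]
      simp only [f] at a b ⊢
      rw [inner_sub_right, inner_sub_right] at c
      rw [inner_sub_right]
      rw [real_inner_comm z' (Rm z'), real_inner_comm z (Rm z'), real_inner_comm z' (Rm z),
        real_inner_comm z (Rm z)] at *
      rw [Real.norm_of_nonneg, Real.norm_of_nonneg (by positivity)]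
      · nlinarith [sq_nonneg ‖Rm z' - Rm z‖]
      · nlinarith [sq_nonneg ‖Rm z - Rm z'‖]
    refine hO.trans_isLittleO ?_
    have : (fun z' : Eu d => ‖z' - z‖ ^ 2) =o[nhds z] fun z' => z' - z :=
      Asymptotics.isLittleO_pow_sub_sub z (by norm_num)
    exact this
  · simpa [dist_eq_norm] using hlip z z'
  · intro x p hx hp
    have hx' : x ∈ Metric.closedBall (0 : Eu d) r := by simpa using hx
    have a := hst (x + p) x hx'
    have b := hp (Rm (x + p))
    set R := Rm (x + p)
    have e : ‖x - R‖ ^ 2 = ‖x‖ ^ 2 - 2 * ⟪x, R⟫ + ‖R‖ ^ 2 := norm_sub_sq_real _ _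
    simp only [f] at a
    rw [inner_add_left, inner_add_left, real_inner_self_eq_norm_sq] at a
    rw [inner_sub_right] at b
    have : ‖x - R‖ ^ 2 ≤ 0 := by nlinarith
    have : ‖x - R‖ = 0 := by nlinarith [norm_nonneg (x - R)]
    exact (sub_eq_zero.1 (norm_eq_zero.1 this)).symm

open Set MeasureTheory ProbabilityTheory
open scoped ENNReal RealInnerProductSpace

lemma resolv_facts {d : ℕ} {Ω0 Ω1 : Set (Eu d)} (h0 : IsOpen Ω0) {ψ : Eu d → ℝ}
    {T : Eu d → Eu d} (hT : Measurable T)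
    (hpush : (volume.restrict Ω0).map T = volume.restrict Ω1) {D : Set (Eu d)}
    (hD : BD Ω0 Ω1 ψ T D) {r : ℝ} (hr : ∀ x ∈ Ω0, ‖x‖ ≤ r) {Rm : Eu d → Eu d} {φ : Eu d → ℝ}
    (hφ : ∀ z, HasGradientAt φ (Rm z) z) (hl : LipschitzWith 1 Rm)
    (hmn : ∀ z z', 0 ≤ ⟪Rm z - Rm z', z - z'⟫)
    (hR : ∀ x p, ‖x‖ ≤ r → (∀ y, ψ x + ⟪p, y - x⟫ ≤ ψ y) → Rm (x + p) = x) :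
    ∃ U : Set (Eu d), MeasurableSet U ∧ (∀ z ∈ U, Rm z ∈ Ω0 ∧ z - Rm z ∈ Ω1) ∧
      (∀ z ∈ U, DifferentiableAt ℝ Rm z) ∧
      ∫⁻ z in U, ENNReal.ofReal (sg (fderiv ℝ Rm z)) = volume Ω0 ∧
      ∫⁻ z in U, ENNReal.ofReal (sg (fderiv ℝ Rm z) * ‖z - (2:ℝ) • Rm z‖ ^ 2) =
        ∫⁻ x in Ω0, ‖T x - x‖ₑ ^ 2 := by
  obtain ⟨hDm, hD0, hDn, hDx⟩ := hD
  have hRS : ∀ x ∈ D, Rm (x + T x) = x := fun x hx => hR x _ (hr x (hD0 hx)) (hDx x hx).2.2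
  let S : Eu d → Eu d := fun x => x + T x
  have hSm : Measurable S := measurable_id.add hT
  have hinj : InjOn S D := fun x hx y hy h => by
    rw [← hRS x hx, ← hRS y hy]; exact congrArg Rm h
  have hUm0 : MeasurableSet (S '' D) := hDm.image_of_measurable_injOn hSm hinj
  let U := S '' D ∩ {z | DifferentiableAt ℝ Rm z}
  have hUm : MeasurableSet U := hUm0.inter (measurableSet_of_differentiableAt ℝ Rm)
  have hU1 : ∀ z ∈ U, Rm z ∈ D ∧ z = Rm z + T (Rm z) := by
    rintro z ⟨⟨x, hx, rfl⟩, -⟩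
    have := hRS x hx
    change Rm (S x) = x at this
    rw [this]; exact ⟨hx, rfl⟩
  have hd : ∀ z ∈ U, HasFDerivAt Rm (fderiv ℝ Rm z) z := fun z hz => hz.2.hasFDerivAt
  have hRi : InjOn Rm U := fun z hz z' hz' h => by
    rw [(hU1 z hz).2, (hU1 z' hz').2, h]
  have hbnd : ∀ z z', ⟪Rm z - Rm z', z - z'⟫ ≤ 1 * ‖z - z'‖ ^ 2 := fun z z' => by
    refine (real_inner_le_norm _ _).trans ?_
    have := hl.dist_le_mul z z'
    simp only [dist_eq_norm, NNReal.coe_one, one_mul] at this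
    nlinarith [norm_nonneg (z - z')]
  have hdet : ∀ z ∈ U, 0 ≤ (fderiv ℝ Rm z).det ∧
      0 ≤ (ContinuousLinearMap.id ℝ (Eu d) - fderiv ℝ Rm z).det := by
    intro z hz
    have hb := mono_deriv (hd z hz) (a := 0) (b := 1) (fun z z' => by simpa using hmn z z') hbnd
    have hs := sg_bd (fderiv ℝ Rm z) (grad_symm hφ (hd z hz)) (fun w => by simpa using (hb w).1)
      (fun w => by simpa using (hb w).2)
    exact ⟨hs.1.trans (min_le_left _ _), hs.1.trans (min_le_right _ _)⟩
  have hle : ∀ᵐ z ∂(volume.restrict U), ENNReal.ofReal (fderiv ℝ Rm z).det ≤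
      ENNReal.ofReal (ContinuousLinearMap.id ℝ (Eu d) - fderiv ℝ Rm z).det := by
    refine ae_le_of_forall_setLIntegral_le_of_sigmaFinite ?_ fun s hs _ => ?_
    · exact (ContinuousLinearMap.continuous_det.measurable.comp (measurable_fderiv ℝ Rm)).ennreal_ofReal
    · rw [Measure.restrict_restrict hs]
      have hsU : s ∩ U ⊆ U := inter_subset_right
      have hsm := hs.inter hUm
      have e1 : ∫⁻ z in s ∩ U, ENNReal.ofReal (fderiv ℝ Rm z).det = volume (Rm '' (s ∩ U)) := by
        rw [← lintegral_abs_det_fderiv_eq_addHaar_image volume hsm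
          (fun z hz => (hd z (hsU hz)).hasFDerivWithinAt) (hRi.mono hsU)]
        refine setLIntegral_congr_fun hsm fun z hz => ?_
        simp only [abs_of_nonneg (hdet z (hsU hz)).1]
      have e2 : volume ((fun z => z - Rm z) '' (s ∩ U)) ≤ ∫⁻ z in s ∩ U, ENNReal.ofReal
          (ContinuousLinearMap.id ℝ (Eu d) - fderiv ℝ Rm z).det := by
        have := addHaar_image_le_lintegral_abs_det_fderiv (volume : Measure (Eu d)) hsm
          (f := fun z => z - Rm z) (f' := fun z => ContinuousLinearMap.id ℝ (Eu d) - fderiv ℝ Rm z)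
          (fun z hz => ((hasFDerivAt_id z).sub (hd z (hsU hz))).hasFDerivWithinAt)
        refine this.trans (le_of_eq (setLIntegral_congr_fun hsm fun z hz => ?_))
        simp only [abs_of_nonneg (hdet z (hsU hz)).2]
      rw [e1]
      refine le_trans ?_ e2
      set V := toMeasurable volume ((fun z => z - Rm z) '' (s ∩ U))
      have hVm : MeasurableSet V := measurableSet_toMeasurable _ _
      have hV : volume V = volume ((fun z => z - Rm z) '' (s ∩ U)) := measure_toMeasurable _
      rw [← hV]
      calc volume (Rm '' (s ∩ U)) ≤ volume (T ⁻¹' V ∩ Ω0) := by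
            refine measure_mono ?_
            rintro _ ⟨z, hz, rfl⟩
            have := hU1 z (hsU hz)
            refine ⟨subset_toMeasurable _ _ ⟨z, hz, ?_⟩, hD0 this.1⟩
            rw [eq_comm, eq_sub_iff_add_eq, add_comm]; exact this.2.symm
        _ = (volume.restrict Ω0).map T V := by
            rw [Measure.map_apply hT hVm, Measure.restrict_apply (hT hVm)]
        _ = volume (V ∩ Ω1) := by rw [hpush, Measure.restrict_apply hVm]
        _ ≤ volume V := measure_mono inter_subset_left
  have hsg : ∀ᵐ z ∂(volume.restrict U), sg (fderiv ℝ Rm z) = |(fderiv ℝ Rm z).det| := by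
    filter_upwards [hle, ae_restrict_mem hUm] with z hz hzU
    have a := hdet z hzU
    rw [ENNReal.ofReal_le_ofReal_iff a.2] at hz
    rw [sg, min_eq_left hz, abs_of_nonneg a.1]
  have hnull : volume (D \ Rm '' U) = 0 := by
    have h1 : D \ Rm '' U ⊆ Rm '' (S '' D ∩ {z | ¬ DifferentiableAt ℝ Rm z}) := by
      rintro x ⟨hx, hx'⟩
      refine ⟨S x, ⟨⟨x, hx, rfl⟩, fun h => hx' ⟨S x, ⟨⟨x, hx, rfl⟩, h⟩, hRS x hx⟩⟩, hRS x hx⟩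
    have h2 : volume (S '' D ∩ {z | ¬ DifferentiableAt ℝ Rm z}) = 0 :=
      measure_mono_null inter_subset_right (ae_iff.1 hl.ae_differentiableAt)
    refine measure_mono_null h1 ?_
    have := lip_vol (hl.lipschitzOnWith (s := S '' D ∩ {z | ¬ DifferentiableAt ℝ Rm z}))
    rw [h2, mul_zero] at this
    exact le_antisymm this zero_le
  have hae : (Rm '' U : Set (Eu d)) =ᵐ[volume] Ω0 := by
    refine Filter.EventuallyLE.antisymm ?_ ?_
    · refine Filter.Eventually.of_forall fun x hx => ?_
      obtain ⟨z, hz, rfl⟩ := hx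
      exact hD0 (hU1 z hz).1
    · rw [ae_le_set]
      refine measure_mono_null (t := (Ω0 \ D) ∪ (D \ Rm '' U)) (fun x hx => ?_)
        (measure_union_null hDn hnull)
      by_cases h : x ∈ D
      · exact Or.inr ⟨h, hx.2⟩
      · exact Or.inl ⟨hx.1, h⟩
  have key := fun g => lintegral_image_eq_lintegral_abs_det_fderiv_mul (volume : Measure (Eu d)) hUm
    (fun z hz => (hd z hz).hasFDerivWithinAt) hRi g
  refine ⟨U, hUm, fun z hz => ?_, fun z hz => hz.2, ?_, ?_⟩
  · have := hU1 z hz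
    refine ⟨hD0 this.1, ?_⟩
    have e : z - Rm z = T (Rm z) := sub_eq_iff_eq_add'.2 this.2
    rw [e]; exact (hDx _ this.1).2.1
  · have := key (fun _ => 1)
    rw [Measure.restrict_congr_set hae] at this
    simp only [lintegral_const, Measure.restrict_apply MeasurableSet.univ, univ_inter, one_mul, mul_one] at this
    rw [this]
    exact lintegral_congr_ae (by filter_upwards [hsg] with z hz; rw [hz])
  · have := key (fun x => ‖T x - x‖ₑ ^ 2)
    rw [Measure.restrict_congr_set hae] at this
    rw [this]
    refine lintegral_congr_ae ?_
    filter_upwards [hsg, ae_restrict_mem hUm] with z hz hzU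
    rw [hz, ENNReal.ofReal_mul (abs_nonneg _)]
    congr 1
    have := (hU1 z hzU).2
    have e : z - (2:ℝ) • Rm z = T (Rm z) - Rm z := by
      nth_rewrite 1 [this]; module
    rw [e, ENNReal.ofReal_pow (norm_nonneg _), ofReal_norm]

open Set MeasureTheory ProbabilityTheory
open scoped ENNReal RealInnerProductSpace

lemma smooth_stage {n : ℕ} {Ω0 Ω1 : Set (Eu (n + 1))} (h0 : IsOpen Ω0) (h1 : IsOpen Ω1)
    (hfin : volume Ω0 < ⊤)
    {Rm : Eu (n + 1) → Eu (n + 1)} {φ : Eu (n + 1) → ℝ}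
    (hφ : ∀ z, HasGradientAt φ (Rm z) z) (hl : LipschitzWith 1 Rm)
    (hmn : ∀ z z', 0 ≤ ⟪Rm z - Rm z', z - z'⟫) {U : Set (Eu (n + 1))} (hU : MeasurableSet U)
    (hUx : ∀ z ∈ U, Rm z ∈ Ω0 ∧ z - Rm z ∈ Ω1) {W2 : ℝ≥0∞} (hW : W2 < ⊤)
    (hi1 : ∫⁻ z in U, ENNReal.ofReal (sg (fderiv ℝ Rm z)) = volume Ω0)
    (hi2 : ∫⁻ z in U, ENNReal.ofReal (sg (fderiv ℝ Rm z) * ‖z - (2:ℝ) • Rm z‖ ^ 2) = W2)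
    {ε : ℝ} (hε : 0 < ε) :
    ∃ E0 E1 : Set (Eu (n + 1)), E0 ⊆ Ω0 ∧ E1 ⊆ Ω1 ∧ MeasurableSet E0 ∧ MeasurableSet E1 ∧
      volume E0 = volume E1 ∧ volume E0 < ⊤ ∧ volume Ω0 ≤ volume E0 + ENNReal.ofReal ε ∧
      ∀ Pk : Set (Eu (n + 1)), MeasurableSet Pk → volume Pk < ⊤ →
        Disjoint (convexHull ℝ (Ω0 ∪ Ω1)) Pk →
        Conn (E0 ∪ Pk) (E1 ∪ Pk) (W2 + ENNReal.ofReal ε) := by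
  set f : Eu (n + 1) → ℝ≥0∞ := fun z => ENNReal.ofReal (sg (fderiv ℝ Rm z)) with hf
  let ν := (volume.restrict U).withDensity f
  have hνU : ∀ s ⊆ U, MeasurableSet s → ν s = ∫⁻ z in s, f z := fun s hs hsm => by
    rw [withDensity_apply _ hsm, Measure.restrict_restrict hsm, inter_eq_left.2 hs]
  have : IsFiniteMeasure ν := ⟨by
    rw [withDensity_apply _ MeasurableSet.univ, Measure.restrict_univ, hi1]; exact hfin⟩
  have hε3 : 0 < ε / 3 := by positivity
  obtain ⟨K, hKU, hK, hKν⟩ := hU.exists_isCompact_lt_add (μ := ν) (measure_ne_top _ _)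
    (ε := ENNReal.ofReal (ε / 3)) (by simpa using hε3)
  rw [hνU U subset_rfl hU, hνU K hKU hK.measurableSet, hi1] at hKν
  obtain ⟨Re, Pe, κ, hj, hlim⟩ := moll_seq hφ hl hmn
  have hRc : Continuous Rm := hl.continuous
  have hRej : ∀ j, Continuous (Re j) := fun j =>
    continuous_iff_continuousAt.2 fun z => ((hj j).2.1 z).continuousAt
  have hPb : ∀ j z w, κ j * ‖w‖ ^ 2 ≤ ⟪Pe j z w, w⟫ ∧ ⟪Pe j z w, w⟫ ≤ (1 - κ j) * ‖w‖ ^ 2 :=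
    fun j z w => mono_deriv ((hj j).2.1 z) (hj j).2.2.2.2.1 (hj j).2.2.2.2.2.1 w
  have hsgb : ∀ j z, 0 ≤ sg (Pe j z) ∧ sg (Pe j z) ≤ 1 := fun j z => by
    have hκ := (hj j).1
    refine sg_bd _ ((hj j).2.2.2.1 z) (fun w => ?_) fun w => ?_
    · have := (hPb j z w).1
      have : 0 ≤ κ j * ‖w‖ ^ 2 := by positivity
      linarith
    · have := (hPb j z w).2
      have : 0 ≤ κ j * ‖w‖ ^ 2 := by positivity
      linarith
  have hgz : ∀ z, Filter.Tendsto (fun j : ℕ => (1 + ‖z‖ + 2 * ‖Rm z‖) * (1 / ((j : ℝ) + 1))) Filter.atTop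
      (nhds 0) := fun z => by
    simpa using (tendsto_one_div_add_atTop_nhds_zero_nat (𝕜 := ℝ)).const_mul (1 + ‖z‖ + 2 * ‖Rm z‖)
  have hReT : ∀ z, Filter.Tendsto (fun j => Re j z) Filter.atTop (nhds (Rm z)) := fun z => by
    rw [tendsto_iff_norm_sub_tendsto_zero]
    exact squeeze_zero (fun j => norm_nonneg _) (fun j => (hj j).2.2.2.2.2.2.2 z) (hgz z)
  -- limits of integrals
  have hL1 : Filter.Tendsto (fun j => ∫⁻ z in K, ENNReal.ofReal (sg (Pe j z))) Filter.atTop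
      (nhds (∫⁻ z in K, f z)) := by
    refine tendsto_lintegral_of_dominated_convergence (fun _ => 1) (fun j => ?_) (fun j => ?_) ?_ ?_
    · exact (sg_cont.comp (hj j).2.2.1).measurable.ennreal_ofReal
    · refine Filter.Eventually.of_forall fun z => ?_
      have := ENNReal.ofReal_le_ofReal (hsgb j z).2
      simpa using this
    · simpa using hK.measure_lt_top.ne
    · filter_upwards [ae_restrict_of_ae hlim] with z hz
      exact (ENNReal.continuous_ofReal.tendsto _).comp ((sg_cont.tendsto _).comp hz)
  let G : Eu (n + 1) → ℝ := fun z => (‖z‖ + 2 * (‖Rm z‖ + (1 + ‖z‖ + 2 * ‖Rm z‖))) ^ 2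
  have hGc : Continuous G := by simp only [G]; fun_prop
  have hL2 : Filter.Tendsto (fun j => ∫⁻ z in K, ENNReal.ofReal (sg (Pe j z) * ‖z - (2:ℝ) • Re j z‖ ^ 2))
      Filter.atTop
      (nhds (∫⁻ z in K, ENNReal.ofReal (sg (fderiv ℝ Rm z) * ‖z - (2:ℝ) • Rm z‖ ^ 2))) := by
    refine tendsto_lintegral_of_dominated_convergence (fun z => ENNReal.ofReal (G z)) (fun j => ?_)
      (fun j => ?_) ?_ ?_
    · have a := sg_cont.comp (hj j).2.2.1
      have b := hRej j
      have : Continuous fun z => sg (Pe j z) * ‖z - (2:ℝ) • Re j z‖ ^ 2 :=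
        a.mul (by fun_prop)
      exact this.measurable.ennreal_ofReal
    · refine Filter.Eventually.of_forall fun z => ENNReal.ofReal_le_ofReal ?_
      have a := (hj j).2.2.2.2.2.2.2 z
      have b : (1 / ((j : ℝ) + 1)) ≤ 1 := by
        rw [div_le_one (by positivity)]; have : (0:ℝ) ≤ j := by positivity
        linarith
      have c : ‖Re j z‖ ≤ ‖Rm z‖ + (1 + ‖z‖ + 2 * ‖Rm z‖) := by
        have e : ‖Re j z‖ ≤ ‖Re j z - Rm z‖ + ‖Rm z‖ := by
          simpa using norm_add_le (Re j z - Rm z) (Rm z)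
        have : (1 + ‖z‖ + 2 * ‖Rm z‖) * (1 / ((j : ℝ) + 1)) ≤ (1 + ‖z‖ + 2 * ‖Rm z‖) * 1 := by
          gcongr
        linarith
      have e : ‖z - (2:ℝ) • Re j z‖ ≤ ‖z‖ + 2 * (‖Rm z‖ + (1 + ‖z‖ + 2 * ‖Rm z‖)) := by
        refine (norm_sub_le _ _).trans ?_
        rw [norm_smul, Real.norm_of_nonneg (by norm_num : (0:ℝ) ≤ 2)]
        linarith
      have e2 : ‖z - (2:ℝ) • Re j z‖ ^ 2 ≤ G z := by
        simp only [G]; gcongr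
      calc _ ≤ 1 * ‖z - (2:ℝ) • Re j z‖ ^ 2 := by gcongr; exact (hsgb j z).2
        _ ≤ _ := by simpa using e2
    · exact (hGc.continuousOn.integrableOn_compact hK).lintegral_lt_top.ne
    · filter_upwards [ae_restrict_of_ae hlim] with z hz
      refine (ENNReal.continuous_ofReal.tendsto _).comp (((sg_cont.tendsto _).comp hz).mul ?_)
      exact ((tendsto_const_nhds.sub ((hReT z).const_smul 2)).norm.pow 2)
  have hKle : ∫⁻ z in K, ENNReal.ofReal (sg (fderiv ℝ Rm z) * ‖z - (2:ℝ) • Rm z‖ ^ 2) ≤ W2 := by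
    rw [← hi2]; exact lintegral_mono_set hKU
  -- images
  obtain ⟨M, hM⟩ := hK.exists_bound_of_continuousOn (f := fun z => 1 + ‖z‖ + 2 * ‖Rm z‖)
    (by fun_prop)
  have hM' : ∀ z ∈ K, ∀ j, ‖Re j z - Rm z‖ ≤ M * (1 / ((j : ℝ) + 1)) := fun z hz j => by
    refine ((hj j).2.2.2.2.2.2.2 z).trans ?_
    have := (Real.le_norm_self _).trans (hM z hz)
    gcongr
  have hMt : Filter.Tendsto (fun j : ℕ => M * (1 / ((j : ℝ) + 1))) Filter.atTop (nhds 0) := by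
    simpa using (tendsto_one_div_add_atTop_nhds_zero_nat (𝕜 := ℝ)).const_mul M
  obtain ⟨δ0, hδ0, ht0⟩ := (hK.image hRc).exists_thickening_subset_open h0 (by
    rintro _ ⟨z, hz, rfl⟩; exact (hUx z (hKU hz)).1)
  obtain ⟨δ1, hδ1, ht1⟩ := (hK.image (continuous_id.sub hRc)).exists_thickening_subset_open h1 (by
    rintro _ ⟨z, hz, rfl⟩; exact (hUx z (hKU hz)).2)
  have hW3 : ∫⁻ z in K, ENNReal.ofReal (sg (fderiv ℝ Rm z) * ‖z - (2:ℝ) • Rm z‖ ^ 2) <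
      W2 + ENNReal.ofReal (ε / 3) := by
    refine hKle.trans_lt (ENNReal.lt_add_right hW.ne (by simpa using hε3))
  have hKfin : ∫⁻ z in K, f z ≠ ⊤ := by
    rw [← hνU K hKU hK.measurableSet]; exact measure_ne_top _ _
  have hev1 : ∀ᶠ j in Filter.atTop, (∫⁻ z in K, f z) < (∫⁻ z in K, ENNReal.ofReal (sg (Pe j z))) +
      ENNReal.ofReal (ε / 3) := by
    have := hL1.add_const (ENNReal.ofReal (ε / 3))
    exact this.eventually (lt_mem_nhds (ENNReal.lt_add_right hKfin (by simpa using hε3)))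
  obtain ⟨j, e1, e2, e3, e4⟩ := (hev1.and ((hL2.eventually (gt_mem_nhds hW3)).and
    ((hMt.eventually (gt_mem_nhds hδ0)).and (hMt.eventually (gt_mem_nhds hδ1))))).exists
  obtain ⟨a1, a2, a3, a4, a5, a6, a7, a8⟩ := hj j
  obtain ⟨E0, E1, b1, b2, b3, b4, b5, b6, b7, b8⟩ := grid_lem (Re j) (Pe j) a2 a3 a4 a1 a5 a6
    (fun z w => (hPb j z w).1) (fun z w => (hPb j z w).2) a7 hK h0 h1
    (fun z hz => ht0 (Metric.mem_thickening_iff.2 ⟨Rm z, ⟨z, hz, rfl⟩, by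
      rw [dist_eq_norm]; exact (hM' z hz j).trans_lt e3⟩))
    (fun z hz => ht1 (Metric.mem_thickening_iff.2 ⟨z - Rm z, ⟨z, hz, rfl⟩, by
      rw [dist_eq_norm, sub_sub_sub_cancel_left, norm_sub_rev]; exact (hM' z hz j).trans_lt e4⟩)) hε3
  have es : ENNReal.ofReal ε = ENNReal.ofReal (ε / 3) + ENNReal.ofReal (ε / 3) + ENNReal.ofReal (ε / 3) := by
    rw [← ENNReal.ofReal_add (by positivity) (by positivity),
      ← ENNReal.ofReal_add (by positivity) (by positivity)]
    congr 1; ring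
  refine ⟨E0, E1, b1, b2, b3, b4, b5, b6, ?_, fun Pk c1 c2 c3 => (b8 Pk c1 c2 c3).mono ?_⟩
  · calc volume Ω0 ≤ (∫⁻ z in K, f z) + ENNReal.ofReal (ε / 3) := hKν.le
      _ ≤ (∫⁻ z in K, ENNReal.ofReal (sg (Pe j z))) + ENNReal.ofReal (ε / 3) + ENNReal.ofReal (ε / 3) := by
        gcongr
      _ ≤ volume E0 + ENNReal.ofReal (ε / 3) + ENNReal.ofReal (ε / 3) + ENNReal.ofReal (ε / 3) := by
        gcongr
      _ = _ := by rw [es]; ring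
  · refine (add_le_add_left e2.le _).trans ?_
    rw [es, add_assoc, add_assoc]
    gcongr
    exact le_add_self

open Set MeasureTheory ProbabilityTheory
open scoped ENNReal RealInnerProductSpace

lemma upper_bound {n : ℕ} {Ω0 Ω1 : Set (Eu (n + 1))} (h0 : IsOpen Ω0) (h1 : IsOpen Ω1)
    {r : ℝ} (hr : 0 < r) (hr0 : ∀ x ∈ Ω0, ‖x‖ ≤ r) (hr1 : ∀ x ∈ Ω1, ‖x‖ ≤ r)
    (hvol : volume Ω0 = volume Ω1) {ψ : Eu (n + 1) → ℝ} (hψ : ConvexOn ℝ univ ψ)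
    {T : Eu (n + 1) → Eu (n + 1)} (hT : Measurable T) (hgrad : ∀ᵐ x, HasGradientAt ψ (T x) x)
    (hpush : (volume.restrict Ω0).map T = volume.restrict Ω1)
    (hW : ∫⁻ x in Ω0, ‖T x - x‖ₑ ^ 2 < ⊤) {c : ℝ≥0∞} (hc : ∫⁻ x in Ω0, ‖T x - x‖ₑ ^ 2 < c) :
    Conn Ω0 Ω1 c := by
  set W2 := ∫⁻ x in Ω0, ‖T x - x‖ₑ ^ 2 with hW2
  have hfin : ∀ A : Set (Eu (n + 1)), (∀ x ∈ A, ‖x‖ ≤ r) → volume A < ⊤ := fun A hA =>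
    (measure_mono (fun x hx => mem_closedBall_zero_iff.2 (hA x hx))).trans_lt
      (isCompact_closedBall (0 : Eu (n + 1)) r).measure_lt_top
  obtain ⟨D, hD⟩ := exists_BD h0 h1 hψ hT hgrad hpush
  obtain ⟨Rm, φ, hφ, hl, hmn, hR⟩ := resolv hψ hr.le
  obtain ⟨U, hUm, hUx, -, hi1, hi2⟩ := resolv_facts h0 hT hpush hD hr0 hφ hl hmn hR
  obtain ⟨c', hc1, hc2⟩ := exists_between hc
  have hct : c' ≠ ⊤ := (hc2.trans_le le_top).ne
  refine Conn.mono ?_ hc2.le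
  set w := Real.sqrt W2.toReal with hw
  set l := Real.sqrt c'.toReal with hl'
  have hwl : w < l := Real.sqrt_lt_sqrt ENNReal.toReal_nonneg ((ENNReal.toReal_lt_toReal hW.ne hct).2 hc1)
  have hw0 : 0 ≤ w := Real.sqrt_nonneg _
  have hlc : ENNReal.ofReal (l ^ 2) = c' := by
    rw [hl', Real.sq_sqrt ENNReal.toReal_nonneg, ENNReal.ofReal_toReal hct]
  have hwc : ENNReal.ofReal (w ^ 2) = W2 := by
    rw [hw, Real.sq_sqrt ENNReal.toReal_nonneg, ENNReal.ofReal_toReal hW.ne]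
  set η := (l - w) / 3 with hη
  have hηp : 0 < η := by rw [hη]; linarith
  obtain ⟨δ, hδ, hsym⟩ := sym_small n (L := 5 * r) (by positivity) hηp
  have hεp : 0 < min δ (η ^ 2) := lt_min hδ (by positivity)
  obtain ⟨E0, E1, b1, b2, b3, b4, b5, b6, b7, b8⟩ := smooth_stage h0 h1 (hfin _ hr0) hφ hl hmn hUm hUx
    hW hi1 hi2 hεp
  let a : Eu (n + 1) := EuclideanSpace.single 0 (3 * r)
  have ha : ‖a‖ = 3 * r := by simp [a, abs_of_pos hr]
  let Pk := (fun x => -a + x) ⁻¹' (Ω0 \ E0)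
  have hPm : MeasurableSet Pk := (h0.measurableSet.diff b3).preimage (by fun_prop)
  have hPv : volume Pk = volume (Ω0 \ E0) := measure_preimage_add _ _ _
  have hPx : ∀ x ∈ Pk, 2 * r ≤ ‖x‖ ∧ ‖x‖ ≤ 4 * r := by
    intro x hx
    have h2 := hr0 _ hx.1
    have e : x = a + (-a + x) := by abel
    constructor
    · have := norm_sub_norm_le a (-(-a + x))
      rw [sub_neg_eq_add, ← e, norm_neg, ha] at this
      linarith
    · have := norm_add_le a (-a + x)
      rw [← e, ha] at this
      linarith
  have hdis : ∀ A : Set (Eu (n + 1)), (∀ x ∈ A, ‖x‖ ≤ r) → Disjoint A Pk := fun A hA => by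
    rw [Set.disjoint_left]
    intro x hx hx'
    have := (hPx x hx').1
    have := hA x hx
    linarith
  have hE0r : ∀ x ∈ E0, ‖x‖ ≤ r := fun x hx => hr0 x (b1 hx)
  have hE1r : ∀ x ∈ E1, ‖x‖ ≤ r := fun x hx => hr1 x (b2 hx)
  have hcoord : ∀ x : Eu (n + 1), ‖x‖ ≤ 4 * r → ∀ j, x j ∈ Ico (-(5 * r)) (5 * r) := fun x hx j => by
    have := (eu_coord_le x j).trans hx
    rw [abs_le] at this
    constructor <;> linarith
  have v0 : volume (E0 ∪ Pk) = volume Ω0 := by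
    rw [measure_union (hdis _ hE0r) hPm, hPv, add_comm, measure_sdiff_add_inter (s := Ω0) b3 |>.symm]
    rw [inter_eq_right.2 b1]
  have v1 : volume (E1 ∪ Pk) = volume Ω1 := by
    rw [measure_union (hdis _ hE1r) hPm, ← b5, ← measure_union (hdis _ hE0r) hPm, v0, hvol]
  have d0 : volume (Ω0 \ E0) ≤ ENNReal.ofReal δ := by
    rw [measure_sdiff b1 b3.nullMeasurableSet b6.ne]
    refine tsub_le_iff_left.2 (b7.trans ?_)
    gcongr; exact min_le_left _ _
  have d1 : volume (Ω1 \ E1) ≤ ENNReal.ofReal δ := by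
    rw [measure_sdiff b2 b4.nullMeasurableSet (b5 ▸ b6.ne), ← b5, ← hvol]
    refine tsub_le_iff_left.2 (b7.trans ?_)
    gcongr; exact min_le_left _ _
  have l0 : Len Ω0 (E0 ∪ Pk) η := by
    refine hsym _ _ h0.measurableSet (b3.union hPm) (fun x hx => hcoord x ?_) (fun x hx => hcoord x ?_)
      (hfin _ hr0) v0.symm ((measure_mono (sdiff_subset_sdiff_right subset_union_left)).trans d0)
    · linarith [hr0 x hx]
    · rcases hx with hx | hx
      · linarith [hE0r x hx]
      · exact (hPx x hx).2
  have l1 : Len Ω1 (E1 ∪ Pk) η := by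
    refine hsym _ _ h1.measurableSet (b4.union hPm) (fun x hx => hcoord x ?_) (fun x hx => hcoord x ?_)
      (hfin _ hr1) v1.symm ((measure_mono (sdiff_subset_sdiff_right subset_union_left)).trans d1)
    · linarith [hr1 x hx]
    · rcases hx with hx | hx
      · linarith [hE1r x hx]
      · exact (hPx x hx).2
  have l2 : Len (E0 ∪ Pk) (E1 ∪ Pk) (w + η) := by
    refine ⟨by positivity, (b8 Pk hPm ?_ ?_).mono ?_⟩
    · rw [hPv]; exact d0.trans_lt ENNReal.ofReal_lt_top
    · refine hdis _ fun x hx => ?_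
      have : convexHull ℝ (Ω0 ∪ Ω1) ⊆ Metric.closedBall 0 r := by
        refine convexHull_min (fun x hx => ?_) (convex_closedBall _ _)
        rw [mem_closedBall_zero_iff]
        exact hx.elim (hr0 x) (hr1 x)
      exact mem_closedBall_zero_iff.1 (this hx)
    · rw [← hwc, ← ENNReal.ofReal_add (by positivity) hεp.le]
      refine ENNReal.ofReal_le_ofReal ?_
      have := min_le_right δ (η ^ 2)
      nlinarith [mul_nonneg hw0 hηp.le]
  have l3 := (l0.trans l2).trans l1.symm
  have e : η + (w + η) + η = l := by rw [hη]; ring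
  rw [e] at l3
  rw [← hlc]
  exact l3.2

open Set MeasureTheory ProbabilityTheory
open scoped ENNReal RealInnerProductSpace

lemma ext_test {d : ℕ} {A B : Set (Eu d)} {S : Set (Eu d × ℝ)} {v : Eu d × ℝ → Eu d}
    (hp : SPath A B S v) (hA : volume A < ⊤) (hB : volume B < ⊤) {q : Eu d × ℝ → ℝ}
    (hq : ContDiff ℝ (⊤ : ℕ∞) q) {C : ℝ} (hC0 : ∀ z, ∀ t ∈ Icc (0:ℝ) 1, |q (z, t)| ≤ C)
    (hC1 : ∀ z, ∀ t ∈ Ioo (0:ℝ) 1, ‖fderiv ℝ q (z, t)‖ ≤ C) :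
    ∫ z in S, fderiv ℝ q z (v z, 1) ∂(spaceTime d) =
      (∫ x in B, q (x, 1)) - (∫ x in A, q (x, 0)) := by
  obtain ⟨hS, hSf, hv, hv2, hw⟩ := hp
  have hfS : IsFiniteMeasure ((spaceTime d).restrict S) := ⟨by simpa using hSf⟩
  have hvi := sq_enorm_integrable hSf hv hv2
  let Ξ : ContDiffBump (0 : Eu d × ℝ) := ⟨1, 2, by norm_num, by norm_num⟩
  have hΞ : ContDiff ℝ (⊤ : ℕ∞) (Ξ : Eu d × ℝ → ℝ) := Ξ.contDiff
  obtain ⟨C', hC'⟩ := fderiv_bound hΞ Ξ.hasCompactSupport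
  let c : ℕ → ℝ := fun n => 1 / ((n : ℝ) + 1)
  have hcp : ∀ n, 0 < c n := fun n => by simp only [c]; positivity
  have hc1 : ∀ n, c n ≤ 1 := fun n => by
    simp only [c]; rw [div_le_one (by positivity)]; have : (0:ℝ) ≤ n := by positivity
    linarith
  have hc0 : Filter.Tendsto c Filter.atTop (nhds 0) := tendsto_one_div_add_atTop_nhds_zero_nat
  let X : ℕ → Eu d × ℝ → ℝ := fun n p => Ξ (c n • p)
  have hX : ∀ n, ContDiff ℝ (⊤ : ℕ∞) (X n) := fun n => hΞ.comp (contDiff_const_smul _)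
  have hXs : ∀ n, HasCompactSupport (X n) := fun n =>
    Ξ.hasCompactSupport.comp_homeomorph (Homeomorph.smulOfNeZero (c n) (hcp n).ne')
  have hXd : ∀ n p, HasFDerivAt (X n) (c n • fderiv ℝ Ξ (c n • p)) p := by
    intro n p
    have h1 : HasFDerivAt (fun p : Eu d × ℝ => c n • p) (c n • ContinuousLinearMap.id ℝ (Eu d × ℝ)) p :=
      (hasFDerivAt_id p).const_smul (c n)
    have h2 := ((hΞ.differentiable (by simp)) (c n • p)).hasFDerivAt
    have h3 := h2.comp p h1
    have e : (fderiv ℝ Ξ (c n • p)).comp (c n • ContinuousLinearMap.id ℝ (Eu d × ℝ)) =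
        c n • fderiv ℝ Ξ (c n • p) := by
      ext <;> simp
    rw [e] at h3
    exact h3
  have hX1 : ∀ p, ∀ᶠ n in Filter.atTop, X n p = 1 := by
    intro p
    have : Filter.Tendsto (fun n => c n • p) Filter.atTop (nhds ((0:ℝ) • p)) := hc0.smul_const p
    rw [zero_smul] at this
    filter_upwards [this.eventually (Metric.closedBall_mem_nhds (0 : Eu d × ℝ) one_pos)] with n hn
    exact Ξ.one_of_mem_closedBall hn
  have hXt : ∀ p, Filter.Tendsto (fun n => X n p) Filter.atTop (nhds 1) := fun p =>
    tendsto_const_nhds.congr' (by filter_upwards [hX1 p] with n hn using hn.symm)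
  have hXb : ∀ n p, |X n p| ≤ 1 := fun n p => by
    rw [abs_of_nonneg Ξ.nonneg]; exact Ξ.le_one
  have hid := fun n => hw (fun p => X n p * q p) ((hX n).mul hq) ((hXs n).mul_right)
  have hC'0 : 0 ≤ C' := (norm_nonneg _).trans (hC' 0)
  have hC00 : 0 ≤ C := (abs_nonneg _).trans (hC0 0 0 (by simp))
  have hfd : ∀ n p, fderiv ℝ (fun p => X n p * q p) p =
      X n p • fderiv ℝ q p + q p • (c n • fderiv ℝ Ξ (c n • p)) := fun n p =>
    ((hXd n p).mul ((hq.differentiable (by simp)) p).hasFDerivAt).fderiv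
  have hIoo : ∀ᵐ z ∂((spaceTime d).restrict S), z.2 ∈ Ioo (0:ℝ) 1 :=
    ae_restrict_of_ae (spaceTime_ae_Ioo d)
  have l1 : Filter.Tendsto (fun n => ∫ z in S, fderiv ℝ (fun p => X n p * q p) z (v z, 1) ∂(spaceTime d))
      Filter.atTop (nhds (∫ z in S, fderiv ℝ q z (v z, 1) ∂(spaceTime d))) := by
    refine tendsto_integral_of_dominated_convergence (fun z => (C + C * C') * ‖((v z, 1) : Eu d × ℝ)‖)
      (fun n => ?_) ?_ (fun n => ?_) ?_
    · have h := ((hX n).mul hq).continuous_fderiv (by simp)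
      have h2 : Measurable fun z => ((v z, (1:ℝ)) : Eu d × ℝ) := hv.prodMk measurable_const
      have : Measurable fun z => fderiv ℝ (fun p => X n p * q p) z (v z, 1) := by
        exact (isBoundedBilinearMap_apply.continuous.measurable.comp (h.measurable.prodMk h2))
      exact this.aestronglyMeasurable
    · have hi : Integrable (fun z => ((v z, (1:ℝ)) : Eu d × ℝ)) ((spaceTime d).restrict S) :=
        hvi.prodMk (integrable_const _)
      exact hi.norm.const_mul _
    · filter_upwards [hIoo] with z hz
      refine (ContinuousLinearMap.le_opNorm _ _).trans ?_
      refine mul_le_mul_of_nonneg_right ?_ (norm_nonneg _)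
      rw [hfd]
      refine (norm_add_le _ _).trans (add_le_add ?_ ?_)
      · rw [norm_smul, Real.norm_eq_abs]
        calc _ ≤ 1 * C := mul_le_mul (hXb n z) (hC1 z.1 z.2 hz) (norm_nonneg _) zero_le_one
          _ = C := one_mul C
      · rw [norm_smul, norm_smul, Real.norm_eq_abs, Real.norm_eq_abs, abs_of_pos (hcp n)]
        have e1 := hC0 z.1 z.2 (Ioo_subset_Icc_self hz)
        have e2 : c n * ‖fderiv ℝ Ξ (c n • z)‖ ≤ 1 * C' :=
          mul_le_mul (hc1 n) (hC' _) (norm_nonneg _) zero_le_one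
        rw [one_mul] at e2
        exact mul_le_mul e1 e2 (mul_nonneg (hcp n).le (norm_nonneg _)) hC00
    · refine Filter.Eventually.of_forall fun z => ?_
      have : Filter.Tendsto (fun n => X n z * fderiv ℝ q z (v z, 1) +
          q z * (c n * fderiv ℝ Ξ (c n • z) (v z, 1))) Filter.atTop
          (nhds (1 * fderiv ℝ q z (v z, 1) + q z * 0)) := by
        refine ((hXt z).mul_const _).add (tendsto_const_nhds.mul ?_)
        refine squeeze_zero_norm (a := fun n => c n * (C' * ‖((v z, 1) : Eu d × ℝ)‖)) (fun n => ?_) ?_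
        · rw [norm_mul, Real.norm_of_nonneg (hcp n).le]
          refine mul_le_mul_of_nonneg_left ?_ (hcp n).le
          refine (ContinuousLinearMap.le_opNorm _ _).trans ?_
          gcongr
          exact hC' _
        · simpa using hc0.mul_const (C' * ‖((v z, 1) : Eu d × ℝ)‖)
      rw [one_mul, mul_zero, add_zero] at this
      refine this.congr fun n => ?_
      rw [hfd]; simp
  have l2 : ∀ (A : Set (Eu d)) (s : ℝ), volume A < ⊤ → s ∈ Icc (0:ℝ) 1 →
      Filter.Tendsto (fun n => ∫ x in A, X n (x, s) * q (x, s)) Filter.atTop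
      (nhds (∫ x in A, q (x, s))) := by
    intro A s hA hs
    have : IsFiniteMeasure (volume.restrict A) := ⟨by simpa using hA⟩
    refine tendsto_integral_of_dominated_convergence (fun z => C) (fun n => ?_) (integrable_const _)
      (fun n => ?_) ?_
    · have : Continuous fun x => X n (x, s) * q (x, s) :=
        (((hX n).mul hq).continuous).comp (by fun_prop : Continuous fun x : Eu d => (x, s))
      exact this.aestronglyMeasurable
    · refine Filter.Eventually.of_forall fun x => ?_
      rw [norm_mul, Real.norm_eq_abs, Real.norm_eq_abs]
      calc _ ≤ 1 * C := mul_le_mul (hXb n _) (hC0 x s hs) (abs_nonneg _) zero_le_one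
        _ = C := one_mul C
    · refine Filter.Eventually.of_forall fun x => ?_
      simpa using (hXt (x, s)).mul_const (q (x, s))
  refine tendsto_nhds_unique l1 ?_
  simp_rw [hid]
  exact (l2 B 1 hB (by simp)).sub (l2 A 0 hA (by simp))

open Set MeasureTheory ProbabilityTheory
open scoped ENNReal RealInnerProductSpace

lemma trunc_exists (c : ℝ) : ∃ h : ℝ → ℝ, ContDiff ℝ (⊤ : ℕ∞) h ∧ (∀ s ≤ c, h s = s) ∧
    (∀ s, c + 1 ≤ s → h s = h (c + 1)) ∧ (∀ s, 0 ≤ deriv h s ∧ deriv h s ≤ 1) ∧ Monotone h ∧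
    ∀ s, h s ≤ c + 1 := by
  let g : ℝ → ℝ := fun τ => Real.smoothTransition (1 + c - τ)
  have hg : ContDiff ℝ (⊤ : ℕ∞) g := Real.smoothTransition.contDiff.comp (by fun_prop)
  let h : ℝ → ℝ := fun s => c + ∫ τ in c..s, g τ
  have hd : ∀ s, HasDerivAt h (g s) s := fun s =>
    (intervalIntegral.integral_hasDerivAt_right (hg.continuous.intervalIntegrable _ _)
      (hg.continuous.stronglyMeasurableAtFilter _ _) hg.continuous.continuousAt).const_add c
  have hde : deriv h = g := funext fun s => (hd s).deriv
  have hg0 : ∀ s, 0 ≤ g s ∧ g s ≤ 1 := fun s =>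
    ⟨Real.smoothTransition.nonneg _, Real.smoothTransition.le_one _⟩
  have hmono : Monotone h := monotone_of_deriv_nonneg (fun s => (hd s).differentiableAt)
    (fun s => by rw [hde]; exact (hg0 s).1)
  have hconst : ∀ s, c + 1 ≤ s → h s = h (c + 1) := by
    intro s hs
    have : ∫ τ in (c + 1)..s, g τ = 0 := by
      rw [intervalIntegral.integral_congr (g := fun _ => 0)]
      · simp
      · intro τ hτ
        rw [uIcc_of_le hs] at hτ
        exact Real.smoothTransition.zero_of_nonpos (by linarith [hτ.1])
    have e := intervalIntegral.integral_add_adjacent_intervals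
      (hg.continuous.intervalIntegrable (μ := volume) c (c + 1))
      (hg.continuous.intervalIntegrable (μ := volume) (c + 1) s)
    simp only [h]
    rw [← e, this, add_zero]
  refine ⟨h, ?_, ?_, hconst, fun s => by rw [hde]; exact hg0 s, hmono, ?_⟩
  · rw [contDiff_infty_iff_deriv]
    exact ⟨fun s => (hd s).differentiableAt, by rw [hde]; exact hg⟩
  · intro s hs
    have : ∫ τ in c..s, g τ = ∫ τ in c..s, (1:ℝ) := by
      refine intervalIntegral.integral_congr fun τ hτ => ?_
      rw [uIcc_of_ge hs] at hτ
      exact Real.smoothTransition.one_of_one_le (by linarith [hτ.2])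
    simp only [h]; rw [this]; simp
  · intro s
    have h1 : h (c + 1) ≤ c + 1 := by
      have : ∫ τ in c..(c + 1), g τ ≤ ∫ τ in c..(c + 1), (1:ℝ) :=
        intervalIntegral.integral_mono_on (by linarith) (hg.continuous.intervalIntegrable _ _)
          (by simp) (fun x _ => (hg0 x).2)
      simp only [intervalIntegral.integral_const, smul_eq_mul, mul_one] at this
      simp only [h]; linarith
    rcases le_total s (c + 1) with hs | hs
    · exact (hmono hs).trans h1
    · rw [hconst s hs]; exact h1

lemma softmin {V : Type*} [NormedAddCommGroup V] [NormedSpace ℝ V] {ι : Type*} [Fintype ι] [Nonempty ι]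
    (c : ι → V → ℝ) (hc : ∀ i, ContDiff ℝ (⊤ : ℕ∞) (c i)) {η : ℝ} (hη : 0 < η) :
    ∃ u : V → ℝ, ContDiff ℝ (⊤ : ℕ∞) u ∧
      (∀ p ξ B, (∀ i, fderiv ℝ (c i) p ξ ≤ B) → fderiv ℝ u p ξ ≤ B) ∧ (∀ p i, u p ≤ c i p) ∧
      ∀ p, ∃ i, c i p - η * Real.log (Fintype.card ι) ≤ u p := by
  let e : ι → V → ℝ := fun i p => Real.exp (-(1 / η) * c i p)
  let Z : V → ℝ := fun p => ∑ i, e i p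
  have hZ : ∀ p, 0 < Z p := fun p => Finset.sum_pos (fun i _ => Real.exp_pos _) Finset.univ_nonempty
  have he : ∀ i, ContDiff ℝ (⊤ : ℕ∞) (e i) := fun i => (contDiff_const.mul (hc i)).exp
  have hZc : ContDiff ℝ (⊤ : ℕ∞) Z := ContDiff.sum fun i _ => he i
  refine ⟨fun p => -η * Real.log (Z p), contDiff_const.mul (hZc.log fun p => (hZ p).ne'), ?_, ?_, ?_⟩
  · intro p ξ B hB
    have h1 : ∀ i, HasFDerivAt (e i) (e i p • (-(1 / η)) • fderiv ℝ (c i) p) p := fun i =>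
      ((((hc i).differentiable (by simp)) p).hasFDerivAt.const_mul (-(1 / η))).exp
    have h2 : HasFDerivAt Z (∑ i, e i p • (-(1 / η)) • fderiv ℝ (c i) p) p :=
      HasFDerivAt.fun_sum fun i _ => h1 i
    have h3 := ((h2.log (hZ p).ne').const_mul (-η)).fderiv
    rw [h3]
    simp only [smul_apply, sum_apply, smul_eq_mul]
    have e1 : -η * ((Z p)⁻¹ * ∑ i, e i p * (-(1 / η) * (fderiv ℝ (c i) p) ξ)) =
        (Z p)⁻¹ * ∑ i, e i p * fderiv ℝ (c i) p ξ := by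
      rw [Finset.mul_sum, Finset.mul_sum, Finset.mul_sum]
      refine Finset.sum_congr rfl fun i _ => ?_
      field_simp
    rw [e1, inv_mul_le_iff₀ (hZ p)]
    simp only [Z]
    rw [Finset.sum_mul]
    exact Finset.sum_le_sum fun i _ => mul_le_mul_of_nonneg_left (hB i) (Real.exp_pos _).le
  · intro p i
    have : e i p ≤ Z p := Finset.single_le_sum (f := fun i => e i p)
      (fun i _ => (Real.exp_pos _).le) (Finset.mem_univ i)
    have h2 := Real.log_le_log (Real.exp_pos _) this
    rw [Real.log_exp] at h2
    have h3 := mul_le_mul_of_nonneg_left h2 hη.le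
    have : η * (-(1 / η) * c i p) = - c i p := by field_simp
    simp only []
    linarith
  · intro p
    obtain ⟨i, hi⟩ := Finite.exists_min fun i => c i p
    refine ⟨i, ?_⟩
    have : Z p ≤ Fintype.card ι * e i p := by
      have := Finset.sum_le_card_nsmul Finset.univ (fun j => e j p) (e i p) (fun j _ => by
        simp only [e]
        rw [Real.exp_le_exp]
        have := hi j
        have : 0 < 1 / η := by positivity
        nlinarith)
      simpa using this
    have hcp : (0:ℝ) < Fintype.card ι := by exact_mod_cast Fintype.card_pos
    have h2 := Real.log_le_log (hZ p) this
    rw [Real.log_mul hcp.ne' (Real.exp_pos _).ne', Real.log_exp] at h2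
    have h3 := mul_le_mul_of_nonneg_left h2 hη.le
    have : η * (-(1 / η) * c i p) = - c i p := by field_simp
    simp only []
    linarith

lemma gt_exists {ε : ℝ} (hε : 0 < ε) : ∃ g : ℝ → ℝ, ContDiff ℝ (⊤ : ℕ∞) g ∧ (∀ t, 0 < g t) ∧
    (∀ t, 0 ≤ t → g t = t + ε) := by
  refine ⟨fun t => ε + t * Real.smoothTransition (1 + (2 / ε) * t), ?_, ?_, ?_⟩
  · exact contDiff_const.add (contDiff_id.mul (Real.smoothTransition.contDiff.comp (by fun_prop)))
  · intro t
    have h1 := Real.smoothTransition.nonneg (1 + (2 / ε) * t)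
    have h2 := Real.smoothTransition.le_one (1 + (2 / ε) * t)
    change 0 < ε + t * Real.smoothTransition (1 + (2 / ε) * t)
    rcases le_total 0 t with ht | ht
    · positivity
    · rcases le_or_gt (1 + (2 / ε) * t) 0 with h | h
      · rw [Real.smoothTransition.zero_of_nonpos h]; linarith
      · have h3 : -ε / 2 < t := by
          have : ε * (1 + (2 / ε) * t) = ε + 2 * t := by field_simp
          have := mul_pos hε h
          linarith
        nlinarith
  · intro t ht
    have : 1 ≤ 1 + (2 / ε) * t := by
      have : 0 ≤ (2 / ε) * t := by positivity
      linarith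
    simp only []
    rw [Real.smoothTransition.one_of_one_le this]; ring

lemma subsol {d : ℕ} {K : Set (Eu d)} (hK : IsCompact K) (hne : K.Nonempty) {a : Eu d → ℝ}
    (ha : Continuous a) {ε : ℝ} (hε : 0 < ε) : ∃ u : Eu d × ℝ → ℝ, ContDiff ℝ (⊤ : ℕ∞) u ∧
      (∀ z w : Eu d, ∀ t : ℝ, 0 < t → fderiv ℝ u (z, t) (w, 1) ≤ ‖w‖ ^ 2 / 2) ∧
      (∀ z : Eu d, ∀ t : ℝ, 0 ≤ t → ∀ x ∈ K, u (z, t) ≤ a x + ‖x - z‖ ^ 2 / (2 * (t + ε)) +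
        ε * (1 + ‖x - z‖)) ∧
      (∀ z : Eu d, ∀ t : ℝ, 0 ≤ t → ∃ x ∈ K, a x + ‖x - z‖ ^ 2 / (2 * (t + ε)) - ε ≤ u (z, t)) := by
  obtain ⟨ρ0, hρ0, huc⟩ := Metric.uniformContinuousOn_iff.1
    (hK.uniformContinuousOn_of_continuous ha.continuousOn) (ε / 2) (by positivity)
  set ρ := min ρ0 (min (ε ^ 2) ε) with hρd
  have hρ : 0 < ρ := lt_min hρ0 (lt_min (by positivity) hε)
  have hρ1 : ρ ≤ ε ^ 2 := (min_le_right _ _).trans (min_le_left _ _)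
  have hρ2 : ρ ≤ ε := (min_le_right _ _).trans (min_le_right _ _)
  obtain ⟨N, hNK, hNf, hcov⟩ := hK.finite_cover_balls hρ
  obtain ⟨x0, hx0⟩ := hne
  have hNne : N.Nonempty := by
    have := hcov hx0
    simp only [mem_iUnion] at this
    obtain ⟨y, hy, -⟩ := this
    exact ⟨y, hy⟩
  have : Fintype N := hNf.fintype
  have : Nonempty N := hNne.to_subtype
  obtain ⟨g, hg, hgp, hgt⟩ := gt_exists hε
  let c : N → Eu d × ℝ → ℝ := fun i p => a i + ‖(i : Eu d) - p.1‖ ^ 2 / (2 * g p.2)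
  have hcc : ∀ i, ContDiff ℝ (⊤ : ℕ∞) (c i) := fun i => by
    have h1 : ContDiff ℝ (⊤ : ℕ∞) fun p : Eu d × ℝ => ‖(i : Eu d) - p.1‖ ^ 2 :=
      (contDiff_const.sub contDiff_fst).norm_sq ℝ
    exact contDiff_const.add (h1.div (contDiff_const.mul (hg.comp contDiff_snd))
      (fun p => by have := hgp p.2; positivity))
  have hlog : 0 ≤ Real.log (Fintype.card N) := Real.log_nonneg (by exact_mod_cast Fintype.card_pos)
  obtain ⟨u, hu, h1, h2, h3⟩ := softmin c hcc (η := ε / (1 + Real.log (Fintype.card N))) (by positivity)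
  refine ⟨u, hu, ?_, ?_, ?_⟩
  · intro z w t ht
    refine h1 _ _ _ fun i => ?_
    have hL := (((hcc i).differentiable (by simp)) (z, t)).hasFDerivAt.hasLineDerivAt (w, 1)
    have hL2 : HasDerivAt (fun s : ℝ => a i + ‖(i : Eu d) - (z + s • w)‖ ^ 2 / (2 * (t + s + ε)))
        (((-2 * ⟪(i : Eu d) - z, w⟫) * (2 * (t + ε)) - ‖(i : Eu d) - z‖ ^ 2 * 2) / (2 * (t + ε)) ^ 2) 0 := by
      have n1 : HasDerivAt (fun s : ℝ => (i : Eu d) - (z + s • w)) (-w) 0 := by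
        simpa using (((hasDerivAt_id (0:ℝ)).smul_const w).const_add z).const_sub (i : Eu d)
      have n2 := n1.norm_sq
      simp only [zero_smul, add_zero, inner_neg_right] at n2
      have n3 : HasDerivAt (fun s : ℝ => 2 * (t + s + ε)) 2 0 := by
        simpa using (((hasDerivAt_id (0:ℝ)).const_add t).add_const ε).const_mul 2
      have n4 := (n2.div n3 (by simp only [add_zero]; positivity)).const_add (a i)
      simp only [zero_smul, add_zero] at n4
      have e : (-2 * ⟪(i : Eu d) - z, w⟫) = 2 * -⟪(i : Eu d) - z, w⟫ := by ring
      rw [e]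
      exact n4
    have hE : (fun s : ℝ => a i + ‖(i : Eu d) - (z + s • w)‖ ^ 2 / (2 * (t + s + ε))) =ᶠ[nhds 0]
        fun s : ℝ => c i ((z, t) + s • (w, 1)) := by
      filter_upwards [lt_mem_nhds (show -t < 0 by linarith)] with s hs
      simp only [c, Prod.smul_mk, Prod.mk_add_mk, smul_eq_mul, mul_one]
      rw [hgt _ (by linarith)]
    have := (hL2.congr_of_eventuallyEq hE.symm).unique hL
    rw [← this, div_le_iff₀ (by positivity)]
    have hp : 0 < t + ε := by positivity
    have hsq : 0 ≤ ‖(t + ε) • w + ((i : Eu d) - z)‖ ^ 2 := sq_nonneg _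
    rw [norm_add_sq_real, norm_smul, real_inner_smul_left, Real.norm_of_nonneg hp.le, mul_pow,
      real_inner_comm] at hsq
    nlinarith
  · intro z t ht x hx
    have := hcov hx
    simp only [mem_iUnion] at this
    obtain ⟨y, hy, hxy⟩ := this
    refine (h2 (z, t) ⟨y, hy⟩).trans ?_
    simp only [c]
    rw [hgt t ht]
    rw [Metric.mem_ball] at hxy
    have b1 := huc x hx y (hNK hy) (hxy.trans_le (min_le_left _ _))
    rw [Real.dist_eq, abs_lt] at b1
    rw [dist_eq_norm, norm_sub_rev] at hxy
    have b2 : ‖y - z‖ ≤ ρ + ‖x - z‖ := by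
      have := norm_add_le (y - x) (x - z)
      rw [sub_add_sub_cancel] at this
      linarith
    have b3 : ‖y - z‖ ^ 2 ≤ ‖x - z‖ ^ 2 + (2 * (ε * ‖x - z‖) + ε) * ε := by
      have : ‖y - z‖ ^ 2 ≤ (ρ + ‖x - z‖) ^ 2 := by gcongr
      have e1 : ρ * ‖x - z‖ ≤ ε ^ 2 * ‖x - z‖ := by gcongr
      have e2 : ρ ^ 2 ≤ ε ^ 2 := by gcongr
      nlinarith
    have b4 : ‖y - z‖ ^ 2 / (2 * (t + ε)) ≤ ‖x - z‖ ^ 2 / (2 * (t + ε)) + (ε * ‖x - z‖ + ε / 2) := by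
      rw [div_le_iff₀ (by positivity), add_mul, div_mul_cancel₀ _ (by positivity)]
      refine b3.trans ?_
      have : (2 * (ε * ‖x - z‖) + ε) * ε ≤ (2 * (ε * ‖x - z‖) + ε) * (t + ε) := by
        gcongr; linarith
      linarith
    linarith [b1.1]
  · intro z t ht
    obtain ⟨i, hi⟩ := h3 (z, t)
    refine ⟨i, hNK i.2, le_trans ?_ hi⟩
    simp only [c]
    rw [hgt t ht]
    have : ε / (1 + Real.log (Fintype.card N)) * Real.log (Fintype.card N) ≤ ε := by
      rw [div_mul_eq_mul_div, div_le_iff₀ (by positivity)]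
      nlinarith
    linarith

open Set MeasureTheory ProbabilityTheory
open scoped ENNReal RealInnerProductSpace

/-- truncation profile -/
def Tr (c : ℝ) (h : ℝ → ℝ) : Prop := ContDiff ℝ (⊤ : ℕ∞) h ∧ (∀ s ≤ c, h s = s) ∧
    (∀ s, c + 1 ≤ s → h s = h (c + 1)) ∧ (∀ s, 0 ≤ deriv h s ∧ deriv h s ≤ 1) ∧ Monotone h ∧
    ∀ s, h s ≤ c + 1

/-- inf-convolution -/
noncomputable def Fm {d : ℕ} (K : Set (Eu d)) (a : Eu d → ℝ) (z : Eu d) (s : ℝ) : ℝ :=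
  sInf ((fun x => a x + s * ‖x - z‖ ^ 2) '' K)

lemma Fm_cont {d : ℕ} {K : Set (Eu d)} (hK : IsCompact K) {a : Eu d → ℝ} (ha : Continuous a) :
    Continuous fun p : Eu d × ℝ => Fm K a p.1 p.2 := by
  have : Continuous (Function.uncurry fun (p : Eu d × ℝ) (x : Eu d) => a x + p.2 * ‖x - p.1‖ ^ 2) := by
    unfold Function.uncurry; fun_prop
  exact hK.continuous_sInf this

lemma Fm_att {d : ℕ} {K : Set (Eu d)} (hK : IsCompact K) (hne : K.Nonempty) {a : Eu d → ℝ}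
    (ha : Continuous a) (z : Eu d) (s : ℝ) : ∃ x ∈ K, Fm K a z s = a x + s * ‖x - z‖ ^ 2 := by
  have hc : Continuous fun x => a x + s * ‖x - z‖ ^ 2 := by fun_prop
  obtain ⟨x, hx, h⟩ := hK.exists_sInf_image_eq hne hc.continuousOn
  exact ⟨x, hx, h⟩

lemma Fm_le {d : ℕ} {K : Set (Eu d)} (hK : IsCompact K) {a : Eu d → ℝ}
    (ha : Continuous a) (z : Eu d) (s : ℝ) {x : Eu d} (hx : x ∈ K) :
    Fm K a z s ≤ a x + s * ‖x - z‖ ^ 2 := by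
  have hc : Continuous fun x => a x + s * ‖x - z‖ ^ 2 := by fun_prop
  exact csInf_le (hK.image hc).bddBelow ⟨x, hx, rfl⟩

lemma trsub {d : ℕ} {K : Set (Eu d)} (hK : IsCompact K) (hne : K.Nonempty) {a : Eu d → ℝ}
    (ha : Continuous a) {c : ℝ} {h : ℝ → ℝ} (hh : Tr c h) {m : ℝ} (hm : ∀ x ∈ K, m ≤ a x)
    {ε : ℝ} (hε : 0 < ε) (hε1 : ε ≤ 1) : ∃ U : Eu d × ℝ → ℝ, ContDiff ℝ (⊤ : ℕ∞) U ∧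
      (∀ z w : Eu d, ∀ t : ℝ, 0 < t → fderiv ℝ U (z, t) (w, 1) ≤ ‖w‖ ^ 2 / 2) ∧
      (∀ z : Eu d, ∀ t : ℝ, 0 ≤ t → ∀ x ∈ K, U (z, t) ≤ h (a x + ‖x - z‖ ^ 2 / (2 * (t + ε)) +
        ε * (1 + ‖x - z‖))) ∧
      (∀ z : Eu d, ∀ t : ℝ, 0 ≤ t → h (Fm K a z (1 / (2 * (t + ε))) - ε) ≤ U (z, t)) ∧
      (∀ z : Eu d, ∀ t : ℝ, 0 ≤ t → h (m - 1) ≤ U (z, t) ∧ U (z, t) ≤ c + 1) ∧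
      ∃ C, ∀ z : Eu d, ∀ t ∈ Ioo (0:ℝ) 1, ‖fderiv ℝ U (z, t)‖ ≤ C := by
  obtain ⟨hc, hid, hconst, hder, hmono, hle⟩ := hh
  obtain ⟨u, hu, h1, h2, h3⟩ := subsol hK hne ha hε
  have hUc : ContDiff ℝ (⊤ : ℕ∞) (fun p => h (u p)) := hc.comp hu
  refine ⟨fun p => h (u p), hUc, ?_, fun z t ht x hx => hmono (h2 z t ht x hx), ?_, ?_, ?_⟩
  · intro z w t ht
    have e : HasFDerivAt (fun p => h (u p)) (deriv h (u (z, t)) • fderiv ℝ u (z, t)) (z, t) :=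
      ((hc.differentiable (by simp)) _).hasDerivAt.comp_hasFDerivAt (z, t)
        ((hu.differentiable (by simp)) (z, t)).hasFDerivAt
    rw [e.fderiv]
    simp only [smul_apply, smul_eq_mul]
    have e1 := mul_le_mul_of_nonneg_left (h1 z w t ht) (hder (u (z, t))).1
    have e2 := mul_le_mul_of_nonneg_right (hder (u (z, t))).2 (by positivity : 0 ≤ ‖w‖ ^ 2 / 2)
    linarith
  · intro z t ht
    obtain ⟨x, hx, hxu⟩ := h3 z t ht
    refine hmono (le_trans ?_ hxu)
    have := Fm_le hK ha z (1 / (2 * (t + ε))) hx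
    rw [one_div_mul_eq_div] at this
    linarith
  · intro z t ht
    obtain ⟨x, hx, hxu⟩ := h3 z t ht
    refine ⟨hmono (le_trans ?_ hxu), hle _⟩
    have := hm x hx
    have : 0 ≤ ‖x - z‖ ^ 2 / (2 * (t + ε)) := by positivity
    linarith
  · obtain ⟨r, hr⟩ := hK.isBounded.exists_norm_le
    set Q := 2 * (1 + ε) * (c + 1 + ε - m) with hQ
    set R := r + 1 + |Q| with hR
    have hbig : ∀ z : Eu d, R < ‖z‖ → ∀ t ∈ Ioo (0:ℝ) 1, h (u (z, t)) = h (c + 1) := by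
      intro z hz t ht
      obtain ⟨x, hx, hxu⟩ := h3 z t ht.1.le
      refine hconst _ (le_trans ?_ hxu)
      have a1 : 1 + |Q| ≤ ‖x - z‖ := by
        have := norm_sub_norm_le z x
        rw [norm_sub_rev] at this
        have := hr x hx
        linarith
      have a2 : Q ≤ ‖x - z‖ ^ 2 := by
        have : (1 + |Q|) ^ 2 ≤ ‖x - z‖ ^ 2 := by gcongr
        nlinarith [le_abs_self Q, abs_nonneg Q]
      have a3 : c + 1 + ε - m ≤ ‖x - z‖ ^ 2 / (2 * (t + ε)) := by
        rw [le_div_iff₀ (by have := ht.1; positivity)]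
        rcases le_total 0 (c + 1 + ε - m) with hp | hp
        · refine le_trans ?_ a2
          rw [hQ]
          nlinarith [ht.2]
        · have : (c + 1 + ε - m) * (2 * (t + ε)) ≤ 0 :=
            mul_nonpos_of_nonpos_of_nonneg hp (by have := ht.1; positivity)
          exact this.trans (sq_nonneg _)
      linarith [hm x hx]
    have hcpt : IsCompact (Metric.closedBall (0 : Eu d) R ×ˢ Icc (0:ℝ) 1) :=
      (isCompact_closedBall _ _).prod isCompact_Icc
    obtain ⟨C, hC⟩ := hcpt.exists_bound_of_continuousOn (f := fderiv ℝ (fun p => h (u p)))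
      (hUc.continuous_fderiv (by simp)).continuousOn
    refine ⟨max C 0, fun z t ht => ?_⟩
    by_cases hz : ‖z‖ ≤ R
    · exact (hC (z, t) ⟨by simpa using hz, Ioo_subset_Icc_self ht⟩).trans (le_max_left _ _)
    · push Not at hz
      have : (fun p : Eu d × ℝ => h (u p)) =ᶠ[nhds (z, t)] fun _ => h (c + 1) := by
        have o1 : IsOpen {p : Eu d × ℝ | R < ‖p.1‖} := isOpen_lt continuous_const (by fun_prop)
        have o2 : IsOpen {p : Eu d × ℝ | p.2 ∈ Ioo (0:ℝ) 1} := isOpen_Ioo.preimage continuous_snd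
        filter_upwards [o1.mem_nhds (show R < ‖((z, t) : Eu d × ℝ).1‖ from hz), o2.mem_nhds ht] with p p1 p2
        exact hbig p.1 p1 p.2 p2
      rw [this.fderiv_eq]
      simp

open Set MeasureTheory ProbabilityTheory
open scoped ENNReal RealInnerProductSpace

lemma sq_integrable {d : ℕ} {S : Set (Eu d × ℝ)} {v : Eu d × ℝ → Eu d} (hv : Measurable v)
    (hv2 : (∫⁻ z in S, ‖v z‖ₑ ^ 2 ∂(spaceTime d)) < ⊤) :
    Integrable (fun z => ‖v z‖ ^ 2) ((spaceTime d).restrict S) := by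
  refine ⟨(hv.norm.pow_const 2).aestronglyMeasurable, ?_⟩
  rw [HasFiniteIntegral]
  refine lt_of_eq_of_lt (lintegral_congr fun z => ?_) hv2
  rw [enorm_pow, enorm_norm]

lemma star_fix {d : ℕ} {A B : Set (Eu d)} {S : Set (Eu d × ℝ)} {v : Eu d × ℝ → Eu d}
    (hp : SPath A B S v) (hA : volume A < ⊤) (hB : volume B < ⊤) {U V : Eu d × ℝ → ℝ}
    (hU : ContDiff ℝ (⊤ : ℕ∞) U) (hV : ContDiff ℝ (⊤ : ℕ∞) V)
    (hU1 : ∀ z w : Eu d, ∀ t : ℝ, 0 < t → fderiv ℝ U (z, t) (w, 1) ≤ ‖w‖ ^ 2 / 2)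
    (hV1 : ∀ z w : Eu d, ∀ t : ℝ, 0 < t → fderiv ℝ V (z, t) (w, 1) ≤ ‖w‖ ^ 2 / 2)
    {C : ℝ} (hUC : ∀ z : Eu d, ∀ t : ℝ, 0 ≤ t → |U (z, t)| ≤ C)
    (hVC : ∀ z : Eu d, ∀ t : ℝ, 0 ≤ t → |V (z, t)| ≤ C)
    (hUD : ∃ C, ∀ z : Eu d, ∀ t ∈ Ioo (0:ℝ) 1, ‖fderiv ℝ U (z, t)‖ ≤ C)
    (hVD : ∃ C, ∀ z : Eu d, ∀ t ∈ Ioo (0:ℝ) 1, ‖fderiv ℝ V (z, t)‖ ≤ C)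
    {χ : ℝ → ℝ} (hχ : ContDiff ℝ (⊤ : ℕ∞) χ) (hχ0 : χ 0 = 0) (hχ1 : χ 1 = 1)
    (hχI : ∀ t ∈ Icc (0:ℝ) 1, χ t ∈ Icc (0:ℝ) 1) :
    -(∫ x in B, V (x, 0)) - (∫ x in A, U (x, 0)) +
      ∫ z in S, deriv χ z.2 * (U z + V (z.1, 1 - z.2)) ∂(spaceTime d) ≤
      (∫ z in S, ‖v z‖ ^ 2 ∂(spaceTime d)) / 2 := by
  have hp' := hp
  obtain ⟨hS, hSf, hv, hv2, -⟩ := hp'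
  have hfS : IsFiniteMeasure ((spaceTime d).restrict S) := ⟨by simpa using hSf⟩
  have hvi := sq_enorm_integrable hSf hv hv2
  obtain ⟨CU, hCU⟩ := hUD
  obtain ⟨CV, hCV⟩ := hVD
  have hχd : Continuous (deriv χ) := hχ.continuous_deriv (by simp)
  obtain ⟨Cχ, hCχ⟩ := (isCompact_Icc (a := (0:ℝ)) (b := 1)).exists_bound_of_continuousOn hχd.continuousOn
  have hC : 0 ≤ C := (abs_nonneg _).trans (hUC 0 0 le_rfl)
  have hmid : (1/2:ℝ) ∈ Ioo (0:ℝ) 1 := ⟨by norm_num, by norm_num⟩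
  have hCU0 : 0 ≤ CU := (norm_nonneg _).trans (hCU 0 (1/2) hmid)
  have hCV0 : 0 ≤ CV := (norm_nonneg _).trans (hCV 0 (1/2) hmid)
  have hCχ0 : 0 ≤ Cχ := (norm_nonneg _).trans (hCχ 0 ⟨le_rfl, zero_le_one⟩)
  let σ : Eu d × ℝ → Eu d × ℝ := fun p => (p.1, 1 - p.2)
  have hσ : ContDiff ℝ (⊤ : ℕ∞) σ := by simp only [σ]; fun_prop
  let L : Eu d × ℝ →L[ℝ] Eu d × ℝ :=
    (ContinuousLinearMap.fst ℝ (Eu d) ℝ).prod (-(ContinuousLinearMap.snd ℝ (Eu d) ℝ))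
  have hσd : ∀ p, HasFDerivAt σ L p := by
    intro p
    exact (ContinuousLinearMap.fst ℝ (Eu d) ℝ).hasFDerivAt.prodMk
      ((ContinuousLinearMap.snd ℝ (Eu d) ℝ).hasFDerivAt.const_sub 1)
  have hL : ∀ w : Eu d × ℝ, ‖L w‖ ≤ ‖w‖ := by
    intro w
    simp [L, Prod.norm_def]
  have hL1 : ‖L‖ ≤ 1 := L.opNorm_le_bound zero_le_one (fun w => by rw [one_mul]; exact hL w)
  let q : Eu d × ℝ → ℝ := fun p => (1 - χ p.2) * U p - χ p.2 * V (σ p)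
  have hq : ContDiff ℝ (⊤ : ℕ∞) q := by
    have h1 : ContDiff ℝ (⊤ : ℕ∞) (fun p : Eu d × ℝ => χ p.2) := hχ.comp contDiff_snd
    exact ((contDiff_const.sub h1).mul hU).sub (h1.mul (hV.comp hσ))
  let sn := ContinuousLinearMap.snd ℝ (Eu d) ℝ
  have hqd : ∀ p, fderiv ℝ q p = ((1 - χ p.2) • fderiv ℝ U p + U p • (-(deriv χ p.2 • sn))) -
      (χ p.2 • ((fderiv ℝ V (σ p)).comp L) + V (σ p) • (deriv χ p.2 • sn)) := by
    intro p
    have h1 : HasFDerivAt (fun p : Eu d × ℝ => χ p.2) (deriv χ p.2 • sn) p :=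
      ((hχ.differentiable (by simp)) p.2).hasDerivAt.comp_hasFDerivAt p sn.hasFDerivAt
    have h2 := ((hU.differentiable (by simp)) p).hasFDerivAt
    have h3 : HasFDerivAt (fun p => V (σ p)) ((fderiv ℝ V (σ p)).comp L) p :=
      ((hV.differentiable (by simp)) (σ p)).hasFDerivAt.comp p (hσd p)
    exact (((h1.const_sub 1).mul h2).sub (h1.mul h3)).fderiv
  have hsn : ‖sn‖ ≤ 1 := ContinuousLinearMap.norm_snd_le ..
  have hσI : ∀ t ∈ Ioo (0:ℝ) 1, 1 - t ∈ Ioo (0:ℝ) 1 := fun t ht => ⟨by linarith [ht.2], by linarith [ht.1]⟩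
  have hqC0 : ∀ z, ∀ t ∈ Icc (0:ℝ) 1, |q (z, t)| ≤ 2 * C := by
    intro z t ht
    have h1 := hUC z t ht.1
    have h2 := hVC z (1 - t) (by linarith [ht.2])
    have h3 := hχI t ht
    have h4 : |(1 - χ t) * U (z, t)| ≤ C := by
      rw [abs_mul, abs_of_nonneg (by linarith [h3.2])]
      nlinarith [h3.1, h3.2, abs_nonneg (U (z, t))]
    have h5 : |χ t * V (z, 1 - t)| ≤ C := by
      rw [abs_mul, abs_of_nonneg h3.1]
      nlinarith [h3.1, h3.2, abs_nonneg (V (z, 1 - t))]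
    have := abs_sub ((1 - χ t) * U (z, t)) (χ t * V (z, 1 - t))
    simp only [q, σ]
    linarith
  have hqC1 : ∀ z, ∀ t ∈ Ioo (0:ℝ) 1, ‖fderiv ℝ q (z, t)‖ ≤ CU + C * Cχ + (CV + C * Cχ) := by
    intro z t ht
    rw [hqd]
    have h3 := hχI t ⟨ht.1.le, ht.2.le⟩
    have hd : ‖deriv χ t • sn‖ ≤ Cχ := by
      rw [norm_smul]
      have := hCχ t ⟨ht.1.le, ht.2.le⟩
      nlinarith [norm_nonneg sn, norm_nonneg (deriv χ t)]
    have e1 : ‖(1 - χ t) • fderiv ℝ U (z, t)‖ ≤ CU := by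
      rw [norm_smul, Real.norm_of_nonneg (by linarith [h3.2])]
      nlinarith [hCU z t ht, h3.1, h3.2, norm_nonneg (fderiv ℝ U (z, t))]
    have e2 : ‖U (z, t) • (-(deriv χ t • sn))‖ ≤ C * Cχ := by
      rw [norm_smul, norm_neg]
      exact mul_le_mul (hUC z t ht.1.le) hd (norm_nonneg _) hC
    have e3 : ‖χ t • ((fderiv ℝ V (σ (z, t))).comp L)‖ ≤ CV := by
      rw [norm_smul, Real.norm_of_nonneg h3.1]
      have h4 := hCV z (1 - t) (hσI t ht)
      have h5 := (fderiv ℝ V (σ (z, t))).opNorm_comp_le L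
      have h6 : ‖fderiv ℝ V (σ (z, t))‖ * ‖L‖ ≤ CV * 1 := mul_le_mul h4 hL1 (norm_nonneg _) hCV0
      nlinarith [h3.1, h3.2, norm_nonneg ((fderiv ℝ V (σ (z, t))).comp L)]
    have e4 : ‖V (σ (z, t)) • (deriv χ t • sn)‖ ≤ C * Cχ := by
      rw [norm_smul]
      exact mul_le_mul (hVC z (1 - t) (hσI t ht).1.le) hd (norm_nonneg _) hC
    refine (norm_sub_le _ _).trans (add_le_add ((norm_add_le _ _).trans (add_le_add e1 e2))
      ((norm_add_le _ _).trans (add_le_add e3 e4)))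
  set M := 2 * C + (CU + C * Cχ + (CV + C * Cχ)) with hM
  have key := ext_test hp hA hB hq (C := M)
    (fun z t ht => (hqC0 z t ht).trans (by rw [hM]; have : 0 ≤ CU + C * Cχ + (CV + C * Cχ) := by positivity
                                           linarith))
    (fun z t ht => (hqC1 z t ht).trans (by rw [hM]; linarith))
  have hb1 : (∫ x in B, q (x, 1)) = -(∫ x in B, V (x, 0)) := by
    rw [← integral_neg]; congr 1; ext x; simp [q, σ, hχ1]
  have ha1 : (∫ x in A, q (x, 0)) = ∫ x in A, U (x, 0) := by
    congr 1; ext x; simp [q, hχ0]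
  rw [hb1, ha1] at key
  have hIoo : ∀ᵐ z ∂((spaceTime d).restrict S), z.2 ∈ Ioo (0:ℝ) 1 := ae_restrict_of_ae (spaceTime_ae_Ioo d)
  have hqi : Integrable (fun z => fderiv ℝ q z (v z, 1)) ((spaceTime d).restrict S) := by
    refine test_integrable hvi hq (CU + C * Cχ + (CV + C * Cχ)) ?_
    filter_upwards [hIoo] with z hz using hqC1 z.1 z.2 hz
  have hsi := sq_integrable hv hv2
  have hci : Integrable (fun z : Eu d × ℝ => deriv χ z.2 * (U z + V (z.1, 1 - z.2)))
      ((spaceTime d).restrict S) := by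
    refine Integrable.of_bound (C := Cχ * (C + C)) ?_ ?_
    · have := hU.continuous; have := hV.continuous
      exact Continuous.aestronglyMeasurable (by fun_prop)
    · filter_upwards [hIoo] with z hz
      rw [norm_mul]
      refine mul_le_mul (hCχ _ ⟨hz.1.le, hz.2.le⟩) ?_ (norm_nonneg _) hCχ0
      exact (norm_add_le _ _).trans (add_le_add (hUC z.1 z.2 hz.1.le) (hVC z.1 _ (hσI _ hz).1.le))
  have hle : ∫ z in S, (fderiv ℝ q z (v z, 1) + deriv χ z.2 * (U z + V (z.1, 1 - z.2))) ∂(spaceTime d)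
      ≤ ∫ z in S, ‖v z‖ ^ 2 / 2 ∂(spaceTime d) := by
    refine integral_mono_ae (hqi.add hci) (hsi.div_const 2) ?_
    filter_upwards [hIoo] with z hz
    have h3 := hχI z.2 ⟨hz.1.le, hz.2.le⟩
    have hLw : L (v z, 1) = -(-(v z), 1) := by simp [L]
    have e1 := hU1 z.1 (v z) z.2 hz.1
    have e2 := hV1 z.1 (-(v z)) (1 - z.2) (hσI _ hz).1
    rw [norm_neg] at e2
    rw [hqd]
    simp only [sub_apply, add_apply, smul_apply, neg_apply, ContinuousLinearMap.comp_apply, hLw,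
      map_neg, smul_eq_mul]
    have e3 : sn (v z, 1) = 1 := rfl
    have e4 : σ z = (z.1, 1 - z.2) := rfl
    rw [e3, e4]
    have e5 := mul_le_mul_of_nonneg_left e1 (by linarith [h3.2] : 0 ≤ 1 - χ z.2)
    have e6 := mul_le_mul_of_nonneg_left e2 h3.1
    linear_combination e5 + e6
  rw [integral_add hqi hci, integral_div, key] at hle
  linarith

open Set MeasureTheory ProbabilityTheory
open scoped ENNReal RealInnerProductSpace

lemma trsub_seq {d : ℕ} {K : Set (Eu d)} (hK : IsCompact K) (hne : K.Nonempty) {a : Eu d → ℝ}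
    (ha : Continuous a) {c : ℝ} {h : ℝ → ℝ} (hh : Tr c h) (hac : ∀ x ∈ K, a x ≤ c - 1) :
    ∃ (U : ℕ → Eu d × ℝ → ℝ) (C : ℝ), (∀ n, ContDiff ℝ (⊤ : ℕ∞) (U n)) ∧
      (∀ n, ∀ z w : Eu d, ∀ t : ℝ, 0 < t → fderiv ℝ (U n) (z, t) (w, 1) ≤ ‖w‖ ^ 2 / 2) ∧
      (∀ n, ∀ x ∈ K, U n (x, 0) ≤ a x + 1 / ((n : ℝ) + 1)) ∧
      (∀ n, ∀ z : Eu d, ∀ t : ℝ, 0 ≤ t → |U n (z, t)| ≤ C) ∧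
      (∀ n, ∃ C, ∀ z : Eu d, ∀ t ∈ Ioo (0:ℝ) 1, ‖fderiv ℝ (U n) (z, t)‖ ≤ C) ∧
      (∀ z : Eu d, ∀ t : ℝ, 0 < t → Filter.Tendsto (fun n => U n (z, t)) Filter.atTop
        (nhds (h (Fm K a z (1 / (2 * t)))))) := by
  obtain ⟨xm, hxm, hmin⟩ := hK.exists_isMinOn hne ha.continuousOn
  have hm : ∀ x ∈ K, a xm ≤ a x := fun x hx => hmin hx
  let e : ℕ → ℝ := fun n => 1 / ((n : ℝ) + 1)
  have hep : ∀ n, 0 < e n := fun n => by simp only [e]; positivity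
  have he1 : ∀ n, e n ≤ 1 := fun n => by
    simp only [e]; rw [div_le_one (by positivity)]; have : (0:ℝ) ≤ n := by positivity
    linarith
  have he0 : Filter.Tendsto e Filter.atTop (nhds 0) := tendsto_one_div_add_atTop_nhds_zero_nat
  choose U hU h1 h2 h3 h4 h5 using fun n => trsub hK hne ha hh hm (hep n) (he1 n)
  have hhc : Continuous h := hh.1.continuous
  refine ⟨U, |h (a xm - 1)| + |c + 1|, hU, h1, ?_, ?_, h5, ?_⟩
  · intro n x hx
    have := h2 n x 0 le_rfl x hx
    simp only [sub_self, norm_zero, ne_eq, OfNat.ofNat_ne_zero, not_false_eq_true, zero_pow, zero_div,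
      add_zero, mul_one] at this
    rwa [hh.2.1 _ (by linarith [hac x hx, he1 n])] at this
  · intro n z t ht
    have := h4 n z t ht
    rw [abs_le]
    constructor
    · linarith [neg_abs_le (h (a xm - 1)), abs_nonneg (c + 1)]
    · linarith [le_abs_self (c + 1), abs_nonneg (h (a xm - 1))]
  · intro z t ht
    obtain ⟨x, hx, hxF⟩ := Fm_att hK hne ha z (1 / (2 * t))
    have hFc : Continuous fun s : ℝ => Fm K a z s :=
      (Fm_cont hK ha).comp (continuous_const.prodMk continuous_id : Continuous fun s : ℝ => (z, s))
    have hlim : Filter.Tendsto (fun n => 1 / (2 * (t + e n))) Filter.atTop (nhds (1 / (2 * t))) := by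
      have : Filter.Tendsto (fun n => 1 / (2 * (t + e n))) Filter.atTop (nhds (1 / (2 * (t + 0)))) := by
        refine Filter.Tendsto.div tendsto_const_nhds ((tendsto_const_nhds.add he0).const_mul 2) ?_
        simp; positivity
      simpa using this
    refine tendsto_of_tendsto_of_tendsto_of_le_of_le ?_ ?_ (fun n => h3 n z t ht.le)
      (fun n => h2 n z t ht.le x hx)
    · have g1 : Filter.Tendsto (fun n => Fm K a z (1 / (2 * (t + e n))) - e n) Filter.atTop
          (nhds (Fm K a z (1 / (2 * t)) - 0)) :=
        Filter.Tendsto.sub ((hFc.tendsto (1 / (2 * t))).comp hlim) he0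
      rw [sub_zero] at g1
      exact (hhc.tendsto _).comp g1
    · have g1 : Filter.Tendsto (fun n => a x + ‖x - z‖ ^ 2 / (2 * (t + e n)) + e n * (1 + ‖x - z‖))
          Filter.atTop (nhds (a x + (1 / (2 * t)) * ‖x - z‖ ^ 2 + 0 * (1 + ‖x - z‖))) := by
        refine ((tendsto_const_nhds).add ?_).add (he0.mul_const _)
        simpa [div_eq_inv_mul] using hlim.mul_const (‖x - z‖ ^ 2)
      rw [zero_mul, add_zero, ← hxF] at g1
      exact (hhc.tendsto _).comp g1

lemma star {d : ℕ} {A B K K1 : Set (Eu d)} {S : Set (Eu d × ℝ)} {v : Eu d × ℝ → Eu d}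
    (hp : SPath A B S v) (hA : volume A < ⊤) (hB : volume B < ⊤) (hAm : MeasurableSet A)
    (hBm : MeasurableSet B) (hK : IsCompact K) (hKn : K.Nonempty) (hK1 : IsCompact K1) (hK1n : K1.Nonempty)
    (hAK : A ⊆ K) (hBK : B ⊆ K1) {a b : Eu d → ℝ} (ha : Continuous a) (hb : Continuous b)
    {c : ℝ} {h : ℝ → ℝ} (hh : Tr c h) (hac : ∀ x ∈ K, a x ≤ c - 1) (hbc : ∀ x ∈ K1, b x ≤ c - 1)
    {χ : ℝ → ℝ} (hχ : ContDiff ℝ (⊤ : ℕ∞) χ) (hχ0 : χ 0 = 0) (hχ1 : χ 1 = 1)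
    (hχI : ∀ t ∈ Icc (0:ℝ) 1, χ t ∈ Icc (0:ℝ) 1) :
    -(∫ x in B, b x) - (∫ x in A, a x) +
      ∫ z in S, deriv χ z.2 * (h (Fm K a z.1 (1 / (2 * z.2))) + h (Fm K1 b z.1 (1 / (2 * (1 - z.2)))))
        ∂(spaceTime d) ≤ (∫ z in S, ‖v z‖ ^ 2 ∂(spaceTime d)) / 2 := by
  have hp' := hp
  obtain ⟨hS, hSf, hv, hv2, -⟩ := hp'
  have hfS : IsFiniteMeasure ((spaceTime d).restrict S) := ⟨by simpa using hSf⟩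
  obtain ⟨U, CU, hU, hU1, hUa, hUC, hUD, hUt⟩ := trsub_seq hK hKn ha hh hac
  obtain ⟨V, CV, hV, hV1, hVb, hVC, hVD, hVt⟩ := trsub_seq hK1 hK1n hb hh hbc
  have hχd : Continuous (deriv χ) := hχ.continuous_deriv (by simp)
  obtain ⟨Cχ, hCχ⟩ := (isCompact_Icc (a := (0:ℝ)) (b := 1)).exists_bound_of_continuousOn hχd.continuousOn
  have hCχ0 : 0 ≤ Cχ := (norm_nonneg _).trans (hCχ 0 ⟨le_rfl, zero_le_one⟩)
  have hIoo : ∀ᵐ z ∂((spaceTime d).restrict S), z.2 ∈ Ioo (0:ℝ) 1 := ae_restrict_of_ae (spaceTime_ae_Ioo d)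
  have he0 : Filter.Tendsto (fun n : ℕ => 1 / ((n : ℝ) + 1)) Filter.atTop (nhds 0) :=
    tendsto_one_div_add_atTop_nhds_zero_nat
  have bd : ∀ {A K : Set (Eu d)} {a : Eu d → ℝ} (_ : volume A < ⊤) (_ : MeasurableSet A)
      (_ : IsCompact K) (_ : A ⊆ K) (_ : Continuous a) {U : Eu d × ℝ → ℝ} (_ : Continuous U) {C e : ℝ}
      (_ : ∀ z : Eu d, ∀ t : ℝ, 0 ≤ t → |U (z, t)| ≤ C) (_ : ∀ x ∈ K, U (x, 0) ≤ a x + e),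
      ∫ x in A, U (x, 0) ≤ (∫ x in A, a x) + e * volume.real A := by
    intro A K a hA hAm hK hAK ha U hU C e hUC hUe
    have hfA : IsFiniteMeasure (volume.restrict A) := ⟨by simpa using hA⟩
    obtain ⟨Ca, hCa⟩ := hK.exists_bound_of_continuousOn ha.continuousOn
    have i1 : Integrable a (volume.restrict A) := by
      refine Integrable.of_bound ha.aestronglyMeasurable Ca ?_
      filter_upwards [ae_restrict_mem hAm] with x hx using hCa x (hAK hx)
    have i2 : Integrable (fun x => U (x, 0)) (volume.restrict A) :=
      Integrable.of_bound (hU.comp (by fun_prop : Continuous fun x : Eu d => (x, (0:ℝ)))).aestronglyMeasurable C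
        (Filter.Eventually.of_forall fun x => hUC x 0 le_rfl)
    have : ∫ x in A, U (x, 0) ≤ ∫ x in A, (a x + e) := by
      refine integral_mono_ae i2 (i1.add (integrable_const e)) ?_
      filter_upwards [ae_restrict_mem hAm] with x hx using hUe x (hAK hx)
    rw [integral_add i1 (integrable_const e), integral_const] at this
    simpa [mul_comm] using this
  have ineq : ∀ n : ℕ, -((∫ x in B, b x) + 1 / ((n : ℝ) + 1) * volume.real B) -
      ((∫ x in A, a x) + 1 / ((n : ℝ) + 1) * volume.real A) +
      ∫ z in S, deriv χ z.2 * (U n z + V n (z.1, 1 - z.2)) ∂(spaceTime d) ≤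
      (∫ z in S, ‖v z‖ ^ 2 ∂(spaceTime d)) / 2 := by
    intro n
    have := star_fix hp hA hB (hU n) (hV n) (hU1 n) (hV1 n) (C := max CU CV)
      (fun z t ht => (hUC n z t ht).trans (le_max_left _ _))
      (fun z t ht => (hVC n z t ht).trans (le_max_right _ _)) (hUD n) (hVD n) hχ hχ0 hχ1 hχI
    have e1 := bd hA hAm hK hAK ha (hU n).continuous (hUC n) (hUa n)
    have e2 := bd hB hBm hK1 hBK hb (hV n).continuous (hVC n) (hVb n)
    linarith
  have lim : Filter.Tendsto (fun n => ∫ z in S, deriv χ z.2 * (U n z + V n (z.1, 1 - z.2)) ∂(spaceTime d))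
      Filter.atTop (nhds (∫ z in S, deriv χ z.2 * (h (Fm K a z.1 (1 / (2 * z.2))) +
        h (Fm K1 b z.1 (1 / (2 * (1 - z.2))))) ∂(spaceTime d))) := by
    refine tendsto_integral_of_dominated_convergence (fun _ => Cχ * (CU + CV)) ?_ (integrable_const _) ?_ ?_
    · intro n
      have := (hU n).continuous; have := (hV n).continuous
      exact Continuous.aestronglyMeasurable (by fun_prop)
    · intro n
      filter_upwards [hIoo] with z hz
      rw [norm_mul]
      refine mul_le_mul (hCχ _ ⟨hz.1.le, hz.2.le⟩) ?_ (norm_nonneg _) hCχ0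
      exact (norm_add_le _ _).trans (add_le_add (hUC n z.1 z.2 hz.1.le)
        (hVC n z.1 _ (by linarith [hz.2])))
    · filter_upwards [hIoo] with z hz
      exact ((hUt z.1 z.2 hz.1).add (hVt z.1 (1 - z.2) (by linarith [hz.2]))).const_mul _
  have lim2 := ((((he0.mul_const (volume.real B)).const_add (∫ x in B, b x)).neg).sub
    ((he0.mul_const (volume.real A)).const_add (∫ x in A, a x))).add lim
  simp only [zero_mul, add_zero] at lim2
  exact le_of_tendsto' lim2 ineq

open Set MeasureTheory ProbabilityTheory
open scoped ENNReal RealInnerProductSpace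

lemma tr_sum {c : ℝ} {h : ℝ → ℝ} (hh : Tr c h) (hc : 1 ≤ c) {s u : ℝ} (hs : -(c - 1) ≤ s)
    (hu : -(c - 1) ≤ u) (hsu : 0 ≤ s + u) : 0 ≤ h s + h u ∧ (h s + h u = 0 → s + u = 0) := by
  obtain ⟨-, hid, -, -, hmono, -⟩ := hh
  have h1 : ∀ s, -(c - 1) ≤ s → -(c - 1) ≤ h s := fun s hs => by
    have := hmono hs
    rwa [hid (-(c - 1)) (by linarith)] at this
  have h2 : ∀ s, c ≤ s → c ≤ h s := fun s hs => by
    have := hmono hs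
    rwa [hid c le_rfl] at this
  rcases le_total s c with k | k
  · rcases le_total u c with k' | k'
    · rw [hid _ k, hid _ k']; exact ⟨hsu, id⟩
    · have := h1 s hs; have := h2 u k'
      exact ⟨by linarith, fun h => by linarith⟩
  · have := h1 u hu; have := h2 s k
    exact ⟨by linarith, fun h => by linarith⟩

lemma dual_ident {d : ℕ} (x y z : Eu d) {t : ℝ} (h0 : 0 < t) (h1 : t < 1) :
    1 / (2 * t) * ‖x - z‖ ^ 2 + 1 / (2 * (1 - t)) * ‖y - z‖ ^ 2 =
      ‖x - y‖ ^ 2 / 2 + ‖z - ((1 - t) • x + t • y)‖ ^ 2 / (2 * t * (1 - t)) := by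
  have h2 : 0 < 1 - t := by linarith
  have e1 : x - y = (x - z) - (y - z) := by abel
  have e2 : z - ((1 - t) • x + t • y) = -((1 - t) • (x - z) + t • (y - z)) := by
    module
  rw [e1, e2, norm_neg, @norm_sub_sq_real _ _ _ (x - z), @norm_add_sq_real, norm_smul, norm_smul, inner_smul_left, inner_smul_right,
    Real.norm_of_nonneg h0.le, Real.norm_of_nonneg h2.le]
  simp only [conj_trivial]
  field_simp
  ring

lemma Fm_ge {d : ℕ} {K : Set (Eu d)} (hK : IsCompact K) (hne : K.Nonempty) {a : Eu d → ℝ}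
    (ha : Continuous a) (z : Eu d) {s m : ℝ} (hs : 0 ≤ s) (hm : ∀ x ∈ K, m ≤ a x) : m ≤ Fm K a z s := by
  obtain ⟨x, hx, h⟩ := Fm_att hK hne ha z s
  rw [h]
  have := hm x hx
  have : 0 ≤ s * ‖x - z‖ ^ 2 := by positivity
  linarith

lemma Fm_dual {d : ℕ} {K K1 : Set (Eu d)} (hK : IsCompact K) (hKn : K.Nonempty) (hK1 : IsCompact K1)
    (hK1n : K1.Nonempty) {a b : Eu d → ℝ} (ha : Continuous a) (hb : Continuous b)
    (hab : ∀ x ∈ K, ∀ y ∈ K1, 0 ≤ a x + b y + ‖x - y‖ ^ 2 / 2) (z : Eu d) {t : ℝ} (h0 : 0 < t) (h1 : t < 1) :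
    0 ≤ Fm K a z (1 / (2 * t)) + Fm K1 b z (1 / (2 * (1 - t))) ∧
    (Fm K a z (1 / (2 * t)) + Fm K1 b z (1 / (2 * (1 - t))) = 0 → ∀ x ∈ K, ∀ y ∈ K1,
      Fm K a z (1 / (2 * t)) = a x + 1 / (2 * t) * ‖x - z‖ ^ 2 →
      Fm K1 b z (1 / (2 * (1 - t))) = b y + 1 / (2 * (1 - t)) * ‖y - z‖ ^ 2 →
      z = (1 - t) • x + t • y ∧ a x + b y + ‖x - y‖ ^ 2 / 2 = 0) := by
  have h2 : 0 < 1 - t := by linarith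
  constructor
  · obtain ⟨x, hx, hxe⟩ := Fm_att hK hKn ha z (1 / (2 * t))
    obtain ⟨y, hy, hye⟩ := Fm_att hK1 hK1n hb z (1 / (2 * (1 - t)))
    have := dual_ident x y z h0 h1
    have := hab x hx y hy
    have : 0 ≤ ‖z - ((1 - t) • x + t • y)‖ ^ 2 / (2 * t * (1 - t)) := by positivity
    linarith
  · intro hz x hx y hy hxe hye
    have e1 := dual_ident x y z h0 h1
    have e2 := hab x hx y hy
    have e3 : 0 ≤ ‖z - ((1 - t) • x + t • y)‖ ^ 2 / (2 * t * (1 - t)) := by positivity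
    have e4 : ‖z - ((1 - t) • x + t • y)‖ ^ 2 / (2 * t * (1 - t)) = 0 := by linarith
    have e5 : 2 * t * (1 - t) ≠ 0 := by positivity
    rw [div_eq_zero_iff, or_iff_left e5] at e4
    refine ⟨?_, by linarith⟩
    exact sub_eq_zero.1 (norm_eq_zero.1 (pow_eq_zero_iff (two_ne_zero) |>.1 e4))

lemma quot_lim {d : ℕ} {K : Set (Eu d)} (hK : IsCompact K) (hne : K.Nonempty) {a ζ : Eu d → ℝ}
    (ha : Continuous a) (hζ : Continuous ζ) {M : ℝ} (hM : ∀ x ∈ K, |ζ x| ≤ M) (z : Eu d) (s : ℝ) :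
    (∀ l : ℝ, 0 < l → |Fm K (fun x => a x + l * ζ x) z s - Fm K a z s| ≤ l * M) ∧
    ∀ X ∈ K, (∀ x ∈ K, Fm K a z s = a x + s * ‖x - z‖ ^ 2 → x = X) →
    Filter.Tendsto (fun n : ℕ => (Fm K (fun x => a x + 1 / ((n:ℝ) + 1) * ζ x) z s - Fm K a z s) /
      (1 / ((n:ℝ) + 1))) Filter.atTop (nhds (ζ X)) := by
  have hal : ∀ l : ℝ, Continuous fun x => a x + l * ζ x := fun l => by fun_prop
  have up : ∀ l : ℝ, ∀ x ∈ K, Fm K a z s = a x + s * ‖x - z‖ ^ 2 →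
      Fm K (fun x => a x + l * ζ x) z s - Fm K a z s ≤ l * ζ x := by
    intro l x hx hxe
    have := Fm_le hK (hal l) z s hx
    linarith
  have lo : ∀ l : ℝ, ∀ x ∈ K, Fm K (fun x => a x + l * ζ x) z s = a x + l * ζ x + s * ‖x - z‖ ^ 2 →
      l * ζ x ≤ Fm K (fun x => a x + l * ζ x) z s - Fm K a z s := by
    intro l x hx hxe
    have := Fm_le hK ha z s hx
    linarith
  have bdd : ∀ l : ℝ, 0 < l → |Fm K (fun x => a x + l * ζ x) z s - Fm K a z s| ≤ l * M := by
    intro l hl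
    obtain ⟨x, hx, hxe⟩ := Fm_att hK hne ha z s
    obtain ⟨y, hy, hye⟩ := Fm_att hK hne (hal l) z s
    have e1 := up l x hx hxe
    have e2 := lo l y hy hye
    have e3 := mul_le_mul_of_nonneg_left (abs_le.1 (hM x hx)).2 hl.le
    have e4 := mul_le_mul_of_nonneg_left (abs_le.1 (hM y hy)).1 hl.le
    rw [abs_le]
    constructor <;> linarith
  refine ⟨bdd, fun X hX huniq => ?_⟩
  let e : ℕ → ℝ := fun n => 1 / ((n : ℝ) + 1)
  have hep : ∀ n, 0 < e n := fun n => by simp only [e]; positivity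
  have he0 : Filter.Tendsto e Filter.atTop (nhds 0) := tendsto_one_div_add_atTop_nhds_zero_nat
  choose x hx hxe using fun n => Fm_att hK hne (hal (e n)) z s
  have hXe : Fm K a z s = a X + s * ‖X - z‖ ^ 2 := by
    obtain ⟨x, hx, hxe⟩ := Fm_att hK hne ha z s
    rw [← huniq x hx hxe]; exact hxe
  have hgc : Continuous fun x => a x + s * ‖x - z‖ ^ 2 := by fun_prop
  have hg : Filter.Tendsto (fun n => a (x n) + s * ‖x n - z‖ ^ 2) Filter.atTop (nhds (Fm K a z s)) := by
    have e1 : Filter.Tendsto (fun n => Fm K a z s + e n * (2 * M)) Filter.atTop (nhds (Fm K a z s + 0 * (2 * M))) :=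
      (he0.mul_const _).const_add _
    rw [zero_mul, add_zero] at e1
    refine tendsto_of_tendsto_of_tendsto_of_le_of_le tendsto_const_nhds e1
      (fun n => Fm_le hK ha z s (hx n)) (fun n => ?_)
    have k1 := (abs_le.1 (bdd (e n) (hep n))).2
    have k2 := hxe n
    have k3 := mul_le_mul_of_nonneg_left (abs_le.1 (hM _ (hx n))).1 (hep n).le
    show a (x n) + s * ‖x n - z‖ ^ 2 ≤ Fm K a z s + e n * (2 * M)
    linarith
  have hxX : Filter.Tendsto x Filter.atTop (nhds X) := by
    refine hK.tendsto_nhds_of_unique_mapClusterPt (Filter.Eventually.of_forall hx) ?_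
    intro y hy hcl
    refine huniq y hy ?_
    have k := hcl.continuousAt_comp hgc.continuousAt
    have k2 : ClusterPt (a y + s * ‖y - z‖ ^ 2) (nhds (Fm K a z s)) := ClusterPt.mono k hg
    exact (eq_of_nhds_neBot k2).symm
  refine tendsto_of_tendsto_of_tendsto_of_le_of_le ((hζ.tendsto X).comp hxX) tendsto_const_nhds ?_ ?_
  · intro n
    show ζ (x n) ≤ _ / e n
    rw [le_div_iff₀ (hep n), mul_comm]
    exact lo _ _ (hx n) (hxe n)
  · intro n
    show _ / e n ≤ _
    rw [div_le_iff₀ (hep n), mul_comm]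
    exact up _ _ hX hXe

open Set MeasureTheory ProbabilityTheory
open scoped ENNReal RealInnerProductSpace

/-- the data for the duality argument -/
structure DD {d : ℕ} (A B K K1 : Set (Eu d)) (a b : Eu d → ℝ) : Prop where
  hA : volume A < ⊤
  hB : volume B < ⊤
  hAm : MeasurableSet A
  hBm : MeasurableSet B
  hK : IsCompact K
  hKn : K.Nonempty
  hK1 : IsCompact K1
  hK1n : K1.Nonempty
  hAK : A ⊆ K
  hBK : B ⊆ K1
  ha : Continuous a
  hb : Continuous b
  hab : ∀ x ∈ K, ∀ y ∈ K1, 0 ≤ a x + b y + ‖x - y‖ ^ 2 / 2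

lemma DD.hFae {d : ℕ} {A B K K1 : Set (Eu d)} {a b : Eu d → ℝ} (D : DD A B K K1 a b) {h : ℝ → ℝ}
    (hh : Continuous h) (μ : Measure (Eu d × ℝ)) :
    AEStronglyMeasurable (fun z : Eu d × ℝ => h (Fm K a z.1 (1 / (2 * z.2))) +
      h (Fm K1 b z.1 (1 / (2 * (1 - z.2))))) μ := by
  have h1 : Measurable fun z : Eu d × ℝ => Fm K a z.1 (1 / (2 * z.2)) :=
    (Fm_cont D.hK D.ha).measurable.comp (f := fun z : Eu d × ℝ => (z.1, 1 / (2 * z.2))) (by fun_prop)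
  have h2 : Measurable fun z : Eu d × ℝ => Fm K1 b z.1 (1 / (2 * (1 - z.2))) :=
    (Fm_cont D.hK1 D.hb).measurable.comp (f := fun z : Eu d × ℝ => (z.1, 1 / (2 * (1 - z.2)))) (by fun_prop)
  exact ((hh.measurable.comp h1).add (hh.measurable.comp h2)).aestronglyMeasurable

lemma DD.bound {d : ℕ} {A B K K1 : Set (Eu d)} {a b : Eu d → ℝ} (D : DD A B K K1 a b) (M : ℝ) :
    ∃ c h, 1 ≤ c ∧ Tr c h ∧ (∀ x ∈ K, |a x| ≤ c - 1 - |M|) ∧ (∀ x ∈ K1, |b x| ≤ c - 1 - |M|) := by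
  obtain ⟨Ca, hCa⟩ := D.hK.exists_bound_of_continuousOn D.ha.continuousOn
  obtain ⟨Cb, hCb⟩ := D.hK1.exists_bound_of_continuousOn D.hb.continuousOn
  have := abs_nonneg Ca; have := abs_nonneg Cb; have := abs_nonneg M
  obtain ⟨h, hh⟩ := trunc_exists (1 + |M| + |Ca| + |Cb|)
  refine ⟨1 + |M| + |Ca| + |Cb|, h, by linarith, hh, fun x hx => ?_, fun x hx => ?_⟩
  · have := hCa x hx; rw [Real.norm_eq_abs] at this; linarith [le_abs_self Ca]
  · have := hCb x hx; rw [Real.norm_eq_abs] at this; linarith [le_abs_self Cb]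

/-- pointwise lower bounds -/
lemma DD.point {d : ℕ} {A B K K1 : Set (Eu d)} {a b : Eu d → ℝ} (D : DD A B K K1 a b) {c m : ℝ}
    (hca : ∀ x ∈ K, |a x| ≤ m) (hcb : ∀ x ∈ K1, |b x| ≤ m)
    {z : Eu d × ℝ} (hz : z.2 ∈ Ioo (0:ℝ) 1) : -m ≤ Fm K a z.1 (1 / (2 * z.2)) ∧
      -m ≤ Fm K1 b z.1 (1 / (2 * (1 - z.2))) := by
  have h2 : 0 < 1 - z.2 := by linarith [hz.2]
  have h1 := hz.1
  exact ⟨Fm_ge D.hK D.hKn D.ha _ (by positivity) (fun x hx => (abs_le.1 (hca x hx)).1),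
    Fm_ge D.hK1 D.hK1n D.hb _ (by positivity) (fun x hx => (abs_le.1 (hcb x hx)).1)⟩

lemma DD.lower {d : ℕ} {A B K K1 : Set (Eu d)} {a b : Eu d → ℝ} (D : DD A B K K1 a b)
    {S : Set (Eu d × ℝ)} {v : Eu d × ℝ → Eu d} (hp : SPath A B S v) :
    -(∫ x in B, b x) - (∫ x in A, a x) ≤ (∫ z in S, ‖v z‖ ^ 2 ∂(spaceTime d)) / 2 ∧
    ((∫ z in S, ‖v z‖ ^ 2 ∂(spaceTime d)) / 2 ≤ -(∫ x in B, b x) - (∫ x in A, a x) →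
      ∀ᵐ z ∂((spaceTime d).restrict S), Fm K a z.1 (1 / (2 * z.2)) + Fm K1 b z.1 (1 / (2 * (1 - z.2))) = 0) := by
  have hp' := hp
  obtain ⟨hS, hSf, hv, hv2, -⟩ := hp'
  have hfS : IsFiniteMeasure ((spaceTime d).restrict S) := ⟨by simpa using hSf⟩
  have hIoo : ∀ᵐ z ∂((spaceTime d).restrict S), z.2 ∈ Ioo (0:ℝ) 1 := ae_restrict_of_ae (spaceTime_ae_Ioo d)
  obtain ⟨c, h, hc, hh, hca, hcb⟩ := D.bound 0
  simp only [abs_zero, sub_zero] at hca hcb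
  have key := star hp D.hA D.hB D.hAm D.hBm D.hK D.hKn D.hK1 D.hK1n D.hAK D.hBK D.ha D.hb hh
    (fun x hx => (abs_le.1 (hca x hx)).2) (fun x hx => (abs_le.1 (hcb x hx)).2)
    (χ := fun t => t) contDiff_id rfl rfl (fun t ht => ht)
  simp only [deriv_id'', one_mul] at key
  have hnn : ∀ᵐ z ∂((spaceTime d).restrict S), 0 ≤ h (Fm K a z.1 (1 / (2 * z.2))) +
      h (Fm K1 b z.1 (1 / (2 * (1 - z.2)))) := by
    filter_upwards [hIoo] with z hz
    obtain ⟨p1, p2⟩ := D.point (c := c) hca hcb hz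
    exact (tr_sum hh hc p1 p2 (Fm_dual D.hK D.hKn D.hK1 D.hK1n D.ha D.hb D.hab z.1 hz.1 hz.2).1).1
  have hintg : Integrable (fun z : Eu d × ℝ => h (Fm K a z.1 (1 / (2 * z.2))) +
      h (Fm K1 b z.1 (1 / (2 * (1 - z.2))))) ((spaceTime d).restrict S) := by
    refine Integrable.of_bound (C := (c + 1) + (c + 1)) (D.hFae hh.1.continuous _) ?_
    filter_upwards [hnn] with z hz
    rw [Real.norm_of_nonneg hz]
    exact add_le_add (hh.2.2.2.2.2 _) (hh.2.2.2.2.2 _)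
  have h0 := integral_nonneg_of_ae hnn
  refine ⟨by linarith, fun hle => ?_⟩
  have h1 : ∫ z in S, (h (Fm K a z.1 (1 / (2 * z.2))) +
      h (Fm K1 b z.1 (1 / (2 * (1 - z.2))))) ∂(spaceTime d) = 0 := le_antisymm (by linarith) h0
  rw [integral_eq_zero_iff_of_nonneg_ae hnn hintg] at h1
  filter_upwards [h1, hIoo] with z hz0 hz
  obtain ⟨p1, p2⟩ := D.point (c := c) hca hcb hz
  exact (tr_sum hh hc p1 p2 (Fm_dual D.hK D.hKn D.hK1 D.hK1n D.ha D.hb D.hab z.1 hz.1 hz.2).1).2 hz0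

lemma DD.qlim {d : ℕ} {A B K K1 : Set (Eu d)} {a b : Eu d → ℝ} (D : DD A B K K1 a b)
    {ζ : Eu d → ℝ} (hζ : Continuous ζ) {z : Eu d × ℝ} (hz : z.2 ∈ Ioo (0:ℝ) 1)
    (h0 : Fm K a z.1 (1 / (2 * z.2)) + Fm K1 b z.1 (1 / (2 * (1 - z.2))) = 0) {X : Eu d} (hX : X ∈ K)
    (hXe : Fm K a z.1 (1 / (2 * z.2)) = a X + 1 / (2 * z.2) * ‖X - z.1‖ ^ 2) :
    Filter.Tendsto (fun n : ℕ => (Fm K (fun x => a x + 1 / ((n:ℝ) + 1) * ζ x) z.1 (1 / (2 * z.2)) -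
      Fm K a z.1 (1 / (2 * z.2))) / (1 / ((n:ℝ) + 1))) Filter.atTop (nhds (ζ X)) := by
  obtain ⟨M, hM⟩ := D.hK.exists_bound_of_continuousOn hζ.continuousOn
  refine (quot_lim D.hK D.hKn D.ha hζ hM z.1 _).2 X hX ?_
  intro x hx hxe
  obtain ⟨y, hy, hye⟩ := Fm_att D.hK1 D.hK1n D.hb z.1 (1 / (2 * (1 - z.2)))
  have k := (Fm_dual D.hK D.hKn D.hK1 D.hK1n D.ha D.hb D.hab z.1 hz.1 hz.2).2 h0
  have k1 := (k x hx y hy hxe hye).1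
  have k2 := (k X hX y hy hXe hye).1
  rw [k1] at k2
  have h3 : (1 - z.2) ≠ 0 := by linarith [hz.2]
  exact smul_right_injective _ h3 (add_right_cancel k2)

lemma DD.push_le {d : ℕ} {A B K K1 : Set (Eu d)} {a b : Eu d → ℝ} (D : DD A B K K1 a b)
    {S : Set (Eu d × ℝ)} {v : Eu d × ℝ → Eu d} (hp : SPath A B S v)
    (hle : (∫ z in S, ‖v z‖ ^ 2 ∂(spaceTime d)) / 2 ≤ -(∫ x in B, b x) - (∫ x in A, a x))
    {X : Eu d × ℝ → Eu d} (hX : ∀ z, X z ∈ K)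
    (hXe : ∀ z, Fm K a z.1 (1 / (2 * z.2)) = a (X z) + 1 / (2 * z.2) * ‖X z - z.1‖ ^ 2)
    {ζ : Eu d → ℝ} (hζ : Continuous ζ)
    {χ : ℝ → ℝ} (hχ : ContDiff ℝ (⊤ : ℕ∞) χ) (hχ0 : χ 0 = 0) (hχ1 : χ 1 = 1)
    (hχI : ∀ t ∈ Icc (0:ℝ) 1, χ t ∈ Icc (0:ℝ) 1) :
    ∫ z in S, deriv χ z.2 * ζ (X z) ∂(spaceTime d) ≤ ∫ x in A, ζ x := by
  have hp' := hp
  obtain ⟨hS, hSf, hv, hv2, -⟩ := hp'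
  have hfS : IsFiniteMeasure ((spaceTime d).restrict S) := ⟨by simpa using hSf⟩
  have hfA : IsFiniteMeasure (volume.restrict A) := ⟨by simpa using D.hA⟩
  have hIoo : ∀ᵐ z ∂((spaceTime d).restrict S), z.2 ∈ Ioo (0:ℝ) 1 := ae_restrict_of_ae (spaceTime_ae_Ioo d)
  have hz0 := (D.lower hp).2 hle
  obtain ⟨M, hM⟩ := D.hK.exists_bound_of_continuousOn hζ.continuousOn
  have hMM : M ≤ |M| := le_abs_self M
  obtain ⟨c, h, hc, hh, hca, hcb⟩ := D.bound M
  have hχd : Continuous (deriv χ) := hχ.continuous_deriv (by simp)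
  obtain ⟨Cχ, hCχ⟩ := (isCompact_Icc (a := (0:ℝ)) (b := 1)).exists_bound_of_continuousOn hχd.continuousOn
  have hCχ0 : 0 ≤ Cχ := (norm_nonneg _).trans (hCχ 0 ⟨le_rfl, zero_le_one⟩)
  let e : ℕ → ℝ := fun n => 1 / ((n : ℝ) + 1)
  have hep : ∀ n, 0 < e n := fun n => by simp only [e]; positivity
  have he1 : ∀ n, e n ≤ 1 := fun n => by
    simp only [e]; rw [div_le_one (by positivity)]; have : (0:ℝ) ≤ n := by positivity
    linarith
  let F : ℕ → Eu d × ℝ → ℝ := fun n z => (Fm K (fun x => a x + e n * ζ x) z.1 (1 / (2 * z.2)) -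
      Fm K a z.1 (1 / (2 * z.2))) / (e n)
  have hal : ∀ l : ℝ, Continuous fun x => a x + l * ζ x := fun l => by
    have := D.ha; fun_prop
  have hmF : ∀ {a : Eu d → ℝ}, Continuous a → Measurable fun z : Eu d × ℝ => Fm K a z.1 (1 / (2 * z.2)) :=
    fun ha => (Fm_cont D.hK ha).measurable.comp (f := fun z : Eu d × ℝ => (z.1, 1 / (2 * z.2))) (by fun_prop)
  have hFm : ∀ n, Measurable (F n) := fun n => ((hmF (hal _)).sub (hmF D.ha)).div_const _
  have hFb : ∀ n z, |F n z| ≤ M := by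
    intro n z
    simp only [F]
    rw [abs_div, abs_of_pos (hep n), div_le_iff₀ (hep n), mul_comm M]
    exact (quot_lim D.hK D.hKn D.ha hζ hM z.1 _).1 _ (hep n)
  have iζ : Integrable ζ (volume.restrict A) := by
    refine Integrable.of_bound hζ.aestronglyMeasurable M ?_
    filter_upwards [ae_restrict_mem D.hAm] with x hx using hM x (D.hAK hx)
  have ia : Integrable a (volume.restrict A) := by
    refine Integrable.of_bound D.ha.aestronglyMeasurable (c - 1 - |M|) ?_
    filter_upwards [ae_restrict_mem D.hAm] with x hx using hca x (D.hAK hx)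
  have ineq : ∀ n, ∫ z in S, deriv χ z.2 * F n z ∂(spaceTime d) ≤ ∫ x in A, ζ x := by
    intro n
    have key := star hp D.hA D.hB D.hAm D.hBm D.hK D.hKn D.hK1 D.hK1n D.hAK D.hBK (hal (e n)) D.hb hh
      (fun x hx => by
        have h1 := (abs_le.1 (hca x hx)).2
        have h2 : ζ x ≤ |M| := ((le_abs_self _).trans (hM x hx)).trans hMM
        have h3 := mul_le_mul_of_nonneg_left h2 (hep n).le
        nlinarith [he1 n, abs_nonneg M])
      (fun x hx => by linarith [(abs_le.1 (hcb x hx)).2, abs_nonneg M]) hχ hχ0 hχ1 hχI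
    have e1 : ∫ x in A, (a x + e n * ζ x) = (∫ x in A, a x) + e n * ∫ x in A, ζ x := by
      rw [integral_add ia (iζ.const_mul _), integral_const_mul]
    have e2 : ∫ z in S, deriv χ z.2 * (h (Fm K (fun x => a x + e n * ζ x) z.1 (1 / (2 * z.2))) +
        h (Fm K1 b z.1 (1 / (2 * (1 - z.2))))) ∂(spaceTime d) =
        e n * ∫ z in S, deriv χ z.2 * F n z ∂(spaceTime d) := by
      rw [← integral_const_mul]
      refine integral_congr_ae ?_
      filter_upwards [hIoo, hz0] with z hz hz0
      obtain ⟨p1, p2⟩ := D.point (c := c) hca hcb hz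
      have q1 := abs_le.1 ((quot_lim D.hK D.hKn D.ha hζ hM z.1 (1 / (2 * z.2))).1 _ (hep n))
      have q2 : e n * M ≤ |M| := by nlinarith [he1 n, hep n, abs_nonneg M]
      have r1 : h (Fm K (fun x => a x + e n * ζ x) z.1 (1 / (2 * z.2))) =
        Fm K (fun x => a x + e n * ζ x) z.1 (1 / (2 * z.2)) := hh.2.1 _ (by linarith [q1.2])
      have r2 : h (Fm K1 b z.1 (1 / (2 * (1 - z.2)))) = Fm K1 b z.1 (1 / (2 * (1 - z.2))) :=
        hh.2.1 _ (by linarith [abs_nonneg M])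
      have r3 : e n * F n z = Fm K (fun x => a x + e n * ζ x) z.1 (1 / (2 * z.2)) -
        Fm K a z.1 (1 / (2 * z.2)) := mul_div_cancel₀ _ (hep n).ne'
      show deriv χ z.2 * _ = e n * (deriv χ z.2 * F n z)
      rw [r1, r2, mul_left_comm, r3]
      congr 1
      linarith
    rw [e1, e2] at key
    have : e n * ∫ z in S, deriv χ z.2 * F n z ∂(spaceTime d) ≤ e n * ∫ x in A, ζ x := by linarith
    exact le_of_mul_le_mul_left this (hep n)
  have lim : Filter.Tendsto (fun n => ∫ z in S, deriv χ z.2 * F n z ∂(spaceTime d))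
      Filter.atTop (nhds (∫ z in S, deriv χ z.2 * ζ (X z) ∂(spaceTime d))) := by
    refine tendsto_integral_of_dominated_convergence (fun _ => Cχ * M) ?_ (integrable_const _) ?_ ?_
    · intro n
      exact ((hχd.measurable.comp measurable_snd).mul (hFm n)).aestronglyMeasurable
    · intro n
      filter_upwards [hIoo] with z hz
      rw [norm_mul]
      exact mul_le_mul (hCχ _ ⟨hz.1.le, hz.2.le⟩) (hFb n z) (norm_nonneg _) hCχ0
    · filter_upwards [hIoo, hz0] with z hz hz0
      exact (D.qlim hζ hz hz0 (hX z) (hXe z)).const_mul _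
  exact le_of_tendsto' lim ineq

open Set MeasureTheory ProbabilityTheory
open scoped ENNReal RealInnerProductSpace

lemma cut_of_pos {g : ℝ → ℝ} (hg : ContDiff ℝ (⊤ : ℕ∞) g) (hpos : ∀ t ∈ Icc (0:ℝ) 1, 0 < g t) :
    ∃ (c : ℝ) (χ : ℝ → ℝ), 0 < c ∧ c = (∫ t in Icc (0:ℝ) 1, g t) ∧ ContDiff ℝ (⊤ : ℕ∞) χ ∧ χ 0 = 0 ∧ χ 1 = 1 ∧
      (∀ t ∈ Icc (0:ℝ) 1, χ t ∈ Icc (0:ℝ) 1) ∧ ∀ t, deriv χ t = g t / c := by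
  have hgc := hg.continuous
  set c := ∫ t in (0:ℝ)..1, g t with hc
  have hI : ∀ x y : ℝ, IntervalIntegrable g volume x y := fun x y => hgc.intervalIntegrable _ _
  have hcpos : 0 < c := intervalIntegral.intervalIntegral_pos_of_pos_on (hI 0 1)
    (fun t ht => hpos t ⟨ht.1.le, ht.2.le⟩) zero_lt_one
  have hd : ∀ t, HasDerivAt (fun u => (∫ s in (0:ℝ)..u, g s) / c) (g t / c) t := fun t =>
    (hgc.integral_hasStrictDerivAt 0 t).hasDerivAt.div_const c
  have hde : ∀ t, deriv (fun u => (∫ s in (0:ℝ)..u, g s) / c) t = g t / c := fun t => (hd t).deriv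
  refine ⟨c, fun u => (∫ s in (0:ℝ)..u, g s) / c, hcpos, ?_, ?_, by simp, ?_, ?_, hde⟩
  · rw [hc, intervalIntegral.integral_of_le zero_le_one, integral_Icc_eq_integral_Ioc]
  · rw [contDiff_infty_iff_deriv]
    refine ⟨fun t => (hd t).differentiableAt, ?_⟩
    rw [funext hde]
    exact hg.div_const c
  · exact div_self hcpos.ne'
  · intro t ht
    have h1 : 0 ≤ ∫ s in (0:ℝ)..t, g s := intervalIntegral.integral_nonneg ht.1
      (fun u hu => (hpos u ⟨hu.1, hu.2.trans ht.2⟩).le)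
    have h2 : 0 ≤ ∫ s in t..1, g s := intervalIntegral.integral_nonneg ht.2
      (fun u hu => (hpos u ⟨ht.1.trans hu.1, hu.2⟩).le)
    have h3 := intervalIntegral.integral_add_adjacent_intervals (hI 0 t) (hI t 1)
    refine ⟨by positivity, ?_⟩
    rw [div_le_one hcpos]
    linarith

lemma DD.meas {d : ℕ} {A B K K1 : Set (Eu d)} {a b : Eu d → ℝ} (D : DD A B K K1 a b)
    {S : Set (Eu d × ℝ)} {v : Eu d × ℝ → Eu d} (hp : SPath A B S v)
    (hle : (∫ z in S, ‖v z‖ ^ 2 ∂(spaceTime d)) / 2 ≤ -(∫ x in B, b x) - (∫ x in A, a x))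
    {X : Eu d × ℝ → Eu d} (hX : ∀ z, X z ∈ K)
    (hXe : ∀ z, Fm K a z.1 (1 / (2 * z.2)) = a (X z) + 1 / (2 * z.2) * ‖X z - z.1‖ ^ 2) :
    AEMeasurable X ((spaceTime d).restrict S) := by
  have hIoo : ∀ᵐ z ∂((spaceTime d).restrict S), z.2 ∈ Ioo (0:ℝ) 1 := ae_restrict_of_ae (spaceTime_ae_Ioo d)
  have hz0 := (D.lower hp).2 hle
  have hmF : ∀ {a : Eu d → ℝ}, Continuous a → Measurable fun z : Eu d × ℝ => Fm K a z.1 (1 / (2 * z.2)) :=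
    fun ha => (Fm_cont D.hK ha).measurable.comp (f := fun z : Eu d × ℝ => (z.1, 1 / (2 * z.2))) (by fun_prop)
  have hco : ∀ i, AEMeasurable (fun z => X z i) ((spaceTime d).restrict S) := by
    intro i
    have hζ : Continuous fun x : Eu d => x i := by fun_prop
    refine aemeasurable_of_tendsto_metrizable_ae Filter.atTop (f := fun (n : ℕ) (z : Eu d × ℝ) =>
      (Fm K (fun x => a x + 1 / ((n:ℝ) + 1) * x i) z.1 (1 / (2 * z.2)) -
      Fm K a z.1 (1 / (2 * z.2))) / (1 / ((n:ℝ) + 1))) ?_ ?_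
    · intro n
      have := D.ha
      exact (((hmF (by fun_prop)).sub (hmF D.ha)).div_const _).aemeasurable
    · filter_upwards [hIoo, hz0] with z hz hz0
      exact D.qlim hζ hz hz0 (hX z) (hXe z)
  have h1 : AEMeasurable (fun z => WithLp.ofLp (X z)) ((spaceTime d).restrict S) := aemeasurable_pi_iff.2 hco
  exact (WithLp.measurable_toLp 2 (Fin d → ℝ)).comp_aemeasurable h1

lemma DD.push_poly {d : ℕ} {A B K K1 : Set (Eu d)} {a b : Eu d → ℝ} (D : DD A B K K1 a b)
    {S : Set (Eu d × ℝ)} {v : Eu d × ℝ → Eu d} (hp : SPath A B S v)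
    (hle : (∫ z in S, ‖v z‖ ^ 2 ∂(spaceTime d)) / 2 ≤ -(∫ x in B, b x) - (∫ x in A, a x))
    {X : Eu d × ℝ → Eu d} (hX : ∀ z, X z ∈ K)
    (hXe : ∀ z, Fm K a z.1 (1 / (2 * z.2)) = a (X z) + 1 / (2 * z.2) * ‖X z - z.1‖ ^ 2)
    {ζ : Eu d → ℝ} (hζ : Continuous ζ) {g : ℝ → ℝ} (hg : ContDiff ℝ (⊤ : ℕ∞) g) :
    ∫ z in S, ζ (X z) * g z.2 ∂(spaceTime d) = (∫ x in A, ζ x) * ∫ t in Icc (0:ℝ) 1, g t := by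
  have hXm := D.meas hp hle hX hXe
  have hfS : IsFiniteMeasure ((spaceTime d).restrict S) := ⟨by simpa using hp.2.1⟩
  have hIoo : ∀ᵐ z ∂((spaceTime d).restrict S), z.2 ∈ Ioo (0:ℝ) 1 := ae_restrict_of_ae (spaceTime_ae_Ioo d)
  have pos : ∀ {g : ℝ → ℝ}, ContDiff ℝ (⊤ : ℕ∞) g → (∀ t ∈ Icc (0:ℝ) 1, 0 < g t) →
      ∫ z in S, ζ (X z) * g z.2 ∂(spaceTime d) = (∫ x in A, ζ x) * ∫ t in Icc (0:ℝ) 1, g t := by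
    intro g hg hpos
    obtain ⟨c, χ, hc, hce, hχ, hχ0, hχ1, hχI, hχd⟩ := cut_of_pos hg hpos
    have k1 := D.push_le hp hle hX hXe hζ hχ hχ0 hχ1 hχI
    have k2 := D.push_le hp hle hX hXe (ζ := fun x => -ζ x) hζ.neg hχ hχ0 hχ1 hχI
    simp only [mul_neg, integral_neg, neg_le_neg_iff] at k2
    have k3 := le_antisymm k1 k2
    rw [← hce, ← k3, mul_comm, ← integral_const_mul]
    refine integral_congr_ae (Filter.Eventually.of_forall fun z => ?_)
    simp only [hχd]
    field_simp
  obtain ⟨C, hC⟩ := (isCompact_Icc (a := (0:ℝ)) (b := 1)).exists_bound_of_continuousOn hg.continuous.continuousOn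
  obtain ⟨M, hM⟩ := D.hK.exists_bound_of_continuousOn hζ.continuousOn
  have hC0 : 0 ≤ C := (norm_nonneg _).trans (hC 0 ⟨le_rfl, zero_le_one⟩)
  have hM0 : 0 ≤ M := (norm_nonneg _).trans (hM _ (hX 0))
  have p1 := pos (g := fun t => g t + (C + 1)) (hg.add contDiff_const) (fun t ht => by
    have := hC t ht; rw [Real.norm_eq_abs] at this; have := (abs_le.1 this).1; linarith)
  have p2 := pos (g := fun _ => C + 1) contDiff_const (fun t ht => by linarith)
  have i0 : AEStronglyMeasurable (fun z => ζ (X z)) ((spaceTime d).restrict S) :=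
    (hζ.measurable.comp_aemeasurable hXm).aestronglyMeasurable
  have i1 : Integrable (fun z => ζ (X z) * g z.2) ((spaceTime d).restrict S) := by
    refine Integrable.of_bound (C := M * C) (i0.mul (hg.continuous.comp continuous_snd).aestronglyMeasurable) ?_
    filter_upwards [hIoo] with z hz
    rw [norm_mul]
    exact mul_le_mul (hM _ (hX z)) (hC _ ⟨hz.1.le, hz.2.le⟩) (norm_nonneg _) hM0
  have i2 : Integrable (fun z => ζ (X z) * (C + 1)) ((spaceTime d).restrict S) :=
    (Integrable.of_bound i0 M (Filter.Eventually.of_forall fun z => hM _ (hX z))).mul_const _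
  have i3 : Integrable g (volume.restrict (Icc (0:ℝ) 1)) := hg.continuous.integrableOn_Icc
  simp only [mul_add ] at p1
  simp only [← mul_add ] at p1
  have e1 : ∫ z in S, (ζ (X z) * (g z.2 + (C + 1))) ∂(spaceTime d) =
      ∫ z in S, ζ (X z) * g z.2 ∂(spaceTime d) + ∫ z in S, ζ (X z) * (C + 1) ∂(spaceTime d) := by
    rw [← integral_add i1 i2]; simp only [mul_add]
  rw [e1, integral_add i3 (integrable_const _), p2, mul_add] at p1
  linarith

lemma DD.push {d : ℕ} {A B K K1 : Set (Eu d)} {a b : Eu d → ℝ} (D : DD A B K K1 a b)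
    {S : Set (Eu d × ℝ)} {v : Eu d × ℝ → Eu d} (hp : SPath A B S v)
    (hle : (∫ z in S, ‖v z‖ ^ 2 ∂(spaceTime d)) / 2 ≤ -(∫ x in B, b x) - (∫ x in A, a x))
    {X : Eu d × ℝ → Eu d} (hX : ∀ z, X z ∈ K)
    (hXe : ∀ z, Fm K a z.1 (1 / (2 * z.2)) = a (X z) + 1 / (2 * z.2) * ‖X z - z.1‖ ^ 2) :
    ((spaceTime d).restrict S).map (fun z => (X z, z.2)) =
      (volume.restrict A).prod (volume.restrict (Icc (0:ℝ) 1)) := by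
  have hXm := D.meas hp hle hX hXe
  have hXm' : AEMeasurable (fun z => (X z, z.2)) ((spaceTime d).restrict S) := hXm.prodMk measurable_snd.aemeasurable
  have hfS : IsFiniteMeasure ((spaceTime d).restrict S) := ⟨by simpa using hp.2.1⟩
  have hfA : IsFiniteMeasure (volume.restrict A) := ⟨by simpa using D.hA⟩
  have hIoo : ∀ᵐ z ∂((spaceTime d).restrict S), z.2 ∈ Ioo (0:ℝ) 1 := ae_restrict_of_ae (spaceTime_ae_Ioo d)
  refine Measure.eq_prod_of_integral_mul_boundedContinuousFunction fun f g => ?_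
  rw [integral_map hXm' (by
    exact ((f.continuous.comp continuous_fst).mul (g.continuous.comp continuous_snd)).aestronglyMeasurable)]
  show ∫ z in S, f (X z) * g z.2 ∂(spaceTime d) = _
  choose p hpo using fun n : ℕ => exists_polynomial_near_of_continuousOn 0 1 g g.continuous.continuousOn
    (1 / ((n:ℝ) + 1)) (by positivity)
  have he0 : Filter.Tendsto (fun n : ℕ => 1 / ((n : ℝ) + 1)) Filter.atTop (nhds 0) :=
    tendsto_one_div_add_atTop_nhds_zero_nat
  have hpt : ∀ t ∈ Icc (0:ℝ) 1, Filter.Tendsto (fun n => (p n).eval t) Filter.atTop (nhds (g t)) := by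
    intro t ht
    rw [tendsto_iff_norm_sub_tendsto_zero]
    exact squeeze_zero (fun n => norm_nonneg _) (fun n => (hpo n t ht).le) he0
  have hpb : ∀ n, ∀ t ∈ Icc (0:ℝ) 1, ‖(p n).eval t‖ ≤ 1 + ‖g‖ := by
    intro n t ht
    have h1 := (hpo n t ht).le
    have h2 : 1 / ((n:ℝ) + 1) ≤ 1 := by
      rw [div_le_one (by positivity)]; have : (0:ℝ) ≤ n := by positivity
      linarith
    have h3 := g.norm_coe_le_norm t
    have h4 := norm_add_le ((p n).eval t - g t) (g t)
    rw [sub_add_cancel, Real.norm_eq_abs (_ - _)] at h4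
    linarith
  have hpc : ∀ n, ContDiff ℝ (⊤ : ℕ∞) fun t => (p n).eval t := fun n => by
    simpa using! (p n).contDiff_aeval (𝕜 := ℝ) (⊤ : ℕ∞)
  have l1 : Filter.Tendsto (fun n => ∫ z in S, f (X z) * (p n).eval z.2 ∂(spaceTime d)) Filter.atTop
      (nhds (∫ z in S, f (X z) * g z.2 ∂(spaceTime d))) := by
    refine tendsto_integral_of_dominated_convergence (fun _ => ‖f‖ * (1 + ‖g‖)) ?_ (integrable_const _) ?_ ?_
    · intro n
      exact ((f.continuous.measurable.comp_aemeasurable hXm).aestronglyMeasurable).mul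
        ((hpc n).continuous.comp continuous_snd).aestronglyMeasurable
    · intro n
      filter_upwards [hIoo] with z hz
      rw [norm_mul]
      exact mul_le_mul (f.norm_coe_le_norm _) (hpb n _ ⟨hz.1.le, hz.2.le⟩) (norm_nonneg _) (norm_nonneg _)
    · filter_upwards [hIoo] with z hz
      exact (hpt _ ⟨hz.1.le, hz.2.le⟩).const_mul _
  have l2 : Filter.Tendsto (fun n => ∫ t in Icc (0:ℝ) 1, (p n).eval t) Filter.atTop
      (nhds (∫ t in Icc (0:ℝ) 1, g t)) := by
    refine tendsto_integral_of_dominated_convergence (fun _ => (1 + ‖g‖)) ?_ (integrable_const _) ?_ ?_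
    · intro n
      exact (hpc n).continuous.aestronglyMeasurable
    · intro n
      filter_upwards [ae_restrict_mem measurableSet_Icc] with t ht using hpb n t ht
    · filter_upwards [ae_restrict_mem measurableSet_Icc] with t ht using hpt t ht
  refine tendsto_nhds_unique l1 ?_
  have l3 := l2.const_mul (∫ x in A, f x)
  refine l3.congr fun n => ?_
  exact (D.push_poly hp hle hX hXe f.continuous (hpc n)).symm

open Set MeasureTheory ProbabilityTheory
open scoped ENNReal RealInnerProductSpace

lemma half_sq {d : ℕ} (x y : Eu d) : 1 / 2 * ‖x - y‖ ^ 2 = ‖x‖ ^ 2 / 2 - ⟪y, x⟫ + ‖y‖ ^ 2 / 2 := by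
  rw [@norm_sub_sq_real, real_inner_comm]; ring

lemma brenier_dd {d : ℕ} {Ω0 Ω1 : Set (Eu d)} (h0 : IsOpen Ω0) (h1 : IsOpen Ω1)
    (hb0 : Bornology.IsBounded Ω0) (hb1 : Bornology.IsBounded Ω1) (hn0 : Ω0.Nonempty) (hn1 : Ω1.Nonempty)
    {ψ : Eu d → ℝ} (hψ : ConvexOn ℝ univ ψ) {T : Eu d → Eu d} (hT : Measurable T)
    (hpush : (volume.restrict Ω0).map T = volume.restrict Ω1) {D : Set (Eu d)} (hD : BD Ω0 Ω1 ψ T D) :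
    ∃ a b, DD Ω0 Ω1 (closure Ω0) (closure Ω1) a b ∧
      -(∫ x in Ω1, b x) - (∫ x in Ω0, a x) = (∫ x in Ω0, ‖T x - x‖ ^ 2) / 2 ∧
      ∀ x ∈ D, ∀ y, a x + b y + ‖x - y‖ ^ 2 / 2 = 0 → y = T x := by
  have hψc : Continuous ψ := continuousOn_univ.1 (hψ.continuousOn isOpen_univ)
  have hK : IsCompact (closure Ω0) := hb0.isCompact_closure
  have hK1 : IsCompact (closure Ω1) := hb1.isCompact_closure
  let a : Eu d → ℝ := fun x => ψ x - ‖x‖ ^ 2 / 2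
  have ha : Continuous a := by simp only [a]; fun_prop
  let b : Eu d → ℝ := fun y => -(Fm (closure Ω0) a y (1 / 2))
  have hb : Continuous b := ((Fm_cont hK ha).comp
    (continuous_id.prodMk continuous_const : Continuous fun y : Eu d => (y, (1/2 : ℝ)))).neg
  have hfin0 : volume Ω0 < ⊤ := hb0.measure_lt_top
  have hfin1 : volume Ω1 < ⊤ := hb1.measure_lt_top
  have DDx : DD Ω0 Ω1 (closure Ω0) (closure Ω1) a b :=
    { hA := hfin0, hB := hfin1, hAm := h0.measurableSet, hBm := h1.measurableSet, hK := hK, hKn := hn0.closure,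
      hK1 := hK1, hK1n := hn1.closure, hAK := subset_closure, hBK := subset_closure, ha := ha, hb := hb,
      hab := fun x hx y _ => by
        have := Fm_le hK ha y (1 / 2) hx
        simp only [b]; linarith }
  obtain ⟨hDm, hD0, hDn, hDp⟩ := hD
  have hDae : ∀ᵐ x ∂(volume.restrict Ω0), x ∈ D := by
    rw [ae_restrict_iff' h0.measurableSet, ae_iff]
    refine measure_mono_null (fun x hx => ?_) hDn
    simpa using hx
  have hbT : ∀ x ∈ D, b (T x) = -a x - ‖T x - x‖ ^ 2 / 2 := by
    intro x hx
    obtain ⟨y, hy, hye⟩ := Fm_att hK hn0.closure ha (T x) (1 / 2)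
    have e1 := Fm_le hK ha (T x) (1 / 2) (subset_closure (hD0 hx))
    have e2 := (hDp x hx).2.2 y
    rw [inner_sub_right] at e2
    have e3 : Fm (closure Ω0) a (T x) (1 / 2) = a x + 1 / 2 * ‖x - T x‖ ^ 2 := by
      refine le_antisymm e1 ?_
      rw [hye, half_sq, half_sq]
      simp only [a]
      linarith
    simp only [b]
    rw [e3, norm_sub_rev]; ring
  have hf0 : IsFiniteMeasure (volume.restrict Ω0) := ⟨by simpa using hfin0⟩
  obtain ⟨Ca, hCa⟩ := hK.exists_bound_of_continuousOn ha.continuousOn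
  obtain ⟨Cb, hCb⟩ := hK1.exists_bound_of_continuousOn hb.continuousOn
  have ia : Integrable a (volume.restrict Ω0) := by
    refine Integrable.of_bound ha.aestronglyMeasurable Ca ?_
    filter_upwards [ae_restrict_mem h0.measurableSet] with x hx using hCa x (subset_closure hx)
  have ib : Integrable (fun x => b (T x)) (volume.restrict Ω0) := by
    refine Integrable.of_bound (hb.measurable.comp hT).aestronglyMeasurable Cb ?_
    filter_upwards [hDae] with x hx using hCb _ (subset_closure (hDp x hx).2.1)
  have ib' : Integrable (fun x => -b (T x)) (volume.restrict Ω0) := ib.neg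
  refine ⟨a, b, DDx, ?_, ?_⟩
  · rw [← hpush, integral_map hT.aemeasurable hb.aestronglyMeasurable, ← integral_neg, ← integral_sub ib' ia,
      ← integral_div]
    refine integral_congr_ae ?_
    filter_upwards [hDae] with x hx
    rw [hbT x hx]; ring
  · intro x hx y hy
    have hmin : IsLocalMin (fun x' => ψ x' - ⟪y, x'⟫) x := by
      filter_upwards [h0.mem_nhds (hD0 hx)] with x' hx'
      have e1 := Fm_le hK ha y (1 / 2) (subset_closure hx')
      have e2 : Fm (closure Ω0) a y (1 / 2) = a x + 1 / 2 * ‖x - y‖ ^ 2 := by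
        simp only [b] at hy; linarith
      rw [e2, half_sq, half_sq] at e1
      simp only [a] at e1
      linarith
    have hg : HasGradientAt (fun x' => ψ x' - ⟪y, x'⟫) (T x - y) x := by
      have g1 := (hDp x hx).1.hasFDerivAt
      have g2 : HasFDerivAt (fun x' : Eu d => ⟪y, x'⟫) (InnerProductSpace.toDual ℝ (Eu d) y) x :=
        (InnerProductSpace.toDual ℝ (Eu d) y).hasFDerivAt
      have := g1.sub g2
      rw [← map_sub] at this
      exact this
    have := hmin.hasFDerivAt_eq_zero hg.hasFDerivAt
    have h3 : T x - y = 0 := (InnerProductSpace.toDual ℝ (Eu d)).map_eq_zero_iff.1 this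
    exact (sub_eq_zero.1 h3).symm

lemma geo_meas {d : ℕ} {Ω0 Ω1 : Set (Eu d)} (h0 : IsOpen Ω0) {K K1 : Set (Eu d)} {ψ : Eu d → ℝ}
    {T : Eu d → Eu d} (hT : Measurable T) {D : Set (Eu d)} (hD : BD Ω0 Ω1 ψ T D) {a b : Eu d → ℝ}
    (DDx : DD Ω0 Ω1 K K1 a b) (hy : ∀ x ∈ D, ∀ y, a x + b y + ‖x - y‖ ^ 2 / 2 = 0 → y = T x)
    {S : Set (Eu d × ℝ)} {v : Eu d × ℝ → Eu d} (hp : SPath Ω0 Ω1 S v)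
    (hle : (∫ z in S, ‖v z‖ ^ 2 ∂(spaceTime d)) / 2 ≤ -(∫ x in Ω1, b x) - (∫ x in Ω0, a x)) :
    (spaceTime d).restrict S = ((volume.restrict Ω0).prod (volume.restrict (Icc (0:ℝ) 1))).map
      (fun p => ((1 - p.2) • p.1 + p.2 • T p.1, p.2)) := by
  choose X hX hXe using fun z : Eu d × ℝ => Fm_att DDx.hK DDx.hKn DDx.ha z.1 (1 / (2 * z.2))
  have hXm := DDx.meas hp hle hX hXe
  have hpu := DDx.push hp hle hX hXe
  have hIoo : ∀ᵐ z ∂((spaceTime d).restrict S), z.2 ∈ Ioo (0:ℝ) 1 := ae_restrict_of_ae (spaceTime_ae_Ioo d)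
  have hz0 := (DDx.lower hp).2 hle
  have hXm' : AEMeasurable (fun z => (X z, z.2)) ((spaceTime d).restrict S) := hXm.prodMk measurable_snd.aemeasurable
  have hDae : ∀ᵐ x ∂(volume.restrict Ω0), x ∈ D := by
    rw [ae_restrict_iff' h0.measurableSet, ae_iff]
    refine measure_mono_null (fun x hx => ?_) hD.2.2.1
    simpa using hx
  have hXD : ∀ᵐ z ∂((spaceTime d).restrict S), X z ∈ D := by
    have : ∀ᵐ p ∂(((spaceTime d).restrict S).map (fun z => (X z, z.2))), p.1 ∈ D := by
      rw [hpu]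
      exact Measure.quasiMeasurePreserving_fst.ae hDae
    exact ae_of_ae_map hXm' this
  have hΨ : Measurable (fun p : Eu d × ℝ => ((1 - p.2) • p.1 + p.2 • T p.1, p.2)) := by fun_prop
  rw [← hpu, AEMeasurable.map_map_of_aemeasurable hΨ.aemeasurable hXm']
  conv_lhs => rw [← Measure.map_id (μ := (spaceTime d).restrict S)]
  refine Measure.map_congr ?_
  filter_upwards [hIoo, hz0, hXD] with z hz hz0 hzD
  obtain ⟨y, hyK, hye⟩ := Fm_att DDx.hK1 DDx.hK1n DDx.hb z.1 (1 / (2 * (1 - z.2)))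
  obtain ⟨k1, k2⟩ := (Fm_dual DDx.hK DDx.hKn DDx.hK1 DDx.hK1n DDx.ha DDx.hb DDx.hab z.1 hz.1 hz.2).2 hz0
    (X z) (hX z) y hyK (hXe z) hye
  have k3 := hy _ hzD y k2
  rw [k3] at k1
  exact Prod.ext k1 rfl

open Set MeasureTheory ProbabilityTheory
open scoped ENNReal RealInnerProductSpace

lemma geo_ae {d : ℕ} (m : Measure (Eu d)) [IsFiniteMeasure m] {T : Eu d → Eu d} (hT : Measurable T)
    {S : Set (Eu d × ℝ)} (hS : MeasurableSet S)
    (h : (spaceTime d).restrict S = (m.prod (volume.restrict (Icc (0:ℝ) 1))).map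
      (fun p => ((1 - p.2) • p.1 + p.2 • T p.1, p.2))) :
    ∀ᵐ t ∂(volume.restrict (Icc (0:ℝ) 1)), ∃ A : Set (Eu d), MeasurableSet A ∧
      m.map (fun x => (1 - t) • x + t • T x) = volume.restrict A := by
  classical
  set I := volume.restrict (Icc (0:ℝ) 1) with hI
  have hΨ : Measurable (fun p : Eu d × ℝ => ((1 - p.2) • p.1 + p.2 • T p.1, p.2)) := by fun_prop
  let Sl : ℝ → Set (Eu d) := fun t => {x | (x, t) ∈ S}
  have hSl : ∀ t, MeasurableSet (Sl t) := fun t => measurable_prodMk_right hS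
  have hTt : ∀ t : ℝ, Measurable fun x : Eu d => (1 - t) • x + t • T x := fun t => by fun_prop
  have key : ∀ s : Set (ℝ × Eu d), MeasurableSet s →
      ∫⁻ t, (m.map (fun x => (1 - t) • x + t • T x)) (Prod.mk t ⁻¹' s) ∂I =
      ∫⁻ t, (volume.restrict (Sl t)) (Prod.mk t ⁻¹' s) ∂I := by
    intro s hs
    have hs' : MeasurableSet (Prod.swap ⁻¹' s : Set (Eu d × ℝ)) := measurable_swap hs
    have h1 := congrArg (fun ν => ν (Prod.swap ⁻¹' s)) h
    rw [Measure.restrict_apply hs', Measure.map_apply hΨ hs', spaceTime, Measure.prod_apply_symm (hs'.inter hS),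
      Measure.prod_apply_symm (hΨ hs')] at h1
    calc _ = _ := lintegral_congr fun t => Measure.map_apply (hTt t) (measurable_prodMk_left hs)
      _ = _ := h1.symm
      _ = _ := lintegral_congr fun t => (Measure.restrict_apply (measurable_prodMk_left hs)).symm
  have hvm : Measurable fun t => volume (Sl t) := measurable_measure_prodMk_right hS
  have hvol : ∀ᵐ t ∂I, volume (Sl t) = m univ := by
    refine ae_eq_of_forall_setLIntegral_eq_of_sigmaFinite hvm measurable_const ?_
    intro J hJ _
    have h1 := key (J ×ˢ univ) (hJ.prod MeasurableSet.univ)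
    have e1 : ∀ t, (m.map (fun x => (1 - t) • x + t • T x)) (Prod.mk t ⁻¹' (J ×ˢ univ)) =
        J.indicator (fun _ => m univ) t := by
      intro t
      by_cases ht : t ∈ J
      · simp only [mk_preimage_prod_right ht, indicator_of_mem ht]
        rw [Measure.map_apply (hTt t) MeasurableSet.univ, preimage_univ]
      · simp [ht]
    have e2 : ∀ t, (volume.restrict (Sl t)) (Prod.mk t ⁻¹' (J ×ˢ univ)) =
        J.indicator (fun t => volume (Sl t)) t := by
      intro t
      by_cases ht : t ∈ J <;> simp [ht]
    rw [lintegral_congr e1, lintegral_congr e2, lintegral_indicator hJ, lintegral_indicator hJ] at h1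
    exact h1.symm
  let κ : Kernel ℝ (Eu d) := ⟨fun t => m.map (fun x => (1 - t) • x + t • T x), by
    refine Measure.measurable_of_measurable_coe _ fun C hC => ?_
    have e : ∀ t, (m.map (fun x => (1 - t) • x + t • T x)) C =
      m (Prod.mk t ⁻¹' {p : ℝ × Eu d | (1 - p.1) • p.2 + p.1 • T p.2 ∈ C}) := fun t => Measure.map_apply (hTt t) hC
    simp_rw [e]
    exact measurable_measure_prodMk_left
      ((by fun_prop : Measurable fun p : ℝ × Eu d => (1 - p.1) • p.2 + p.1 • T p.2) hC)⟩
  have hκ : IsFiniteKernel κ := ⟨m univ, measure_lt_top _ _, fun t => by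
    show (m.map (fun x => (1 - t) • x + t • T x)) univ ≤ _
    rw [Measure.map_apply (hTt t) MeasurableSet.univ, preimage_univ]⟩
  have hG : MeasurableSet {t | volume (Sl t) = m univ} := hvm (measurableSet_singleton _)
  let η : Kernel ℝ (Eu d) := ⟨fun t => if volume (Sl t) = m univ then volume.restrict (Sl t) else 0, by
    refine Measurable.ite hG ?_ measurable_const
    refine Measure.measurable_of_measurable_coe _ fun C hC => ?_
    simp_rw [Measure.restrict_apply hC]
    exact measurable_measure_prodMk_right (s := {p : Eu d × ℝ | p.1 ∈ C} ∩ S) ((measurable_fst hC).inter hS)⟩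
  have hη : IsFiniteKernel η := ⟨m univ, measure_lt_top _ _, fun t => by
    show (if volume (Sl t) = m univ then volume.restrict (Sl t) else 0) univ ≤ _
    split_ifs with hh
    · rw [Measure.restrict_apply_univ, hh]
    · simp⟩
  have heq : I ⊗ₘ κ = I ⊗ₘ η := by
    ext s hs
    rw [Measure.compProd_apply hs, Measure.compProd_apply hs]
    refine (key s hs).trans (lintegral_congr_ae ?_)
    filter_upwards [hvol] with t ht
    show _ = (if volume (Sl t) = m univ then volume.restrict (Sl t) else 0) _
    rw [if_pos ht]
  filter_upwards [Kernel.ae_eq_of_compProd_eq heq, hvol] with t ht ht2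
  refine ⟨Sl t, hSl t, ?_⟩
  have e : κ t = if volume (Sl t) = m univ then volume.restrict (Sl t) else 0 := ht
  rw [if_pos ht2] at e
  exact e

lemma mono_lip {d : ℕ} {T : Eu d → Eu d} {D : Set (Eu d)}
    (hmon : ∀ x ∈ D, ∀ y ∈ D, 0 ≤ ⟪T x - T y, x - y⟫) {s t L : ℝ} (hs : s ∈ Ioo (0:ℝ) 1) (ht : t ∈ Ioo (0:ℝ) 1)
    (hL : 0 ≤ L) (h1 : 1 - t ≤ L * (1 - s)) (h2 : t ≤ L * s) {x y : Eu d} (hx : x ∈ D) (hy : y ∈ D) :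
    ‖((1 - t) • x + t • T x) - ((1 - t) • y + t • T y)‖ ≤
      L * ‖((1 - s) • x + s • T x) - ((1 - s) • y + s • T y)‖ := by
  have e : ∀ t : ℝ, ((1 - t) • x + t • T x) - ((1 - t) • y + t • T y) =
      (1 - t) • (x - y) + t • (T x - T y) := fun t => by module
  have sq : ∀ t : ℝ, ‖(1 - t) • (x - y) + t • (T x - T y)‖ ^ 2 = (1 - t) ^ 2 * ‖x - y‖ ^ 2 +
      2 * ((1 - t) * t) * ⟪T x - T y, x - y⟫ + t ^ 2 * ‖T x - T y‖ ^ 2 := by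
    intro t
    rw [@norm_add_sq_real, norm_smul, norm_smul, inner_smul_left, inner_smul_right, mul_pow, mul_pow,
      Real.norm_eq_abs, Real.norm_eq_abs, sq_abs, sq_abs, real_inner_comm]
    simp only [conj_trivial]; ring
  rw [e, e]
  have hm := hmon x hx y hy
  have ht1 : 0 ≤ 1 - t := by linarith [ht.2]
  have ht0 : 0 ≤ t := ht.1.le
  refine abs_le_of_sq_le_sq' ?_ (by positivity) |>.2
  rw [mul_pow, sq, sq]
  have k1 : (1 - t) ^ 2 ≤ L ^ 2 * (1 - s) ^ 2 := by rw [← mul_pow]; gcongr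
  have k2 : t ^ 2 ≤ L ^ 2 * s ^ 2 := by rw [← mul_pow]; gcongr
  have k3 : (1 - t) * t ≤ L ^ 2 * ((1 - s) * s) := by
    have := mul_le_mul h1 h2 ht0 (ht1.trans h1)
    linarith
  have m1 := mul_le_mul_of_nonneg_right k1 (sq_nonneg ‖x - y‖)
  have m2 := mul_le_mul_of_nonneg_right k2 (sq_nonneg ‖T x - T y‖)
  have m3 := mul_le_mul_of_nonneg_right k3 hm
  linarith

open Set MeasureTheory ProbabilityTheory
open scoped ENNReal RealInnerProductSpace

lemma img_vol_le {d : ℕ} {T : Eu d → Eu d} {D E : Set (Eu d)}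
    (hmon : ∀ x ∈ D, ∀ y ∈ D, 0 ≤ ⟪T x - T y, x - y⟫) {s t : ℝ} {L : NNReal} (hs : s ∈ Ioo (0:ℝ) 1)
    (ht : t ∈ Ioo (0:ℝ) 1) (h1 : 1 - t ≤ L * (1 - s)) (h2 : t ≤ L * s) (hE : E ⊆ D) :
    volume ((fun x => (1 - t) • x + t • T x) '' E) ≤
      (L : ℝ≥0∞) ^ d * volume ((fun x => (1 - s) • x + s • T x) '' E) := by
  classical
  set Ts : Eu d → Eu d := fun x => (1 - s) • x + s • T x with hTs
  set Tt : Eu d → Eu d := fun x => (1 - t) • x + t • T x with hTt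
  have hl : ∀ x ∈ E, ∀ y ∈ E, ‖Tt x - Tt y‖ ≤ L * ‖Ts x - Ts y‖ := fun x hx y hy =>
    mono_lip hmon hs ht L.2 h1 h2 (hE hx) (hE hy)
  rcases E.eq_empty_or_nonempty with rfl | ⟨x0, hx0⟩
  · simp
  have hne : Nonempty (Eu d) := ⟨0⟩
  let inv := Function.invFunOn Ts E
  have hinv : ∀ x ∈ E, inv (Ts x) ∈ E ∧ Ts (inv (Ts x)) = Ts x := fun x hx =>
    ⟨Function.invFunOn_mem ⟨x, hx, rfl⟩, Function.invFunOn_eq ⟨x, hx, rfl⟩⟩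
  have hg : ∀ x ∈ E, Tt (inv (Ts x)) = Tt x := by
    intro x hx
    have h := hl _ (hinv x hx).1 x hx
    rw [(hinv x hx).2, sub_self, norm_zero, mul_zero] at h
    exact sub_eq_zero.1 (norm_le_zero_iff.1 h)
  have hLip : LipschitzOnWith L (fun y => Tt (inv y)) (Ts '' E) := by
    refine LipschitzOnWith.of_dist_le_mul ?_
    rintro _ ⟨x, hx, rfl⟩ _ ⟨y, hy, rfl⟩
    simp only [hg x hx, hg y hy, dist_eq_norm]
    exact hl x hx y hy
  have himg : (fun y => Tt (inv y)) '' (Ts '' E) = Tt '' E := by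
    rw [image_image]
    exact image_congr hg
  have := lip_vol hLip
  rwa [himg] at this

lemma interp_inj {d : ℕ} {T : Eu d → Eu d} {D : Set (Eu d)}
    (hmon : ∀ x ∈ D, ∀ y ∈ D, 0 ≤ ⟪T x - T y, x - y⟫) {t : ℝ} (ht : t ∈ Ioo (0:ℝ) 1) :
    InjOn (fun x => (1 - t) • x + t • T x) D := by
  intro x hx y hy hxy
  have e : (1 - t) • (x - y) + t • (T x - T y) = 0 := by
    have : (1 - t) • x + t • T x = (1 - t) • y + t • T y := hxy
    have := sub_eq_zero.2 this
    rw [← this]; module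
  have h := congrArg (fun z => ⟪z, x - y⟫) e
  simp only [inner_add_left, inner_smul_left, inner_zero_left, conj_trivial, real_inner_self_eq_norm_sq] at h
  have hm := mul_nonneg ht.1.le (hmon x hx y hy)
  have h1 : 0 < 1 - t := by linarith [ht.2]
  have : ‖x - y‖ ^ 2 ≤ 0 := by
    by_contra hc
    push Not at hc
    have := mul_pos h1 hc
    linarith
  have : ‖x - y‖ = 0 := by nlinarith [norm_nonneg (x - y)]
  exact sub_eq_zero.1 (norm_eq_zero.1 this)

lemma BD.mono {d : ℕ} {Ω0 Ω1 : Set (Eu d)} {ψ : Eu d → ℝ} {T : Eu d → Eu d} {D : Set (Eu d)}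
    (hD : BD Ω0 Ω1 ψ T D) : ∀ x ∈ D, ∀ y ∈ D, 0 ≤ ⟪T x - T y, x - y⟫ := by
  intro x hx y hy
  have h1 := (hD.2.2.2 x hx).2.2 y
  have h2 := (hD.2.2.2 y hy).2.2 x
  have e : ⟪T x - T y, x - y⟫ = -⟪T x, y - x⟫ - ⟪T y, x - y⟫ := by
    rw [inner_sub_left, ← neg_sub y x, inner_neg_right]
  rw [e]; linarith

lemma all_times {d : ℕ} {Ω0 D : Set (Eu d)} {T : Eu d → Eu d} (hT : Measurable T)
    (hmon : ∀ x ∈ D, ∀ y ∈ D, 0 ≤ ⟪T x - T y, x - y⟫) (hDm : MeasurableSet D) (hD0 : D ⊆ Ω0)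
    (hDn : volume (Ω0 \ D) = 0) (hfin : volume Ω0 ≠ ⊤)
    (hae : ∀ᵐ t ∂(volume.restrict (Icc (0:ℝ) 1)), ∃ A : Set (Eu d), MeasurableSet A ∧
      (volume.restrict Ω0).map (fun x => (1 - t) • x + t • T x) = volume.restrict A)
    {t : ℝ} (ht : t ∈ Ioo (0:ℝ) 1) :
    ∃ A : Set (Eu d), MeasurableSet A ∧
      (volume.restrict Ω0).map (fun x => (1 - t) • x + t • T x) = volume.restrict A := by
  classical
  have hTm : ∀ t : ℝ, Measurable fun x : Eu d => (1 - t) • x + t • T x := fun t => by fun_prop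
  have hfm : IsFiniteMeasure ((volume : Measure (Eu d)).restrict Ω0) :=
    ⟨by rw [Measure.restrict_apply_univ]; exact hfin.lt_top⟩
  have hDfull : volume.restrict Ω0 = volume.restrict D := by
    refine (Measure.restrict_congr_set ?_).symm
    exact (ae_le_set.2 (by rw [sdiff_eq_empty.2 hD0]; simp)).antisymm (ae_le_set.2 hDn)
  have hgood : ∀ L : ℝ, 1 < L → ∃ s ∈ Ioo (0:ℝ) 1, (∃ A : Set (Eu d), MeasurableSet A ∧
      (volume.restrict Ω0).map (fun x => (1 - s) • x + s • T x) = volume.restrict A) ∧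
      1 - t ≤ L * (1 - s) ∧ t ≤ L * s ∧ 1 - s ≤ L * (1 - t) ∧ s ≤ L * t := by
    intro L hL
    rw [ae_restrict_iff' measurableSet_Icc] at hae
    have hd := Measure.dense_of_ae hae
    let U : Set ℝ := Ioo 0 1 ∩ ({s | 1 - t < L * (1 - s)} ∩ ({s | t < L * s} ∩
      ({s | 1 - s < L * (1 - t)} ∩ {s | s < L * t})))
    have hU : IsOpen U := by
      refine isOpen_Ioo.inter (IsOpen.inter ?_ (IsOpen.inter ?_ (IsOpen.inter ?_ ?_)))
      all_goals exact isOpen_lt (by fun_prop) (by fun_prop)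
    have h1 : 0 < 1 - t := by linarith [ht.2]
    have h2 : 0 < t := ht.1
    have k1 : 1 - t < L * (1 - t) := by nlinarith
    have k2 : t < L * t := by nlinarith
    obtain ⟨s, hsU, hs⟩ := hd.inter_open_nonempty U hU ⟨t, ht, k1, k2, k1, k2⟩
    exact ⟨s, hsU.1, hs ⟨hsU.1.1.le, hsU.1.2.le⟩, hsU.2.1.le, hsU.2.2.1.le, hsU.2.2.2.1.le, hsU.2.2.2.2.le⟩
  let L : ℕ → NNReal := fun n => 1 + 1 / ((n : NNReal) + 1)
  have hL1 : ∀ n, (1:ℝ) < L n := fun n => by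
    simp only [L, NNReal.coe_add, NNReal.coe_one, NNReal.coe_div, NNReal.coe_natCast]
    have : (0:ℝ) < 1 / ((n:ℝ) + 1) := by positivity
    linarith
  have hLl : Filter.Tendsto L Filter.atTop (nhds 1) := by
    have h : Filter.Tendsto (fun n : ℕ => 1 / ((n:NNReal) + 1)) Filter.atTop (nhds 0) :=
      tendsto_one_div_add_atTop_nhds_zero_nat
    simpa [L] using h.const_add 1
  have hlim : ∀ c : ℝ≥0∞, Filter.Tendsto (fun n => (L n : ℝ≥0∞) ^ d * c) Filter.atTop (nhds c) := by
    intro c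
    have h : Filter.Tendsto (fun n => (((L n) ^ d : NNReal) : ℝ≥0∞)) Filter.atTop (nhds ((1 : NNReal) : ℝ≥0∞)) := by
      rw [ENNReal.tendsto_coe]
      simpa using hLl.pow d
    have h2 := ENNReal.Tendsto.mul_const (b := c) h (Or.inl (by simp))
    simpa using h2
  have hgood' := fun n => hgood (L n) (hL1 n)
  choose s hs hex hsL1 hsL2 hsL3 hsL4 using hgood'
  choose A hAm hA using hex
  have hvA : ∀ n, volume (A n) = volume Ω0 := by
    intro n
    have h := congrArg (fun ν => ν univ) (hA n)
    beta_reduce at h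
    rw [Measure.map_apply (hTm _) MeasurableSet.univ, preimage_univ, Measure.restrict_apply_univ,
      Measure.restrict_apply_univ] at h
    exact h.symm
  let D' : Set (Eu d) := D ∩ ⋂ n, (fun x => (1 - s n) • x + s n • T x) ⁻¹' (A n)
  have hD'D : D' ⊆ D := inter_subset_left
  have hD'm : MeasurableSet D' := hDm.inter (MeasurableSet.iInter fun n => hTm _ (hAm n))
  have hD'n : volume.restrict Ω0 D'ᶜ = 0 := by
    have e : D'ᶜ = Dᶜ ∪ ⋃ n, (fun x => (1 - s n) • x + s n • T x) ⁻¹' (A n)ᶜ := by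
      simp only [D', compl_inter, compl_iInter, preimage_compl]
    rw [e, measure_union_null_iff, measure_iUnion_null_iff]
    refine ⟨?_, fun n => ?_⟩
    · rw [hDfull, Measure.restrict_apply hDm.compl, compl_inter_self]; simp
    · rw [← Measure.map_apply (hTm _) (hAm n).compl, hA n, Measure.restrict_apply (hAm n).compl, compl_inter_self]
      simp
  set Tt : Eu d → Eu d := fun x => (1 - t) • x + t • T x with hTt
  have hinj : InjOn Tt D' := (interp_inj hmon ht).mono hD'D
  have hBm : MeasurableSet (Tt '' D') := hD'm.image_of_measurable_injOn (hTm t) hinj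
  have hi : volume (Tt '' D') ≤ volume Ω0 := by
    refine ge_of_tendsto' (hlim (volume Ω0)) fun n => ?_
    refine (img_vol_le hmon (hs n) ht (hsL1 n) (hsL2 n) hD'D).trans ?_
    rw [← hvA n]
    gcongr
    rintro _ ⟨x, hx, rfl⟩
    exact mem_iInter.1 hx.2 n
  have hle : (volume.restrict Ω0).map Tt ≤ volume.restrict (Tt '' D') := by
    refine Measure.le_iff.2 fun C hC => ?_
    rw [Measure.map_apply (hTm t) hC, Measure.restrict_apply hC]
    refine ge_of_tendsto' (hlim _) fun n => ?_
    set E : Set (Eu d) := D' ∩ Tt ⁻¹' C with hE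
    have hEm : MeasurableSet E := hD'm.inter (hTm t hC)
    have hEi : MeasurableSet ((fun x => (1 - s n) • x + s n • T x) '' E) :=
      hEm.image_of_measurable_injOn (hTm _) ((interp_inj hmon (hs n)).mono (inter_subset_left.trans hD'D))
    have h1 : volume.restrict Ω0 (Tt ⁻¹' C) ≤ volume.restrict Ω0 E := by
      calc _ ≤ volume.restrict Ω0 (E ∪ D'ᶜ) := measure_mono fun x hx => by
            by_cases hx' : x ∈ D'
            · exact Or.inl ⟨hx', hx⟩
            · exact Or.inr hx'
        _ ≤ _ := measure_union_le _ _
        _ = _ := by rw [hD'n, add_zero]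
    have h2 : volume.restrict Ω0 E ≤ volume ((fun x => (1 - s n) • x + s n • T x) '' E) := by
      calc _ ≤ volume.restrict Ω0 ((fun x => (1 - s n) • x + s n • T x) ⁻¹'
              ((fun x => (1 - s n) • x + s n • T x) '' E)) := measure_mono (subset_preimage_image _ _)
        _ = volume.restrict (A n) ((fun x => (1 - s n) • x + s n • T x) '' E) := by
            rw [← Measure.map_apply (hTm _) hEi, hA n]
        _ ≤ _ := Measure.restrict_apply_le _ _
    have h3 := img_vol_le (E := E) hmon ht (hs n) (hsL3 n) (hsL4 n) (inter_subset_left.trans hD'D)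
    refine (h1.trans h2).trans (h3.trans ?_)
    gcongr
    rintro _ ⟨x, hx, rfl⟩
    exact ⟨hx.2, x, hx.1, rfl⟩
  refine ⟨Tt '' D', hBm, ?_⟩
  have hfB : IsFiniteMeasure (volume.restrict (Tt '' D')) :=
    ⟨by rw [Measure.restrict_apply_univ]; exact hi.trans_lt hfin.lt_top⟩
  refine Measure.eq_of_le_of_measure_univ_eq hle ?_
  refine le_antisymm (hle univ) ?_
  rw [Measure.map_apply (hTm t) MeasurableSet.univ, preimage_univ, Measure.restrict_apply_univ,
      Measure.restrict_apply_univ]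
  exact hi

open Set MeasureTheory ProbabilityTheory
open scoped ENNReal RealInnerProductSpace

lemma sq_lint {α : Type*} [MeasurableSpace α] {d : ℕ} {m : Measure α} {v : α → Eu d} (hv : Measurable v)
    (h2 : ∫⁻ z, ‖v z‖ₑ ^ 2 ∂m < ⊤) :
    ENNReal.ofReal (∫ z, ‖v z‖ ^ 2 ∂m) = ∫⁻ z, ‖v z‖ₑ ^ 2 ∂m := by
  have e : ∀ z, ENNReal.ofReal (‖v z‖ ^ 2) = ‖v z‖ₑ ^ 2 := fun z => by
    rw [ENNReal.ofReal_pow (norm_nonneg _), ofReal_norm]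
  have hi : Integrable (fun z => ‖v z‖ ^ 2) m := by
    refine ⟨(hv.norm.pow_const 2).aestronglyMeasurable, ?_⟩
    rw [hasFiniteIntegral_iff_ofReal (Filter.Eventually.of_forall fun z => by positivity)]
    simp_rw [e]; exact h2
  rw [ofReal_integral_eq_lintegral_ofReal hi (Filter.Eventually.of_forall fun z => by positivity)]
  simp_rw [e]

theorem shape_minimizer_exists_iff_geodesic_is_characteristic
    (d : ℕ) (Ω₀ Ω₁ : Set (EuclideanSpace ℝ (Fin d)))
    (h₀open : IsOpen Ω₀) (h₁open : IsOpen Ω₁)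
    (h₀bdd : Bornology.IsBounded Ω₀) (h₁bdd : Bornology.IsBounded Ω₁)
    (hvol : volume Ω₀ = volume Ω₁) (hpos : 0 < volume Ω₀)
    (ψ : EuclideanSpace ℝ (Fin d) → ℝ) (hψconv : ConvexOn ℝ Set.univ ψ)
    (T : EuclideanSpace ℝ (Fin d) → EuclideanSpace ℝ (Fin d)) (hT : Measurable T)
    (hgrad : ∀ᵐ x, HasGradientAt ψ (T x) x)
    (hpush : (volume.restrict Ω₀).map T = volume.restrict Ω₁) :
    (∃ ρ v, ShapeAdmissible Ω₀ Ω₁ ρ v ∧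
        (∫⁻ q, ENNReal.ofReal (ρ q.1 q.2 * ‖v q.1 q.2‖ ^ 2) ∂(spaceTime d)) =
          sInf (shapeActionSet Ω₀ Ω₁)) ↔
      ∀ t ∈ Icc (0:ℝ) 1, ∃ A : Set (EuclideanSpace ℝ (Fin d)), MeasurableSet A ∧
        (volume.restrict Ω₀).map (fun x => (1 - t) • x + t • T x) =
          volume.restrict A := by
  obtain ⟨D, hD⟩ := exists_BD h₀open h₁open hψconv hT hgrad hpush
  have hn0 : Ω₀.Nonempty := nonempty_of_measure_ne_zero hpos.ne'
  have hn1 : Ω₁.Nonempty := nonempty_of_measure_ne_zero (hvol ▸ hpos.ne')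
  have hfin : volume Ω₀ ≠ ⊤ := h₀bdd.measure_lt_top.ne
  have hfm : IsFiniteMeasure ((volume : Measure (Eu d)).restrict Ω₀) :=
    ⟨by rw [Measure.restrict_apply_univ]; exact hfin.lt_top⟩
  obtain ⟨r0, hr0⟩ := h₀bdd.exists_norm_le
  obtain ⟨r1, hr1⟩ := h₁bdd.exists_norm_le
  set r : ℝ := max 1 (max r0 r1) with hr
  have hrp : 0 < r := lt_of_lt_of_le one_pos (le_max_left _ _)
  have hr0' : ∀ x ∈ Ω₀, ‖x‖ ≤ r := fun x hx => (hr0 x hx).trans ((le_max_left _ _).trans (le_max_right _ _))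
  have hr1' : ∀ x ∈ Ω₁, ‖x‖ ≤ r := fun x hx => (hr1 x hx).trans ((le_max_right _ _).trans (le_max_right _ _))
  have hDn : volume.restrict Ω₀ Dᶜ = 0 := by
    rw [Measure.restrict_apply hD.1.compl, inter_comm, ← sdiff_eq]; exact hD.2.2.1
  have hDae : ∀ᵐ x ∂(volume.restrict Ω₀), x ∈ D := hDn
  have hW : ∫⁻ x in Ω₀, ‖T x - x‖ₑ ^ 2 < ⊤ := by
    calc _ ≤ ∫⁻ x in Ω₀, (ENNReal.ofReal (r + r)) ^ 2 := by
          refine lintegral_mono_ae ?_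
          filter_upwards [hDae] with x hx
          gcongr
          rw [← ofReal_norm]
          refine ENNReal.ofReal_le_ofReal ((norm_sub_le _ _).trans ?_)
          exact add_le_add (hr1' _ (hD.2.2.2 x hx).2.1) (hr0' _ (hD.2.1 hx))
      _ < ⊤ := by
          rw [lintegral_const, Measure.restrict_apply_univ]
          exact ENNReal.mul_lt_top (ENNReal.pow_lt_top ENNReal.ofReal_lt_top) hfin.lt_top
  set W2 := ∫⁻ x in Ω₀, ‖T x - x‖ₑ ^ 2 with hW2
  have hWr : ENNReal.ofReal (∫ x in Ω₀, ‖T x - x‖ ^ 2) = W2 := sq_lint (hT.sub measurable_id) hW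
  obtain ⟨a, b, hdd, hval, hy⟩ := brenier_dd h₀open h₁open h₀bdd h₁bdd hn0 hn1 hψconv hT hpush hD
  have hlow : ∀ S v, SPath Ω₀ Ω₁ S v → W2 ≤ ∫⁻ z in S, ‖v z‖ₑ ^ 2 ∂(spaceTime d) := by
    intro S v hp
    have h := (hdd.lower hp).1
    rw [← sq_lint hp.2.2.1 hp.2.2.2.1, ← hWr]
    refine ENNReal.ofReal_le_ofReal ?_
    rw [hval] at h
    linarith
  have hlow' : W2 ≤ sInf (shapeActionSet Ω₀ Ω₁) := by
    refine le_sInf ?_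
    rintro _ ⟨ρ, v, hadm, rfl⟩
    obtain ⟨S, w, hp, he⟩ := adm_path hadm
    rw [he]; exact hlow S w hp
  have hup : ∀ c, Conn Ω₀ Ω₁ c → sInf (shapeActionSet Ω₀ Ω₁) ≤ c := by
    rintro c ⟨S, v, hp, hc⟩
    obtain ⟨ρ, w, hadm, he⟩ := hp.adm
    refine le_trans (sInf_le ⟨ρ, w, hadm, rfl⟩) ?_
    rw [he]; exact hc
  constructor
  · rintro ⟨ρ, v, hadm, hact⟩ t ht
    rcases Nat.eq_zero_or_pos d with rfl | hd
    · refine ⟨Ω₀, h₀open.measurableSet, ?_⟩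
      have e : (fun x : Eu 0 => (1 - t) • x + t • T x) = id := funext fun x => Subsingleton.elim _ _
      rw [e, Measure.map_id]
    rcases eq_or_lt_of_le ht.1 with rfl | ht0
    · refine ⟨Ω₀, h₀open.measurableSet, ?_⟩
      have e : (fun x : Eu d => (1 - (0:ℝ)) • x + (0:ℝ) • T x) = id := funext fun x => by simp
      rw [e, Measure.map_id]
    rcases eq_or_lt_of_le ht.2 with rfl | ht1
    · refine ⟨Ω₁, h₁open.measurableSet, ?_⟩
      have e : (fun x : Eu d => (1 - (1:ℝ)) • x + (1:ℝ) • T x) = T := funext fun x => by simp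
      rw [e, hpush]
    obtain ⟨S, w, hp, he⟩ := adm_path hadm
    have hle : ∫⁻ z in S, ‖w z‖ₑ ^ 2 ∂(spaceTime d) ≤ W2 := by
      rw [← he, hact]
      refine le_of_forall_gt fun c hc => ?_
      obtain ⟨c', hc1, hc2⟩ := exists_between hc
      refine lt_of_le_of_lt (hup c' ?_) hc2
      obtain ⟨n, rfl⟩ : ∃ n, d = n + 1 := ⟨d - 1, by omega⟩
      exact upper_bound h₀open h₁open hrp hr0' hr1' hvol hψconv hT hgrad hpush hW hc1
    have hleR : (∫ z in S, ‖w z‖ ^ 2 ∂(spaceTime d)) / 2 ≤ -(∫ x in Ω₁, b x) - (∫ x in Ω₀, a x) := by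
      rw [hval]
      rw [← sq_lint hp.2.2.1 hp.2.2.2.1, ← hWr,
        ENNReal.ofReal_le_ofReal_iff (integral_nonneg fun x => by positivity)] at hle
      linarith
    have hg := geo_meas h₀open hT hD hdd hy hp hleR
    exact all_times hT hD.mono hD.1 hD.2.1 hD.2.2.1 hfin (geo_ae _ hT hp.1 hg) ⟨ht0, ht1⟩
  · intro h
    have hc : Conn Ω₀ Ω₁ W2 := lagr (volume.restrict Ω₀) id T measurable_id hT hW D hD.1 hDn
      (fun t ht => interp_inj hD.mono ht) (fun t ht => h t ⟨ht.1.le, ht.2.le⟩)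
      h₀open.measurableSet h₁open.measurableSet Measure.map_id hpush
    obtain ⟨S, v, hp, hle⟩ := hc
    obtain ⟨ρ, w, hadm, he⟩ := hp.adm
    refine ⟨ρ, w, hadm, le_antisymm ?_ (sInf_le ⟨ρ, w, hadm, rfl⟩)⟩
    rw [he]
    exact hle.trans hlow'
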